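/- Let g ∈ {4,5}. If G is a subcubic graph that does not contain two vertex-disjoint cycles each of length less than g, then φ(G) ≤ t_g·|E(G)| + r_g(G). -/

import Mathlib

open SimpleGraph

namespace InducedForest

/-- A graph is subcubic if every vertex has at most 3 neighbours. -/
def Subcubic {V : Type} (G : SimpleGraph V) : Prop := ∀ v : V, (G.neighborSet v).ncard ≤ 3

/-- A graph is cubic if every vertex has exactly 3 neighbours. -/
def Cubic {V : Type} (G : SimpleGraph V) : Prop := ∀ v : V, (G.neighborSet v).ncard = 3

/-- `S` is a feedback vertex set of `G` iff `G - S` is a forest. -/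
def IsFVS {V : Type} (G : SimpleGraph V) (S : Set V) : Prop := (G.induce Sᶜ).IsAcyclic

/-- `φ(G)`: the minimum size of a feedback vertex set of `G`. -/
noncomputable def fvs {V : Type} (G : SimpleGraph V) : ℕ :=
  sInf {n : ℕ | ∃ S : Set V, IsFVS G S ∧ S.ncard = n}

/-- `a(G)`: the maximum number of vertices of an induced forest in `G`. -/
noncomputable def indForestNum {V : Type} (G : SimpleGraph V) : ℕ :=
  sSup {n : ℕ | ∃ S : Set V, (G.induce S).IsAcyclic ∧ S.ncard = n}

/-- `v` is a cut-vertex of `G`: deleting it increases the number of connected components. -/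
def IsCutVertex {V : Type} (G : SimpleGraph V) (v : V) : Prop :=
  Nat.card G.ConnectedComponent < Nat.card (G.induce {u | u ≠ v}).ConnectedComponent

/-- `B` is a block of `G`: a maximal set of vertices inducing a connected subgraph
without cut-vertices. -/
def IsBlock {V : Type} (G : SimpleGraph V) (B : Set V) : Prop :=
  ((G.induce B).Connected ∧ ∀ v, ¬ IsCutVertex (G.induce B) v) ∧
  ∀ B' : Set V, B ⊆ B' →
    ((G.induce B').Connected ∧ ∀ v, ¬ IsCutVertex (G.induce B') v) → B' = B

/-- 2-connectedness: at least 3 vertices and removing fewer than 2 vertices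
leaves a connected graph. -/
def TwoConnected {V : Type} (G : SimpleGraph V) : Prop :=
  3 ≤ Nat.card V ∧ ∀ s : Set V, s.ncard < 2 → (G.induce sᶜ).Connected

/-- 3-connectedness: at least 4 vertices and removing fewer than 3 vertices
leaves a connected graph. -/
def ThreeConnected {V : Type} (G : SimpleGraph V) : Prop :=
  4 ≤ Nat.card V ∧ ∀ s : Set V, s.ncard < 3 → (G.induce sᶜ).Connected

/-- The graph obtained from `H` by subdividing the edge `xy` once;
the subdivision vertex is `none`. -/
def subdivide {V : Type} (H : SimpleGraph V) (x y : V) : SimpleGraph (Option V) :=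
  SimpleGraph.fromRel (fun p q =>
    match p, q with
    | some u, some v => H.Adj u v ∧ s(u, v) ≠ s(x, y)
    | some u, none => u = x ∨ u = y
    | _, _ => False)

/-- `G` is obtained from `H` by subdividing one edge once. -/
def IsSubdivisionOfOneEdge {V W : Type} (H : SimpleGraph V) (G : SimpleGraph W) : Prop :=
  ∃ x y : V, H.Adj x y ∧ Nonempty (G ≃g subdivide H x y)

/-- The graph obtained from `K` by adding one new vertex (`none`)
joined to all vertices of `S`. -/
def addApex {V : Type} (K : SimpleGraph V) (S : Set V) : SimpleGraph (Option V) :=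
  SimpleGraph.fromRel (fun p q =>
    match p, q with
    | some u, some v => K.Adj u v
    | some u, none => u ∈ S
    | _, _ => False)

/-- `G` is (isomorphic to) `H ∘ (e1, e2, a)`: subdivide `e1` and `e2` once each
(with `e1` subdivided twice if `e1 = e2`) and add a new vertex adjacent to `a` and to the
two subdivision vertices. -/
def IsCircOp {V W : Type} (H : SimpleGraph V) (e1 e2 : Sym2 V) (a : V)
    (G : SimpleGraph W) : Prop :=
  (e1 ≠ e2 ∧ ∃ x1 y1 x2 y2 : V, e1 = s(x1, y1) ∧ e2 = s(x2, y2) ∧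
    Nonempty (G ≃g addApex (subdivide (subdivide H x1 y1) (some x2) (some y2))
      {some (some a), some none, none})) ∨
  (e1 = e2 ∧ ∃ x y : V, e1 = s(x, y) ∧
    Nonempty (G ≃g addApex (subdivide (subdivide H x y) none (some y))
      {some (some a), some none, none}))

/-- The cycle of length `n` (for `n ≥ 3`). -/
def cyc (n : ℕ) : SimpleGraph (ZMod n) :=
  SimpleGraph.fromRel (fun u v => v = u + 1)

/-- The families `F_{i,j}` of graphs (closed under isomorphism):
`F_{i,0} = {C_i}` for `i ≥ 3`; `F_{1,1} = {K_4}`; `F_{j,j}` for `j ≥ 2` is obtained from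
`F_{j-1,j-1}` by subdividing one edge once and then applying the `∘` operation at the
subdivision vertex; and `F_{i,j}` for `i > j ≥ 1` is obtained from `F_{j,j}` by `i - j`
successive single-edge subdivisions. -/
inductive MemF : ℕ → ℕ → ∀ {V : Type}, SimpleGraph V → Prop
  | cycle {i : ℕ} (hi : 3 ≤ i) {V : Type} {G : SimpleGraph V}
      (h : Nonempty (G ≃g cyc i)) : MemF i 0 G
  | k4 {V : Type} {G : SimpleGraph V}
      (h : Nonempty (G ≃g (⊤ : SimpleGraph (Fin 4)))) : MemF 1 1 G
  | circ {j : ℕ} (hj : 2 ≤ j) {V : Type} {H : SimpleGraph V}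
      (hH : MemF (j - 1) (j - 1) H) {x y : V} (hxy : H.Adj x y)
      {e1 e2 : Sym2 (Option V)} (he1 : e1 ∈ (subdivide H x y).edgeSet)
      (he2 : e2 ∈ (subdivide H x y).edgeSet)
      {W : Type} {G : SimpleGraph W}
      (hG : IsCircOp (subdivide H x y) e1 e2 none G) : MemF j j G
  | subd {i j : ℕ} (hj : 1 ≤ j) {V : Type} {H : SimpleGraph V}
      (hH : MemF i j H) {x y : V} (hxy : H.Adj x y) {W : Type} {G : SimpleGraph W}
      (hG : Nonempty (G ≃g subdivide H x y)) : MemF (i + 1) j G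

/-- `K_4^+`: the graph obtained from `K_4` by subdividing one edge once. -/
def K4plus : SimpleGraph (Option (Fin 4)) :=
  subdivide (⊤ : SimpleGraph (Fin 4)) 0 1

/-- `L`: the graph obtained from `K_4` by subdividing once each edge
of a perfect matching. -/
def Lgraph : SimpleGraph (Option (Option (Fin 4))) :=
  subdivide (subdivide (⊤ : SimpleGraph (Fin 4)) 0 1) (some 2) (some 3)

/-- The Petersen graph. -/
def petersen : SimpleGraph (ZMod 5 × Fin 2) :=
  SimpleGraph.fromRel (fun u v =>
    (u.2 = 0 ∧ v.2 = 0 ∧ v.1 = u.1 + 1) ∨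
    (u.2 = 1 ∧ v.2 = 1 ∧ v.1 = u.1 + 2) ∨
    (u.2 = 0 ∧ v.2 = 1 ∧ u.1 = v.1))

/-- `R`: the Petersen graph minus one edge. -/
def Rgraph : SimpleGraph (ZMod 5 × Fin 2) :=
  petersen.deleteEdges {s(((0 : ZMod 5), (0 : Fin 2)), ((1 : ZMod 5), (0 : Fin 2)))}

/-- `Q_3`: the 3-dimensional cube graph. -/
def Q3 : SimpleGraph (Fin 2 × Fin 2 × Fin 2) :=
  SimpleGraph.fromRel (fun u v =>
    (u.1 ≠ v.1 ∧ u.2 = v.2) ∨ (u.1 = v.1 ∧ u.2.1 ≠ v.2.1 ∧ u.2.2 = v.2.2) ∨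
    (u.1 = v.1 ∧ u.2.1 = v.2.1 ∧ u.2.2 ≠ v.2.2))

/-- `V_8`: the Wagner graph. -/
def V8 : SimpleGraph (ZMod 8) :=
  SimpleGraph.fromRel (fun u v => v = u + 1 ∨ v = u + 4)

/-- The dodecahedron, presented as the generalized Petersen graph `GP(10,2)`. -/
def dodecahedron : SimpleGraph (ZMod 10 × Fin 2) :=
  SimpleGraph.fromRel (fun u v =>
    (u.2 = 0 ∧ v.2 = 0 ∧ v.1 = u.1 + 1) ∨
    (u.2 = 1 ∧ v.2 = 1 ∧ v.1 = u.1 + 2) ∨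
    (u.2 = 0 ∧ v.2 = 1 ∧ u.1 = v.1))

/-- The families `F^g_{i,j,k}`: 2-connected subcubic graphs obtained from the disjoint
union of `k` copies of `L` (when `g = 4`) or of `R` (when `g = 5`) and one member of
`F_{i,j}` by adding `k+1` edges; when `k ≥ 1`, each added edge joins two different
constituent copies. -/
def MemFG (g i j k : ℕ) {W : Type} (G : SimpleGraph W) : Prop :=
  TwoConnected G ∧ Subcubic G ∧
  ∃ (P : W → Fin (k + 1)) (H : SimpleGraph W),
    H ≤ G ∧ (∀ u v, H.Adj u v → P u = P v) ∧
    MemF i j (H.induce (P ⁻¹' {0})) ∧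
    ((g = 4 ∧ ∀ l : Fin (k + 1), l ≠ 0 → Nonempty ((H.induce (P ⁻¹' {l})) ≃g Lgraph)) ∨
     (g = 5 ∧ ∀ l : Fin (k + 1), l ≠ 0 → Nonempty ((H.induce (P ⁻¹' {l})) ≃g Rgraph))) ∧
    (G.edgeSet \ H.edgeSet).ncard = k + 1 ∧
    (1 ≤ k → ∀ u v, G.Adj u v → ¬ H.Adj u v → P u ≠ P v)

/-- `t_4 = 2/9`, `t_5 = 1/5`. -/
noncomputable def tg (g : ℕ) : ℝ := if g = 4 then 2 / 9 else 1 / 5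

/-- The error function `ε_g` on graphs. -/
noncomputable def eps (g : ℕ) {V : Type} (G : SimpleGraph V) : ℝ := by
  classical
  exact
    if h1 : ∃ p : ℕ × ℕ, 1 ≤ p.1 ∧ p.2 ≤ p.1 ∧ MemF p.1 p.2 G then
      max (1 - (h1.choose.2 : ℝ) * (5 * tg g - 1) - (h1.choose.1 : ℝ) * tg g) 0
    else if h2 : ∃ q : ℕ × ℕ × ℕ, 1 ≤ q.1 ∧ q.2.1 ≤ q.1 ∧ MemFG g q.1 q.2.1 q.2.2 G then
      max (1 - tg g - (h2.choose.2.1 : ℝ) * (5 * tg g - 1) - (h2.choose.1 : ℝ) * tg g) 0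
    else if Nonempty (G ≃g (⊤ : SimpleGraph (Fin 2))) then -tg g
    else 0

/-- The error function `r_g(G)`: the sum of `ε_g(B)` over all blocks `B` of `G`. -/
noncomputable def rg (g : ℕ) {V : Type} (G : SimpleGraph V) : ℝ :=
  ∑ᶠ B ∈ {B : Set V | IsBlock G B}, eps g (G.induce B)

/-- `G` has two vertex-disjoint cycles, each of length less than `g`. -/
def TwoDisjointCyclesLt {V : Type} (G : SimpleGraph V) (g : ℕ) : Prop :=
  ∃ (u v : V) (c1 : G.Walk u u) (c2 : G.Walk v v), c1.IsCycle ∧ c2.IsCycle ∧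
    c1.length < g ∧ c2.length < g ∧ ∀ x, x ∈ c1.support → x ∉ c2.support

/-- `G` contains a (not necessarily induced) subgraph isomorphic to `K`. -/
def ContainsSubgraphCopy {U V : Type} (K : SimpleGraph U) (G : SimpleGraph V) : Prop :=
  ∃ f : U → V, Function.Injective f ∧ ∀ u v, K.Adj u v → G.Adj (f u) (f v)

/-- `G` is obtained from `H` by adding edges, each of which is a cut-edge of `G`. -/
def AddCutEdges {V : Type} (H G : SimpleGraph V) : Prop :=
  H ≤ G ∧ ∀ e ∈ G.edgeSet \ H.edgeSet, G.IsBridge e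

/-- The edges of `H` all lie inside the parts of the partition given by `P`. -/
def PartitionedBy {V ι : Type} (H : SimpleGraph V) (P : V → ι) : Prop :=
  ∀ u v, H.Adj u v → P u = P v

/-- `G` is `g`-minimal: a minimum counterexample to the main theorem. -/
def GMinimal (g : ℕ) {V : Type} [Fintype V] (G : SimpleGraph V) : Prop :=
  Subcubic G ∧ ¬ TwoDisjointCyclesLt G g ∧
  tg g * G.edgeSet.ncard + rg g G < (fvs G : ℝ) ∧
  ∀ (W : Type) [Fintype W] (H : SimpleGraph W), Nat.card W < Nat.card V →
    Subcubic H → ¬ TwoDisjointCyclesLt H g →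
    (fvs H : ℝ) ≤ tg g * H.edgeSet.ncard + rg g H

section part_P1
open Module
set_option linter.unusedSectionVars false

/-! ### Part 1: alternating forms of linear type -/

def Nd {E : Type*} [AddCommGroup E] [Module ℂ E] (B : E →ₗ[ℂ] E →ₗ[ℂ] ℂ) (S : Submodule ℂ E) : Prop :=
  ∀ z ∈ S, (∀ z' ∈ S, B z z' = 0) → z = 0

noncomputable def Yf {E : Type*} [AddCommGroup E] [Module ℂ E] {ι : Type*} [Fintype ι]
    (a b : ι → E →ₗ[ℂ] ℂ) (x : ι → ℂ) : E →ₗ[ℂ] E →ₗ[ℂ] ℂ :=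
  ∑ i, x i • ((a i).smulRight (b i) - (b i).smulRight (a i))

def KU {E : Type*} [AddCommGroup E] [Module ℂ E] {ι : Type*}
    (a b : ι → E →ₗ[ℂ] ℂ) (U : Set ι) : Submodule ℂ E :=
  ⨅ i ∈ U, (LinearMap.ker (a i) ⊓ LinearMap.ker (b i))

section abs
variable {E : Type*} [AddCommGroup E] [Module ℂ E] [FiniteDimensional ℂ E]

lemma mem_KU {ι : Type*} {a b : ι → E →ₗ[ℂ] ℂ} {U : Set ι} {z : E} :
    z ∈ KU a b U ↔ ∀ i ∈ U, a i z = 0 ∧ b i z = 0 := by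
  simp [KU, Submodule.mem_iInf]

lemma nd_dual {B : E →ₗ[ℂ] E →ₗ[ℂ] ℂ} {S : Submodule ℂ E} (h : Nd B S) (f : E →ₗ[ℂ] ℂ) :
    ∃ u ∈ S, ∀ z ∈ S, B u z = f z := by
  let φ : S →ₗ[ℂ] Module.Dual ℂ S :=
    (Module.Dual.transpose (R := ℂ) S.subtype) ∘ₗ B ∘ₗ S.subtype
  have hinj : Function.Injective φ := by
    rw [injective_iff_map_eq_zero]
    rintro ⟨z, hz⟩ h0
    have : z = 0 := h z hz (fun z' hz' => by
      have := congrArg (fun f => f ⟨z', hz'⟩) h0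
      simpa [φ, Module.Dual.transpose_apply] using this)
    simpa using this
  have hsurj : Function.Surjective φ :=
    (LinearMap.injective_iff_surjective_of_finrank_eq_finrank
      (Subspace.dual_finrank_eq (K := ℂ) (V := S)).symm).1 hinj
  obtain ⟨u, hu⟩ := hsurj (f ∘ₗ S.subtype)
  refine ⟨u, u.2, fun z hz => ?_⟩
  have := congrArg (fun f => f ⟨z, hz⟩) hu
  simpa [φ, Module.Dual.transpose_apply] using this

lemma nd_op {B : E →ₗ[ℂ] E →ₗ[ℂ] ℂ} {S : Submodule ℂ E} (h : Nd B S) (B' : E →ₗ[ℂ] E →ₗ[ℂ] ℂ) :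
    ∃ N : S →ₗ[ℂ] S, ∀ z z' : S, B (N z) z' = B' z z' := by
  have h1 : ∀ z : S, ∃ u : S, ∀ z' : S, B u z' = B' z z' := by
    intro z
    obtain ⟨u, hu, hu'⟩ := nd_dual h (B' z)
    exact ⟨⟨u, hu⟩, fun z' => hu' z' z'.2⟩
  choose N hN using h1
  have key : ∀ u v : S, (∀ z' : S, B u z' = B v z') → u = v := by
    intro u v huv
    have := h (u - v : E) (S.sub_mem u.2 v.2) (fun z' hz' => by
      have := huv ⟨z', hz'⟩
      simp at this
      simp [this])
    exact Subtype.ext (sub_eq_zero.1 this)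
  refine ⟨{ toFun := N, map_add' := ?_, map_smul' := ?_ }, hN⟩
  · intro z1 z2; apply key; intro z'
    simp [hN]
  · intro c z; apply key; intro z'
    simp [hN]

lemma finrank_ker {S : Submodule ℂ E} (f : E →ₗ[ℂ] ℂ) (h : ∃ u ∈ S, f u ≠ 0) :
    finrank ℂ (S ⊓ LinearMap.ker f : Submodule ℂ E) + 1 = finrank ℂ S := by
  obtain ⟨u, hu, hfu⟩ := h
  have h1 := LinearMap.finrank_range_add_finrank_ker (f.domRestrict S)
  have h2 : LinearMap.range (f.domRestrict S) = ⊤ := by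
    rw [LinearMap.range_eq_top]
    intro c
    refine ⟨(c / f u) • ⟨u, hu⟩, ?_⟩
    simp [hfu]
  have h3 : finrank ℂ (LinearMap.ker (f.domRestrict S)) = finrank ℂ (S ⊓ LinearMap.ker f : Submodule ℂ E) := by
    have : (LinearMap.ker (f.domRestrict S)).map S.subtype = S ⊓ LinearMap.ker f := by
      ext z; simp
      tauto
    rw [← this]
    exact (Submodule.finrank_map_subtype_eq _ _).symm
  rw [h2, h3] at h1
  simp at h1
  omega

lemma finrank_ker_ge (S : Submodule ℂ E) (f : E →ₗ[ℂ] ℂ) :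
    finrank ℂ S ≤ finrank ℂ (S ⊓ LinearMap.ker f : Submodule ℂ E) + 1 := by
  by_cases h : ∃ u ∈ S, f u ≠ 0
  · exact (finrank_ker f h).ge
  · push Not at h
    have : S ⊓ LinearMap.ker f = S := by
      apply inf_eq_left.2; intro z hz; exact h z hz
    rw [this]; omega

lemma nd_LK {B : E →ₗ[ℂ] E →ₗ[ℂ] ℂ} (hB : ∀ z, B z z = 0) {S : Submodule ℂ E} (h : Nd B S)
    {g1 g2 : E →ₗ[ℂ] ℂ} {u2 : E} (hu2 : u2 ∈ S)
    (h2 : ∀ z ∈ S, B u2 z = g2 z) (hne : g1 u2 ≠ 0) :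
    Nd B (S ⊓ LinearMap.ker g1 ⊓ LinearMap.ker g2) ∧
    finrank ℂ (S ⊓ LinearMap.ker g1 ⊓ LinearMap.ker g2 : Submodule ℂ E) + 2 = finrank ℂ S := by
  have hanti : ∀ z w, B z w = - B w z := by
    intro z w
    have := hB (z + w)
    simp [hB] at this
    linear_combination this
  obtain ⟨u1, hu1, h1⟩ := nd_dual h g1
  have e11 : g1 u1 = 0 := by rw [← h1 u1 hu1]; exact hB _
  have e22 : g2 u2 = 0 := by rw [← h2 u2 hu2]; exact hB _
  have e21 : g2 u1 = - g1 u2 := by rw [← h2 u1 hu1, ← h1 u2 hu2, hanti]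
  constructor
  · rintro z ⟨⟨hz, hz1⟩, hz2⟩ hall
    simp at hz1 hz2
    apply h z hz
    intro z' hz'
    have := hall (z' - (g1 z' / g1 u2) • u2 + (g2 z' / g1 u2) • u1) ⟨⟨?_, ?_⟩, ?_⟩
    · have a1 : B z u1 = 0 := by rw [hanti, h1 z hz, hz1]; simp
      have a2 : B z u2 = 0 := by rw [hanti, h2 z hz, hz2]; simp
      simpa [a1, a2] using this
    · exact S.add_mem (S.sub_mem hz' (S.smul_mem _ hu2)) (S.smul_mem _ hu1)
    · simp [e11]; field_simp; ring
    · simp [e22, e21]; field_simp; ring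
  · have r1 := finrank_ker g1 ⟨u2, hu2, hne⟩
    have r2 := finrank_ker (S := S ⊓ LinearMap.ker g1) g2 ⟨u1, ⟨hu1, e11⟩, by rw [e21]; simpa using hne⟩
    omega

variable {ι : Type*} [Fintype ι] {a b : ι → E →ₗ[ℂ] ℂ}

lemma Yf_apply (x : ι → ℂ) (z z' : E) :
    Yf a b x z z' = ∑ i, x i * (a i z * b i z' - b i z * a i z') := by
  simp [Yf, LinearMap.sum_apply]

lemma Yf_alt (x : ι → ℂ) (z : E) : Yf a b x z z = 0 := by
  rw [Yf_apply]; apply Finset.sum_eq_zero; intro i _; ring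

lemma Yf_anti (x : ι → ℂ) (z w : E) : Yf a b x z w = - Yf a b x w z := by
  rw [Yf_apply, Yf_apply, ← Finset.sum_neg_distrib]; apply Finset.sum_congr rfl; intro i _; ring

lemma Yf_add_smul (x x' : ι → ℂ) (s : ℂ) : Yf a b (x + s • x') = Yf a b x + s • Yf a b x' := by
  ext z z'
  simp [Yf_apply, Finset.mul_sum, ← Finset.sum_add_distrib]
  apply Finset.sum_congr rfl; intro i _; ring

lemma Yf_smul (x' : ι → ℂ) (s : ℂ) : Yf a b (s • x') = s • Yf a b x' := by
  ext z z'
  simp [Yf_apply, Finset.mul_sum]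
  apply Finset.sum_congr rfl; intro i _; ring

lemma Nd_smul {B : E →ₗ[ℂ] E →ₗ[ℂ] ℂ} {S : Submodule ℂ E} {s : ℂ} (hs : s ≠ 0) :
    Nd (s • B) S ↔ Nd B S := by
  unfold Nd
  simp [hs]

lemma Yf_update [DecidableEq ι] (x : ι → ℂ) (w : ι) (c : ℂ) (z z' : E) :
    Yf a b (Function.update x w c) z z' = Yf a b x z z' + (c - x w) * (a w z * b w z' - b w z * a w z') := by
  rw [Yf_apply, Yf_apply, ← Finset.add_sum_erase _ _ (Finset.mem_univ w),
    ← Finset.add_sum_erase (a := w) _ (fun i => x i * (a i z * b i z' - b i z * a i z')) (Finset.mem_univ w)]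
  have : ∑ i ∈ Finset.univ.erase w, Function.update x w c i * (a i z * b i z' - b i z * a i z')
      = ∑ i ∈ Finset.univ.erase w, x i * (a i z * b i z' - b i z * a i z') := by
    apply Finset.sum_congr rfl
    intro i hi
    rw [Function.update_of_ne (Finset.ne_of_mem_erase hi)]
  rw [this]; simp; ring

def Sw (a b : ι → E →ₗ[ℂ] ℂ) (S : Submodule ℂ E) (w : ι) : Submodule ℂ E :=
  S ⊓ LinearMap.ker (a w) ⊓ LinearMap.ker (b w)

lemma nd_move [DecidableEq ι] {x : ι → ℂ} {S : Submodule ℂ E} (h : Nd (Yf a b x) S) (w : ι) (c : ℂ)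
    (hn : ¬ Nd (Yf a b (Function.update x w c)) S) :
    Nd (Yf a b x) (Sw a b S w) ∧ finrank ℂ (Sw a b S w) + 2 = finrank ℂ S := by
  obtain ⟨ub, hub, hb⟩ := nd_dual h (b w)
  apply nd_LK (Yf_alt x) h hub hb
  intro hπ
  apply hn
  obtain ⟨ua, hua, ha⟩ := nd_dual h (a w)
  have e1 : a w ua = 0 := by rw [← ha ua hua, Yf_alt]
  have e2 : b w ub = 0 := by rw [← hb ub hub, Yf_alt]
  have e3 : b w ua = 0 := by rw [← hb ua hua, Yf_anti, ha ub hub, hπ, neg_zero]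
  intro z hz hz0
  have key : z + (c - x w) • (a w z • ub - b w z • ua) = 0 := by
    apply h
    · exact S.add_mem hz (S.smul_mem _ (S.sub_mem (S.smul_mem _ hub) (S.smul_mem _ hua)))
    · intro z' hz'
      have := hz0 z' hz'
      rw [Yf_update] at this
      simp [ha z' hz', hb z' hz']
      exact this
  have a0 : a w z = 0 := by
    have := congrArg (a w) key
    simpa [e1, hπ] using this
  have b0 : b w z = 0 := by
    have := congrArg (b w) key
    simpa [e2, e3] using this
  simpa [a0, b0] using key

lemma nd_freeze {x : ι → ℂ} {S : Submodule ℂ E} (h : Nd (Yf a b x) S) (Q : Set ι)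
    (hQ : ∀ w ∈ Q, ∀ x', ¬ (Nd (Yf a b x') (Sw a b S w) ∧ finrank ℂ (Sw a b S w) + 2 = finrank ℂ S))
    (x' : ι → ℂ) (hx' : ∀ i, i ∉ Q → x' i = x i) : Nd (Yf a b x') S := by
  classical
  have key : ∀ F : Finset ι, (∀ i ∈ F, i ∈ Q) → ∀ x', (∀ i, i ∉ F → x' i = x i) → Nd (Yf a b x') S := by
    intro F
    induction F using Finset.induction_on with
    | empty =>
      intro _ x' hx'
      have : x' = x := by ext i; exact hx' i (by simp)
      rwa [this]
    | insert w F hw ih =>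
      intro hF x' hx'
      have h1 := ih (fun i hi => hF i (by simp [hi])) (Function.update x' w (x w)) (by
        intro i hi
        by_cases hiw : i = w
        · subst hiw; simp
        · rw [Function.update_of_ne hiw]; exact hx' i (by simp [hi, hiw]))
      by_contra hcon
      have := nd_move h1 w (x' w) (by simpa using hcon)
      exact hQ w (hF w (by simp)) _ this
  exact key (Finset.univ.filter (· ∈ Q)) (by simp) x' (by simpa using hx')

def Good (a b : ι → E →ₗ[ℂ] ℂ) (S : Submodule ℂ E) : Prop := ∃ x, Nd (Yf a b x) S

lemma KU_insert {U : Set ι} {w : ι} (S : Submodule ℂ E) : S ⊓ KU a b (insert w U) = Sw a b S w ⊓ KU a b U := by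
  ext z
  simp [mem_KU, Sw]
  tauto

lemma finrank_KU (S : Submodule ℂ E) (U : Finset ι) :
    finrank ℂ S ≤ finrank ℂ (S ⊓ KU a b (U : Set ι) : Submodule ℂ E) + 2 * U.card := by
  classical
  induction U using Finset.induction_on generalizing S with
  | empty =>
    have : S ⊓ KU a b ((∅ : Finset ι) : Set ι) = S := by
      apply inf_eq_left.2; intro z _; simp [mem_KU]
    rw [this]; simp
  | insert w U hw ih =>
    rw [Finset.coe_insert, KU_insert, Finset.card_insert_of_notMem hw]
    have h1 := ih (Sw a b S w)
    have h2 := finrank_ker_ge S (a w)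
    have h3 := finrank_ker_ge (S ⊓ LinearMap.ker (a w)) (b w)
    unfold Sw at h1
    unfold Sw
    omega

lemma good_perfect {S : Submodule ℂ E} (h : Good a b S) :
    Even (finrank ℂ S) ∧ ∃ U : Finset ι, 2 * U.card ≤ finrank ℂ S ∧ S ⊓ KU a b (U : Set ι) = ⊥ := by
  classical
  obtain ⟨n, hn⟩ : ∃ n, finrank ℂ S = n := ⟨_, rfl⟩
  induction n using Nat.strong_induction_on generalizing S with
  | _ n ih =>
    obtain ⟨x, hx⟩ := h
    by_cases hall : ∀ w ∈ (Set.univ : Set ι), ∀ x', ¬ (Nd (Yf a b x') (Sw a b S w) ∧ finrank ℂ (Sw a b S w) + 2 = finrank ℂ S)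
    · have h0 := nd_freeze hx Set.univ hall 0 (by simp)
      have : S = ⊥ := by
        rw [eq_bot_iff]; intro z hz
        have := h0 z hz (by intro z' _; rw [Yf_apply]; simp)
        simpa using this
      subst this
      exact ⟨by simp, ∅, by simp⟩
    · push Not at hall
      obtain ⟨w, _, x', h1, h2⟩ := hall
      obtain ⟨he, U, hU, hU'⟩ := ih (finrank ℂ (Sw a b S w)) (by omega) ⟨x', h1⟩ rfl
      refine ⟨?_, insert w U, ?_, ?_⟩
      · rw [← h2]; exact he.add (by decide)
      · have := Finset.card_insert_le w U; omega
      · rw [Finset.coe_insert, KU_insert]; exact hU'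

lemma perfect_good {S : Submodule ℂ E} (U : Finset ι) (hU : 2 * U.card ≤ finrank ℂ S)
    (h : S ⊓ KU a b (U : Set ι) = ⊥) : Good a b S := by
  classical
  refine ⟨fun i => if i ∈ U then 1 else 0, ?_⟩
  let φ : S →ₗ[ℂ] (U → Fin 2 → ℂ) :=
    LinearMap.pi (fun i => LinearMap.pi (fun k => if k = 0 then (a i) ∘ₗ S.subtype else (b i) ∘ₗ S.subtype))
  have hinj : Function.Injective φ := by
    rw [injective_iff_map_eq_zero]
    rintro ⟨z, hz⟩ h0
    have : z ∈ S ⊓ KU a b (U : Set ι) := ⟨hz, by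
      rw [SetLike.mem_coe, mem_KU]
      intro i hi
      have h1 := congrFun (congrFun h0 ⟨i, hi⟩) 0
      have h2 := congrFun (congrFun h0 ⟨i, hi⟩) 1
      simp [φ] at h1 h2
      exact ⟨h1, h2⟩⟩
    rw [h] at this
    simpa using this
  have hd : finrank ℂ S = finrank ℂ (U → Fin 2 → ℂ) := by
    have h1 := LinearMap.finrank_le_finrank_of_injective hinj
    have h2 : finrank ℂ (U → Fin 2 → ℂ) = U.card * 2 := by
      rw [Module.finrank_pi_fintype]; simp
    omega
  have hs := (LinearMap.injective_iff_surjective_of_finrank_eq_finrank hd).1 hinj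
  intro z hz hz0
  have key : ∀ (c d : U → ℂ), ∑ i : U, (a i z * d i - b i z * c i) = 0 := by
    intro c d
    obtain ⟨z', hz'⟩ := hs (fun i k => if k = 0 then c i else d i)
    have e1 : ∀ i : U, a i z' = c i := fun i => by
      have := congrFun (congrFun hz' i) 0
      simpa [φ] using this
    have e2 : ∀ i : U, b i z' = d i := fun i => by
      have := congrFun (congrFun hz' i) 1
      simpa [φ] using this
    have := hz0 z' z'.2
    rw [Yf_apply] at this
    simp only [ite_mul, one_mul, zero_mul, Finset.sum_ite_mem, Finset.univ_inter] at this
    rw [← Finset.sum_coe_sort] at this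
    simpa [e1, e2] using this
  have : z ∈ S ⊓ KU a b (U : Set ι) := ⟨hz, by
    rw [SetLike.mem_coe, mem_KU]
    intro i hi
    constructor
    · have := key 0 (Pi.single ⟨i, hi⟩ 1)
      simpa [Pi.single_apply] using this
    · have := key (Pi.single ⟨i, hi⟩ 1) 0
      simpa [Pi.single_apply] using this⟩
  rw [h] at this
  simpa using this

end abs

end part_P1

section part_P1b
open Module
set_option linter.unusedSectionVars false
section abs2
variable {E : Type*} [AddCommGroup E] [Module ℂ E] [FiniteDimensional ℂ E]

lemma nilp_of_eig (f : Module.End ℂ E) (h : ∀ μ, f.HasEigenvalue μ → μ = 0) : IsNilpotent f := by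
  have h1 := (IsAlgClosed.splits f.charpoly).eq_prod_roots_of_monic f.charpoly_monic
  have h2 : f.charpoly.roots = Multiset.replicate f.charpoly.roots.card 0 := by
    rw [Multiset.eq_replicate]
    refine ⟨rfl, fun μ hμ => h μ ?_⟩
    rw [Module.End.hasEigenvalue_iff_isRoot_charpoly]
    exact Polynomial.isRoot_of_mem_roots hμ
  rw [h2] at h1
  simp at h1
  refine ⟨f.charpoly.roots.card, ?_⟩
  have h3 := f.aeval_self_charpoly
  rw [h1] at h3
  simpa using h3

lemma nd_cofinite {B0 : E →ₗ[ℂ] E →ₗ[ℂ] ℂ} {T : Submodule ℂ E} (h : Nd B0 T)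
    (B1 : E →ₗ[ℂ] E →ₗ[ℂ] ℂ) : ∀ᶠ s in Filter.cofinite, Nd (B0 + (s : ℂ) • B1) T := by
  obtain ⟨N, hN⟩ := nd_op h B1
  have hfin : ({μ | Module.End.HasEigenvalue N μ}).Finite := Module.End.finite_hasEigenvalue N
  have h1 : ∀ᶠ s : ℂ in Filter.cofinite, ¬ Module.End.HasEigenvalue N (-s⁻¹) := by
    rw [Filter.eventually_cofinite]
    have : Function.Injective (fun s : ℂ => -s⁻¹) := by
      intro s t hst; simpa using hst
    simpa using hfin.preimage (this.injOn)
  filter_upwards [h1] with s hs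
  intro z hz hz0
  by_contra hne
  have key : z + s • (N ⟨z, hz⟩ : E) = 0 := by
    apply h _ (T.add_mem hz (T.smul_mem _ (N ⟨z, hz⟩).2))
    intro z' hz'
    have e := hN ⟨z, hz⟩ ⟨z', hz'⟩
    have := hz0 z' hz'
    simp at e this
    simp [e, this]
  have hs0 : s ≠ 0 := by
    rintro rfl
    exact hne (by simpa using key)
  apply hs
  apply Module.End.hasEigenvalue_of_hasEigenvector (x := ⟨z, hz⟩)
  rw [Module.End.hasEigenvector_iff, Module.End.mem_eigenspace_iff]
  refine ⟨?_, fun h0 => hne (by simpa using h0)⟩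
  apply Subtype.ext
  simp
  have : s • (N ⟨z, hz⟩ : E) = - z := by rw [eq_neg_iff_add_eq_zero, add_comm]; exact key
  have h2 := congrArg (fun v => s⁻¹ • v) this
  simpa [smul_smul, hs0] using h2

variable {ι : Type*} [Fintype ι] {a b : ι → E →ₗ[ℂ] ℂ}

lemma nd_two {a' b' : ι → E →ₗ[ℂ] ℂ} {x0 x1 : ι → ℂ} {T0 T1 : Submodule ℂ E}
    (h0 : Nd (Yf a b x0) T0) (h1 : Nd (Yf a' b' x1) T1) :
    ∀ᶠ s : ℂ in Filter.cofinite, Nd (Yf a b (x0 + s • x1)) T0 ∧ Nd (Yf a' b' (x0 + s • x1)) T1 := by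
  have e1 := nd_cofinite h0 (Yf a b x1)
  have e2 := nd_cofinite h1 (Yf a' b' x0)
  have e2' : ∀ᶠ s : ℂ in Filter.cofinite, Nd (Yf a' b' x1 + s⁻¹ • Yf a' b' x0) T1 :=
    (Function.Injective.tendsto_cofinite (inv_injective (G := ℂ))).eventually e2
  have e3 : ∀ᶠ s : ℂ in Filter.cofinite, s ≠ 0 := by
    rw [Filter.eventually_cofinite]; simp
  filter_upwards [e1, e2', e3] with s h1 h2 h3
  refine ⟨by rw [Yf_add_smul]; exact h1, ?_⟩
  rw [← Nd_smul h3] at h2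
  rw [Yf_add_smul]
  convert h2 using 1
  rw [smul_add, smul_smul, mul_inv_cancel₀ h3, one_smul, add_comm]

lemma nd_family {κ : Type*} (F : Finset κ) (T : κ → Submodule ℂ E) (h : ∀ k ∈ F, Good a b (T k)) :
    ∃ x, ∀ k ∈ F, Nd (Yf a b x) (T k) := by
  classical
  induction F using Finset.induction_on with
  | empty => exact ⟨0, by simp⟩
  | insert k F hk ih =>
    obtain ⟨x, hx⟩ := ih (fun i hi => h i (by simp [hi]))
    obtain ⟨x1, hx1⟩ := h k (by simp)
    have e1 : ∀ᶠ s : ℂ in Filter.cofinite, ∀ i ∈ F, Nd (Yf a b (x1 + s • x)) (T i) ∧ Nd (Yf a b (x1 + s • x)) (T k) := by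
      rw [Filter.eventually_all_finset]
      intro i hi
      filter_upwards [nd_two hx1 (hx i hi)] with s hs using ⟨hs.2, hs.1⟩
    have e2 := nd_cofinite hx1 (Yf a b x)
    obtain ⟨s, hs1, hs2⟩ := (e1.and e2).exists
    refine ⟨x1 + s • x, fun i hi => ?_⟩
    rw [Finset.mem_insert] at hi
    rcases hi with rfl | hi
    · rw [Yf_add_smul]; exact hs2
    · exact (hs1 i hi).1

lemma red_step {S : Submodule ℂ E} {Δ : Submodule ℂ (E →ₗ[ℂ] ℂ)} (h1 : Good a b S)
    {g g' : E →ₗ[ℂ] ℂ} (hg : g ∈ Δ) (hg' : g' ∈ Δ)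
    (h2 : Good a b (S ⊓ LinearMap.ker g ⊓ LinearMap.ker g'))
    (h2' : finrank ℂ (S ⊓ LinearMap.ker g ⊓ LinearMap.ker g' : Submodule ℂ E) + 2 = finrank ℂ S) :
    (∃ w, (Good a b (Sw a b S w) ∧ finrank ℂ (Sw a b S w) + 2 = finrank ℂ S) ∧
      ∃ h ∈ Δ, ∃ h' ∈ Δ, Good a b (Sw a b S w ⊓ LinearMap.ker h ⊓ LinearMap.ker h') ∧
        finrank ℂ (Sw a b S w ⊓ LinearMap.ker h ⊓ LinearMap.ker h' : Submodule ℂ E) + 4 = finrank ℂ S) ∨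
    (∀ h ∈ Δ, ∃ α β : ℂ, ∀ z ∈ S, h z = α * g z + β * g' z) := by
  classical
  by_contra hcon
  push Not at hcon
  obtain ⟨hno, h, hh, hspan⟩ := hcon
  let Vp : Set ι := {w | Good a b (Sw a b S w) ∧ finrank ℂ (Sw a b S w) + 2 = finrank ℂ S}
  obtain ⟨x, hx⟩ := h1
  have hev := (good_perfect ⟨x, hx⟩).1
  obtain ⟨x', hx'⟩ := h2
  let xp : ι → ℂ := fun i => if i ∈ Vp then x i else 0
  let xr : ι → ℂ := fun i => if i ∈ Vp then 0 else x' i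
  have fr1 : ∀ y y', Nd (Yf a b y) S → (∀ i, i ∈ Vp → y' i = y i) → Nd (Yf a b y') S := by
    intro y y' hy hyy
    refine nd_freeze hy Vpᶜ ?_ y' (fun i hi => hyy i (by simpa using hi))
    rintro w hw x'' ⟨c1, c2⟩
    exact hw ⟨⟨x'', c1⟩, c2⟩
  have fr2 : ∀ h ∈ Δ, ∀ h' ∈ Δ,
      finrank ℂ (S ⊓ LinearMap.ker h ⊓ LinearMap.ker h' : Submodule ℂ E) + 2 = finrank ℂ S →
      ∀ y y', Nd (Yf a b y) (S ⊓ LinearMap.ker h ⊓ LinearMap.ker h') → (∀ i, i ∉ Vp → y' i = y i) →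
        Nd (Yf a b y') (S ⊓ LinearMap.ker h ⊓ LinearMap.ker h') := by
    intro h hh h' hh' hd y y' hy hyy
    refine nd_freeze hy Vp ?_ y' hyy
    rintro w hw x'' ⟨c1, c2⟩
    have e : Sw a b (S ⊓ LinearMap.ker h ⊓ LinearMap.ker h') w = Sw a b S w ⊓ LinearMap.ker h ⊓ LinearMap.ker h' := by
      unfold Sw; ext z; simp; tauto
    rw [e] at c1 c2
    refine hno w hw h hh h' hh' ⟨x'', c1⟩ ?_
    omega
  have F1 : ∀ s : ℂ, Nd (Yf a b (xp + s • xr)) S := by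
    intro s
    apply fr1 x _ hx
    intro i hi
    simp [xp, xr, hi]
  have F2 : Nd (Yf a b xr) (S ⊓ LinearMap.ker g ⊓ LinearMap.ker g') := by
    apply fr2 g hg g' hg' h2' x' _ hx'
    intro i hi
    simp [xr, hi]
  have F3 : ∀ h ∈ Δ, ∀ h' ∈ Δ,
      finrank ℂ (S ⊓ LinearMap.ker h ⊓ LinearMap.ker h' : Submodule ℂ E) + 2 = finrank ℂ S →
      ∀ s : ℂ, s ≠ 0 → Nd (Yf a b (xp + s • xr)) (S ⊓ LinearMap.ker h ⊓ LinearMap.ker h') →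
        Nd (Yf a b xr) (S ⊓ LinearMap.ker h ⊓ LinearMap.ker h') := by
    intro h hh h' hh' hd s hs hn
    rw [← Nd_smul hs, ← Yf_smul]
    apply fr2 h hh h' hh' hd _ _ hn
    intro i hi
    simp [xp, hi]
  have F0 : Nd (Yf a b xp) S := by simpa using F1 0
  obtain ⟨M, hM⟩ := nd_op F0 (Yf a b xr)
  have hMnil : IsNilpotent M := by
    apply nilp_of_eig
    intro μ hμ
    by_contra hne
    obtain ⟨v, hv⟩ := hμ.exists_hasEigenvector
    have hv1 : M v = μ • v := hv.apply_eq_smul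
    apply hv.2
    have := F1 (-μ⁻¹) v v.2 (by
      intro z' hz'
      have := hM v ⟨z', hz'⟩
      rw [Yf_add_smul]
      simp [hv1] at this
      simp [← this, hne])
    simpa using this
  -- kernel of M
  have hker : ∀ v : S, M v = 0 → ∀ z' ∈ S, Yf a b xr v z' = 0 := by
    intro v hv z' hz'
    rw [← hM v ⟨z', hz'⟩, hv]; simp
  have hker' : ∀ v : S, (∀ z' ∈ S, Yf a b xr v z' = 0) → M v = 0 := by
    intro v hv
    have := F0 (M v) (M v).2 (fun z' hz' => by rw [hM v ⟨z', hz'⟩]; exact hv z' hz')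
    exact Subtype.ext this
  have hkS : ∀ v : S, M v = 0 → g v = 0 → g' v = 0 → v = 0 := by
    intro v hv hg0 hg0'
    have := F2 v ⟨⟨v.2, hg0⟩, hg0'⟩ (fun z' hz' => hker v hv z' hz'.1.1)
    exact Subtype.ext this
  have hSpos : Nontrivial S := by
    apply Module.nontrivial_of_finrank_pos (R := ℂ); omega
  -- N0 nonzero
  obtain ⟨n0, hn0, hn0'⟩ : ∃ n0 : S, M n0 = 0 ∧ n0 ≠ 0 := by
    by_contra hcon
    push Not at hcon
    have hinj : Function.Injective M := (injective_iff_map_eq_zero M).2 hcon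
    obtain ⟨k, hk⟩ := hMnil
    obtain ⟨v, hv⟩ := exists_ne (0 : S)
    have : Function.Injective (M ^ k) := by
      rw [Module.End.coe_pow]; exact hinj.iterate k
    apply hv
    apply this
    rw [hk]; simp
  -- for any g1 in Δ nonzero on some kernel vector n, kernel ∩ ker g1 nonzero
  have odd_contra : ∀ g1 : E →ₗ[ℂ] ℂ, ∃ n : S, M n = 0 ∧ n ≠ 0 ∧ g1 n = 0 := by
    intro g1
    by_contra hcon
    push Not at hcon
    have hgn := hcon n0 hn0 hn0'
    have hr := finrank_ker (S := S) g1 ⟨n0, n0.2, hgn⟩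
    have hnd : Nd (Yf a b xr) (S ⊓ LinearMap.ker g1) := by
      rintro z ⟨hz, hz1⟩ hz0
      have hz2 : M ⟨z, hz⟩ = 0 := by
        apply hker'
        intro z' hz'
        have := hz0 (z' - (g1 z' / g1 n0) • (n0 : E)) ⟨S.sub_mem hz' (S.smul_mem _ n0.2), by simp [hgn]⟩
        have e : Yf a b xr z n0 = 0 := by rw [Yf_anti, hker n0 hn0 z hz, neg_zero]
        simpa [e] using this
      by_contra hne
      exact hcon ⟨z, hz⟩ hz2 (by simpa using hne) hz1
    have := (good_perfect ⟨xr, hnd⟩).1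
    rw [← hr] at hev
    rw [Nat.even_add_one] at hev
    exact hev this
  -- adjust h to vanish on the kernel
  obtain ⟨α, β, hαβ⟩ : ∃ α β : ℂ, ∀ v : S, M v = 0 → h v = α * g v + β * g' v := by
    obtain ⟨n1, m1, m1', m1g⟩ := odd_contra g
    have c1 : g' n1 ≠ 0 := fun hc => m1' (hkS n1 m1 m1g hc)
    obtain ⟨n2, m2, m2', m2g⟩ := odd_contra g'
    have c2 : g n2 ≠ 0 := fun hc => m2' (hkS n2 m2 hc m2g)
    refine ⟨h n2 / g n2, h n1 / g' n1, ?_⟩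
    intro v hv
    have : v - (g v / g n2) • n2 - (g' v / g' n1) • n1 = 0 := by
      apply hkS
      · simp [hv, m1, m2]
      · simp [m1g, c2]
      · simp [m2g, c1]
    have := congrArg (fun u : S => h u) this
    simp at this
    field_simp
    field_simp at this
    linear_combination this
  let h0 : E →ₗ[ℂ] ℂ := h - α • g - β • g'
  have hh0 : h0 ∈ Δ := Δ.sub_mem (Δ.sub_mem hh (Δ.smul_mem _ hg)) (Δ.smul_mem _ hg')
  have hh0k : ∀ v : S, M v = 0 → h0 v = 0 := by
    intro v hv; simp [h0, hαβ v hv]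
  obtain ⟨u0, hu0, hu0'⟩ := nd_dual F0 h0
  obtain ⟨k, hk⟩ := hMnil
  let us : ℂ → S := fun s => (∑ i ∈ Finset.range k, ((-s) • M) ^ i) ⟨u0, hu0⟩
  have hus : ∀ s : ℂ, us s + s • M (us s) = ⟨u0, hu0⟩ := by
    intro s
    have e := mul_neg_geom_sum ((-s) • M) k
    have : ((-s) • M) ^ k = 0 := by rw [smul_pow, hk, smul_zero]
    rw [this, sub_zero] at e
    have := congrArg (fun f : Module.End ℂ S => f ⟨u0, hu0⟩) e
    simp only [Module.End.mul_apply, Module.End.one_apply] at this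
    rw [← this]
    change us s + s • M (us s) = (1 - -s • M) (us s)
    simp
  have husd : ∀ s : ℂ, ∀ z ∈ S, Yf a b (xp + s • xr) (us s) z = h0 z := by
    intro s z hz
    rw [← hu0' z hz, Yf_add_smul]
    have e1 := congrArg (fun v : S => (v : E)) (hus s)
    simp only at e1
    rw [← e1]
    have e2 := hM (us s) ⟨z, hz⟩
    simp at e2
    simp [e2]
  have hvan : ∀ g1 ∈ Δ, ∀ s : ℂ, s ≠ 0 → g1 (us s) = 0 := by
    intro g1 hg1 s hs
    by_contra hne
    obtain ⟨c1, c2⟩ := nd_LK (Yf_alt (xp + s • xr)) (F1 s) (us s).2 (husd s) hne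
    have c3 := F3 g1 hg1 h0 hh0 c2 s hs c1
    obtain ⟨n, hn1, hn2, hn3⟩ := odd_contra g1
    apply hn2
    apply Subtype.ext
    exact c3 n ⟨⟨n.2, hn3⟩, hh0k n hn1⟩ (fun z' hz' => hker n hn1 z' hz'.1.1)
  have hpow : ∀ g1 ∈ Δ, ∀ i, g1 ((M ^ i) ⟨u0, hu0⟩) = 0 := by
    intro g1 hg1 i
    by_cases hik : k ≤ i
    · have : M ^ i = 0 := pow_eq_zero_of_le hik hk
      rw [this]; simp
    push Not at hik
    let p : Polynomial ℂ := ∑ i ∈ Finset.range k, Polynomial.C ((-1) ^ i * g1 ((M ^ i) ⟨u0, hu0⟩)) * Polynomial.X ^ i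
    have hp : p = 0 := by
      apply Polynomial.eq_zero_of_infinite_isRoot
      apply Set.Infinite.mono (s := {0}ᶜ)
      · intro s hs
        have := hvan g1 hg1 s (by simpa using hs)
        simp only [Set.mem_ofPred_eq, Polynomial.IsRoot, p, Polynomial.eval_finsetSum]
        rw [← this]
        simp only [us, LinearMap.sum_apply, AddSubmonoidClass.coe_finsetSum, map_sum]
        apply Finset.sum_congr rfl
        intro i _
        simp only [Polynomial.eval_mul, Polynomial.eval_C, Polynomial.eval_pow, Polynomial.eval_X, smul_pow,
          LinearMap.smul_apply, SetLike.val_smul, map_smul, smul_eq_mul]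
        rw [neg_pow s i]; ring
      · exact (Set.finite_singleton _).infinite_compl
    have := congrArg (fun q => q.coeff i) hp
    simp only [p, Polynomial.finsetSum_coeff, Polynomial.coeff_C_mul_X_pow, Polynomial.coeff_zero] at this
    simpa [hik] using this
  have hu0ne : (⟨u0, hu0⟩ : S) ≠ 0 := by
    intro hc
    have hc : u0 = 0 := by simpa using hc
    obtain ⟨z, hz, hz'⟩ := hspan α β
    apply hz'
    have := hu0' z hz
    rw [hc] at this
    simp [h0] at this
    linear_combination -this
  have hex : ∃ m, (M ^ m) ⟨u0, hu0⟩ = 0 := ⟨k, by rw [hk]; simp⟩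
  have hmpos : Nat.find hex ≠ 0 := by
    intro hc
    have := Nat.find_spec hex
    rw [hc] at this
    exact hu0ne (by simpa using this)
  obtain ⟨m, hm⟩ := Nat.exists_eq_succ_of_ne_zero hmpos
  have hm1 := Nat.find_spec hex
  rw [hm, Nat.succ_eq_add_one, pow_succ'] at hm1
  exact Nat.find_min hex (m := m) (by omega) (hkS _ hm1 (hpow g hg m) (hpow g' hg' m))

lemma red_iter {S : Submodule ℂ E} {Δ : Submodule ℂ (E →ₗ[ℂ] ℂ)} (h1 : Good a b S)
    {g g' : E →ₗ[ℂ] ℂ} (hg : g ∈ Δ) (hg' : g' ∈ Δ)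
    (h2 : Good a b (S ⊓ LinearMap.ker g ⊓ LinearMap.ker g'))
    (h2' : finrank ℂ (S ⊓ LinearMap.ker g ⊓ LinearMap.ker g' : Submodule ℂ E) + 2 = finrank ℂ S) :
    ∃ U : Finset ι, finrank ℂ (S ⊓ KU a b (U : Set ι) : Submodule ℂ E) + 2 * U.card = finrank ℂ S ∧
      Good a b (S ⊓ KU a b (U : Set ι)) ∧ ∃ g ∈ Δ, ∃ g' ∈ Δ,
      Good a b (S ⊓ KU a b (U : Set ι) ⊓ LinearMap.ker g ⊓ LinearMap.ker g') ∧
      finrank ℂ (S ⊓ KU a b (U : Set ι) ⊓ LinearMap.ker g ⊓ LinearMap.ker g' : Submodule ℂ E) + 2 =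
        finrank ℂ (S ⊓ KU a b (U : Set ι) : Submodule ℂ E) ∧
      ∀ h ∈ Δ, ∃ α β : ℂ, ∀ z ∈ S ⊓ KU a b (U : Set ι), h z = α * g z + β * g' z := by
  classical
  obtain ⟨n, hn⟩ : ∃ n, finrank ℂ S = n := ⟨_, rfl⟩
  induction n using Nat.strong_induction_on generalizing S g g' with
  | _ n ih =>
    rcases red_step h1 hg hg' h2 h2' with ⟨w, ⟨c1, c2⟩, h, hh, h', hh', c3, c4⟩ | hfin
    · obtain ⟨U, hU, rest⟩ := ih (finrank ℂ (Sw a b S w)) (by omega) c1 hh hh' c3 (by omega) rfl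
      refine ⟨insert w U, ?_, ?_⟩
      · have k1 := finrank_KU (a := a) (b := b) S (insert w U)
        rw [Finset.coe_insert, KU_insert] at k1 ⊢
        have := Finset.card_insert_le w U
        omega
      · rw [Finset.coe_insert, KU_insert]; exact rest
    · have e : S ⊓ KU a b ((∅ : Finset ι) : Set ι) = S := by
        apply inf_eq_left.2; intro z _; simp [mem_KU]
      refine ⟨∅, ?_⟩
      rw [e]
      exact ⟨by simp, h1, g, hg, g', hg', h2, h2', hfin⟩

/-- the radical of `Y x` on `S` -/
noncomputable def rad (a b : ι → E →ₗ[ℂ] ℂ) (x : ι → ℂ) (S : Submodule ℂ E) : Submodule ℂ E where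
  carrier := {z | z ∈ S ∧ ∀ z' ∈ S, Yf a b x z z' = 0}
  add_mem' := by
    rintro z w ⟨h1, h2⟩ ⟨h3, h4⟩
    exact ⟨S.add_mem h1 h3, fun z' hz' => by simp [h2 z' hz', h4 z' hz']⟩
  zero_mem' := ⟨S.zero_mem, by simp⟩
  smul_mem' := by
    rintro c z ⟨h1, h2⟩
    exact ⟨S.smul_mem c h1, fun z' hz' => by simp [h2 z' hz']⟩

lemma mem_rad {x : ι → ℂ} {S : Submodule ℂ E} {z : E} :
    z ∈ rad a b x S ↔ z ∈ S ∧ ∀ z' ∈ S, Yf a b x z z' = 0 := Iff.rfl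

lemma rad_max {S T : Submodule ℂ E} {x : ι → ℂ} (hT : T ≤ S) (hx : Nd (Yf a b x) T)
    (hmax : ∀ T' ≤ S, Good a b T' → finrank ℂ T' ≤ finrank ℂ T) :
    T ⊓ rad a b x S = ⊥ ∧ T ⊔ rad a b x S = S ∧
    ∀ i, ∀ z ∈ rad a b x S, ∀ z' ∈ rad a b x S, a i z * b i z' - b i z * a i z' = 0 := by
  classical
  have hstrict : ∀ (z z' : E), z ∈ S → z' ∈ S → z ∉ T → ¬ Good a b (T ⊔ Submodule.span ℂ {z, z'}) := by
    intro z z' hz hz' hzT hgood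
    have := hmax _ (sup_le hT (Submodule.span_le.2 (by
      intro w hw; simp at hw; rcases hw with rfl | rfl <;> assumption))) hgood
    have h2 := Submodule.finrank_lt_finrank_of_lt (s := T) (t := T ⊔ Submodule.span ℂ {z, z'}) (by
      refine lt_of_le_of_ne le_sup_left ?_
      intro he
      apply hzT
      rw [he]
      exact (le_sup_right : _ ≤ T ⊔ Submodule.span ℂ {z, z'}) (Submodule.subset_span (by simp)))
    omega
  have hdisj : T ⊓ rad a b x S = ⊥ := by
    rw [eq_bot_iff]
    rintro z ⟨h1, h2⟩
    have := hx z h1 (fun z' hz' => h2.2 z' (hT hz'))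
    simpa using this
  refine ⟨hdisj, ?_, ?_⟩
  · apply le_antisymm (sup_le hT (fun z hz => (mem_rad.1 hz).1))
    intro z hz
    have proj : ∀ z ∈ S, ∃ t ∈ T, z - t ∈ S ∧ ∀ t' ∈ T, Yf a b x (z - t) t' = 0 := by
      intro z hz
      obtain ⟨t, ht, ht'⟩ := nd_dual hx (Yf a b x z)
      exact ⟨t, ht, S.sub_mem hz (hT ht), fun t' h' => by simp [ht' t' h']⟩
    obtain ⟨t, ht, hzt, hzt'⟩ := proj z hz
    suffices z - t ∈ rad a b x S by
      have := Submodule.add_mem_sup ht this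
      simpa using this
    refine ⟨hzt, ?_⟩
    by_contra hcon
    push Not at hcon
    obtain ⟨z1, hz1, hne⟩ := hcon
    obtain ⟨t1, ht1, hz2, hz2'⟩ := proj z1 hz1
    set z0 := z - t with hz0
    set w := z1 - t1 with hw
    have hne' : Yf a b x z0 w ≠ 0 := by
      rw [hw]; simp [hzt' t1 ht1]; exact hne
    have hz0T : z0 ∉ T := by
      intro h0
      have := hx z0 h0 hzt'
      rw [this] at hne; simp at hne
    refine hstrict z0 w hzt hz2 hz0T ⟨x, ?_⟩
    intro y hy hy0
    rw [Submodule.mem_sup] at hy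
    obtain ⟨t2, ht2, v, hv, rfl⟩ := hy
    rw [Submodule.mem_span_pair] at hv
    obtain ⟨α, β, rfl⟩ := hv
    have m1 : z0 ∈ T ⊔ Submodule.span ℂ {z0, w} :=
      (le_sup_right : _ ≤ T ⊔ Submodule.span ℂ {z0, w}) (Submodule.subset_span (by simp))
    have m2 : w ∈ T ⊔ Submodule.span ℂ {z0, w} :=
      (le_sup_right : _ ≤ T ⊔ Submodule.span ℂ {z0, w}) (Submodule.subset_span (by simp))
    have e1 := hy0 _ m1
    have e2 := hy0 _ m2
    have p1 : Yf a b x t2 z0 = 0 := by rw [Yf_anti, hzt' t2 ht2, neg_zero]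
    have p2 : Yf a b x t2 w = 0 := by rw [Yf_anti, hz2' t2 ht2, neg_zero]
    have p3 : Yf a b x w z0 ≠ 0 := by rw [Yf_anti]; simpa using hne'
    have hβ : β = 0 := by simpa [p1, Yf_alt, p3] using e1
    have hα : α = 0 := by simpa [p2, Yf_alt, hne', hβ] using e2
    have := hx t2 ht2 (fun z' hz' => by
      have := hy0 z' ((le_sup_left : T ≤ T ⊔ Submodule.span ℂ {z0, w}) hz')
      simpa [hα, hβ] using this)
    simp [this, hα, hβ]
  · intro i z hz z' hz'
    by_contra hne
    have hzT : z ∉ T := by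
      intro h0
      have : z ∈ T ⊓ rad a b x S := ⟨h0, hz⟩
      rw [hdisj] at this
      have : z = 0 := by simpa using this
      rw [this] at hne; simp at hne
    refine hstrict z z' hz.1 hz'.1 hzT ⟨Function.update x i (x i + 1), ?_⟩
    intro y hy hy0
    simp only [Yf_update, add_sub_cancel_left, one_mul] at hy0
    have hyS : y ∈ S := by
      have : T ⊔ Submodule.span ℂ {z, z'} ≤ S := sup_le hT (Submodule.span_le.2 (by
        intro w hw; simp at hw; rcases hw with rfl | rfl
        · exact hz.1
        · exact hz'.1))
      exact this hy
    rw [Submodule.mem_sup] at hy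
    obtain ⟨t, ht, v, hv, rfl⟩ := hy
    rw [Submodule.mem_span_pair] at hv
    obtain ⟨α, β, rfl⟩ := hv
    set y := t + (α • z + β • z') with hy
    have m1 : z ∈ T ⊔ Submodule.span ℂ {z, z'} :=
      (le_sup_right : _ ≤ T ⊔ Submodule.span ℂ {z, z'}) (Submodule.subset_span (by simp))
    have m2 : z' ∈ T ⊔ Submodule.span ℂ {z, z'} :=
      (le_sup_right : _ ≤ T ⊔ Submodule.span ℂ {z, z'}) (Submodule.subset_span (by simp))
    have e1 := hy0 _ m1
    have e2 := hy0 _ m2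
    rw [Yf_anti, hz.2 y hyS] at e1
    rw [Yf_anti, hz'.2 y hyS] at e2
    have ay : a i y = 0 := by
      have : a i y * (a i z * b i z' - b i z * a i z') = 0 := by
        linear_combination (a i z) * e2 - (a i z') * e1
      simpa [hne] using this
    have by' : b i y = 0 := by
      have : b i y * (a i z * b i z' - b i z * a i z') = 0 := by
        linear_combination (b i z) * e2 - (b i z') * e1
      simpa [hne] using this
    have ht0 : t = 0 := by
      apply hx t ht
      intro t' ht'
      have := hy0 t' ((le_sup_left : T ≤ T ⊔ Submodule.span ℂ {z, z'}) ht')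
      rw [ay, by', hy] at this
      simpa [hz.2 t' (hT ht'), hz'.2 t' (hT ht')] using this
    rw [ht0, zero_add] at hy
    rw [hy] at ay by'
    simp at ay by'
    have hα : α = 0 := by
      have : α * (a i z * b i z' - b i z * a i z') = 0 := by linear_combination (b i z') * ay - (a i z') * by'
      simpa [hne] using this
    have hβ : β = 0 := by
      have : β * (a i z * b i z' - b i z * a i z') = 0 := by linear_combination (a i z) * by' - (b i z) * ay
      simpa [hne] using this
    rw [hy, hα, hβ]; simp

end abs2

end part_P1b

section part_P2
open Module
set_option linter.unusedSectionVars false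

/-! ### Part 2: flows -/

section flows
variable {V : Type} [Fintype V]

/-- delete the vertices of `U` (they become isolated) -/
def delV (G : SimpleGraph V) (U : Set V) : SimpleGraph V where
  Adj u v := G.Adj u v ∧ u ∉ U ∧ v ∉ U
  symm := ⟨fun _ _ h => ⟨h.1.symm, h.2.2, h.2.1⟩⟩
  loopless := ⟨fun _ h => G.loopless.irrefl _ h.1⟩

lemma delV_adj {G : SimpleGraph V} {U : Set V} {u v : V} :
    (delV G U).Adj u v ↔ G.Adj u v ∧ u ∉ U ∧ v ∉ U := Iff.rfl

lemma delV_le {G : SimpleGraph V} {U : Set V} : delV G U ≤ G := fun _ _ h => h.1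

/-- flows on `G` relative to `X` -/
def Zr (G : SimpleGraph V) (X : Set V) : Submodule ℂ (V → V → ℂ) where
  carrier := {z | (∀ u v, z u v = - z v u) ∧ (∀ u v, ¬ G.Adj u v → z u v = 0) ∧
    (∀ u ∈ X, ∀ v ∈ X, z u v = 0) ∧ ∀ v, v ∉ X → ∑ u, z v u = 0}
  add_mem' := by
    rintro z w ⟨h1, h2, h3, h4⟩ ⟨k1, k2, k3, k4⟩
    refine ⟨fun u v => ?_, fun u v h => ?_, fun u hu v hv => ?_, fun v hv => ?_⟩
    · simp only [Pi.add_apply]; rw [h1, k1]; ring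
    · simp [h2 u v h, k2 u v h]
    · simp [h3 u hu v hv, k3 u hu v hv]
    · simp [Finset.sum_add_distrib, h4 v hv, k4 v hv]
  zero_mem' := by simp
  smul_mem' := by
    rintro c z ⟨h1, h2, h3, h4⟩
    refine ⟨fun u v => ?_, fun u v h => ?_, fun u hu v hv => ?_, fun v hv => ?_⟩
    · simp only [Pi.smul_apply]; rw [h1]; simp
    · simp [h2 u v h]
    · simp [h3 u hu v hv]
    · simp [← Finset.mul_sum, h4 v hv]

lemma mem_Zr {G : SimpleGraph V} {X : Set V} {z : V → V → ℂ} :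
    z ∈ Zr G X ↔ (∀ u v, z u v = - z v u) ∧ (∀ u v, ¬ G.Adj u v → z u v = 0) ∧
    (∀ u ∈ X, ∀ v ∈ X, z u v = 0) ∧ ∀ v, v ∉ X → ∑ u, z v u = 0 := Iff.rfl

/-- the coordinate functional -/
def cf (u v : V) : (V → V → ℂ) →ₗ[ℂ] ℂ :=
  (LinearMap.proj v : (V → ℂ) →ₗ[ℂ] ℂ) ∘ₗ (LinearMap.proj u : (V → V → ℂ) →ₗ[ℂ] (V → ℂ))

@[simp] lemma cf_apply (u v : V) (z : V → V → ℂ) : cf u v z = z u v := rfl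

open Classical in
noncomputable def fa (n : V → V) (X : Set V) (u : V) : (V → V → ℂ) →ₗ[ℂ] ℂ :=
  if u ∈ X then 0 else cf u (n u)

lemma fa_mem {n : V → V} {X : Set V} {u : V} (h : u ∈ X) (z) : fa n X u z = 0 := by simp [fa, h]
lemma fa_notMem {n : V → V} {X : Set V} {u : V} (h : u ∉ X) (z) : fa n X u z = z u (n u) := by simp [fa, h]

/-- `n1 u`, `n2 u`, `n3 u` list all neighbours of `u` -/
def Nb (G : SimpleGraph V) (n : Fin 3 → V → V) : Prop :=
  ∀ u w, G.Adj u w → ∃ i, w = n i u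

lemma exists_Nb {G : SimpleGraph V} (h : Subcubic G) : ∃ n, Nb G n := by
  classical
  have key : ∀ u, ∃ f : Fin 3 → V, ∀ w, G.Adj u w → ∃ i, w = f i := by
    intro u
    by_cases hne : (G.neighborSet u).Nonempty
    · have hc : (G.neighborSet u).toFinset.card ≤ 3 := by
        have := h u
        rwa [Set.ncard_eq_toFinset_card'] at this
      obtain ⟨w0, hw0⟩ := hne
      have e := (G.neighborSet u).toFinset.equivFin
      refine ⟨fun i => if hi : i.1 < (G.neighborSet u).toFinset.card then (e.symm ⟨i.1, hi⟩).1 else w0, ?_⟩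
      intro w hw
      have hw' : w ∈ (G.neighborSet u).toFinset := by simpa using hw
      refine ⟨⟨(e ⟨w, hw'⟩).1, by have := (e ⟨w, hw'⟩).2; omega⟩, ?_⟩
      simp only []
      rw [dif_pos (e ⟨w, hw'⟩).2]
      simp
    · refine ⟨fun _ => u, fun w hw => ?_⟩
      exact absurd ⟨w, hw⟩ hne
  choose f hf using key
  exact ⟨fun i u => f u i, fun u w huw => hf u w huw⟩

/-- a row supported on three entries with zero sum -/
lemma row_zero {r : V → ℂ} {m0 m1 m2 : V} (hs : ∀ w, r w ≠ 0 → w = m0 ∨ w = m1 ∨ w = m2)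
    (hsum : ∑ w, r w = 0) (h0 : r m0 = 0) (h1 : r m1 = 0) : ∀ w, r w = 0 := by
  classical
  have h2 : ∀ w, w ≠ m2 → r w = 0 := by
    intro w hw
    by_contra hne
    rcases hs w hne with rfl | rfl | rfl <;> simp_all
  rw [Finset.sum_eq_single m2 (fun w _ hw => h2 w hw) (by simp)] at hsum
  intro w
  by_cases hw : w = m2
  · rw [hw, hsum]
  · exact h2 w hw

lemma row_minor {r r' : V → ℂ} {m0 m1 m2 : V} (hs : ∀ w, r w ≠ 0 → w = m0 ∨ w = m1 ∨ w = m2)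
    (hs' : ∀ w, r' w ≠ 0 → w = m0 ∨ w = m1 ∨ w = m2)
    (hsum : ∑ w, r w = 0) (hsum' : ∑ w, r' w = 0) (hm : r m0 * r' m1 - r m1 * r' m0 = 0)
    (v w : V) : r v * r' w - r w * r' v = 0 := by
  by_contra hne
  -- linear combination vanishing at m0, m1
  by_cases h00 : r m0 = 0 ∧ r m1 = 0
  · have := row_zero hs hsum h00.1 h00.2
    simp [this] at hne
  · have key : ∃ α β : ℂ, (α ≠ 0) ∧ (∀ y, α * r' y + β * r y = 0) := by
      by_cases h0 : r m0 = 0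
      · have h1 : r m1 ≠ 0 := fun h => h00 ⟨h0, h⟩
        refine ⟨r m1, - r' m1, h1, ?_⟩
        apply row_zero (m0 := m0) (m1 := m1) (m2 := m2)
        · intro w hw
          by_cases hr : r w = 0
          · apply hs'; intro h; simp [hr, h] at hw
          · exact hs w hr
        · rw [Finset.sum_add_distrib, ← Finset.mul_sum, ← Finset.mul_sum, hsum, hsum']; simp
        · linear_combination -hm
        · ring
      · refine ⟨r m0, - r' m0, h0, ?_⟩
        apply row_zero (m0 := m0) (m1 := m1) (m2 := m2)
        · intro w hw
          by_cases hr : r w = 0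
          · apply hs'; intro h; simp [hr, h] at hw
          · exact hs w hr
        · rw [Finset.sum_add_distrib, ← Finset.mul_sum, ← Finset.mul_sum, hsum, hsum']; simp
        · ring
        · linear_combination hm
    obtain ⟨α, β, hα, hy⟩ := key
    apply hne
    have e1 := hy v
    have e2 := hy w
    have : α * (r v * r' w - r w * r' v) = 0 := by linear_combination (r v) * e2 - (r w) * e1
    simpa [hα] using this

lemma Zr_supp {G : SimpleGraph V} {n : Fin 3 → V → V} (hn : Nb G n) {X : Set V} {z : V → V → ℂ} (hz : z ∈ Zr G X)
    (u : V) : ∀ w, z u w ≠ 0 → w = n 0 u ∨ w = n 1 u ∨ w = n 2 u := by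
  intro w hw
  have : G.Adj u w := by
    by_contra h; exact hw (hz.2.1 u w h)
  obtain ⟨i, hi⟩ := hn u w this
  fin_cases i <;> simp_all

lemma Zr_KU {G : SimpleGraph V} {n : Fin 3 → V → V} (hn : Nb G n) (X U : Set V) (hUX : ∀ u ∈ U, u ∉ X) :
    Zr G X ⊓ KU (fa (n 0) X) (fa (n 1) X) U = Zr (delV G U) X := by
  ext z
  constructor
  · rintro ⟨hz, hz'⟩
    rw [SetLike.mem_coe, mem_KU] at hz'
    have hrow : ∀ u ∈ U, ∀ w, z u w = 0 := by
      intro u hu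
      have := hz' u hu
      rw [fa_notMem (hUX u hu), fa_notMem (hUX u hu)] at this
      exact row_zero (Zr_supp hn hz u) (hz.2.2.2 u (hUX u hu)) this.1 this.2
    refine ⟨hz.1, ?_, hz.2.2.1, hz.2.2.2⟩
    intro u v huv
    by_cases h1 : G.Adj u v
    · by_cases h2 : u ∈ U
      · exact hrow u h2 v
      · by_cases h3 : v ∈ U
        · rw [hz.1, hrow v h3 u, neg_zero]
        · exact absurd ⟨h1, h2, h3⟩ huv
    · exact hz.2.1 u v h1
  · intro hz
    refine ⟨⟨hz.1, fun u v h => hz.2.1 u v (fun h' => h h'.1), hz.2.2.1, hz.2.2.2⟩, ?_⟩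
    rw [SetLike.mem_coe, mem_KU]
    intro u hu
    rw [fa_notMem (hUX u hu), fa_notMem (hUX u hu)]
    exact ⟨hz.2.1 _ _ (fun h => h.2.1 hu), hz.2.1 _ _ (fun h => h.2.1 hu)⟩

lemma Zr_delE {G : SimpleGraph V} (D : Set (Sym2 V)) (X : Set V) {z : V → V → ℂ} :
    z ∈ Zr (G.deleteEdges D) X ↔ z ∈ Zr G X ∧ ∀ u v, s(u, v) ∈ D → z u v = 0 := by
  constructor
  · intro hz
    refine ⟨⟨hz.1, fun u v h => hz.2.1 u v (fun h' => h (by simp at h'; exact h'.1)), hz.2.2.1, hz.2.2.2⟩, ?_⟩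
    intro u v huv
    apply hz.2.1
    simp [huv]
  · rintro ⟨hz, h⟩
    refine ⟨hz.1, fun u v h' => ?_, hz.2.2.1, hz.2.2.2⟩
    by_cases h1 : G.Adj u v
    · apply h; by_contra hc; exact h' (by simp [h1, hc])
    · exact hz.2.1 u v h1

lemma Zr_mono {G H : SimpleGraph V} (h : G ≤ H) (X : Set V) : Zr G X ≤ Zr H X := by
  intro z hz
  exact ⟨hz.1, fun u v h' => hz.2.1 u v (fun h'' => h' (h h'')), hz.2.2.1, hz.2.2.2⟩

open Classical in
/-- unit flow along a dart -/
noncomputable def unitF (u v : V) : V → V → ℂ := fun x y =>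
  (if x = u ∧ y = v then 1 else 0) - (if x = v ∧ y = u then 1 else 0)

open Classical in
/-- flow along a walk -/
noncomputable def wf {H : SimpleGraph V} : {u v : V} → H.Walk u v → V → V → ℂ
  | _, _, .nil => 0
  | u, _, .cons (v := v) _ p => unitF u v + wf p

lemma unitF_anti (u v x y : V) : unitF u v x y = - unitF u v y x := by
  classical
  simp only [unitF]
  have h1 : (x = u ∧ y = v) ↔ (y = v ∧ x = u) := and_comm
  have h2 : (x = v ∧ y = u) ↔ (y = u ∧ x = v) := and_comm
  rw [neg_sub]
  exact congrArg₂ _ (if_congr h1 rfl rfl) (if_congr h2 rfl rfl)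

open Classical in
lemma unitF_sum (u v x : V) : ∑ y, unitF u v x y = (if x = u then 1 else 0) - (if x = v then 1 else 0) := by
  simp only [unitF, Finset.sum_sub_distrib]
  congr 1
  · by_cases h : x = u <;> simp [h]
  · by_cases h : x = v <;> simp [h]

lemma wf_anti {H : SimpleGraph V} {u v : V} (p : H.Walk u v) (x y : V) : wf p x y = - wf p y x := by
  induction p with
  | nil => simp [wf]
  | cons h p ih => simp only [wf, Pi.add_apply]; rw [unitF_anti, ih]; ring

open Classical in
lemma wf_sum {H : SimpleGraph V} {u v : V} (p : H.Walk u v) (x : V) :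
    ∑ y, wf p x y = (if x = u then 1 else 0) - (if x = v then 1 else 0) := by
  induction p with
  | nil => simp [wf]
  | cons h p ih => simp only [wf, Pi.add_apply, Finset.sum_add_distrib]; rw [unitF_sum, ih]; ring

lemma unitF_zero {u v x y : V} (h : s(x, y) ≠ s(u, v)) : unitF u v x y = 0 := by
  simp [unitF]
  rw [if_neg, if_neg]; simp
  · rintro ⟨rfl, rfl⟩; exact h Sym2.eq_swap
  · rintro ⟨rfl, rfl⟩; exact h rfl

lemma wf_zero {H : SimpleGraph V} {u v : V} (p : H.Walk u v) {x y : V} (h : s(x, y) ∉ p.edges) : wf p x y = 0 := by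
  induction p with
  | nil => simp [wf]
  | cons h' p ih =>
    simp only [Walk.edges_cons, List.mem_cons, not_or] at h
    simp only [wf, Pi.add_apply]
    rw [unitF_zero h.1, ih h.2, add_zero]

lemma wf_zero' {H : SimpleGraph V} {u v : V} (p : H.Walk u v) {x y : V} (h : ¬ H.Adj x y) : wf p x y = 0 :=
  wf_zero p (fun h' => h (p.adj_of_mem_edges h'))

lemma unitF_self {u v : V} (h : u ≠ v) : unitF u v u v = 1 := by
  simp [unitF, h]

open Classical in
/-- zero out the `X`-`X` entries -/
noncomputable def resF (X : Set V) (z : V → V → ℂ) : V → V → ℂ := fun u v =>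
  if u ∈ X ∧ v ∈ X then 0 else z u v

lemma resF_in {X : Set V} {z : V → V → ℂ} {u v : V} (hu : u ∈ X) (hv : v ∈ X) : resF X z u v = 0 := by
  simp [resF, hu, hv]

lemma resF_out {X : Set V} {z : V → V → ℂ} {u v : V} (h : ¬ (u ∈ X ∧ v ∈ X)) : resF X z u v = z u v := by
  simp [resF, h]

lemma resF_anti {X : Set V} {z : V → V → ℂ} (h : ∀ u v, z u v = - z v u) (u v : V) :
    resF X z u v = - resF X z v u := by
  by_cases hh : u ∈ X ∧ v ∈ X
  · rw [resF_in hh.1 hh.2, resF_in hh.2 hh.1]; simp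
  · rw [resF_out hh, resF_out (fun h => hh ⟨h.2, h.1⟩)]; exact h u v

lemma resF_sum {X : Set V} {z : V → V → ℂ} {v : V} (hv : v ∉ X) : ∑ u, resF X z v u = ∑ u, z v u := by
  apply Finset.sum_congr rfl
  intro u _
  exact resF_out (fun h => hv h.1)

/-- enlarging X -/
lemma resF_mem {G : SimpleGraph V} {X Y : Set V} (hXY : X ⊆ Y) {z : V → V → ℂ} (hz : z ∈ Zr G X) :
    resF Y z ∈ Zr G Y := by
  refine ⟨resF_anti hz.1, fun u v h => ?_, fun u hu v hv => resF_in hu hv, fun v hv => ?_⟩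
  · by_cases hh : u ∈ Y ∧ v ∈ Y
    · exact resF_in hh.1 hh.2
    · rw [resF_out hh]; exact hz.2.1 u v h
  · rw [resF_sum hv]; exact hz.2.2.2 v (fun h => hv (hXY h))

open Classical in
/-- generic sum over a closed set -/
lemma sum_closed {z : V → V → ℂ} (ha : ∀ u v, z u v = - z v u) (D : Finset V)
    (hD : ∀ v ∈ D, ∑ u, z v u = 0) : ∑ v ∈ D, ∑ u ∈ Finset.univ.filter (fun u => u ∉ D), z v u = 0 := by
  classical
  have h1 : ∑ v ∈ D, ∑ u ∈ D, z v u = 0 := by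
    have : ∑ v ∈ D, ∑ u ∈ D, z v u = - ∑ v ∈ D, ∑ u ∈ D, z v u := by
      conv_lhs => rw [Finset.sum_comm]
      rw [← Finset.sum_neg_distrib]
      apply Finset.sum_congr rfl; intro v _
      rw [← Finset.sum_neg_distrib]
      apply Finset.sum_congr rfl; intro u _
      exact ha _ _
    have h2 : (2 : ℂ) * ∑ v ∈ D, ∑ u ∈ D, z v u = 0 := by linear_combination this
    simpa using h2
  have h2 : ∑ v ∈ D, ∑ u, z v u = 0 := Finset.sum_eq_zero hD
  have h3 : ∀ v, ∑ u, z v u = ∑ u ∈ D, z v u + ∑ u ∈ Finset.univ.filter (fun u => u ∉ D), z v u := by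
    intro v
    rw [← Finset.sum_filter_add_sum_filter_not Finset.univ (fun u => u ∈ D)]
    congr 1
    apply Finset.sum_congr _ (fun _ _ => rfl)
    ext; simp
  simp only [h3, Finset.sum_add_distrib, h1, zero_add] at h2
  exact h2

lemma path_lemma {H : SimpleGraph V} {X : Set V} {z : V → V → ℂ} (hz : z ∈ Zr H X) {p q : V}
    (hp : p ∈ X) (hq : q ∉ X) (hpq : z p q ≠ 0) :
    ∃ p' q', p' ∈ X ∧ q' ∉ X ∧ (p', q') ≠ (p, q) ∧ z p' q' ≠ 0 ∧ (delV H X).Reachable q q' := by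
  classical
  by_contra hcon
  push Not at hcon
  let D : Finset V := Finset.univ.filter (fun v => v ∉ X ∧ (delV H X).Reachable q v)
  have h1 := sum_closed hz.1 D (fun v hv => hz.2.2.2 v (by simp [D] at hv; exact hv.1))
  have hqD : q ∈ D := by simp [D, hq]
  have hz0 : ∀ v ∈ D, ∀ u, u ∉ D → (u, v) ≠ (p, q) → z v u = 0 := by
    intro v hv u hu hne
    simp [D] at hv hu
    by_cases huX : u ∈ X
    · by_contra h0
      have h0' : z u v ≠ 0 := by rw [hz.1]; simpa using h0
      exact hcon u v huX hv.1 hne h0' hv.2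
    · apply hz.2.1
      intro hadj
      exact hu huX (hv.2.trans (Adj.reachable ⟨hadj, hv.1, huX⟩))
  rw [Finset.sum_eq_single q, Finset.sum_eq_single p] at h1
  · rw [hz.1] at h1; exact hpq (by simpa using h1)
  · intro u hu hup
    exact hz0 q hqD u (by simpa using hu) (by simp [hup])
  · intro h; exact absurd hp (by simp [D] at h; exact (h.1 ))
  · intro v hv hvq
    apply Finset.sum_eq_zero
    intro u hu
    exact hz0 v hv u (by simpa using hu) (by simp [hvq])
  · intro h; exact absurd hqD h

lemma acyclic_Zr {H : SimpleGraph V} (h : H.IsAcyclic) : Zr H ∅ = ⊥ := by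
  classical
  rw [eq_bot_iff]
  intro z hz
  have : z = 0 := by
    funext u v
    by_cases huv : H.Adj u v
    · rw [isAcyclic_iff_forall_adj_isBridge] at h
      have hb := h huv
      rw [isBridge_iff] at hb
      let D : Finset V := Finset.univ.filter (fun w => (H.deleteEdges {s(u, v)}).Reachable u w)
      have h1 := sum_closed hz.1 D (fun v hv => hz.2.2.2 v (by simp))
      have huD : u ∈ D := by simp [D]
      have hvD : v ∉ D := by simpa [D] using hb
      have hz0 : ∀ x ∈ D, ∀ y, y ∉ D → (x, y) ≠ (u, v) → z x y = 0 := by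
        intro x hx y hy hne
        simp only [D, Finset.mem_filter, Finset.mem_univ, true_and] at hx hy
        apply hz.2.1
        intro hadj
        apply hy
        apply hx.trans
        apply Adj.reachable
        simp only [deleteEdges_adj, Set.mem_singleton_iff]
        refine ⟨hadj, fun he => ?_⟩
        rw [Sym2.eq_iff] at he
        rcases he with ⟨rfl, rfl⟩ | ⟨rfl, rfl⟩
        · exact absurd rfl hne
        · exact absurd hx (by simpa [D] using hvD)
      rw [Finset.sum_eq_single u, Finset.sum_eq_single v] at h1
      · simpa using h1
      · intro y hy hyv
        exact hz0 u huD y (by simpa using hy) (by simp [hyv])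
      · intro h; simp [hvD] at h
      · intro x hx hxu
        apply Finset.sum_eq_zero
        intro y hy
        exact hz0 x hx y (by simpa using hy) (by simp [hxu])
      · intro h; exact absurd huD h
    · exact hz.2.1 u v huv
  simp [this]

lemma cycle_wf {H : SimpleGraph V} {u : V} (c : H.Walk u u) : wf c ∈ Zr H ∅ := by
  refine ⟨wf_anti c, fun x y h => wf_zero' c h, by simp, fun v _ => ?_⟩
  rw [wf_sum]; simp

lemma wf_cycle_ne {H : SimpleGraph V} {u : V} (c : H.Walk u u) (hc : c.IsCycle) :
    ∃ v, H.Adj u v ∧ wf c u v ≠ 0 := by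
  cases c with
  | nil => simp at hc
  | cons h p =>
    rename_i v
    refine ⟨v, h, ?_⟩
    have h2 : s(u, v) ∉ p.edges := by
      have := hc.isTrail.edges_nodup
      simp at this
      exact this.1
    simp only [wf, Pi.add_apply]
    rw [wf_zero p h2, unitF_self h.ne]
    simp

lemma acyclic_of_Zr {H : SimpleGraph V} (h : Zr H ∅ = ⊥) : H.IsAcyclic := by
  intro u c hc
  obtain ⟨v, _, hv⟩ := wf_cycle_ne c hc
  have := cycle_wf c
  rw [h] at this
  have : wf c = 0 := by simpa using this
  rw [this] at hv
  simp at hv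

end flows

end part_P2

section part_P3
open Module
set_option linter.unusedSectionVars false
set_option linter.unusedVariables false

/-! ### Part 3: reduction to critical components -/

section rank
variable {E : Type*} [AddCommGroup E] [Module ℂ E] [FiniteDimensional ℂ E]
variable {ι : Type*} [Fintype ι] {a b : ι → E →ₗ[ℂ] ℂ}

noncomputable def rk (a b : ι → E →ₗ[ℂ] ℂ) (S : Submodule ℂ E) : ℕ :=
  sSup {k | ∃ T ≤ S, Good a b T ∧ finrank ℂ T = k}

lemma rk_bdd (S : Submodule ℂ E) : BddAbove {k | ∃ T ≤ S, Good a b T ∧ finrank ℂ T = k} := by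
  refine ⟨finrank ℂ S, ?_⟩
  rintro k ⟨T, hT, _, rfl⟩
  exact Submodule.finrank_mono hT

lemma rk_max {S T : Submodule ℂ E} (hT : T ≤ S) (h : Good a b T) : finrank ℂ T ≤ rk a b S :=
  le_csSup (rk_bdd S) ⟨T, hT, h, rfl⟩

lemma rk_spec (S : Submodule ℂ E) : ∃ T ≤ S, Good a b T ∧ finrank ℂ T = rk a b S := by
  have : rk a b S ∈ {k | ∃ T ≤ S, Good a b T ∧ finrank ℂ T = k} := by
    apply Nat.sSup_mem _ (rk_bdd S)
    refine ⟨0, ⊥, bot_le, ⟨0, ?_⟩, by simp⟩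
    intro z hz _; simpa using hz
  exact this

lemma rk_even (S : Submodule ℂ E) : Even (rk a b S) := by
  obtain ⟨T, _, h, h'⟩ := rk_spec (a := a) (b := b) S
  rw [← h']; exact (good_perfect h).1

lemma rk_mono {S S' : Submodule ℂ E} (h : S ≤ S') : rk a b S ≤ rk a b S' := by
  obtain ⟨T, hT, hg, h'⟩ := rk_spec (a := a) (b := b) S
  rw [← h']; exact rk_max (hT.trans h) hg

lemma rk_le (S : Submodule ℂ E) : rk a b S ≤ finrank ℂ S := by
  obtain ⟨T, hT, hg, h'⟩ := rk_spec (a := a) (b := b) S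
  rw [← h']; exact Submodule.finrank_mono hT

end rank

section main3
variable {V : Type} [Fintype V]

lemma greedy_D (W : Submodule ℂ (V → V → ℂ)) : ∃ D : Finset (V × V), D.card ≤ finrank ℂ W ∧
    ∀ w ∈ W, (∀ p ∈ D, w p.1 p.2 = 0) → w = 0 := by
  classical
  obtain ⟨m, hm⟩ : ∃ m, finrank ℂ W = m := ⟨_, rfl⟩
  induction m generalizing W with
  | zero =>
    refine ⟨∅, by simp, fun w hw _ => ?_⟩
    rw [Submodule.finrank_eq_zero] at hm
    rw [hm] at hw; simpa using hw
  | succ m ih =>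
    have : W ≠ ⊥ := by rintro rfl; simp at hm
    obtain ⟨w, hw, hne⟩ := W.ne_bot_iff.1 this
    have : ∃ u v, w u v ≠ 0 := by
      by_contra h; push Not at h; exact hne (by funext u v; exact h u v)
    obtain ⟨u, v, huv⟩ := this
    have h1 := finrank_ker (S := W) (cf u v) ⟨w, hw, huv⟩
    obtain ⟨D, hD, hD'⟩ := ih (W ⊓ LinearMap.ker (cf u v)) (by omega)
    refine ⟨insert (u, v) D, ?_, fun z hz h0 => ?_⟩
    · have := Finset.card_insert_le (u, v) D; omega
    · apply hD' z ⟨hz, ?_⟩ (fun p hp => h0 p (by simp [hp]))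
      exact h0 (u, v) (by simp)

lemma finrank_kerD (S : Submodule ℂ (V → V → ℂ)) (D : Finset (V × V)) :
    ∃ S1 : Submodule ℂ (V → V → ℂ), (∀ z, z ∈ S1 ↔ z ∈ S ∧ ∀ p ∈ D, z p.1 p.2 = 0) ∧
      finrank ℂ S ≤ finrank ℂ S1 + D.card := by
  classical
  induction D using Finset.induction_on with
  | empty => exact ⟨S, by simp, by simp⟩
  | insert p D hp ih =>
    obtain ⟨S1, h1, h2⟩ := ih
    refine ⟨S1 ⊓ LinearMap.ker (cf p.1 p.2), ?_, ?_⟩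
    · intro z
      rw [Submodule.mem_inf, h1, LinearMap.mem_ker, cf_apply]
      simp only [Finset.mem_insert, forall_eq_or_imp]
      tauto
    · have := finrank_ker_ge S1 (cf p.1 p.2)
      rw [Finset.card_insert_of_notMem hp]; omega

lemma fvs_le_of_delV {G : SimpleGraph V} {S : Set V} (h : (delV G S).IsAcyclic) : fvs G ≤ S.ncard := by
  apply Nat.sInf_le
  refine ⟨S, ?_, rfl⟩
  unfold IsFVS
  let f : G.induce Sᶜ →g delV G S := ⟨fun x => x.1, fun {x y} hxy => ⟨hxy, x.2, y.2⟩⟩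
  exact h.comap f Subtype.val_injective

lemma Nb_mono {G H : SimpleGraph V} (h : G ≤ H) {n} (hn : Nb H n) : Nb G n :=
  fun u w huw => hn u w (h huw)

lemma fvs_le_psi {G : SimpleGraph V} {n : Fin 3 → V → V} (hn : Nb G n) :
    2 * fvs G + rk (fa (n 0) ∅) (fa (n 1) ∅) (Zr G ∅) ≤ 2 * finrank ℂ (Zr G ∅) := by
  classical
  obtain ⟨T, hT, ⟨x, hx⟩, hr⟩ := rk_spec (a := fa (n 0) ∅) (b := fa (n 1) ∅) (Zr G ∅)
  obtain ⟨h1, h2, _⟩ := rad_max hT hx (fun T' hT' hg => hr ▸ rk_max hT' hg)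
  set S := Zr G ∅ with hS
  set W := rad (fa (n 0) ∅) (fa (n 1) ∅) x S with hW
  obtain ⟨D, hD, hD'⟩ := greedy_D W
  obtain ⟨S1, hS1, hS1'⟩ := finrank_kerD S D
  have hS1S : S1 ≤ S := fun z hz => ((hS1 z).1 hz).1
  have hWS : W ≤ S := fun z hz => (mem_rad.1 hz).1
  have hdim := Submodule.finrank_sup_add_finrank_inf_eq T W
  rw [h1, h2, finrank_bot] at hdim
  have hinf : S1 ⊓ W = ⊥ := by
    rw [eq_bot_iff]; rintro z ⟨hz1, hz2⟩
    have := hD' z hz2 ((hS1 z).1 hz1).2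
    simp [this]
  have hdim2 := Submodule.finrank_sup_add_finrank_inf_eq S1 W
  rw [hinf, finrank_bot] at hdim2
  have hle := Submodule.finrank_mono (sup_le hS1S hWS)
  have hsup : S1 ⊔ W = S := Submodule.eq_of_le_of_finrank_le (sup_le hS1S hWS) (by omega)
  rw [hsup] at hdim2
  have hgood : Good (fa (n 0) ∅) (fa (n 1) ∅) S1 := by
    refine ⟨x, fun z hz h0 => ?_⟩
    apply hD' z _ ((hS1 z).1 hz).2
    refine mem_rad.2 ⟨hS1S hz, fun z' hz' => ?_⟩
    rw [← hsup] at hz'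
    obtain ⟨s, hs, w, hw, rfl⟩ := Submodule.mem_sup.1 hz'
    rw [map_add, h0 s hs, Yf_anti, (mem_rad.1 hw).2 z (hS1S hz)]; simp
  obtain ⟨_, U, hU, hU'⟩ := good_perfect hgood
  have hfvs : fvs G ≤ (U ∪ D.image Prod.fst).card := by
    rw [← Set.ncard_coe_finset]
    apply fvs_le_of_delV
    apply acyclic_of_Zr
    rw [eq_bot_iff, ← hU']
    intro z hz
    have hz' : z ∈ S := Zr_mono delV_le _ hz
    refine ⟨(hS1 z).2 ⟨hz', fun p hp => ?_⟩, ?_⟩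
    · apply hz.2.1
      intro h
      exact h.2.1 (by simp; right; exact ⟨_, hp⟩)
    · rw [SetLike.mem_coe, mem_KU]
      intro u hu
      rw [fa_notMem (by simp), fa_notMem (by simp)]
      constructor <;> exact hz.2.1 _ _ (fun h => h.2.1 (by simp at hu ⊢; exact Or.inl hu))
  have := Finset.card_union_le U (D.image Prod.fst)
  have := Finset.card_image_le (s := D) (f := Prod.fst)
  omega

/-- a critical set -/
def Crit (G : SimpleGraph V) (n : Fin 3 → V → V) (C : Set V) (j : ℕ) : Prop :=
  finrank ℂ (Zr G Cᶜ) = 2 * j + 1 ∧ ∀ u v, u ∈ C → v ∈ C → G.Adj u v →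
    Good (fa (n 0) Cᶜ) (fa (n 1) Cᶜ) (Zr G Cᶜ ⊓ LinearMap.ker (cf u v))

open Classical in
/-- restriction of a flow to rows in `C` -/
noncomputable def rowR (C : Set V) : (V → V → ℂ) →ₗ[ℂ] (V → V → ℂ) where
  toFun z := fun u v => if u ∈ C then z u v else 0
  map_add' := by intro z w; funext u v; by_cases h : u ∈ C <;> simp [h]
  map_smul' := by intro c z; funext u v; by_cases h : u ∈ C <;> simp [h]

lemma rowR_in {C : Set V} {z : V → V → ℂ} {u v : V} (h : u ∈ C) : rowR C z u v = z u v := by simp [rowR, h]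
lemma rowR_out {C : Set V} {z : V → V → ℂ} {u v : V} (h : u ∉ C) : rowR C z u v = 0 := by simp [rowR, h]

/-- `C` is closed under adjacency. -/
def Closed (G : SimpleGraph V) (C : Set V) : Prop := ∀ u v, G.Adj u v → u ∈ C → v ∈ C

lemma closed_supp {G : SimpleGraph V} (c : G.ConnectedComponent) : Closed G c.supp := by
  intro u v h hu
  rw [ConnectedComponent.mem_supp_iff] at hu ⊢
  rw [← hu]
  exact ConnectedComponent.sound h.symm.reachable

lemma rowR_mem {G : SimpleGraph V} {C : Set V} (hC : Closed G C) {z : V → V → ℂ} (hz : z ∈ Zr G ∅) :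
    rowR C z ∈ Zr G Cᶜ := by
  refine ⟨fun u v => ?_, fun u v h => ?_, fun u hu v hv => rowR_out hu, fun v hv => ?_⟩
  · by_cases hu : u ∈ C <;> by_cases hv : v ∈ C
    · rw [rowR_in hu, rowR_in hv]; exact hz.1 u v
    · rw [rowR_in hu, rowR_out hv, hz.2.1 u v (fun h => hv (hC u v h hu))]; simp
    · rw [rowR_out hu, rowR_in hv, hz.2.1 v u (fun h => hu (hC v u h hv))]; simp
    · rw [rowR_out hu, rowR_out hv]; simp
  · by_cases hu : u ∈ C
    · rw [rowR_in hu]; exact hz.2.1 u v h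
    · exact rowR_out hu
  · simp only [Set.mem_compl_iff, not_not] at hv
    simp only [rowR_in hv]
    exact hz.2.2.2 v (by simp)

lemma ZrC_row {G : SimpleGraph V} {C : Set V} (hC : Closed G C) {z : V → V → ℂ} (hz : z ∈ Zr G Cᶜ)
    {u : V} (hu : u ∉ C) (v : V) : z u v = 0 := by
  by_cases hv : v ∈ C
  · exact hz.2.1 u v (fun h => hu (hC v u h.symm hv))
  · exact hz.2.2.1 u hu v hv

lemma ZrC_le {G : SimpleGraph V} {C : Set V} (hC : Closed G C) : Zr G Cᶜ ≤ Zr G ∅ := by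
  intro z hz
  refine ⟨hz.1, hz.2.1, by simp, fun v _ => ?_⟩
  by_cases hv : v ∈ C
  · exact hz.2.2.2 v (by simpa using hv)
  · exact Finset.sum_eq_zero (fun u _ => ZrC_row hC hz hv u)

lemma rowR_ZrC {G : SimpleGraph V} {C : Set V} (hC : Closed G C) {z : V → V → ℂ} (hz : z ∈ Zr G Cᶜ) :
    rowR C z = z := by
  funext u v
  by_cases hu : u ∈ C
  · rw [rowR_in hu]
  · rw [rowR_out hu, ZrC_row hC hz hu]

lemma fa_empty {n : V → V} {u : V} (z) : fa n ∅ u z = z u (n u) := fa_notMem (by simp) z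

lemma Yf_row {n : Fin 3 → V → V} {C : Set V} {z z' : V → V → ℂ} (x : V → ℂ) :
    Yf (fa (n 0) ∅) (fa (n 1) ∅) x (rowR C z) z' = Yf (fa (n 0) ∅) (fa (n 1) ∅) x z (rowR C z') := by
  rw [Yf_apply, Yf_apply]
  apply Finset.sum_congr rfl
  intro u _
  simp only [fa_empty]
  by_cases hu : u ∈ C
  · simp only [rowR_in hu]
  · simp only [rowR_out hu]; ring

lemma Yf_C {n : Fin 3 → V → V} {G : SimpleGraph V} {C : Set V} (hC : Closed G C) {z z' : V → V → ℂ} (x : V → ℂ)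
    (hz : z ∈ Zr G Cᶜ) :
    Yf (fa (n 0) Cᶜ) (fa (n 1) Cᶜ) x z z' = Yf (fa (n 0) ∅) (fa (n 1) ∅) x z z' := by
  rw [Yf_apply, Yf_apply]
  apply Finset.sum_congr rfl
  intro u _
  by_cases hu : u ∈ C
  · simp only [fa_empty, fa_notMem (X := Cᶜ) (by simpa using hu : u ∉ Cᶜ)]
  · simp only [fa_empty, fa_mem (X := Cᶜ) (by simpa using hu : u ∈ Cᶜ), ZrC_row hC hz hu]; ring

theorem crit_decomp {G : SimpleGraph V} {n : Fin 3 → V → V} (hn : Nb G n) :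
    ∃ G' ≤ G, ∃ m : G'.ConnectedComponent → ℕ, fvs G ≤ ∑ᶠ c, m c ∧
      ∀ c, m c = 0 ∨ ∃ j, m c = j + 1 ∧ Crit G' n c.supp j := by
  classical
  set a := fa (V := V) (n 0) ∅ with ha
  set b := fa (V := V) (n 1) ∅ with hb
  set ψ : SimpleGraph V → ℕ := fun H => 2 * finrank ℂ (Zr H ∅) - rk a b (Zr H ∅) with hψ
  -- choose the subgraph
  have hex : ∃ k, ∃ H ≤ G, ψ G ≤ ψ H ∧ H.edgeSet.ncard = k := ⟨_, G, le_rfl, le_rfl, rfl⟩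
  obtain ⟨H, hHG, hψH, hHk⟩ := Nat.find_spec hex
  have hmin : ∀ H' ≤ G, ψ G ≤ ψ H' → H.edgeSet.ncard ≤ H'.edgeSet.ncard := by
    intro H' h1 h2
    rw [hHk]; exact Nat.find_min' hex ⟨H', h1, h2, rfl⟩
  have hnH : Nb H n := Nb_mono hHG hn
  set S := Zr H ∅ with hS
  have hrkS := rk_le (a := a) (b := b) S
  -- every edge
  have hedge : ∀ u v, H.Adj u v → (∃ z ∈ S, z u v ≠ 0) ∧
      rk a b (S ⊓ LinearMap.ker (cf u v)) = rk a b S := by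
    intro u v huv
    set H' := H.deleteEdges {s(u, v)} with hH'
    have hle : H' ≤ H := deleteEdges_le _
    have hZ : Zr H' ∅ = S ⊓ LinearMap.ker (cf u v) := by
      ext z
      rw [hH', Zr_delE, Submodule.mem_inf, LinearMap.mem_ker, cf_apply]
      refine and_congr_right (fun hz => ⟨fun h => h u v (by simp), fun h x y hxy => ?_⟩)
      simp only [Set.mem_singleton_iff, Sym2.eq_iff] at hxy
      rcases hxy with ⟨rfl, rfl⟩ | ⟨rfl, rfl⟩
      · exact h
      · rw [hz.1, h, neg_zero]
    have hlt : H'.edgeSet.ncard < H.edgeSet.ncard := by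
      apply Set.ncard_lt_ncard _ (Set.toFinite _)
      refine ⟨edgeSet_subset_edgeSet.2 hle, fun h => ?_⟩
      have : s(u, v) ∈ H'.edgeSet := h huv
      simp [hH'] at this
    have hψ' : ψ H' < ψ G := by
      by_contra hcon
      push Not at hcon
      have := hmin H' (hle.trans hHG) hcon
      omega
    have hne : ∃ z ∈ S, z u v ≠ 0 := by
      by_contra hcon
      push Not at hcon
      have : Zr H' ∅ = S := by
        rw [hZ]; apply inf_eq_left.2; intro z hz; exact hcon z hz
      have : ψ H' = ψ H := by simp only [hψ]; rw [this]
      omega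
    refine ⟨hne, ?_⟩
    have h1 := finrank_ker (S := S) (cf u v) hne
    have h2 := rk_mono (a := a) (b := b) (inf_le_left : S ⊓ LinearMap.ker (cf u v) ≤ S)
    have h3 := rk_le (a := a) (b := b) (S ⊓ LinearMap.ker (cf u v))
    obtain ⟨k1, hk1⟩ := rk_even (a := a) (b := b) S
    obtain ⟨k2, hk2⟩ := rk_even (a := a) (b := b) (S ⊓ LinearMap.ker (cf u v))
    have h4 : ψ H' < ψ H := by omega
    simp only [hψ] at h4
    rw [hZ, ← hS] at h4
    omega
  -- common x
  have hTe : ∀ p : V × V, ∃ T, H.Adj p.1 p.2 → (T ≤ S ⊓ LinearMap.ker (cf p.1 p.2) ∧ Good a b T ∧ finrank ℂ T = rk a b S) := by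
    intro p
    by_cases hp : H.Adj p.1 p.2
    · obtain ⟨T, h1, h2, h3⟩ := rk_spec (a := a) (b := b) (S ⊓ LinearMap.ker (cf p.1 p.2))
      exact ⟨T, fun _ => ⟨h1, h2, h3.trans (hedge _ _ hp).2⟩⟩
    · exact ⟨⊥, fun h => absurd h hp⟩
  choose T hT using hTe
  obtain ⟨x, hx⟩ := nd_family (a := a) (b := b) (Finset.univ.filter (fun p : V × V => H.Adj p.1 p.2)) T
    (fun p hp => (hT p (by simpa using hp)).2.1)
  set W := rad a b x S with hW
  have hrad : ∀ u v, H.Adj u v → T (u, v) ⊓ W = ⊥ ∧ T (u, v) ⊔ W = S ∧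
      ∀ i, ∀ z ∈ W, ∀ z' ∈ W, a i z * b i z' - b i z * a i z' = 0 := by
    intro u v huv
    have h1 := hT (u, v) huv
    apply rad_max (h1.1.trans inf_le_left) (hx (u, v) (by simpa using huv))
    intro T' hT' hg
    rw [h1.2.2]; exact rk_max hT' hg
  have hWS : W ≤ S := fun z hz => (mem_rad.1 hz).1
  have hWne : ∀ u v, H.Adj u v → ∃ w ∈ W, w u v ≠ 0 := by
    intro u v huv
    by_contra hcon
    push Not at hcon
    obtain ⟨z, hz, hne⟩ := (hedge u v huv).1
    rw [← (hrad u v huv).2.1] at hz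
    obtain ⟨t, ht, w, hw, rfl⟩ := Submodule.mem_sup.1 hz
    apply hne
    have h1 : t u v = 0 := ((hT (u, v) huv).1 ht).2
    simp [h1, hcon w hw]
  have hrow : ∀ u, ∀ w ∈ W, ∀ w' ∈ W, ∀ y y', w u y * w' u y' - w u y' * w' u y = 0 := by
    intro u w hw w' hw' y y'
    by_cases hy : ∃ v, H.Adj u v
    · obtain ⟨v, huv⟩ := hy
      have := (hrad u v huv).2.2 u w hw w' hw'
      rw [ha, hb, fa_notMem (by simp), fa_notMem (by simp), fa_notMem (by simp), fa_notMem (by simp)] at this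
      exact row_minor (Zr_supp hnH (hWS hw) u) (Zr_supp hnH (hWS hw') u) ((hWS hw).2.2.2 u (by simp))
        ((hWS hw').2.2.2 u (by simp)) this y y'
    · push Not at hy
      rw [(hWS hw).2.1 u y (hy y), (hWS hw).2.1 u y' (hy y')]; ring
  have hrow0 : ∀ u v, H.Adj u v → ∀ w ∈ W, w u v = 0 → ∀ y, w u y = 0 := by
    intro u v huv w hw h0 y
    obtain ⟨w', hw', hne⟩ := hWne u v huv
    have := hrow u w hw w' hw' y v
    rw [h0, zero_mul, sub_zero] at this
    exact (mul_eq_zero.1 this).resolve_right hne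
  have hprop : ∀ w ∈ W, ∀ u v, H.Reachable u v → (∀ y, w u y = 0) → ∀ y, w v y = 0 := by
    intro w hw u v ⟨p⟩ h0
    induction p with
    | nil => exact h0
    | cons h p ih =>
      apply ih
      apply hrow0 _ _ h.symm w hw
      rw [(hWS hw).1, h0, neg_zero]
  -- components
  have hres : ∀ c : H.ConnectedComponent, ∀ w ∈ W, rowR c.supp w ∈ W := by
    intro c w hw
    have h1 := ZrC_le (closed_supp c) (rowR_mem (closed_supp c) (hWS hw))
    refine mem_rad.2 ⟨h1, fun z' hz' => ?_⟩
    rw [ha, hb, Yf_row]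
    exact (mem_rad.1 hw).2 _ (ZrC_le (closed_supp c) (rowR_mem (closed_supp c) hz'))
  have hinj : ∀ c : H.ConnectedComponent, ∀ u v, H.Adj u v → u ∈ c.supp → ∀ w ∈ W ⊓ Zr H c.suppᶜ, w u v = 0 → w = 0 := by
    intro c u v huv hu w hw h0
    have h1 := hrow0 u v huv w hw.1 h0
    funext y y'
    by_cases hy : y ∈ c.supp
    · refine hprop w hw.1 u y ?_ h1 y'
      rw [ConnectedComponent.mem_supp_iff] at hu hy
      exact ConnectedComponent.exact (hu.trans hy.symm)
    · exact ZrC_row (closed_supp c) hw.2 hy y'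
  have hcrit : ∀ c : H.ConnectedComponent, (∃ u v, H.Adj u v ∧ u ∈ c.supp) →
      (∃ j, Crit H n c.supp j) ∧ finrank ℂ (W ⊓ Zr H c.suppᶜ : Submodule ℂ (V → V → ℂ)) ≤ 1 := by
    intro c ⟨u0, v0, huv0, hu0⟩
    have hC := closed_supp c
    have hgood : ∀ u v, u ∈ c.supp → H.Adj u v →
        Good (fa (n 0) c.suppᶜ) (fa (n 1) c.suppᶜ) (Zr H c.suppᶜ ⊓ LinearMap.ker (cf u v)) := by
      intro u v hu huv
      refine ⟨x, fun z hz h0 => ?_⟩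
      apply hinj c u v huv hu z ⟨?_, hz.1⟩ hz.2
      refine mem_rad.2 ⟨ZrC_le hC hz.1, fun z' hz' => ?_⟩
      have e1 : Yf a b x z z' = Yf a b x z (rowR c.supp z') := by
        rw [ha, hb, ← Yf_row, rowR_ZrC hC hz.1]
      rw [e1]
      set y := rowR c.supp z' with hy
      have hyC : y ∈ Zr H c.suppᶜ := rowR_mem hC hz'
      obtain ⟨w, hw, hne⟩ := hWne u v huv
      set w1 := rowR c.supp w with hw1
      have hw1C : w1 ∈ Zr H c.suppᶜ := rowR_mem hC (hWS hw)
      have hw1W := hres c w hw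
      have hw1ne : w1 u v ≠ 0 := by rw [hw1, rowR_in hu]; exact hne
      have h2 := h0 (y - (y u v / w1 u v) • w1) ⟨Submodule.sub_mem _ hyC (Submodule.smul_mem _ _ hw1C), by
        simp [hw1ne]⟩
      rw [Yf_C hC x hz.1] at h2
      have h3 : Yf a b x z w1 = 0 := by
        rw [Yf_anti, (mem_rad.1 hw1W).2 z (ZrC_le hC hz.1), neg_zero]
      rw [map_sub, map_smul, ← ha, ← hb, h3] at h2
      simpa using h2
    refine ⟨?_, ?_⟩
    · obtain ⟨⟨j, hj⟩, -⟩ := good_perfect (hgood u0 v0 hu0 huv0)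
      obtain ⟨w, hw, hne⟩ := hWne u0 v0 huv0
      have := finrank_ker (S := Zr H c.suppᶜ) (cf u0 v0) ⟨rowR c.supp w, rowR_mem hC (hWS hw), by
        rw [cf_apply, rowR_in hu0]; exact hne⟩
      refine ⟨j, by omega, fun u v hu _ huv => hgood u v hu huv⟩
    · have := finrank_ker_ge (W ⊓ Zr H c.suppᶜ) (cf u0 v0)
      have h2 : W ⊓ Zr H c.suppᶜ ⊓ LinearMap.ker (cf u0 v0) = ⊥ := by
        rw [eq_bot_iff]; rintro z ⟨hz1, hz2⟩
        simpa using hinj c u0 v0 huv0 hu0 z hz1 hz2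
      rw [h2, finrank_bot] at this
      omega
  -- dims
  have hbound : ∀ S' ≤ S, (∀ c : H.ConnectedComponent, ∀ z ∈ S', rowR c.supp z ∈ S') →
      finrank ℂ S' ≤ ∑ c : H.ConnectedComponent, finrank ℂ (S' ⊓ Zr H c.suppᶜ : Submodule ℂ (V → V → ℂ)) := by
    intro S' hS' hr
    rw [← Module.finrank_pi_fintype]
    let f : S' →ₗ[ℂ] ((c : H.ConnectedComponent) → (S' ⊓ Zr H c.suppᶜ : Submodule ℂ (V → V → ℂ))) :=
      LinearMap.pi (fun c => LinearMap.codRestrict _ (rowR c.supp ∘ₗ S'.subtype)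
        (fun z => ⟨hr c z z.2, rowR_mem (closed_supp c) (hS' z.2)⟩))
    apply LinearMap.finrank_le_finrank_of_injective (f := f)
    rw [injective_iff_map_eq_zero]
    intro z hz
    ext u v
    have := congrArg (fun g => ((g (H.connectedComponentMk u)) : V → V → ℂ) u v) hz
    have h2 : rowR (H.connectedComponentMk u).supp z u v = 0 := this
    rw [rowR_in (by simp)] at h2
    exact h2
  have hb1 := hbound S le_rfl (fun c z hz => ZrC_le (closed_supp c) (rowR_mem (closed_supp c) hz))
  have hb2 := hbound W hWS hres
  have hSC : ∀ c : H.ConnectedComponent, S ⊓ Zr H c.suppᶜ = Zr H c.suppᶜ := fun c =>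
    inf_eq_right.2 (ZrC_le (closed_supp c))
  have hchoice : ∀ c : H.ConnectedComponent, ∃ m : ℕ, (finrank ℂ (S ⊓ Zr H c.suppᶜ : Submodule ℂ (V → V → ℂ)) +
      finrank ℂ (W ⊓ Zr H c.suppᶜ : Submodule ℂ (V → V → ℂ)) ≤ 2 * m) ∧ (m = 0 ∨ ∃ j, m = j + 1 ∧ Crit H n c.supp j) := by
    intro c
    by_cases hc : ∃ u v, H.Adj u v ∧ u ∈ c.supp
    · obtain ⟨⟨j, hj⟩, h2⟩ := hcrit c hc
      refine ⟨j + 1, ?_, Or.inr ⟨j, rfl, hj⟩⟩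
      rw [hSC, hj.1]; omega
    · push Not at hc
      have h0 : Zr H c.suppᶜ = ⊥ := by
        rw [eq_bot_iff]; intro z hz
        have : z = 0 := by
          funext u v
          by_cases hu : u ∈ c.supp
          · exact hz.2.1 u v (fun h => hc u v h hu)
          · exact ZrC_row (closed_supp c) hz hu v
        simp [this]
      refine ⟨0, ?_, Or.inl rfl⟩
      rw [h0]; simp
  choose m hm hm' using hchoice
  refine ⟨H, hHG, m, ?_, hm'⟩
  rw [finsum_eq_sum_of_fintype]
  have hsum := Finset.sum_le_sum (fun c (_ : c ∈ (Finset.univ : Finset H.ConnectedComponent)) => hm c)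
  rw [Finset.sum_add_distrib, ← Finset.mul_sum] at hsum
  have hpsi := fvs_le_psi hn
  rw [← ha, ← hb] at hpsi
  have hψG : 2 * fvs G ≤ ψ G := by simp only [hψ]; omega
  have hψH2 : ψ H = 2 * finrank ℂ S - rk a b S := rfl
  by_cases hE : ∃ u v, H.Adj u v
  · obtain ⟨u, v, huv⟩ := hE
    have hdim := Submodule.finrank_sup_add_finrank_inf_eq (T (u, v)) W
    rw [(hrad u v huv).1, (hrad u v huv).2.1, finrank_bot, (hT (u, v) huv).2.2] at hdim
    omega
  · push Not at hE
    have : S = ⊥ := by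
      rw [eq_bot_iff]; intro z hz
      have : z = 0 := by
        funext u v
        exact hz.2.1 u v (hE u v)
      simp [this]
    have : finrank ℂ S = 0 := by rw [this]; simp
    omega

end main3

end part_P3

section part_Q1
set_option linter.unusedSectionVars false
set_option linter.unusedVariables false

/-! ### Combinatorics of the families `MemF` -/

section memF

@[simp] lemma subd_ss {V : Type} {H : SimpleGraph V} {x y u v : V} :
    (subdivide H x y).Adj (some u) (some v) ↔ H.Adj u v ∧ s(u, v) ≠ s(x, y) := by
  simp only [subdivide, fromRel_adj]
  constructor
  · rintro ⟨_, h | h⟩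
    · exact h
    · exact ⟨h.1.symm, by rw [Sym2.eq_swap]; exact h.2⟩
  · intro h
    exact ⟨by simpa using h.1.ne, Or.inl h⟩

@[simp] lemma subd_sn {V : Type} {H : SimpleGraph V} {x y u : V} :
    (subdivide H x y).Adj (some u) none ↔ u = x ∨ u = y := by
  simp [subdivide, fromRel_adj]

@[simp] lemma subd_ns {V : Type} {H : SimpleGraph V} {x y u : V} :
    (subdivide H x y).Adj none (some u) ↔ u = x ∨ u = y := by
  simp [subdivide, fromRel_adj]

@[simp] lemma subd_nn {V : Type} {H : SimpleGraph V} {x y : V} :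
    ¬ (subdivide H x y).Adj none none := SimpleGraph.irrefl _

@[simp] lemma apex_ss {V : Type} {H : SimpleGraph V} {S : Set V} {u v : V} :
    (addApex H S).Adj (some u) (some v) ↔ H.Adj u v := by
  simp only [addApex, fromRel_adj]
  constructor
  · rintro ⟨_, h | h⟩
    · exact h
    · exact h.symm
  · intro h
    exact ⟨by simpa using h.ne, Or.inl h⟩

@[simp] lemma apex_sn {V : Type} {H : SimpleGraph V} {S : Set V} {u : V} :
    (addApex H S).Adj (some u) none ↔ u ∈ S := by
  simp [addApex, fromRel_adj]

@[simp] lemma apex_ns {V : Type} {H : SimpleGraph V} {S : Set V} {u : V} :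
    (addApex H S).Adj none (some u) ↔ u ∈ S := by
  simp [addApex, fromRel_adj]

@[simp] lemma apex_nn {V : Type} {H : SimpleGraph V} {S : Set V} :
    ¬ (addApex H S).Adj none none := SimpleGraph.irrefl _

lemma subd_symm {V : Type} (H : SimpleGraph V) (x y : V) : subdivide H x y = subdivide H y x := by
  ext p q
  rcases p with _ | u <;> rcases q with _ | v
  · simp
  · simp [or_comm]
  · simp [or_comm]
  · simp [Sym2.eq_swap (a := x)]

/-- isomorphic graphs have isomorphic subdivisions -/
def subdIso {V W : Type} {G : SimpleGraph V} {H : SimpleGraph W} (e : G ≃g H) (x y : V) :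
    subdivide G x y ≃g subdivide H (e x) (e y) where
  toEquiv := Equiv.optionCongr e.toEquiv
  map_rel_iff' := by
    rintro (_ | u) (_ | v)
    · simp
    · simp
    · simp
    · simp only [Equiv.optionCongr_apply, Option.map_some, subd_ss]
      have : s(e u, e v) = s(e x, e y) ↔ s(u, v) = s(x, y) := by
        simp [Sym2.eq_iff]
      simp only [RelIso.coe_fn_toEquiv, ne_eq, this, e.map_adj_iff]

def apexIso {V W : Type} {G : SimpleGraph V} {H : SimpleGraph W} (e : G ≃g H) (S : Set V) (S' : Set W)
    (hS : ∀ v, v ∈ S ↔ e v ∈ S') :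
    addApex G S ≃g addApex H S' where
  toEquiv := Equiv.optionCongr e.toEquiv
  map_rel_iff' := by
    rintro (_ | u) (_ | v)
    · simp
    · simp [hS]
    · simp [hS]
    · simp [e.map_adj_iff]

lemma MemF.iso {i j : ℕ} {V W : Type} {G : SimpleGraph V} {H : SimpleGraph W} (h : MemF i j G)
    (e : H ≃g G) : MemF i j H := by
  cases h with
  | cycle hi h => exact .cycle hi (h.map (fun f => e.trans f))
  | k4 h => exact .k4 (h.map (fun f => e.trans f))
  | circ hj hH hxy he1 he2 hG =>
    refine .circ hj hH hxy he1 he2 ?_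
    rcases hG with ⟨h1, x1, y1, x2, y2, h2, h3, h4⟩ | ⟨h1, x1, y1, h2, h4⟩
    · exact Or.inl ⟨h1, x1, y1, x2, y2, h2, h3, h4.map (fun f => e.trans f)⟩
    · exact Or.inr ⟨h1, x1, y1, h2, h4.map (fun f => e.trans f)⟩
  | subd hj hH hxy hG => exact .subd hj hH hxy (hG.map (fun f => e.trans f))

lemma MemF.finite {i j : ℕ} {V : Type} {G : SimpleGraph V} (h : MemF i j G) : Finite V := by
  induction h with
  | cycle hi h =>
    rename_i i V G
    obtain ⟨e⟩ := h
    haveI : NeZero i := ⟨by omega⟩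
    exact Finite.of_equiv _ e.toEquiv.symm
  | k4 h => obtain ⟨e⟩ := h; exact Finite.of_equiv _ e.toEquiv.symm
  | circ hj hH hxy he1 he2 hG ih =>
    rcases hG with ⟨h1, x1, y1, x2, y2, h2, h3, ⟨e⟩⟩ | ⟨h1, x1, y1, h2, ⟨e⟩⟩
    · exact Finite.of_equiv _ e.toEquiv.symm
    · exact Finite.of_equiv _ e.toEquiv.symm
  | subd hj hH hxy hG ih => obtain ⟨e⟩ := hG; exact Finite.of_equiv _ e.toEquiv.symm

/-- the degree used here -/
noncomputable def dg {V : Type} (G : SimpleGraph V) (v : V) : ℕ := (G.neighborSet v).ncard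

lemma dg_iso {V W : Type} {G : SimpleGraph V} {H : SimpleGraph W} (e : G ≃g H) (v : V) :
    dg H (e v) = dg G v := by
  unfold dg
  rw [← Set.ncard_image_of_injective _ e.injective]
  congr 1
  ext w
  simp only [mem_neighborSet, Set.mem_image]
  constructor
  · intro h
    refine ⟨e.symm w, ?_, by simp⟩
    rw [← e.map_adj_iff]; simpa using h
  · rintro ⟨u, hu, rfl⟩
    exact e.map_adj_iff.2 hu

lemma dg_subd_none {V : Type} {H : SimpleGraph V} {x y : V} (h : H.Adj x y) : dg (subdivide H x y) none = 2 := by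
  unfold dg
  have : (subdivide H x y).neighborSet none = {some x, some y} := by
    ext p; rcases p with _ | u <;> simp
  rw [this]
  exact Set.ncard_pair (by simpa using h.ne)

lemma dg_subd_some {V : Type} [Finite V] {H : SimpleGraph V} {x y : V} (h : H.Adj x y) (u : V) :
    dg (subdivide H x y) (some u) = dg H u := by
  classical
  unfold dg
  -- bijection v ↦ if s(u,v)=s(x,y) then none else some v
  symm
  apply Set.ncard_congr (fun v _ => if s(u, v) = s(x, y) then none else some v)
  · intro v hv
    simp only [mem_neighborSet] at hv ⊢
    split_ifs with hh
    · rw [subd_sn]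
      rw [Sym2.eq_iff] at hh; tauto
    · rw [subd_ss]; exact ⟨hv, hh⟩
  · intro v w hv hw
    split_ifs with h1 h2 h2
    · intro _
      exact Sym2.congr_right.1 (h1.trans h2.symm)
    · simp
    · simp
    · simp
  · intro p hp
    rcases p with _ | v
    · simp only [mem_neighborSet, subd_sn] at hp
      rcases hp with rfl | rfl
      · exact ⟨y, h, by simp⟩
      · exact ⟨x, h.symm, by simp [Sym2.eq_swap]⟩
    · simp only [mem_neighborSet, subd_ss] at hp
      exact ⟨v, hp.1, by simp [hp.2]⟩

lemma dg_apex_none {V : Type} {H : SimpleGraph V} {S : Set V} : dg (addApex H S) none = S.ncard := by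
  unfold dg
  have : (addApex H S).neighborSet none = some '' S := by
    ext p; rcases p with _ | u <;> simp
  rw [this, Set.ncard_image_of_injective _ (Option.some_injective _)]

lemma dg_apex_notMem {V : Type} {H : SimpleGraph V} {S : Set V} {u : V} (h : u ∉ S) :
    dg (addApex H S) (some u) = dg H u := by
  unfold dg
  have : (addApex H S).neighborSet (some u) = some '' (H.neighborSet u) := by
    ext p; rcases p with _ | v <;> simp [h]
  rw [this, Set.ncard_image_of_injective _ (Option.some_injective _)]

lemma dg_apex_mem {V : Type} [Finite V] {H : SimpleGraph V} {S : Set V} {u : V} (h : u ∈ S) :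
    dg (addApex H S) (some u) = dg H u + 1 := by
  unfold dg
  have : (addApex H S).neighborSet (some u) = insert none (some '' (H.neighborSet u)) := by
    ext p; rcases p with _ | v <;> simp [h]
  rw [this, Set.ncard_insert_of_notMem (by simp), Set.ncard_image_of_injective _ (Option.some_injective _)]

lemma dg_circ {V W : Type} [Finite V] {H : SimpleGraph V} (hH : ∀ v, dg H v = 3) {x y : V} (hxy : H.Adj x y)
    {e1 e2 : Sym2 (Option V)} (he1 : e1 ∈ (subdivide H x y).edgeSet)
    (he2 : e2 ∈ (subdivide H x y).edgeSet) {G : SimpleGraph W}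
    (hG : IsCircOp (subdivide H x y) e1 e2 none G) (v : W) : dg G v = 3 := by
  have key : ∀ (K : SimpleGraph (Option (Option (Option V)))), (dg K none = 2) → (dg K (some none) = 2) →
      (dg K (some (some none)) = 2) → (∀ u, dg K (some (some (some u))) = 3) →
      ∀ w, dg (addApex K {some (some none), some none, none}) w = 3 := by
    intro K h1 h2 h3 h4 w
    rcases w with _ | _ | _ | _ | w
    · rw [dg_apex_none, Set.ncard_eq_three]
      exact ⟨_, _, _, by simp, by simp, by simp, rfl⟩
    · rw [dg_apex_mem (by simp), h1]
    · rw [dg_apex_mem (by simp), h2]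
    · rw [dg_apex_mem (by simp), h3]
    · rw [dg_apex_notMem (by simp), h4]
  rcases hG with ⟨h1, x1, y1, x2, y2, rfl, rfl, ⟨e⟩⟩ | ⟨h1, x1, y1, rfl, ⟨e⟩⟩
  · rw [← dg_iso e]
    have a1 : (subdivide H x y).Adj x1 y1 := he1
    have a2 : (subdivide (subdivide H x y) x1 y1).Adj (some x2) (some y2) := by
      rw [subd_ss]; exact ⟨he2, h1.symm⟩
    apply key
    · exact dg_subd_none a2
    · rw [dg_subd_some a2, dg_subd_none a1]
    · rw [dg_subd_some a2, dg_subd_some a1, dg_subd_none hxy]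
    · intro u; rw [dg_subd_some a2, dg_subd_some a1, dg_subd_some hxy, hH]
  · rw [← dg_iso e]
    have a1 : (subdivide H x y).Adj x1 y1 := he1
    have a2 : (subdivide (subdivide H x y) x1 y1).Adj none (some y1) := by
      rw [subd_ns]; exact Or.inr rfl
    apply key
    · exact dg_subd_none a2
    · rw [dg_subd_some a2, dg_subd_none a1]
    · rw [dg_subd_some a2, dg_subd_some a1, dg_subd_none hxy]
    · intro u; rw [dg_subd_some a2, dg_subd_some a1, dg_subd_some hxy, hH]

lemma MemF.le {i j : ℕ} {V : Type} {G : SimpleGraph V} (h : MemF i j G) : j ≤ i ∧ 1 ≤ i := by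
  induction h with
  | cycle hi h => omega
  | k4 h => omega
  | circ hj hH hxy he1 he2 hG ih => omega
  | subd hj hH hxy hG ih => omega

lemma cyc_adj {n : ℕ} (u v : ZMod n) : (cyc n).Adj u v ↔ u ≠ v ∧ (v = u + 1 ∨ u = v + 1) := by
  simp [cyc, fromRel_adj]

lemma dg_cyc {n : ℕ} (hn : 3 ≤ n) (v : ZMod n) : dg (cyc n) v = 2 := by
  unfold dg
  haveI : Fact (1 < n) := ⟨by omega⟩
  have h1 : (1 : ZMod n) ≠ 0 := one_ne_zero
  have h2 : (2 : ZMod n) ≠ 0 := by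
    have : ((2 : ℕ) : ZMod n) ≠ 0 := by
      rw [Ne, ZMod.natCast_eq_zero_iff]
      intro h; have := Nat.le_of_dvd (by norm_num) h; omega
    exact_mod_cast this
  have : (cyc n).neighborSet v = {v + 1, v - 1} := by
    ext w
    simp only [mem_neighborSet, cyc_adj, Set.mem_insert_iff, Set.mem_singleton_iff]
    constructor
    · rintro ⟨_, h | h⟩
      · exact Or.inl h
      · right; rw [h]; ring
    · rintro (rfl | rfl)
      · exact ⟨by simpa using h1.symm, Or.inl rfl⟩
      · refine ⟨?_, Or.inr (by ring)⟩
        intro h; apply h1; linear_combination h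
  rw [this, Set.ncard_pair]
  intro h; apply h2; linear_combination h

lemma MemF.cubic {i j : ℕ} {V : Type} {G : SimpleGraph V} (h : MemF i j G) (hj : i = j) :
    ∀ v, dg G v = 3 := by
  induction h with
  | cycle hi h => omega
  | k4 h =>
    obtain ⟨e⟩ := h
    intro v
    rw [← dg_iso e]
    generalize e v = w
    have : (⊤ : SimpleGraph (Fin 4)).neighborSet w = {w}ᶜ := by
      ext u; simp [eq_comm]
    unfold dg
    rw [this, Set.ncard_compl, Set.ncard_singleton]; simp
  | circ hj hH hxy he1 he2 hG ih =>
    haveI := hH.finite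
    exact dg_circ (ih rfl) hxy he1 he2 hG
  | subd hj hH hxy hG ih => have := hH.le; omega

lemma MemF.deg23 {i j : ℕ} {V : Type} {G : SimpleGraph V} (h : MemF i j G) :
    ∀ v, dg G v = 2 ∨ dg G v = 3 := by
  induction h with
  | cycle hi h =>
    obtain ⟨e⟩ := h
    intro v
    rw [← dg_iso e, dg_cyc hi]; simp
  | k4 h => intro v; exact Or.inr ((MemF.k4 h).cubic rfl v)
  | circ hj hH hxy he1 he2 hG ih => intro v; exact Or.inr ((MemF.circ hj hH hxy he1 he2 hG).cubic rfl v)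
  | subd hj hH hxy hG ih =>
    haveI := hH.finite
    obtain ⟨e⟩ := hG
    intro v
    rw [← dg_iso e]
    rcases e v with _ | u
    · rw [dg_subd_none hxy]; simp
    · rw [dg_subd_some hxy]; exact ih u

end memF

end part_Q1

section part_Q2
set_option linter.unusedSectionVars false
set_option linter.unusedVariables false

section memF2

/-- exchange the two outermost points -/
def swapOO (V : Type) : Option (Option V) ≃ Option (Option V) where
  toFun := fun x => match x with
    | none => some none
    | some none => none
    | some (some v) => some (some v)
  invFun := fun x => match x with
    | none => some none
    | some none => none
    | some (some v) => some (some v)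
  left_inv := by rintro (_ | _ | v) <;> rfl
  right_inv := by rintro (_ | _ | v) <;> rfl

@[simp] lemma swapOO_n {V : Type} : swapOO V none = some none := rfl
@[simp] lemma swapOO_sn {V : Type} : swapOO V (some none) = none := rfl
@[simp] lemma swapOO_ss {V : Type} (v : V) : swapOO V (some (some v)) = some (some v) := rfl

/-- disjoint subdivisions commute -/
def subdSwap {V : Type} (H : SimpleGraph V) (p q a b : V) :
    subdivide (subdivide H p q) (some a) (some b) ≃g subdivide (subdivide H a b) (some p) (some q) where
  toEquiv := swapOO V
  map_rel_iff' := by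
    rintro (_ | _ | u) (_ | _ | v)
    all_goals simp
    tauto

/-- a doubly subdivided edge -/
def subdFlip {V : Type} (H : SimpleGraph V) (p q : V) (h : p ≠ q) :
    subdivide (subdivide H p q) none (some p) ≃g subdivide (subdivide H p q) none (some q) where
  toEquiv := swapOO V
  map_rel_iff' := by
    rintro (_ | _ | u) (_ | _ | v)
    all_goals simp
    · constructor
      · rintro ⟨rfl | rfl, h⟩ <;> first | exact absurd rfl h | rfl | (simp at h; done) | simp_all
      · rintro rfl; simp_all [Ne.symm h]
    · constructor
      · rintro rfl; simp_all; exact fun hh => h hh.symm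
      · rintro ⟨rfl | rfl, h⟩ <;> simp_all [eq_comm]
    · constructor
      · rintro ⟨rfl | rfl, h⟩ <;> first | exact absurd rfl h | rfl | (simp at h; done) | simp_all
      · rintro rfl; simp_all [Ne.symm h]
    · constructor
      · rintro rfl; simp_all; exact fun hh => h hh.symm
      · rintro ⟨rfl | rfl, h⟩ <;> simp_all [eq_comm]

/-- adding an apex commutes with a subdivision elsewhere -/
def apexSwap {V : Type} (H : SimpleGraph V) (p q : V) (S : Set V) :
    addApex (subdivide H p q) (some '' S) ≃g subdivide (addApex H S) (some p) (some q) where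
  toEquiv := swapOO V
  map_rel_iff' := by
    rintro (_ | _ | u) (_ | _ | v)
    all_goals simp

/-- the cycle on `Fin (m+1)`, described through values -/
def cycF (m : ℕ) : SimpleGraph (Fin (m + 1)) :=
  SimpleGraph.fromRel (fun u v => v.val = u.val + 1 ∨ (u.val = m ∧ v.val = 0))

lemma cycF_adj {m : ℕ} (hm : 2 ≤ m) (u v : Fin (m + 1)) : (cycF m).Adj u v ↔
    (v.val = u.val + 1 ∨ u.val = v.val + 1 ∨ (u.val = m ∧ v.val = 0) ∨ (v.val = m ∧ u.val = 0)) := by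
  simp only [cycF, fromRel_adj, ne_eq, Fin.ext_iff]
  omega

lemma fin_succ_iff {m : ℕ} (u v : Fin (m + 1)) : (v = u + 1) ↔ (v.val = u.val + 1 ∨ (u.val = m ∧ v.val = 0)) := by
  rw [Fin.ext_iff, Fin.val_add_one]
  have := v.2; have := u.2
  split_ifs with h
  · have : u.val = m := by rw [h]; rfl
    omega
  · have : u.val ≠ m := fun h' => h (Fin.ext h')
    omega

def cycFIso (m : ℕ) : cyc (m + 1) ≃g cycF m where
  toEquiv := Equiv.refl (Fin (m + 1))
  map_rel_iff' := by
    intro u v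
    refine Iff.trans ?_ (cyc_adj u v).symm
    have h1 : ((v : ZMod (m+1)) = u + 1) ↔ _ := fin_succ_iff (m := m) u v
    have h2 : ((u : ZMod (m+1)) = v + 1) ↔ _ := fin_succ_iff (m := m) v u
    refine Iff.trans ?_ (and_congr_right fun _ => or_congr h1.symm h2.symm)
    exact fromRel_adj _ _ _

/-- a cycle is a subdivision of a shorter cycle -/
def cycSubd {m : ℕ} (hm : 2 ≤ m) : cycF (m + 1) ≃g subdivide (cycF m) (Fin.last m) 0 where
  toEquiv := finSuccEquivLast
  map_rel_iff' := by
    intro u v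
    rw [cycF_adj (by omega)]
    induction u using Fin.lastCases with
    | last =>
      induction v using Fin.lastCases with
      | last => simp
      | cast v =>
        have := v.2
        simp only [finSuccEquivLast_last, finSuccEquivLast_castSucc]
        rw [subd_ns]
        simp only [Fin.ext_iff, Fin.val_last, Fin.val_castSucc, Fin.val_zero, true_and, and_true]
        omega
    | cast u =>
      induction v using Fin.lastCases with
      | last =>
        have := u.2
        simp only [finSuccEquivLast_last, finSuccEquivLast_castSucc]
        rw [subd_sn]
        simp only [Fin.ext_iff, Fin.val_last, Fin.val_castSucc, Fin.val_zero, true_and, and_true]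
        omega
      | cast v =>
        have := u.2
        have := v.2
        simp only [finSuccEquivLast_castSucc]
        rw [subd_ss, cycF_adj hm, Ne, Sym2.eq_iff]
        simp only [Fin.ext_iff, Fin.val_last, Fin.val_castSucc, Fin.val_zero, true_and, and_true]
        omega

def cycRot {n : ℕ} (a : ZMod n) : cyc n ≃g cyc n where
  toEquiv := Equiv.addRight a
  map_rel_iff' := by
    intro u v
    simp only [Equiv.coe_addRight, cyc_adj]
    constructor
    · rintro ⟨h1, h2⟩
      refine ⟨fun h => h1 (by rw [h]), ?_⟩
      rcases h2 with h | h
      · left; linear_combination h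
      · right; linear_combination h
    · rintro ⟨h1, h2⟩
      refine ⟨fun h => h1 (by linear_combination h), ?_⟩
      rcases h2 with h | h
      · left; linear_combination h
      · right; linear_combination h

lemma MemF.suppress {i j : ℕ} {V : Type} {G : SimpleGraph V} (h : MemF i j G) (hij : 1 ≤ j ∨ 4 ≤ i) (v : V)
    (hv : dg G v = 2) : ∃ (W : Type) (G' : SimpleGraph W) (p q : W) (_ : G'.Adj p q) (e : G ≃g subdivide G' p q)
      (i' : ℕ), e v = none ∧ MemF i' j G' := by
  induction h with
  | cycle hi h =>
    rename_i i V G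
    obtain ⟨e⟩ := h
    obtain ⟨m, rfl⟩ : ∃ m, i = m + 2 := ⟨i - 2, by omega⟩
    have hm : 2 ≤ m := by omega
    let z : ZMod (m + 2) := (cycFIso (m + 1)).symm (Fin.last (m + 1))
    refine ⟨_, cycF m, Fin.last m, 0, ?_,
      ((e.trans (cycRot (z - e v))).trans (cycFIso (m + 1))).trans (cycSubd hm), m + 1, ?_, ?_⟩
    · rw [cycF_adj hm]
      right; right; left; simp
    · show cycSubd hm (cycFIso (m + 1) (e v + (z - e v))) = none
      rw [add_sub_cancel]
      simp only [z, RelIso.apply_symm_apply]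
      exact finSuccEquivLast_last
    · exact MemF.cycle (by omega) ⟨(cycFIso m).symm⟩
  | k4 h => have := (MemF.k4 h).cubic rfl v; omega
  | circ hj hH hxy he1 he2 hG ih => have := (MemF.circ hj hH hxy he1 he2 hG).cubic rfl v; omega
  | subd hj hH hxy hG ih =>
    rename_i i j V H x y W G
    haveI := hH.finite
    obtain ⟨e⟩ := hG
    rcases hev : e v with _ | v'
    · exact ⟨_, H, x, y, hxy, e, i, hev, hH⟩
    have hv' : dg H v' = 2 := by
      rw [← dg_subd_some hxy, ← hev, dg_iso, hv]
    obtain ⟨W', H', p, q, hpq, e', i', he', hM⟩ := ih (Or.inl hj) v' hv'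
    have haux : ∀ (X Y : Option W') (hXY : (subdivide H' p q).Adj X Y) (e2 : G ≃g subdivide (subdivide H' p q) X Y)
      (he2 : e2 v = some none), ∃ (W : Type) (G' : SimpleGraph W) (p q : W) (_ : G'.Adj p q) (e : G ≃g subdivide G' p q)
      (i' : ℕ), e v = none ∧ MemF i' j G' := by
      have hns : ∀ (b : W') (hXY : (subdivide H' p q).Adj none (some b)) (e2 : G ≃g subdivide (subdivide H' p q) none (some b))
      (he2 : e2 v = some none), ∃ (W : Type) (G' : SimpleGraph W) (p q : W) (_ : G'.Adj p q) (e : G ≃g subdivide G' p q)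
      (i' : ℕ), e v = none ∧ MemF i' j G' := by
        intro b hXY e2 he2
        rw [subd_ns] at hXY
        rcases hXY with rfl | rfl
        · refine ⟨_, subdivide H' b q, none, some q, by simp, e2.trans (subdFlip H' b q hpq.ne), i' + 1, ?_, ?_⟩
          · simp [he2, subdFlip]
          · exact .subd hj hM hpq ⟨RelIso.refl _⟩
        · refine ⟨_, subdivide H' p b, none, some p, by simp, e2.trans (subdFlip H' p b hpq.ne).symm, i' + 1, ?_, ?_⟩
          · simp [he2, subdFlip, RelIso.symm]; rfl
          · exact .subd hj hM hpq ⟨RelIso.refl _⟩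
      intro X Y hXY e2 he2
      rcases X with _ | a <;> rcases Y with _ | b
      · simp at hXY
      · exact hns b hXY e2 he2
      · revert e2
        rw [subd_symm]
        intro e2 he2
        exact hns a hXY.symm e2 he2
      · rw [subd_ss] at hXY
        refine ⟨_, subdivide H' a b, some p, some q, ?_, e2.trans (subdSwap H' p q a b), i' + 1, ?_, ?_⟩
        · rw [subd_ss]; exact ⟨hpq, hXY.2.symm⟩
        · simp [he2, subdSwap]
        · exact .subd hj hM hXY.1 ⟨RelIso.refl _⟩
    refine haux (e' x) (e' y) (e'.map_adj_iff.2 hxy) (e.trans (subdIso e' x y)) ?_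
    simp [hev, subdIso, he']

lemma MemF.eq_of_cubic {i j : ℕ} {V : Type} {G : SimpleGraph V} (h : MemF i j G) (hc : ∀ v, dg G v = 3) : i = j := by
  cases h with
  | cycle hi h =>
    obtain ⟨e⟩ := h
    have := hc (e.symm 0)
    rw [← dg_iso e, dg_cyc hi] at this
    omega
  | k4 h => rfl
  | circ hj hH hxy he1 he2 hG => rfl
  | subd hj hH hxy hG =>
    obtain ⟨e⟩ := hG
    have := hc (e.symm none)
    rw [← dg_iso e] at this
    simp only [RelIso.apply_symm_apply] at this
    rw [dg_subd_none hxy] at this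
    omega

lemma MemF.apex {i j : ℕ} {V : Type} {G : SimpleGraph V} (h : MemF i j G) {a b c : V} (hab : a ≠ b) (hac : a ≠ c)
    (hbc : b ≠ c) (ha : dg G a = 2) (hb : dg G b = 2) (hc : dg G c = 2) :
    ∃ i', MemF i' (j + 1) (addApex G {a, b, c}) := by
  induction hn : Nat.card V using Nat.strong_induction_on generalizing V i with
  | _ n ih =>
  subst hn
  haveI := h.finite
  by_cases h3 : ¬ (1 ≤ j ∨ 4 ≤ i)
  · cases h with
    | cycle hi h =>
      push Not at h3
      have : i = 3 := by omega
      subst this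
      obtain ⟨e⟩ := h
      have hca : Nat.card V = 3 := by rw [Nat.card_congr e.toEquiv]; simp
      have huniv : ({a, b, c} : Set V) = Set.univ := by
        apply Set.eq_of_subset_of_ncard_le (Set.subset_univ _)
        rw [Set.ncard_univ, hca, Set.ncard_eq_three.2 ⟨a, b, c, hab, hac, hbc, rfl⟩]
      refine ⟨1, .k4 ?_⟩
      have htop : addApex G {a, b, c} = ⊤ := by
        rw [huniv]
        ext x y
        rcases x with _ | x <;> rcases y with _ | y
        · simp
        · simp
        · simp
        · simp only [apex_ss, top_adj, ne_eq, Option.some.injEq]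
          rw [← e.map_adj_iff, ← e.injective.eq_iff]
          generalize e x = x'; generalize e y = y'
          rw [cyc_adj]
          revert x' y'; decide
      rw [htop]
      have hca' : Nat.card (Option V) = 4 := by rw [Finite.card_option, hca]
      exact ⟨Iso.completeGraph ((Finite.equivFin (Option V)).trans (finCongr hca'))⟩
    | k4 h => exact absurd (Or.inl le_rfl) h3
    | circ hj hH hxy he1 he2 hG => exact absurd (Or.inl (by omega)) h3
    | subd hj hH hxy hG => exact absurd (Or.inl hj) h3
  push Not at h3
  by_cases hv : ∃ v, v ∉ ({a, b, c} : Set V) ∧ dg G v = 2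
  · obtain ⟨v, hvS, hv⟩ := hv
    obtain ⟨W, G', p, q, hpq, e, i', hev, hM⟩ := h.suppress h3 v hv
    haveI := hM.finite
    have hsome : ∀ x ∈ ({a, b, c} : Set V), ∃ x', e x = some x' := by
      intro x hx
      rcases hh : e x with _ | x'
      · exact absurd (e.injective (hh.trans hev.symm) ▸ hx) hvS
      · exact ⟨x', rfl⟩
    obtain ⟨a', ha'⟩ := hsome a (by simp)
    obtain ⟨b', hb'⟩ := hsome b (by simp)
    obtain ⟨c', hc'⟩ := hsome c (by simp)
    have hd : ∀ x x', e x = some x' → dg G x = 2 → dg G' x' = 2 := by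
      intro x x' h1 h2
      rw [← dg_subd_some hpq, ← h1, dg_iso, h2]
    have hne : ∀ x y x' y', e x = some x' → e y = some y' → x ≠ y → x' ≠ y' := by
      intro x y x' y' h1 h2 h3 h4
      subst h4
      exact h3 (e.injective (h1.trans h2.symm))
    have hlt : Nat.card W < Nat.card V := by
      rw [Nat.card_congr e.toEquiv, Finite.card_option]; omega
    obtain ⟨i2, hi2⟩ := ih _ hlt hM (hne _ _ _ _ ha' hb' hab) (hne _ _ _ _ ha' hc' hac) (hne _ _ _ _ hb' hc' hbc)
      (hd _ _ ha' ha) (hd _ _ hb' hb) (hd _ _ hc' hc) rfl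
    refine ⟨i2 + 1, ?_⟩
    have h5 : MemF (i2 + 1) (j + 1) (subdivide (addApex G' {a', b', c'}) (some p) (some q)) :=
      .subd (by omega) hi2 (by simpa using hpq) ⟨RelIso.refl _⟩
    refine h5.iso (RelIso.trans (apexIso e _ (some '' {a', b', c'}) ?_) (apexSwap G' p q _))
    intro x
    rw [Set.image_insert_eq, Set.image_pair, ← ha', ← hb', ← hc']
    simp
  push Not at hv
  have hj : 1 ≤ j := by
    rcases h3 with h3 | h3
    · exact h3
    · by_contra hj
      cases h with
      | cycle hi h =>
        obtain ⟨e⟩ := h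
        have hall : ∀ v, dg G v = 2 := fun v => by rw [← dg_iso e, dg_cyc hi]
        have hca : Nat.card V = i := by rw [Nat.card_congr e.toEquiv]; simp
        have hS := Set.ncard_eq_three.2 ⟨a, b, c, hab, hac, hbc, rfl⟩
        have huniv : ({a, b, c} : Set V) = Set.univ := by
          ext x; simp only [Set.mem_univ, iff_true]
          by_contra hx
          exact hv x hx (hall x)
        rw [huniv, Set.ncard_univ, hca] at hS
        omega
      | k4 h => omega
      | circ hj hH hxy he1 he2 hG => omega
      | subd hj hH hxy hG => omega
  -- suppress the three vertices
  obtain ⟨W1, G1, p1, q1, hpq1, e1, i1, he1, hM1⟩ := h.suppress h3 a ha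
  haveI := hM1.finite
  have hsome1 : ∀ x, x ≠ a → ∃ x', e1 x = some x' := by
    intro x hx
    rcases hh : e1 x with _ | x'
    · exact absurd (e1.injective (hh.trans he1.symm)) hx
    · exact ⟨x', rfl⟩
  obtain ⟨b1, hb1⟩ := hsome1 b hab.symm
  obtain ⟨c1, hc1⟩ := hsome1 c hac.symm
  have hdb1 : dg G1 b1 = 2 := by rw [← dg_subd_some hpq1, ← hb1, dg_iso, hb]
  have hdc1 : dg G1 c1 = 2 := by rw [← dg_subd_some hpq1, ← hc1, dg_iso, hc]
  have hbc1 : b1 ≠ c1 := by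
    rintro rfl; exact hbc (e1.injective (hb1.trans hc1.symm))
  obtain ⟨W2, G2, p2, q2, hpq2, e2, i2, he2, hM2⟩ := hM1.suppress (Or.inl hj) b1 hdb1
  haveI := hM2.finite
  obtain ⟨c2, hc2⟩ : ∃ c2, e2 c1 = some c2 := by
    rcases hh : e2 c1 with _ | x'
    · exact absurd (e2.injective (hh.trans he2.symm)) hbc1.symm
    · exact ⟨x', rfl⟩
  have hdc2 : dg G2 c2 = 2 := by rw [← dg_subd_some hpq2, ← hc2, dg_iso, hdc1]
  obtain ⟨W3, G3, p3, q3, hpq3, e3, i3, he3, hM3⟩ := hM2.suppress (Or.inl hj) c2 hdc2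
  haveI := hM3.finite
  have hcub : ∀ v, dg G3 v = 3 := by
    intro v
    rcases hM3.deg23 v with h2 | h2
    · exfalso
      have hw2 : dg G2 (e3.symm (some v)) = 2 := by
        rw [← dg_iso e3]; simp only [RelIso.apply_symm_apply]; rw [dg_subd_some hpq3, h2]
      have hw1 : dg G1 (e2.symm (some (e3.symm (some v)))) = 2 := by
        rw [← dg_iso e2]; simp only [RelIso.apply_symm_apply]; rw [dg_subd_some hpq2, hw2]
      have hw0 : dg G (e1.symm (some (e2.symm (some (e3.symm (some v)))))) = 2 := by
        rw [← dg_iso e1]; simp only [RelIso.apply_symm_apply]; rw [dg_subd_some hpq1, hw1]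
      refine hv _ ?_ hw0
      simp only [Set.mem_insert_iff, Set.mem_singleton_iff, not_or]
      refine ⟨?_, ?_, ?_⟩
      · intro hh
        rw [← hh] at he1; simp at he1
      · intro hh
        rw [← hh] at hb1
        simp only [RelIso.apply_symm_apply, Option.some.injEq] at hb1
        rw [← hb1] at he2; simp at he2
      · intro hh
        rw [← hh] at hc1
        simp only [RelIso.apply_symm_apply, Option.some.injEq] at hc1
        rw [← hc1] at hc2; simp only [RelIso.apply_symm_apply, Option.some.injEq] at hc2
        rw [← hc2] at he3; simp at he3
    · exact h2
  have hij3 := hM3.eq_of_cubic hcub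
  subst hij3
  -- compose the isomorphisms
  let K := subdivide G3 p3 q3
  have E2 : ∃ E : G1 ≃g subdivide K (e3 p2) (e3 q2), E b1 = none ∧ E c1 = some none := by
    refine ⟨e2.trans (subdIso e3 p2 q2), ?_, ?_⟩
    · simp [he2, subdIso]
    · simp [hc2, subdIso, he3]
  obtain ⟨E2, hEb, hEc⟩ := E2
  have hK : K.Adj (e3 p2) (e3 q2) := e3.map_adj_iff.2 hpq2
  generalize e3 p2 = x1 at *
  generalize e3 q2 = y1 at *
  have E1 : ∃ E : G ≃g subdivide (subdivide K x1 y1) (E2 p1) (E2 q1), E a = none ∧ E b = some none ∧ E c = some (some none) := by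
    refine ⟨e1.trans (subdIso E2 p1 q1), ?_, ?_, ?_⟩
    · simp [he1, subdIso]
    · simp [hb1, subdIso, hEb]
    · simp [hc1, subdIso, hEc]
  obtain ⟨E1, hFa, hFb, hFc⟩ := E1
  have hK2 : (subdivide K x1 y1).Adj (E2 p1) (E2 q1) := E2.map_adj_iff.2 hpq1
  generalize E2 p1 = x2 at *
  generalize E2 q1 = y2 at *
  refine ⟨i3 + 1, ?_⟩
  have hS : ∀ v, v ∈ ({a, b, c} : Set V) ↔ E1 v ∈ ({some (some none), some none, none} : Set (Option (Option (Option W3)))) := by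
    intro v
    rw [← hFa, ← hFb, ← hFc]
    simp only [Set.mem_insert_iff, Set.mem_singleton_iff, E1.injective.eq_iff]
    tauto
  have hdbl : ∀ x1 y1 : Option W3, K.Adj x1 y1 → ∀ E : G ≃g subdivide (subdivide K x1 y1) none (some y1),
      (∀ v, v ∈ ({a, b, c} : Set V) ↔ E v ∈ ({some (some none), some none, none} : Set (Option (Option (Option W3))))) →
      MemF (i3 + 1) (i3 + 1) (addApex G {a, b, c}) := by
    intro x1 y1 hK E hS
    refine .circ (by omega) (H := G3) (by simpa using hM3) hpq3 (e1 := s(x1, y1)) (e2 := s(x1, y1)) hK hK ?_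
    exact Or.inr ⟨rfl, x1, y1, rfl, ⟨apexIso E _ _ hS⟩⟩
  have hdbl2 : ∀ y2 : Option W3, (subdivide K x1 y1).Adj none (some y2) → ∀ E : G ≃g subdivide (subdivide K x1 y1) none (some y2),
      (∀ v, v ∈ ({a, b, c} : Set V) ↔ E v ∈ ({some (some none), some none, none} : Set (Option (Option (Option W3))))) →
      MemF (i3 + 1) (i3 + 1) (addApex G {a, b, c}) := by
    intro y2 h E hS
    rw [subd_ns] at h
    rcases h with rfl | rfl
    · revert E
      rw [subd_symm K]
      intro E hS
      exact hdbl _ _ hK.symm E hS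
    · exact hdbl _ _ hK E hS
  rcases x2 with _ | x2 <;> rcases y2 with _ | y2
  · simp at hK2
  · exact hdbl2 _ hK2 E1 hS
  · revert E1
    rw [subd_symm (subdivide K x1 y1)]
    intro E1 _ _ _ hS
    exact hdbl2 _ hK2.symm E1 hS
  · rw [subd_ss] at hK2
    refine .circ (by omega) (H := G3) (by simpa using hM3) hpq3 (e1 := s(x1, y1)) (e2 := s(x2, y2)) hK hK2.1 ?_
    exact Or.inl ⟨hK2.2.symm, x1, y1, x2, y2, rfl, rfl, ⟨apexIso E1 _ _ hS⟩⟩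

end memF2

end part_Q2

section part_Q3
set_option linter.unusedSectionVars false
set_option linter.unusedVariables false

section memF3

lemma MemF.congr {i j : ℕ} {V : Type} {E E' : SimpleGraph V} {Y Y' : Set V} (h : MemF i j (E.induce Y)) (hY : Y = Y')
    (hE : ∀ u ∈ Y, ∀ v ∈ Y, E.Adj u v ↔ E'.Adj u v) : MemF i j (E'.induce Y') := by
  subst hY
  have : E.induce Y = E'.induce Y := by
    ext ⟨u, hu⟩ ⟨v, hv⟩
    simpa using hE u hu v hv
  rwa [← this]

/-- the elements of `insert c Y` as options -/
def optMap {V : Type} (c : V) (Y : Set V) : Option Y → ↥(insert c Y)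
  | none => ⟨c, Set.mem_insert _ _⟩
  | some y => ⟨y.1, Set.mem_insert_of_mem _ y.2⟩

lemma optMap_bij {V : Type} {c : V} {Y : Set V} (hc : c ∉ Y) : Function.Bijective (optMap c Y) := by
  constructor
  · rintro (_ | ⟨u, hu⟩) (_ | ⟨v, hv⟩) h
    · rfl
    · simp only [optMap, Subtype.mk.injEq] at h; subst h; exact absurd hv hc
    · simp only [optMap, Subtype.mk.injEq] at h; subst h; exact absurd hu hc
    · simp only [optMap, Subtype.mk.injEq] at h; subst h; rfl
  · rintro ⟨v, hv⟩
    rcases hv with rfl | hv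
    · exact ⟨none, rfl⟩
    · exact ⟨some ⟨v, hv⟩, rfl⟩

noncomputable def optIso {V : Type} {K : SimpleGraph V} {c : V} {Y : Set V} (hc : c ∉ Y) (F : SimpleGraph (Option Y))
    (h1 : ∀ u v, F.Adj (some u) (some v) ↔ K.Adj u.1 v.1) (h2 : ∀ u, F.Adj none (some u) ↔ K.Adj c u.1) :
    F ≃g K.induce (insert c Y) where
  toEquiv := Equiv.ofBijective _ (optMap_bij hc)
  map_rel_iff' := by
    rintro (_ | u) (_ | v)
    · simp
    · simp [optMap, h2]
    · rw [F.adj_comm]; simp [optMap, h2, K.adj_comm]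
    · simp [optMap, h1]

lemma MemF.of_opt {i j : ℕ} {V : Type} {K : SimpleGraph V} {c : V} {Y : Set V} (hc : c ∉ Y) {F : SimpleGraph (Option Y)}
    (hF : MemF i j F)
    (h1 : ∀ u v, F.Adj (some u) (some v) ↔ K.Adj u.1 v.1) (h2 : ∀ u, F.Adj none (some u) ↔ K.Adj c u.1) :
    MemF i j (K.induce (insert c Y)) := hF.iso (optIso hc F h1 h2).symm

lemma MemF.leg {V : Type} {M : SimpleGraph V} {w q p : V} {i j : ℕ} (hj : 1 ≤ j) (R : M.Walk w q) (hR : R.IsPath)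
    (E0 : SimpleGraph V) (Y : Set V) (hw : w ∈ Y) (hp : p ∈ Y) (hwp : w ≠ p)
    (hRY : ∀ x ∈ R.support, x ∈ Y → x = w) (hE0 : ∀ u v, E0.Adj u v → u ∈ Y ∧ v ∈ Y) (hn : ¬ E0.Adj w p)
    (h : MemF i j ((E0 ⊔ edge w p).induce Y)) :
    ∃ i', MemF i' j ((E0 ⊔ fromEdgeSet {e | e ∈ R.edges} ⊔ edge q p).induce (Y ∪ {x | x ∈ R.support})) := by
  induction R generalizing i E0 Y with
  | nil =>
    refine ⟨i, h.congr ?_ ?_⟩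
    · ext x; simp; rintro rfl; exact hw
    · intro u hu v hv; simp
  | cons had R ih =>
    rename_i w c q
    rw [Walk.cons_isPath_iff] at hR
    have hcY : c ∉ Y := by
      intro hc
      have := hRY c (by simp) hc
      subst this
      exact hR.2 R.start_mem_support
    have hcp : c ≠ p := by rintro rfl; exact hcY hp
    have hwc : w ≠ c := by rintro rfl; exact hcY hw
    have h1 : MemF (i + 1) j (((E0 ⊔ edge w c) ⊔ edge c p).induce (insert c Y)) := by
      refine MemF.of_opt hcY (F := subdivide ((E0 ⊔ edge w p).induce Y) ⟨w, hw⟩ ⟨p, hp⟩)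
        (.subd hj h ?_ ⟨RelIso.refl _⟩) ?_ ?_
      · simp [edge_adj, hwp]
      · rintro ⟨u, hu⟩ ⟨v, hv⟩
        have huc : u ≠ c := by rintro rfl; exact hcY hu
        have hvc : v ≠ c := by rintro rfl; exact hcY hv
        simp only [subd_ss, comap_adj, Function.Embedding.subtype_apply, sup_adj, edge_adj, ne_eq, Sym2.eq_iff,
          Subtype.mk.injEq, huc, hvc]
        constructor
        · rintro ⟨h1 | h1, h2⟩
          · exact Or.inl (Or.inl h1)
          · exact absurd h1.1 h2
        · rintro ((h1 | h1) | h1)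
          · refine ⟨Or.inl h1, ?_⟩
            rintro (⟨rfl, rfl⟩ | ⟨rfl, rfl⟩)
            · exact hn h1
            · exact hn h1.symm
          · simp at h1
          · simp at h1
      · rintro ⟨u, hu⟩
        have huc : u ≠ c := by rintro rfl; exact hcY hu
        simp only [subd_ns, sup_adj, edge_adj, Subtype.mk.injEq]
        have : ¬ E0.Adj c u := fun hh => hcY (hE0 _ _ hh).1
        simp only [this, huc, hcp, false_or]
        constructor
        · rintro (rfl | rfl)
          · left; simp [huc.symm]
          · right; simp [huc.symm]
        · rintro (⟨h1 | h1, _⟩ | ⟨h1 | h1, _⟩)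
          · exact absurd h1.1.symm hwc
          · exact Or.inl h1.2
          · exact Or.inr h1.2
          · simp at h1
    obtain ⟨i', hi'⟩ := ih (E0 := E0 ⊔ edge w c) (Y := insert c Y) (hR := hR.1) (Set.mem_insert _ _) (Set.mem_insert_of_mem _ hp) hcp
      (by
        intro x hx hxY
        rcases hxY with h2 | h2
        · exact h2
        · have := hRY x (by simp [hx]) h2
          subst this
          exact absurd hx hR.2)
      (by
        intro u v huv
        simp only [sup_adj, edge_adj] at huv
        rcases huv with h2 | ⟨⟨rfl, rfl⟩ | ⟨rfl, rfl⟩, _⟩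
        · exact ⟨Or.inr (hE0 _ _ h2).1, Or.inr (hE0 _ _ h2).2⟩
        · exact ⟨Or.inr hw, Or.inl rfl⟩
        · exact ⟨Or.inl rfl, Or.inr hw⟩)
      (by
        simp only [sup_adj, edge_adj, not_or]
        refine ⟨fun hh => hcY (hE0 _ _ hh).1, ?_⟩
        rintro ⟨⟨rfl, rfl⟩ | ⟨_, h2⟩, _⟩
        · exact hwc rfl
        · exact hwp h2.symm)
      h1
    refine ⟨i', hi'.congr ?_ ?_⟩
    · ext x
      simp only [Set.mem_union, Set.mem_insert_iff, Set.mem_ofPred_eq, Walk.support_cons, List.mem_cons]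
      constructor
      · rintro ((rfl | h2) | h2)
        · right; right; exact R.start_mem_support
        · exact Or.inl h2
        · exact Or.inr (Or.inr h2)
      · rintro (h2 | rfl | h2)
        · exact Or.inl (Or.inr h2)
        · exact Or.inl (Or.inr hw)
        · exact Or.inr h2
    · intro u hu v hv
      simp only [sup_adj, edge_adj, fromEdgeSet_adj, Set.mem_ofPred_eq, Walk.edges_cons, List.mem_cons, Sym2.eq_iff, ne_eq, or_and_right]
      generalize (s(u, v) ∈ R.edges ∧ ¬ u = v) = A
      generalize E0.Adj u v = B
      simp only [or_assoc]

lemma cycle_memF {V : Type} {G : SimpleGraph V} {u : V} (c : G.Walk u u) (hc : c.IsCycle)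
    (hch : ∀ x y, x ∈ c.support → y ∈ c.support → G.Adj x y → s(x, y) ∈ c.edges) :
    MemF c.length 0 (G.induce {x | x ∈ c.support}) := by
  have h3 := hc.three_le_length
  obtain ⟨m, hm⟩ : ∃ m, c.length = m + 1 := ⟨c.length - 1, by omega⟩
  have hm2 : 2 ≤ m := by omega
  refine .cycle h3 ?_
  rw [hm]
  have hinj := hc.getVert_injOn'
  have hmem : ∀ k : ℕ, c.getVert k ∈ c.support := fun k => c.getVert_mem_support k
  let f : Fin (m + 1) → {x | x ∈ c.support} := fun k => ⟨c.getVert k.val, hmem _⟩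
  have hf : Function.Bijective f := by
    constructor
    · intro a b hab
      simp only [f, Subtype.mk.injEq] at hab
      apply Fin.ext
      apply hinj _ _ hab
      · simp only [Set.mem_ofPred_eq]; omega
      · simp only [Set.mem_ofPred_eq]; omega
    · rintro ⟨x, hx⟩
      obtain ⟨k, hk, hkl⟩ := Walk.mem_support_iff_exists_getVert.1 hx
      by_cases hkm : k = m + 1
      · refine ⟨0, ?_⟩
        simp only [f, Subtype.mk.injEq]
        have : c.getVert (m + 1) = c.getVert 0 := by rw [← hm]; simp
        rw [← hk, hkm, this]; rfl
      · exact ⟨⟨k, by omega⟩, by simp [f, hk]⟩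
  have hadj : ∀ a b : Fin (m + 1), s(c.getVert a.val, c.getVert b.val) ∈ c.edges ↔ (cycF m).Adj a b := by
    intro a b
    rw [cycF_adj hm2]
    have hz : c.getVert (m + 1) = c.getVert 0 := by rw [← hm]; simp
    have key : ∀ k, k < m + 1 → ∀ a : Fin (m + 1), c.getVert k = c.getVert a.val → a.val = k := by
      intro k hk a h
      refine (hinj ?_ ?_ h).symm
      · simp only [Set.mem_ofPred_eq]; omega
      · simp only [Set.mem_ofPred_eq]; omega
    have key2 : ∀ k, k < m + 1 → ∀ a : Fin (m + 1), c.getVert (k + 1) = c.getVert a.val → a.val = k + 1 ∨ (k = m ∧ a.val = 0) := by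
      intro k hk a h
      by_cases hkm : k = m
      · subst hkm; rw [hz] at h; right; exact ⟨rfl, key 0 (by omega) a h⟩
      · left; exact key _ (by omega) a h
    rw [Walk.mk_mem_edges_iff_exists, hm]
    constructor
    · rintro ⟨k, hk, h⟩
      rw [Sym2.eq_iff] at h
      rcases h with ⟨h1, h2⟩ | ⟨h1, h2⟩
      · have := key k hk _ h1; have := key2 k hk _ h2; omega
      · have := key k hk _ h1; have := key2 k hk _ h2; omega
    · have ha := a.2
      have hb := b.2
      rintro (h | h | ⟨h1, h2⟩ | ⟨h1, h2⟩)
      · exact ⟨a.val, ha, by rw [h]⟩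
      · exact ⟨b.val, hb, by rw [h, Sym2.eq_swap]⟩
      · exact ⟨m, by omega, by rw [h1, h2, hz]⟩
      · exact ⟨m, by omega, by rw [h1, h2, hz, Sym2.eq_swap]⟩
  refine ⟨RelIso.trans ?_ (cycFIso m).symm⟩
  exact RelIso.symm
    { toEquiv := Equiv.ofBijective f hf
      map_rel_iff' := by
        intro a b
        rw [← hadj]
        simp only [Equiv.ofBijective_apply, f, comap_adj, Function.Embedding.subtype_apply]
        exact ⟨fun h => hch _ _ (hmem _) (hmem _) h, fun h => c.adj_of_mem_edges h⟩ }

/-- the graph of edges of `G` inside `Y` -/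
def inn {V : Type} (G : SimpleGraph V) (Y : Set V) : SimpleGraph V where
  Adj u v := G.Adj u v ∧ u ∈ Y ∧ v ∈ Y
  symm := ⟨fun u v h => ⟨h.1.symm, h.2.2, h.2.1⟩⟩
  loopless := ⟨fun u h => G.irrefl h.1⟩

lemma inn_adj {V : Type} {G : SimpleGraph V} {Y : Set V} {u v : V} : (inn G Y).Adj u v ↔ G.Adj u v ∧ u ∈ Y ∧ v ∈ Y := Iff.rfl

lemma tripod_memF {V : Type} {G M E' : SimpleGraph V} {Y0 Y' : Set V} {i m : ℕ} (h : MemF i m (G.induce Y0))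
    {p1 p2 p3 q1 q2 q3 w : V} (hp1 : p1 ∈ Y0) (hp2 : p2 ∈ Y0) (hp3 : p3 ∈ Y0) (h12 : p1 ≠ p2) (h13 : p1 ≠ p3) (h23 : p2 ≠ p3)
    (hd1 : dg (G.induce Y0) ⟨p1, hp1⟩ = 2) (hd2 : dg (G.induce Y0) ⟨p2, hp2⟩ = 2) (hd3 : dg (G.induce Y0) ⟨p3, hp3⟩ = 2)
    (R1 : M.Walk w q1) (R2 : M.Walk w q2) (R3 : M.Walk w q3) (hR1 : R1.IsPath) (hR2 : R2.IsPath) (hR3 : R3.IsPath)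
    (hY1 : ∀ x ∈ R1.support, x ∉ Y0) (hY2 : ∀ x ∈ R2.support, x ∉ Y0) (hY3 : ∀ x ∈ R3.support, x ∉ Y0)
    (hR12 : ∀ x ∈ R2.support, x ∈ R1.support → x = w) (hR13 : ∀ x ∈ R3.support, x ∈ R1.support → x = w)
    (hR23 : ∀ x ∈ R3.support, x ∈ R2.support → x = w)
    (hY : ∀ x, x ∈ Y' ↔ x ∈ Y0 ∨ x ∈ R1.support ∨ x ∈ R2.support ∨ x ∈ R3.support)
    (hE : ∀ u ∈ Y', ∀ v ∈ Y', (E'.Adj u v ↔ (G.Adj u v ∧ u ∈ Y0 ∧ v ∈ Y0) ∨ s(u, v) ∈ R1.edges ∨ s(u, v) ∈ R2.edges ∨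
      s(u, v) ∈ R3.edges ∨ s(u, v) = s(q1, p1) ∨ s(u, v) = s(q2, p2) ∨ s(u, v) = s(q3, p3))) :
    ∃ i', MemF i' (m + 1) (E'.induce Y') := by
  have hw0 : w ∉ Y0 := hY1 w R1.start_mem_support
  obtain ⟨i1, hi1⟩ := h.apex (a := ⟨p1, hp1⟩) (b := ⟨p2, hp2⟩) (c := ⟨p3, hp3⟩) (by simpa using h12) (by simpa using h13)
    (by simpa using h23) hd1 hd2 hd3
  have hw1 : w ≠ p1 := by rintro rfl; exact hw0 hp1
  have hw2 : w ≠ p2 := by rintro rfl; exact hw0 hp2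
  have hw3 : w ≠ p3 := by rintro rfl; exact hw0 hp3
  have hq1 := hY1 _ R1.end_mem_support
  have hq2 := hY2 _ R2.end_mem_support
  have hq3 := hY3 _ R3.end_mem_support
  have hqp : ∀ q p, q ∉ Y0 → p ∈ Y0 → q ≠ p := by rintro q p h1 h2 rfl; exact h1 h2
  have s1 : MemF i1 (m + 1) (((inn G Y0 ⊔ edge w p2 ⊔ edge w p3) ⊔ edge w p1).induce (insert w Y0)) := by
    refine MemF.of_opt hw0 hi1 ?_ ?_
    · rintro ⟨u, hu⟩ ⟨v, hv⟩
      have h1 := hqp w u hw0 hu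
      have h2 := hqp w v hw0 hv
      simp [edge_adj, inn_adj, hu, hv, h1.symm, h2.symm]
    · rintro ⟨u, hu⟩
      have h1 := hqp w u hw0 hu
      simp only [apex_ns, Set.mem_insert_iff, Set.mem_singleton_iff, Subtype.mk.injEq, sup_adj, inn_adj, edge_adj, hw0, hw1, hw2, hw3]
      simp [h1]; tauto
  obtain ⟨i2, s2⟩ := MemF.leg (by omega) R1 hR1 _ _ (Set.mem_insert _ _) (Set.mem_insert_of_mem _ hp1) hw1
    (by
      intro x hx hxY
      rcases hxY with h | h
      · exact h
      · exact absurd h (hY1 x hx))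
    (by
      intro u v huv
      simp only [sup_adj, inn_adj, edge_adj] at huv
      rcases huv with (h | ⟨⟨rfl, rfl⟩ | ⟨rfl, rfl⟩, _⟩) | ⟨⟨rfl, rfl⟩ | ⟨rfl, rfl⟩, _⟩
      · exact ⟨Or.inr h.2.1, Or.inr h.2.2⟩
      · exact ⟨Or.inl rfl, Or.inr hp2⟩
      · exact ⟨Or.inr hp2, Or.inl rfl⟩
      · exact ⟨Or.inl rfl, Or.inr hp3⟩
      · exact ⟨Or.inr hp3, Or.inl rfl⟩)
    (by
      simp only [sup_adj, inn_adj, edge_adj]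
      rintro ((h | ⟨⟨_, h⟩ | ⟨h, _⟩, _⟩) | ⟨⟨_, h⟩ | ⟨h, _⟩, _⟩)
      · exact hw0 h.2.1
      · exact h12 h
      · exact hw2 h
      · exact h13 h
      · exact hw3 h) s1
  have hedge : ∀ {a b : V} (R : M.Walk a b) (u v : V), s(u, v) ∈ R.edges → u ≠ v := by
    intro a b R u v h
    exact (R.adj_of_mem_edges h).ne
  have s2' : MemF i2 (m + 1) (((inn G Y0 ⊔ edge w p3 ⊔ fromEdgeSet {e | e ∈ R1.edges} ⊔ edge q1 p1) ⊔ edge w p2).induce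
      (insert w Y0 ∪ {x | x ∈ R1.support})) := by
    have heq : ∀ a b c d e : SimpleGraph V, a ⊔ b ⊔ c ⊔ d ⊔ e = a ⊔ c ⊔ d ⊔ e ⊔ b := by intros; ac_rfl
    rw [heq] at s2
    exact s2
  obtain ⟨i3, s3⟩ := MemF.leg (by omega) R2 hR2 _ _ (Or.inl (Set.mem_insert _ _)) (Or.inl (Set.mem_insert_of_mem _ hp2)) hw2
    (by
      intro x hx hxY
      rcases hxY with (h | h) | h
      · exact h
      · exact absurd h (hY2 x hx)
      · exact hR12 x hx h)
    (by
      intro u v huv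
      simp only [sup_adj, inn_adj, edge_adj, fromEdgeSet_adj] at huv
      rcases huv with ((h | ⟨⟨rfl, rfl⟩ | ⟨rfl, rfl⟩, _⟩) | ⟨h, _⟩) | ⟨⟨rfl, rfl⟩ | ⟨rfl, rfl⟩, _⟩
      · exact ⟨Or.inl (Or.inr h.2.1), Or.inl (Or.inr h.2.2)⟩
      · exact ⟨Or.inl (Or.inl rfl), Or.inl (Or.inr hp3)⟩
      · exact ⟨Or.inl (Or.inr hp3), Or.inl (Or.inl rfl)⟩
      · exact ⟨Or.inr (R1.fst_mem_support_of_mem_edges h), Or.inr (R1.snd_mem_support_of_mem_edges h)⟩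
      · exact ⟨Or.inr R1.end_mem_support, Or.inl (Or.inr hp1)⟩
      · exact ⟨Or.inl (Or.inr hp1), Or.inr R1.end_mem_support⟩)
    (by
      simp only [sup_adj, inn_adj, edge_adj, fromEdgeSet_adj]
      rintro (((h | ⟨⟨_, h⟩ | ⟨h, _⟩, _⟩) | ⟨h, _⟩) | ⟨⟨_, h⟩ | ⟨h, _⟩, _⟩)
      · exact hw0 h.2.1
      · exact h23 h
      · exact hw3 h
      · exact hY1 _ (R1.snd_mem_support_of_mem_edges h) hp2
      · exact h12 h.symm
      · exact hw1 h) s2'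
  have s3' : MemF i3 (m + 1) (((inn G Y0 ⊔ fromEdgeSet {e | e ∈ R1.edges} ⊔ edge q1 p1 ⊔ fromEdgeSet {e | e ∈ R2.edges} ⊔ edge q2 p2) ⊔ edge w p3).induce
      (insert w Y0 ∪ {x | x ∈ R1.support} ∪ {x | x ∈ R2.support})) := by
    have heq : ∀ a b c d e f : SimpleGraph V, a ⊔ b ⊔ c ⊔ d ⊔ e ⊔ f = a ⊔ c ⊔ d ⊔ e ⊔ f ⊔ b := by intros; ac_rfl
    rw [heq] at s3
    exact s3
  obtain ⟨i4, s4⟩ := MemF.leg (by omega) R3 hR3 _ _ (Or.inl (Or.inl (Set.mem_insert _ _))) (Or.inl (Or.inl (Set.mem_insert_of_mem _ hp3))) hw3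
    (by
      intro x hx hxY
      rcases hxY with ((h | h) | h) | h
      · exact h
      · exact absurd h (hY3 x hx)
      · exact hR13 x hx h
      · exact hR23 x hx h)
    (by
      intro u v huv
      simp only [sup_adj, inn_adj, edge_adj, fromEdgeSet_adj] at huv
      rcases huv with (((h | ⟨h, _⟩) | ⟨⟨rfl, rfl⟩ | ⟨rfl, rfl⟩, _⟩) | ⟨h, _⟩) | ⟨⟨rfl, rfl⟩ | ⟨rfl, rfl⟩, _⟩
      · exact ⟨Or.inl (Or.inl (Or.inr h.2.1)), Or.inl (Or.inl (Or.inr h.2.2))⟩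
      · exact ⟨Or.inl (Or.inr (R1.fst_mem_support_of_mem_edges h)), Or.inl (Or.inr (R1.snd_mem_support_of_mem_edges h))⟩
      · exact ⟨Or.inl (Or.inr R1.end_mem_support), Or.inl (Or.inl (Or.inr hp1))⟩
      · exact ⟨Or.inl (Or.inl (Or.inr hp1)), Or.inl (Or.inr R1.end_mem_support)⟩
      · exact ⟨(Or.inr (R2.fst_mem_support_of_mem_edges h)), (Or.inr (R2.snd_mem_support_of_mem_edges h))⟩
      · exact ⟨Or.inr R2.end_mem_support, Or.inl (Or.inl (Or.inr hp2))⟩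
      · exact ⟨Or.inl (Or.inl (Or.inr hp2)), Or.inr R2.end_mem_support⟩)
    (by
      simp only [sup_adj, inn_adj, edge_adj, fromEdgeSet_adj]
      rintro ((((h | ⟨h, _⟩) | ⟨⟨_, h⟩ | ⟨h, _⟩, _⟩) | ⟨h, _⟩) | ⟨⟨_, h⟩ | ⟨h, _⟩, _⟩)
      · exact hw0 h.2.1
      · exact hY1 _ (R1.snd_mem_support_of_mem_edges h) hp3
      · exact h13 h.symm
      · exact hw1 h
      · exact hY2 _ (R2.snd_mem_support_of_mem_edges h) hp3
      · exact h23 h.symm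
      · exact hw2 h) s3'
  have hYY : (insert w Y0 ∪ {x | x ∈ R1.support} ∪ {x | x ∈ R2.support} ∪ {x | x ∈ R3.support}) = Y' := by
    ext x
    rw [hY]
    simp only [Set.mem_union, Set.mem_insert_iff, Set.mem_ofPred_eq]
    constructor
    · rintro ((((rfl | h) | h) | h) | h)
      · exact Or.inr (Or.inl R1.start_mem_support)
      all_goals tauto
    · tauto
  refine ⟨i4, s4.congr hYY ?_⟩
  intro u hu v hv
  rw [hYY] at hu hv
  rw [hE u hu v hv]
  simp only [sup_adj, inn_adj, edge_adj, fromEdgeSet_adj, Set.mem_ofPred_eq, Sym2.eq_iff]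
  have e1 := hedge R1 u v
  have e2 := hedge R2 u v
  have e3 := hedge R3 u v
  have g1 : ∀ q p, q ∉ Y0 → p ∈ Y0 → ((u = q ∧ v = p ∨ u = p ∧ v = q) ∧ u ≠ v ↔ (u = q ∧ v = p ∨ u = p ∧ v = q)) := by
    intro q p h1 h2
    have := hqp q p h1 h2
    constructor
    · exact fun h => h.1
    · intro h
      refine ⟨h, ?_⟩
      rcases h with ⟨rfl, rfl⟩ | ⟨rfl, rfl⟩
      · exact this
      · exact this.symm
  rw [g1 q1 p1 hq1 hp1, g1 q2 p2 hq2 hp2, g1 q3 p3 hq3 hp3]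
  have f1 : (s(u, v) ∈ R1.edges ∧ u ≠ v) ↔ s(u, v) ∈ R1.edges := ⟨fun h => h.1, fun h => ⟨h, e1 h⟩⟩
  have f2 : (s(u, v) ∈ R2.edges ∧ u ≠ v) ↔ s(u, v) ∈ R2.edges := ⟨fun h => h.1, fun h => ⟨h, e2 h⟩⟩
  have f3 : (s(u, v) ∈ R3.edges ∧ u ≠ v) ↔ s(u, v) ∈ R3.edges := ⟨fun h => h.1, fun h => ⟨h, e3 h⟩⟩
  rw [f1, f2, f3]
  clear * -
  generalize (G.Adj u v ∧ u ∈ Y0 ∧ v ∈ Y0) = a0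
  generalize (s(u, v) ∈ R1.edges) = a1
  generalize (s(u, v) ∈ R2.edges) = a2
  generalize (s(u, v) ∈ R3.edges) = a3
  generalize (u = q1 ∧ v = p1 ∨ u = p1 ∧ v = q1) = b1
  generalize (u = q2 ∧ v = p2 ∨ u = p2 ∧ v = q2) = b2
  generalize (u = q3 ∧ v = p3 ∨ u = p3 ∧ v = q3) = b3
  tauto

end memF3

end part_Q3

section part_P4a
open Module
set_option linter.unusedSectionVars false
set_option linter.unusedVariables false
set_option linter.style.haveILetI false

section ext
variable {V : Type} [Fintype V]

lemma Zr_KU' {G : SimpleGraph V} {n : Fin 3 → V → V} (hn : Nb G n) (X U : Set V) :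
    Zr G X ⊓ KU (fa (n 0) X) (fa (n 1) X) U = Zr (delV G (U \ X)) X := by
  rw [← Zr_KU hn X (U \ X) (fun u hu => hu.2)]
  congr 1
  ext z
  simp only [mem_KU]
  constructor
  · intro h i hi; exact h i hi.1
  · intro h i hi
    by_cases hX : i ∈ X
    · exact ⟨fa_mem hX z, fa_mem hX z⟩
    · exact h i ⟨hi, hX⟩

noncomputable def resL (X : Set V) : (V → V → ℂ) →ₗ[ℂ] (V → V → ℂ) where
  toFun z := resF X z
  map_add' := by
    intro z w; ext u v
    by_cases h : u ∈ X ∧ v ∈ X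
    · simp [resF_in h.1 h.2]
    · simp [resF_out h]
  map_smul' := by
    intro c z; ext u v
    by_cases h : u ∈ X ∧ v ∈ X
    · simp [resF_in h.1 h.2]
    · simp [resF_out h]

lemma resL_apply (X : Set V) (z : V → V → ℂ) : resL X z = resF X z := rfl

open Classical in
lemma drain {T : SimpleGraph V} {X : Set V} {v : V} (h : ∃ x ∈ X, T.Reachable v x) :
    ∃ f : V → V → ℂ, (∀ x y, f x y = - f y x) ∧ (∀ x y, ¬ T.Adj x y → f x y = 0) ∧
      ∀ x, x ∉ X → ∑ y, f x y = if x = v then 1 else 0 := by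
  obtain ⟨x0, hx0, ⟨p⟩⟩ := h
  refine ⟨wf p, wf_anti p, fun x y h => wf_zero' p h, ?_⟩
  intro x hx
  rw [wf_sum, if_neg (c := x = x0) (by rintro rfl; exact hx hx0)]
  simp

lemma push {H T : SimpleGraph V} {X X' : Set V} (hTH : T ≤ H) (hXX : X ⊆ X') (hT : ∀ u v, T.Adj u v → u ∈ X')
    (hd : ∀ v ∈ X', ∃ x ∈ X, T.Reachable v x) {y : V → V → ℂ} (hy : y ∈ Zr H X') :
    ∃ z ∈ Zr H X, resF X' z = y := by
  classical
  have hy' := mem_Zr.1 hy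
  have hf : ∀ v : V, ∃ f : V → V → ℂ, v ∈ X' → (∀ x y, f x y = - f y x) ∧ (∀ x y, ¬ T.Adj x y → f x y = 0) ∧
      ∀ x, x ∉ X → ∑ y, f x y = if x = v then 1 else 0 := by
    intro v
    by_cases hv : v ∈ X'
    · obtain ⟨f, hf⟩ := drain (hd v hv); exact ⟨f, fun _ => hf⟩
    · exact ⟨0, fun h => absurd h hv⟩
  choose f hf using hf
  let D : Finset V := Finset.univ.filter (fun v => v ∈ X')
  let w : V → V → ℂ := fun a b => y a b - ∑ v ∈ D, (∑ u, y v u) * f v a b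
  have hwanti : ∀ a b, w a b = - w b a := by
    intro a b
    simp only [w]
    rw [hy'.1 a b, neg_sub, sub_eq_add_neg, add_comm, ← Finset.sum_neg_distrib, sub_eq_add_neg]
    congr 1
    apply Finset.sum_congr rfl
    intro v hv
    rw [(hf v (by simpa [D] using hv)).1 a b]; ring
  have hwz : ∀ a b, ¬ H.Adj a b → w a b = 0 := by
    intro a b hab
    simp only [w]
    rw [hy'.2.1 a b hab, Finset.sum_eq_zero, sub_zero]
    intro v hv
    rw [(hf v (by simpa [D] using hv)).2.1 a b (fun h => hab (hTH h)), mul_zero]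
  have hwsum : ∀ a, a ∉ X → ∑ b, w a b = 0 := by
    intro a ha
    simp only [w]
    rw [Finset.sum_sub_distrib, Finset.sum_comm]
    have : ∀ v ∈ D, ∑ b, (∑ u, y v u) * f v a b = (∑ u, y v u) * (if a = v then 1 else 0) := by
      intro v hv
      rw [← Finset.mul_sum, (hf v (by simpa [D] using hv)).2.2 a ha]
    rw [Finset.sum_congr rfl this]
    by_cases haX : a ∈ X'
    · have haD : a ∈ D := by simp [D, haX]
      simp [haD]
    · have haD : a ∉ D := by simp [D, haX]
      rw [hy'.2.2.2 a haX]
      simp [haD]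
  refine ⟨resF X w, mem_Zr.2 ⟨fun u v => resF_anti hwanti u v, ?_, fun u hu v hv => resF_in hu hv, ?_⟩, ?_⟩
  · intro u v huv
    by_cases h : u ∈ X ∧ v ∈ X
    · exact resF_in h.1 h.2
    · rw [resF_out h]; exact hwz u v huv
  · intro v hv; rw [resF_sum hv]; exact hwsum v hv
  · ext a b
    by_cases h : a ∈ X' ∧ b ∈ X'
    · rw [resF_in h.1 h.2, hy'.2.2.1 a h.1 b h.2]
    · rw [resF_out h, resF_out (fun h' => h ⟨hXX h'.1, hXX h'.2⟩)]
      simp only [w]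
      rw [Finset.sum_eq_zero, sub_zero]
      intro v hv
      rw [(hf v (by simpa [D] using hv)).2.1 a b (fun h' => h ⟨hT _ _ h', hT _ _ h'.symm⟩), mul_zero]

lemma ext_lemma {G T : SimpleGraph V} {n : Fin 3 → V → V} (hn : Nb G n) {X X' : Set V} (U : Finset V) {d : ℕ}
    (hTK : T ≤ delV G U) (hXX : X ⊆ X') (hT : ∀ u v, T.Adj u v → u ∈ X')
    (hd : ∀ v ∈ X', ∃ x ∈ X, T.Reachable v x) (hU : ∀ u ∈ U, u ∉ X')
    (hK : finrank ℂ (Zr (delV G U) X) = d) (hTd : d ≤ finrank ℂ (Zr T X))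
    (hUd : 2 * U.card + d ≤ finrank ℂ (Zr G X)) :
    Good (fa (n 0) X') (fa (n 1) X') (Zr G X') ∧ finrank ℂ (Zr G X') + d = finrank ℂ (Zr G X) ∧
    ∀ u v, u ∈ X' → v ∈ X' → G.Adj u v → (u ∈ X ∧ v ∈ X) ∨ T.Adj u v := by
  classical
  have hZT : Zr T X = Zr (delV G U) X :=
    Submodule.eq_of_le_of_finrank_le (Zr_mono hTK X) (by rw [hK]; exact hTd)
  have hTG : T ≤ G := hTK.trans delV_le
  -- kernel
  have hker : ∀ z ∈ Zr G X, (∀ a b, ¬ (a ∈ X' ∧ b ∈ X') → z a b = 0) → z ∈ Zr T X := by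
    intro z hz h0
    rw [hZT]
    have hz' := mem_Zr.1 hz
    refine mem_Zr.2 ⟨hz'.1, ?_, hz'.2.2.1, hz'.2.2.2⟩
    intro u v huv
    by_cases h : u ∈ X' ∧ v ∈ X'
    · apply hz'.2.1
      intro hG
      exact huv (delV_adj.2 ⟨hG, fun hu => hU u hu h.1, fun hv => hU v hv h.2⟩)
    · exact h0 u v h
  have hT0 : ∀ z ∈ Zr T X, resF X' z = 0 := by
    intro z hz
    ext a b
    by_cases h : a ∈ X' ∧ b ∈ X'
    · simp [resF_in h.1 h.2]
    · rw [resF_out h]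
      exact (mem_Zr.1 hz).2.1 a b (fun h' => h ⟨hT _ _ h', hT _ _ h'.symm⟩)
  let ρ : Zr G X →ₗ[ℂ] (V → V → ℂ) := (resL X').comp (Zr G X).subtype
  have hrange : LinearMap.range ρ = Zr G X' := by
    ext y
    constructor
    · rintro ⟨z, rfl⟩
      exact resF_mem hXX z.2
    · intro hy
      obtain ⟨z, hz, hzy⟩ := push hTG hXX hT hd hy
      exact ⟨⟨z, hz⟩, hzy⟩
  have hkerρ : finrank ℂ (LinearMap.ker ρ) = d := by
    have : (LinearMap.ker ρ).map (Zr G X).subtype = Zr T X := by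
      ext z
      simp only [Submodule.mem_map, LinearMap.mem_ker, Submodule.subtype_apply]
      constructor
      · rintro ⟨⟨w, hw⟩, h0, rfl⟩
        apply hker w hw
        intro a b hab
        have : resF X' w a b = 0 := congrFun (congrFun h0 a) b
        rwa [resF_out hab] at this
      · intro hz
        exact ⟨⟨z, Zr_mono hTG X hz⟩, hT0 z hz, rfl⟩
    rw [LinearEquiv.finrank_eq (Submodule.equivSubtypeMap (Zr G X) (LinearMap.ker ρ)), this, hZT, hK]
  have hfr : finrank ℂ (Zr G X') + d = finrank ℂ (Zr G X) := by
    have := LinearMap.finrank_range_add_finrank_ker ρ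
    rw [hrange, hkerρ] at this
    exact this
  refine ⟨?_, hfr, ?_⟩
  · refine perfect_good U (by omega) ?_
    rw [Zr_KU hn X' U (fun u hu => hU u hu), eq_bot_iff]
    intro y hy
    obtain ⟨z, hz, hzy⟩ := push hTK hXX hT hd hy
    rw [← hZT] at hz
    rw [Submodule.mem_bot, ← hzy, hT0 z hz]
  · intro u v hu hv huv
    by_contra hcon
    push Not at hcon
    obtain ⟨hc1, hc2⟩ := hcon
    obtain ⟨fu, hfu1, hfu2, hfu3⟩ := drain (hd u hu)
    obtain ⟨fv, hfv1, hfv2, hfv3⟩ := drain (hd v hv)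
    let w : V → V → ℂ := fun a b => unitF u v a b + fv a b - fu a b
    have hwanti : ∀ a b, w a b = - w b a := by
      intro a b; simp only [w]; rw [unitF_anti, hfu1 a b, hfv1 a b]; ring
    have hmem : resF X w ∈ Zr T X := by
      have h1 : resF X w ∈ Zr G X := by
        refine mem_Zr.2 ⟨resF_anti hwanti, ?_, fun a ha b hb => resF_in ha hb, ?_⟩
        · intro a b hab
          by_cases h : a ∈ X ∧ b ∈ X
          · exact resF_in h.1 h.2
          rw [resF_out h]
          simp only [w]
          rw [hfu2 a b (fun h => hab (hTG h)), hfv2 a b (fun h => hab (hTG h)), unitF_zero]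
          · ring
          · intro hs
            rw [Sym2.eq_iff] at hs
            rcases hs with ⟨rfl, rfl⟩ | ⟨rfl, rfl⟩
            · exact hab huv
            · exact hab huv.symm
        · intro a ha
          rw [resF_sum ha]
          simp only [w]
          rw [Finset.sum_sub_distrib, Finset.sum_add_distrib, unitF_sum, hfu3 a ha, hfv3 a ha]
          ring
      apply hker _ h1
      intro a b hab
      rw [resF_out (fun h => hab ⟨hXX h.1, hXX h.2⟩)]
      simp only [w]
      have hnT : ¬ T.Adj a b := fun h' => hab ⟨hT _ _ h', hT _ _ h'.symm⟩
      rw [hfu2 a b hnT, hfv2 a b hnT, unitF_zero]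
      · ring
      · intro hs
        rw [Sym2.eq_iff] at hs
        rcases hs with ⟨rfl, rfl⟩ | ⟨rfl, rfl⟩
        · exact hab ⟨hu, hv⟩
        · exact hab ⟨hv, hu⟩
    have h0 := (mem_Zr.1 hmem).2.1 u v hc2
    rw [resF_out (fun h => hc1 h.1 h.2)] at h0
    simp only [w] at h0
    rw [hfu2 u v hc2, hfv2 u v hc2, unitF_self huv.ne] at h0
    norm_num at h0

lemma reach_notMem {H : SimpleGraph V} {A : Set V} {q x : V} (h : (delV H A).Reachable q x) (hq : q ∉ A) : x ∉ A := by
  obtain ⟨p⟩ := h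
  induction p with
  | nil => exact hq
  | cons h p ih => exact ih (delV_adj.1 h).2.2

lemma path_flow {H : SimpleGraph V} {X : Set V} {p q p3 q3 : V} (hp : p ∈ X) (hq : q ∉ X) (hp3 : p3 ∈ X) (hq3 : q3 ∉ X)
    (hne : (p, q) ≠ (p3, q3)) (hpq : H.Adj p q) (hpq3 : H.Adj p3 q3) (hr : (delV H X).Reachable q q3) :
    ∃ z ∈ Zr H X, z p q = 1 ∧ ∀ a b, a ∈ X → b ∉ X → (a, b) ≠ (p, q) → (a, b) ≠ (p3, q3) → z a b = 0 := by
  classical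
  obtain ⟨W⟩ := hr
  have hW : ∀ a b, a ∈ X → wf W a b = 0 := fun a b ha => wf_zero' W (fun h => (delV_adj.1 h).2.1 ha)
  have hu : ∀ a b c d : V, a ∈ X → b ∉ X → c ∈ X → d ∉ X → (a, b) ≠ (c, d) → unitF c d a b = 0 ∧ unitF d c a b = 0 := by
    intro a b c d ha hb hc hd' h
    have : s(a, b) ≠ s(c, d) := by
      rw [Ne, Sym2.eq_iff]
      rintro (⟨rfl, rfl⟩ | ⟨rfl, rfl⟩)
      · exact h rfl
      · exact hb hc
    exact ⟨unitF_zero this, unitF_zero (by rw [Sym2.eq_swap (a := d)]; exact this)⟩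
  have hnX : ∀ a b c d : V, a ∈ X → b ∈ X → d ∉ X → unitF c d a b = 0 ∧ unitF d c a b = 0 := by
    intro a b c d ha hb hd'
    have : s(a, b) ≠ s(c, d) := by
      rw [Ne, Sym2.eq_iff]
      rintro (⟨rfl, rfl⟩ | ⟨rfl, rfl⟩)
      · exact hd' hb
      · exact hd' ha
    exact ⟨unitF_zero this, unitF_zero (by rw [Sym2.eq_swap (a := d)]; exact this)⟩
  have hE : ∀ a b c d : V, H.Adj c d → ¬ H.Adj a b → unitF c d a b = 0 := by
    intro a b c d h1 h2
    apply unitF_zero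
    rw [Ne, Sym2.eq_iff]
    rintro (⟨rfl, rfl⟩ | ⟨rfl, rfl⟩)
    · exact h2 h1
    · exact h2 h1.symm
  refine ⟨fun a b => unitF p q a b + wf W a b + unitF q3 p3 a b, mem_Zr.2 ⟨?_, ?_, ?_, ?_⟩, ?_, ?_⟩
  · intro a b; rw [unitF_anti, wf_anti, unitF_anti q3]; ring
  · intro a b hab
    rw [hE a b p q hpq hab, hE a b q3 p3 hpq3.symm hab, wf_zero' W (fun h => hab (delV_le h))]; ring
  · intro a ha b hb
    rw [hW a b ha, (hnX a b p q ha hb hq).1, (hnX a b p3 q3 ha hb hq3).2]; ring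
  · intro v hv
    rw [Finset.sum_add_distrib, Finset.sum_add_distrib, unitF_sum, wf_sum, unitF_sum,
      if_neg (c := v = p) (by rintro rfl; exact hv hp), if_neg (c := v = p3) (by rintro rfl; exact hv hp3)]
    ring
  · simp only []
    rw [hW p q hp, unitF_self hpq.ne, (hu p q p3 q3 hp hq hp3 hq3 hne).2]; ring
  · intro a b ha hb h1 h2
    simp only []
    rw [hW a b ha, (hu a b p q ha hb hp hq h1).1, (hu a b p3 q3 ha hb hp3 hq3 h2).2]; ring

lemma first_hit {M : SimpleGraph V} {A : Set V} {a b : V} (W : M.Walk a b) (hb : b ∈ A) :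
    ∃ w ∈ A, ∃ R : M.Walk a w, R.IsPath ∧ ∀ x ∈ R.support, x ∈ A → x = w := by
  classical
  have : ∃ w ∈ A, ∃ R : M.Walk a w, ∀ x ∈ R.support, x ∈ A → x = w := by
    induction W with
    | nil => exact ⟨_, hb, .nil, by simp⟩
    | cons h p ih =>
      rename_i u v w
      by_cases hu : u ∈ A
      · exact ⟨u, hu, .nil, by simp⟩
      · obtain ⟨w', hw', R, hR⟩ := ih hb
        refine ⟨w', hw', .cons h R, ?_⟩
        intro x hx hxA
        rw [Walk.support_cons, List.mem_cons] at hx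
        rcases hx with rfl | hx
        · exact absurd hxA hu
        · exact hR x hx hxA
  obtain ⟨w, hw, R, hR⟩ := this
  exact ⟨w, hw, R.bypass, R.bypass_isPath, fun x hx => hR x (R.support_bypass_subset hx)⟩

lemma tripod {M : SimpleGraph V} {q1 q2 q3 : V} (h1 : M.Reachable q1 q3) (h2 : M.Reachable q2 q3) :
    ∃ w, ∃ (R1 : M.Walk w q1) (R2 : M.Walk w q2) (R3 : M.Walk w q3), R1.IsPath ∧ R2.IsPath ∧ R3.IsPath ∧
      (∀ x ∈ R2.support, x ∈ R1.support → x = w) ∧ (∀ x ∈ R3.support, x ∈ R1.support → x = w) ∧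
      (∀ x ∈ R3.support, x ∈ R2.support → x = w) := by
  classical
  obtain ⟨P, hP⟩ := h1.exists_isPath
  obtain ⟨Q⟩ := h2
  obtain ⟨w, hw, R, hR, hRP⟩ := first_hit (A := {x | x ∈ P.support}) Q P.end_mem_support
  have hw' : w ∈ P.support := hw
  refine ⟨w, (P.takeUntil w hw').reverse, R.reverse, P.dropUntil w hw', (hP.takeUntil hw').reverse, hR.reverse, hP.dropUntil hw', ?_, ?_, ?_⟩
  · intro x hx hx'
    rw [Walk.support_reverse, List.mem_reverse] at hx hx'
    exact hRP x hx (P.support_takeUntil_subset hw' hx')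
  · intro x hx hx'
    rw [Walk.support_reverse, List.mem_reverse] at hx'
    by_contra hne
    have hsplit := P.take_spec hw'
    have hnd := hP.support_nodup
    rw [← hsplit, Walk.support_append] at hnd
    have hx2 : x ∈ (P.dropUntil w hw').support.tail := by
      rcases List.mem_cons.1 ((Walk.support_eq_cons _) ▸ hx : x ∈ w :: (P.dropUntil w hw').support.tail) with h | h
      · exact absurd h hne
      · exact h
    exact (List.nodup_append.1 hnd).2.2 x hx' x hx2 rfl
  · intro x hx hx'
    rw [Walk.support_reverse, List.mem_reverse] at hx'
    exact hRP x hx' (P.support_dropUntil_subset hw' hx)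

end ext

end part_P4a

section part_P4b
open Module
set_option linter.unusedSectionVars false
set_option linter.unusedVariables false
section init
variable {V : Type} [Fintype V]

lemma Closed_mono {G H : SimpleGraph V} {C : Set V} (h : H ≤ G) (hC : Closed G C) : Closed H C :=
  fun u v huv hu => hC u v (h huv) hu

lemma Zr_insert {H : SimpleGraph V} {C : Set V} (hC : Closed H C) {r : V} (hr : r ∈ C) :
    Zr H (insert r Cᶜ) = Zr H Cᶜ := by
  classical
  ext z
  constructor
  · intro hz
    have hz' := mem_Zr.1 hz
    refine mem_Zr.2 ⟨hz'.1, hz'.2.1, fun u hu v hv => hz'.2.2.1 u (Or.inr hu) v (Or.inr hv), ?_⟩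
    have hrow : ∀ v, v ≠ r → ∑ u, z v u = 0 := by
      intro v hv
      by_cases hvC : v ∈ C
      · apply hz'.2.2.2
        rintro (h | h)
        · exact hv h
        · exact h hvC
      · apply Finset.sum_eq_zero
        intro u _
        by_cases huC : u ∈ C
        · exact hz'.2.1 _ _ (fun h => hvC (hC _ _ h.symm huC))
        · exact hz'.2.2.1 v (Or.inr hvC) u (Or.inr huC)
    have htot : ∑ v, ∑ u, z v u = 0 := by
      have : ∑ v, ∑ u, z v u = - ∑ v, ∑ u, z v u := by
        conv_lhs => rw [Finset.sum_comm]
        rw [← Finset.sum_neg_distrib]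
        refine Finset.sum_congr rfl fun v _ => ?_
        rw [← Finset.sum_neg_distrib]
        exact Finset.sum_congr rfl fun u _ => hz'.1 u v
      exact self_eq_neg.1 this
    intro v hv
    by_cases h : v = r
    · subst h
      rwa [Finset.sum_eq_single v (fun b _ hb => hrow b hb) (by simp)] at htot
    · exact hrow v h
  · intro hz
    have hz' := mem_Zr.1 hz
    refine mem_Zr.2 ⟨hz'.1, hz'.2.1, ?_, fun v hv => hz'.2.2.2 v (fun h => hv (Or.inr h))⟩
    rintro u (rfl | hu) v (rfl | hv)
    · exact hz'.2.1 _ _ (H.loopless.irrefl _)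
    · exact hz'.2.1 _ _ (fun h => hv (hC _ _ h hr))
    · exact hz'.2.1 _ _ (fun h => hu (hC _ _ h.symm hr))
    · exact hz'.2.2.1 u hu v hv

lemma crit_init {G : SimpleGraph V} {n : Fin 3 → V → V} (hn : Nb G n) {C : Set V} (hC : Closed G C) {j : ℕ}
    (h : Crit G n C j) : ∃ X : Set V, Cᶜ ⊆ X ∧ (∃ i, MemF i 0 (G.induce (X ∩ C))) ∧
      finrank ℂ (Zr G X) = 2 * j ∧ Good (fa (n 0) X) (fa (n 1) X) (Zr G X) := by
  classical
  obtain ⟨hf, hgood⟩ := h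
  have hne : ∃ z ∈ Zr G Cᶜ, z ≠ 0 := by
    apply Submodule.exists_mem_ne_zero_of_ne_bot
    intro hb; rw [hb] at hf; simp at hf
  obtain ⟨z, hz, hz0⟩ := hne
  have : ∃ u v, z u v ≠ 0 := by
    by_contra hcon
    push Not at hcon
    exact hz0 (by ext u v; exact hcon u v)
  obtain ⟨u, v, huv⟩ := this
  have huC : u ∈ C := by by_contra hu; exact huv (ZrC_row hC hz hu v)
  have hadj : G.Adj u v := by by_contra hu; exact huv ((mem_Zr.1 hz).2.1 _ _ hu)
  have hvC : v ∈ C := hC _ _ hadj huC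
  have hG := hgood u v huC hvC hadj
  have hfr : finrank ℂ (Zr G Cᶜ ⊓ LinearMap.ker (cf u v) : Submodule ℂ _) = 2 * j := by
    have := finrank_ker (S := Zr G Cᶜ) (cf u v) ⟨z, hz, huv⟩
    omega
  obtain ⟨_, U0, hU0, hU0b⟩ := good_perfect hG
  rw [hfr] at hU0
  let U : Finset V := U0.filter (fun x => x ∉ Cᶜ)
  have hUset : (U : Set V) = (U0 : Set V) \ Cᶜ := by ext x; simp [U]
  have hUcard : 2 * U.card ≤ 2 * j := by
    have : U.card ≤ U0.card := Finset.card_filter_le _ _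
    omega
  have hKU := Zr_KU' hn Cᶜ (U0 : Set V)
  rw [← hUset] at hKU
  have hK1 : finrank ℂ (Zr (delV G U) Cᶜ) = 1 := by
    have h1 := finrank_ker_ge (Zr (delV G U) Cᶜ) (cf u v)
    have h2 := finrank_KU (a := fa (n 0) Cᶜ) (b := fa (n 1) Cᶜ) (Zr G Cᶜ) U0
    rw [hKU] at h2
    have h3 : Zr (delV G U) Cᶜ ⊓ LinearMap.ker (cf u v) = ⊥ := by
      rw [← hKU, inf_right_comm]; exact hU0b
    rw [h3, finrank_bot] at h1
    omega
  have hCK : Closed (delV G U) C := Closed_mono delV_le hC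
  have hcyc : ¬ (delV (delV G U) Cᶜ).IsAcyclic := by
    intro hac
    have hb := acyclic_Zr hac
    have hle : Zr (delV G U) Cᶜ ≤ Zr (delV (delV G U) Cᶜ) ∅ := by
      intro y hy
      have hy' := mem_Zr.1 hy
      refine mem_Zr.2 ⟨hy'.1, ?_, by simp, ?_⟩
      · intro a b hab
        by_cases ha : a ∈ C
        · by_cases hb : b ∈ C
          · exact hy'.2.1 _ _ (fun h' => hab (delV_adj.2 ⟨h', by simpa using ha, by simpa using hb⟩))
          · rw [hy'.1, ZrC_row hCK hy hb, neg_zero]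
        · exact ZrC_row hCK hy ha b
      · intro a _
        by_cases ha : a ∈ C
        · exact hy'.2.2.2 a (by simpa using ha)
        · exact Finset.sum_eq_zero fun b _ => ZrC_row hCK hy ha b
    rw [hb, le_bot_iff] at hle
    rw [hle, finrank_bot] at hK1
    omega
  rw [IsAcyclic] at hcyc
  push Not at hcyc
  obtain ⟨r, c, hc⟩ := hcyc
  obtain ⟨r', hrr', hw⟩ := wf_cycle_ne c hc
  have hr := delV_adj.1 hrr'
  have hrC : r ∈ C := by simpa using hr.2.1
  have hrU : r ∉ (U : Set V) := (delV_adj.1 hr.1).2.1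
  have hsC : ∀ x ∈ c.support, x ∈ C := by
    intro x hx
    have := reach_notMem (c.takeUntil x hx).reachable hr.2.1
    simpa using this
  have hsU : ∀ x ∈ c.support, x ∉ (U : Set V) := by
    intro x hx
    exact reach_notMem ((c.takeUntil x hx).reachable.mono delV_le) hrU
  let T : SimpleGraph V := fromEdgeSet {e | e ∈ c.edges}
  have hTadj : ∀ a b, T.Adj a b ↔ s(a, b) ∈ c.edges := by
    intro a b
    simp only [T, fromEdgeSet_adj, Set.mem_setOf_eq]
    exact ⟨fun h => h.1, fun h => ⟨h, (c.adj_of_mem_edges h).ne⟩⟩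
  have hZr : ∀ H : SimpleGraph V, H ≤ G → Zr H (insert r Cᶜ) = Zr H Cᶜ :=
    fun H hH => Zr_insert (Closed_mono hH hC) hrC
  have hTK : T ≤ delV G U := by
    intro a b hab
    exact delV_le (c.adj_of_mem_edges ((hTadj a b).1 hab))
  obtain ⟨g1, g2, g3⟩ := ext_lemma (T := T) (X := insert r Cᶜ) (X' := Cᶜ ∪ {x | x ∈ c.support}) hn U (d := 1) hTK
    (by rintro x (rfl | hx); exacts [Or.inr c.start_mem_support, Or.inl hx])
    (by intro a b hab; exact Or.inr (c.fst_mem_support_of_mem_edges ((hTadj a b).1 hab)))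
    (by
      rintro x (hx | hx)
      · exact ⟨x, Or.inr hx, Reachable.refl _⟩
      · have hx' : x ∈ c.support := hx
        refine ⟨r, Or.inl rfl, ?_⟩
        exact ((c.takeUntil x hx').transfer T (by
          intro e he
          have := c.edges_takeUntil_subset hx' he
          induction e with | _ a b => exact (hTadj a b).2 this)).reachable.symm)
    (by
      rintro x hx (hx' | hx')
      · have : x ∈ (U : Set V) := hx
        rw [hUset] at this
        exact this.2 hx'
      · exact hsU x hx' hx)
    (by rw [hZr _ delV_le]; exact hK1)
    (by
      rw [Nat.one_le_iff_ne_zero, Ne, Submodule.finrank_eq_zero]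
      intro hbot
      have hm : wf c ∈ Zr T (insert r Cᶜ) := by
        have hcw := mem_Zr.1 (cycle_wf c)
        refine mem_Zr.2 ⟨hcw.1, fun a b hab => wf_zero c (fun h => hab ((hTadj a b).2 h)), ?_, fun x _ => hcw.2.2.2 x (by simp)⟩
        intro a ha b hb
        apply wf_zero
        intro hab
        have h1 := hsC a (c.fst_mem_support_of_mem_edges hab)
        have h2 := hsC b (c.snd_mem_support_of_mem_edges hab)
        rcases ha with rfl | ha
        · rcases hb with rfl | hb
          · exact (c.adj_of_mem_edges hab).ne rfl
          · exact hb h2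
        · exact ha h1
      rw [hbot, Submodule.mem_bot] at hm
      rw [hm] at hw
      exact hw rfl)
    (by rw [hZr G le_rfl, hf]; omega)
  refine ⟨Cᶜ ∪ {x | x ∈ c.support}, Set.subset_union_left, ⟨c.length, ?_⟩, ?_, g1⟩
  · have hle : delV (delV G U) Cᶜ ≤ G := delV_le.trans delV_le
    have := cycle_memF (c.mapLe hle) (hc.mapLe hle) (by
      intro x y hx hy hxy
      rw [Walk.support_mapLe_eq_support] at hx hy
      rw [Walk.edges_mapLe_eq_edges]
      rcases g3 x y (Or.inr hx) (Or.inr hy) hxy with h | h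
      · exfalso
        have h1 : x = r := h.1.resolve_right (fun h' => h' (hsC x hx))
        have h2 : y = r := h.2.resolve_right (fun h' => h' (hsC y hy))
        subst h1; subst h2
        exact hxy.ne rfl
      · exact (hTadj x y).1 h)
    rw [Walk.length_map, Walk.support_mapLe_eq_support] at this
    refine this.congr ?_ (fun _ _ _ _ => Iff.rfl)
    ext x
    constructor
    · intro hx; exact ⟨Or.inr hx, hsC x hx⟩
    · rintro ⟨hx | hx, hxC⟩
      · exact absurd hxC hx
      · exact hx
  · rw [hZr G le_rfl, hf] at g2; omega

end init

end part_P4b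

section part_P4c
open Module
set_option linter.unusedSectionVars false
set_option linter.unusedVariables false
section stp
variable {V : Type} [Fintype V]

def Dl (X : Set V) : Submodule ℂ ((V → V → ℂ) →ₗ[ℂ] ℂ) :=
  Submodule.span ℂ {f | ∃ a b, a ∈ X ∧ b ∉ X ∧ f = cf a b}

lemma Dl_mem {X : Set V} {a b : V} (ha : a ∈ X) (hb : b ∉ X) : cf a b ∈ Dl X :=
  Submodule.subset_span ⟨a, b, ha, hb, rfl⟩

lemma Dl_zero {X : Set V} {z : V → V → ℂ} (h : ∀ a b, a ∈ X → b ∉ X → z a b = 0) {f} (hf : f ∈ Dl X) : f z = 0 := by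
  induction hf using Submodule.span_induction with
  | mem f hf => obtain ⟨a, b, ha, hb, rfl⟩ := hf; exact h a b ha hb
  | zero => rfl
  | add f g _ _ h1 h2 => simp [h1, h2]
  | smul c f _ h1 => simp [h1]

lemma step_a {G : SimpleGraph V} {n : Fin 3 → V → V} {C : Set V} (hC : Closed G C) {j : ℕ}
    (h : Crit G n C j) {X : Set V} (hX : Cᶜ ⊆ X) (hg : Good (fa (n 0) X) (fa (n 1) X) (Zr G X))
    {p q : V} (hp : p ∈ X) (hpC : p ∈ C) (hq : q ∉ X) (hpq : G.Adj p q) :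
    ∃ g ∈ Dl X, ∃ g' ∈ Dl X,
      Good (fa (n 0) X) (fa (n 1) X) (Zr G X ⊓ LinearMap.ker g ⊓ LinearMap.ker g') ∧
      finrank ℂ (Zr G X ⊓ LinearMap.ker g ⊓ LinearMap.ker g' : Submodule ℂ _) + 2 = finrank ℂ (Zr G X) := by
  classical
  obtain ⟨hf, hgood⟩ := h
  have hqC : q ∈ C := by by_contra hcon; exact hq (hX hcon)
  have hgC := hgood p q hpC hqC hpq
  obtain ⟨x0, hx0⟩ := hg
  have hev := (good_perfect hgC).1
  obtain ⟨x1, hx1⟩ := hgC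
  obtain ⟨s, hs1, hs2⟩ := (nd_two hx0 hx1).exists
  generalize x0 + s • x1 = x at hs1 hs2
  obtain ⟨u, hu, hdual⟩ := nd_dual hs1 (cf p q)
  have hu' := mem_Zr.1 hu
  by_cases hex : ∃ a b, a ∈ X ∧ b ∉ X ∧ u a b ≠ 0
  · obtain ⟨a, b, ha, hb, hab⟩ := hex
    obtain ⟨h1, h2⟩ := nd_LK (Yf_alt x) hs1 (g1 := cf a b) (g2 := cf p q) hu hdual hab
    exact ⟨cf a b, Dl_mem ha hb, cf p q, Dl_mem hp hq, ⟨x, h1⟩, h2⟩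
  · exfalso
    push Not at hex
    have hrow : ∀ v ∈ X, ∀ w, u v w = 0 := by
      intro v hv w
      by_cases hw : w ∈ X
      · exact hu'.2.2.1 v hv w hw
      · exact hex v w hv hw
    have huC : u ∈ Zr G Cᶜ := by
      refine mem_Zr.2 ⟨hu'.1, hu'.2.1, fun a ha b hb => hu'.2.2.1 a (hX ha) b (hX hb), ?_⟩
      intro v _
      by_cases hv : v ∈ X
      · exact Finset.sum_eq_zero fun w _ => hrow v hv w
      · exact hu'.2.2.2 v hv
    have hYf : ∀ z, Yf (fa (n 0) Cᶜ) (fa (n 1) Cᶜ) x u z = Yf (fa (n 0) X) (fa (n 1) X) x u (resF X z) := by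
      intro z
      rw [Yf_apply, Yf_apply]
      refine Finset.sum_congr rfl fun i _ => ?_
      by_cases hi : i ∈ X
      · simp only [fa_mem hi]
        by_cases hiC : i ∈ Cᶜ
        · simp only [fa_mem hiC]
        · rw [fa_notMem hiC u, fa_notMem hiC u, hrow i hi, hrow i hi]; simp
      · have hiC : i ∉ Cᶜ := fun h' => hi (hX h')
        simp only [fa_notMem hi, fa_notMem hiC]
        rw [resF_out (fun h' => hi h'.1), resF_out (fun h' => hi h'.1)]
    have hval : ∀ z ∈ Zr G Cᶜ, Yf (fa (n 0) Cᶜ) (fa (n 1) Cᶜ) x u z = z p q := by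
      intro z hz
      rw [hYf, hdual _ (resF_mem hX hz), cf_apply, resF_out (fun h' => hq h'.2)]
    have hu0 : u = 0 := by
      apply hs2 u ⟨huC, by simpa using hrow p hp q⟩
      rintro z ⟨hz1, hz2⟩
      rw [hval z hz1]; exact hz2
    have hall : ∀ z ∈ Zr G Cᶜ, z p q = 0 := by
      intro z hz
      rw [← hval z hz, hu0]; simp
    have : Zr G Cᶜ ⊓ LinearMap.ker (cf p q) = Zr G Cᶜ := by
      rw [inf_eq_left]; intro z hz; exact hall z hz
    rw [this, hf] at hev
    rw [Nat.even_iff] at hev; omega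

structure StepB (G : SimpleGraph V) (n : Fin 3 → V → V) (X : Set V) (U1 U2 : Finset V) (p q p' q' : V) : Prop where
  hp : p ∈ X
  hp' : p' ∈ X
  hq : q ∉ X
  hq' : q' ∉ X
  hz : ∃ z ∈ Zr (delV G (((U1 : Set V) ∪ U2) \ X)) X, z p q ≠ 0 ∧ z p' q' = 0
  hz' : ∃ z ∈ Zr (delV G (((U1 : Set V) ∪ U2) \ X)) X, z p q = 0 ∧ z p' q' ≠ 0
  hf : finrank ℂ (Zr (delV G (((U1 : Set V) ∪ U2) \ X)) X) = 2
  hU : 2 * (U1.card + U2.card) + 2 ≤ finrank ℂ (Zr G X)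
  hP : ∀ y ∈ Zr (delV G ((U1 : Set V) \ X)) X, y p q = 0 → y p' q' = 0 → ∀ a b, a ∈ X → b ∉ X → y a b = 0
  hg1 : Good (fa (n 0) X) (fa (n 1) X) (Zr (delV G ((U1 : Set V) \ X)) X)
  hg2 : ∃ S2, Good (fa (n 0) X) (fa (n 1) X) S2 ∧ ∀ y, y ∈ S2 ↔ y ∈ Zr (delV G ((U1 : Set V) \ X)) X ∧
    ∀ a b, a ∈ X → b ∉ X → y a b = 0

lemma step_b {G : SimpleGraph V} {n : Fin 3 → V → V} (hn : Nb G n) {X : Set V}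
    (hg : Good (fa (n 0) X) (fa (n 1) X) (Zr G X))
    (h : ∃ g ∈ Dl X, ∃ g' ∈ Dl X,
      Good (fa (n 0) X) (fa (n 1) X) (Zr G X ⊓ LinearMap.ker g ⊓ LinearMap.ker g') ∧
      finrank ℂ (Zr G X ⊓ LinearMap.ker g ⊓ LinearMap.ker g' : Submodule ℂ _) + 2 = finrank ℂ (Zr G X)) :
    ∃ U1 U2 p q p' q', StepB G n X U1 U2 p q p' q' := by
  classical
  obtain ⟨g0, hg0, g0', hg0', h1, h2⟩ := h
  obtain ⟨U1, hfU1, hG1, g, hgD, g', hgD', hG2, hfG2, hspan⟩ := red_iter hg hg0 hg0' h1 h2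
  obtain ⟨_, U2, hU2, hU2b⟩ := good_perfect hG2
  have hS1 := Zr_KU' hn X (U1 : Set V)
  have hS12 := Zr_KU' hn X ((U1 : Set V) ∪ U2)
  have hKUu : KU (fa (n 0) X) (fa (n 1) X) ((U1 : Set V) ∪ U2) =
      KU (fa (n 0) X) (fa (n 1) X) (U1 : Set V) ⊓ KU (fa (n 0) X) (fa (n 1) X) (U2 : Set V) := by
    ext z
    simp only [mem_KU, Submodule.mem_inf, Set.mem_union]
    constructor
    · intro h; exact ⟨fun i hi => h i (Or.inl hi), fun i hi => h i (Or.inr hi)⟩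
    · rintro ⟨h, h'⟩ i (hi | hi); exacts [h i hi, h' i hi]
  rw [hKUu, ← inf_assoc, hS1] at hS12
  rw [hS1] at hfU1 hG1 hG2 hfG2 hspan hU2 hU2b
  set S1 := Zr (delV G ((U1 : Set V) \ X)) X with hS1d
  set Z2 := Zr (delV G (((U1 : Set V) ∪ U2) \ X)) X with hZ2d
  have hS2 : ∀ y, y ∈ S1 ⊓ LinearMap.ker g ⊓ LinearMap.ker g' ↔ y ∈ S1 ∧ ∀ a b, a ∈ X → b ∉ X → y a b = 0 := by
    intro y
    constructor
    · rintro ⟨⟨hy1, hy2⟩, hy3⟩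
      refine ⟨hy1, fun a b ha hb => ?_⟩
      obtain ⟨α, β, hαβ⟩ := hspan _ (Dl_mem ha hb)
      have := hαβ y hy1
      rw [LinearMap.mem_ker.1 hy2, LinearMap.mem_ker.1 hy3] at this
      simpa using this
    · rintro ⟨hy1, hy2⟩
      exact ⟨⟨hy1, Dl_zero hy2 hgD⟩, Dl_zero hy2 hgD'⟩
  have hZ2b : Z2 ⊓ LinearMap.ker g ⊓ LinearMap.ker g' = ⊥ := by
    rw [← hU2b, ← hS12]; ac_rfl
  have hZ2S1 : Z2 ≤ S1 := by rw [← hS12]; exact inf_le_left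
  have hfZ2 : finrank ℂ Z2 = 2 := by
    have e1 := finrank_ker_ge Z2 g
    have e2 := finrank_ker_ge (Z2 ⊓ LinearMap.ker g) g'
    rw [hZ2b, finrank_bot] at e2
    have e3 := finrank_KU (a := fa (n 0) X) (b := fa (n 1) X) S1 U2
    rw [hS12] at e3
    omega
  have hsep : ∀ y ∈ Z2, y ≠ 0 → ∃ a b, a ∈ X ∧ b ∉ X ∧ y a b ≠ 0 := by
    intro y hy hy0
    by_contra hcon
    push Not at hcon
    have h1 := (hS2 y).2 ⟨hZ2S1 hy, hcon⟩
    have : y ∈ Z2 ⊓ LinearMap.ker g ⊓ LinearMap.ker g' := ⟨⟨hy, h1.1.2⟩, h1.2⟩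
    rw [hZ2b] at this
    exact hy0 this
  obtain ⟨y, hy, hy0⟩ : ∃ y ∈ Z2, y ≠ 0 := by
    apply Submodule.exists_mem_ne_zero_of_ne_bot
    intro hb; rw [hb] at hfZ2; simp at hfZ2
  obtain ⟨p, q, hp, hq, hypq⟩ := hsep y hy hy0
  have hf1 := finrank_ker (S := Z2) (cf p q) ⟨y, hy, hypq⟩
  obtain ⟨z', hz', hz0⟩ : ∃ z' ∈ Z2 ⊓ LinearMap.ker (cf p q), z' ≠ 0 := by
    apply Submodule.exists_mem_ne_zero_of_ne_bot
    intro hb; rw [hb] at hf1; simp at hf1; omega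
  have hz'pq : z' p q = 0 := hz'.2
  obtain ⟨p', q', hp', hq', hzpq'⟩ := hsep z' hz'.1 hz0
  have hzmem : y - (y p' q' / z' p' q') • z' ∈ Z2 := Z2.sub_mem hy (Z2.smul_mem _ hz'.1)
  refine ⟨U1, U2, p, q, p', q', hp, hp', hq, hq', ⟨_, hzmem, ?_, ?_⟩, ⟨z', hz'.1, hz'pq, hzpq'⟩, hfZ2, ?_, ?_, hG1,
    ⟨_, hG2, hS2⟩⟩
  · simp [hz'pq, hypq]
  · simp [hzpq']
  · omega
  · have e1 := finrank_ker (S := S1) (cf p q) ⟨y, hZ2S1 hy, hypq⟩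
    have e2 := finrank_ker (S := S1 ⊓ LinearMap.ker (cf p q)) (cf p' q') ⟨z', ⟨hZ2S1 hz'.1, hz'pq⟩, hzpq'⟩
    have hle : S1 ⊓ LinearMap.ker g ⊓ LinearMap.ker g' ≤ S1 ⊓ LinearMap.ker (cf p q) ⊓ LinearMap.ker (cf p' q') := by
      intro v hv
      have := (hS2 v).1 hv
      exact ⟨⟨this.1, this.2 p q hp hq⟩, this.2 p' q' hp' hq'⟩
    have heq := Submodule.eq_of_le_of_finrank_le hle (by omega)
    intro v hv hv1 hv2
    have : v ∈ S1 ⊓ LinearMap.ker g ⊓ LinearMap.ker g' := by rw [heq]; exact ⟨⟨hv, hv1⟩, hv2⟩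
    exact ((hS2 v).1 this).2

lemma step_c {G : SimpleGraph V} {n : Fin 3 → V → V} {X : Set V} {U1 U2 : Finset V} {p q p' q' : V}
    (h : StepB G n X U1 U2 p q p' q') : (delV (delV G ((U1 : Set V) \ X)) X).Reachable q q' := by
  classical
  by_contra hnr
  obtain ⟨hp, hp', hq, hq', ⟨z, hz, hzpq, hzpq'⟩, -, -, -, hP, ⟨x0, hx0⟩, S2, ⟨x1, hx1⟩, hS2⟩ := h
  have hz1 : z ∈ Zr (delV G ((U1 : Set V) \ X)) X := by
    refine Zr_mono ?_ X hz
    intro a b hab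
    have := delV_adj.1 hab
    refine delV_adj.2 ⟨this.1, fun h => this.2.1 ⟨Or.inl h.1, h.2⟩, fun h => this.2.2 ⟨Or.inl h.1, h.2⟩⟩
  clear hz
  generalize delV G ((U1 : Set V) \ X) = G1 at *
  obtain ⟨s, hs1, hs2⟩ := (nd_two hx0 hx1).exists
  generalize x0 + s • x1 = x at hs1 hs2
  obtain ⟨u, hu, hdual⟩ := nd_dual hs1 (cf p q)
  let D : Set V := {v | (delV G1 X).Reachable q v}
  have hDX : ∀ v ∈ D, v ∉ X := fun v hv => reach_notMem hv hq
  have hqD : q ∈ D := Reachable.refl _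
  let r : (V → V → ℂ) → V → V → ℂ := fun y a b => if a ∈ D ∨ b ∈ D then y a b else 0
  have hrrow : ∀ y ∈ Zr G1 X, ∀ v, v ∉ X → v ∉ D → ∀ b, r y v b = 0 := by
    intro y hy v hv hvD b
    simp only [r]
    split_ifs with hc
    · have hbD : b ∈ D := hc.resolve_left hvD
      apply (mem_Zr.1 hy).2.1
      intro hadj
      apply hvD
      have : (delV G1 X).Adj b v := delV_adj.2 ⟨hadj.symm, hDX b hbD, hv⟩
      exact Reachable.trans hbD this.reachable
    · rfl
  have hrrow' : ∀ y, ∀ v, v ∈ D → ∀ b, r y v b = y v b := by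
    intro y v hv b; simp only [r]; rw [if_pos (Or.inl hv)]
  have hr : ∀ y ∈ Zr G1 X, r y ∈ Zr G1 X := by
    intro y hy
    have hy' := mem_Zr.1 hy
    refine mem_Zr.2 ⟨?_, ?_, ?_, ?_⟩
    · intro a b; simp only [r]
      by_cases hc : a ∈ D ∨ b ∈ D
      · rw [if_pos hc, if_pos hc.symm]; exact hy'.1 a b
      · rw [if_neg hc, if_neg (fun h => hc h.symm)]; simp
    · intro a b hab; simp only [r]; rw [hy'.2.1 a b hab]; simp
    · intro a ha b hb; simp only [r]; rw [hy'.2.2.1 a ha b hb]; simp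
    · intro v hv
      by_cases hvD : v ∈ D
      · rw [Finset.sum_congr rfl fun b _ => hrrow' y v hvD b]; exact hy'.2.2.2 v hv
      · exact Finset.sum_eq_zero fun b _ => hrrow y hy v hv hvD b
  have hYf : ∀ y ∈ Zr G1 X, Yf (fa (n 0) X) (fa (n 1) X) x (r u) y = y p q := by
    intro y hy
    have : Yf (fa (n 0) X) (fa (n 1) X) x (r u) y = Yf (fa (n 0) X) (fa (n 1) X) x u (r y) := by
      rw [Yf_apply, Yf_apply]
      refine Finset.sum_congr rfl fun i _ => ?_
      by_cases hi : i ∈ X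
      · simp [fa_mem hi]
      · simp only [fa_notMem hi]
        by_cases hiD : i ∈ D
        · simp only [hrrow' _ i hiD]
        · simp only [hrrow _ hy i hi hiD, hrrow _ hu i hi hiD]; ring
    rw [this, hdual _ (hr y hy), cf_apply]
    simp [r, hqD]
  have hu1 : r u p q = 0 := by rw [← hYf _ (hr u hu), Yf_alt]
  have hu2 : r u p' q' = 0 := by
    simp only [r]
    rw [if_neg]
    rintro (hc | hc)
    · exact hDX _ hc hp'
    · exact hnr hc
  have hmem : r u ∈ S2 := (hS2 _).2 ⟨hr u hu, hP _ (hr u hu) hu1 hu2⟩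
  have h0 : r u = 0 := by
    apply hs2 _ hmem
    intro y hy
    have := (hS2 y).1 hy
    rw [hYf y this.1]
    exact this.2 p q hp hq
  apply hzpq
  rw [← hYf z hz1, h0]; simp

lemma step_d {G : SimpleGraph V} {n : Fin 3 → V → V} {X : Set V} {U1 U2 : Finset V} {p q p' q' : V}
    (h : StepB G n X U1 U2 p q p' q') :
    ∃ p3 q3, p3 ∈ X ∧ q3 ∉ X ∧ (p3, q3) ≠ (p, q) ∧ (p3, q3) ≠ (p', q') ∧ (p, q) ≠ (p', q') ∧
    (delV G (((U1 : Set V) ∪ U2) \ X)).Adj p q ∧ (delV G (((U1 : Set V) ∪ U2) \ X)).Adj p' q' ∧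
    (delV G (((U1 : Set V) ∪ U2) \ X)).Adj p3 q3 ∧
    (delV (delV G (((U1 : Set V) ∪ U2) \ X)) X).Reachable q q3 ∧
    (delV (delV G (((U1 : Set V) ∪ U2) \ X)) X).Reachable q' q3 := by
  classical
  have hc := step_c h
  obtain ⟨hp, hp', hq, hq', ⟨z, hz, hzpq, hzpq'⟩, ⟨z', hz', hz'pq, hz'pq'⟩, -, -, hP, -, -⟩ := h
  have hle : delV G (((U1 : Set V) ∪ U2) \ X) ≤ delV G ((U1 : Set V) \ X) := by
    intro a b hab
    have := delV_adj.1 hab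
    refine delV_adj.2 ⟨this.1, fun h => this.2.1 ⟨Or.inl h.1, h.2⟩, fun h => this.2.2 ⟨Or.inl h.1, h.2⟩⟩
  generalize delV G (((U1 : Set V) ∪ U2) \ X) = G2 at *
  generalize delV G ((U1 : Set V) \ X) = G1 at *
  have hadj : ∀ y ∈ Zr G2 X, ∀ a b, y a b ≠ 0 → G2.Adj a b := by
    intro y hy a b hab; by_contra hcon; exact hab ((mem_Zr.1 hy).2.1 a b hcon)
  have hle' : delV G2 X ≤ delV G1 X := by
    intro a b hab
    have := delV_adj.1 hab
    exact delV_adj.2 ⟨hle this.1, this.2⟩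
  obtain ⟨p3, q3, hp3, hq3, hne3, hz3, hr3⟩ := path_lemma hz hp hq hzpq
  obtain ⟨p4, q4, hp4, hq4, hne4, hz4, hr4⟩ := path_lemma hz' hp' hq' hz'pq'
  have h3' : (p3, q3) ≠ (p', q') := by
    intro he; rw [Prod.mk.injEq] at he; rw [he.1, he.2] at hz3; exact hz3 hzpq'
  have h4' : (p4, q4) ≠ (p, q) := by
    intro he; rw [Prod.mk.injEq] at he; rw [he.1, he.2] at hz4; exact hz4 hz'pq
  have h0 : (p, q) ≠ (p', q') := by
    intro he; rw [Prod.mk.injEq] at he; rw [he.1, he.2] at hzpq; exact hzpq hzpq'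
  have heq : (p3, q3) = (p4, q4) := by
    by_contra hne
    obtain ⟨y, hy, hy1, hy0⟩ := path_flow (H := G1) (X := X) hp3 hq3 hp4 hq4 hne (hle (hadj z hz _ _ hz3))
      (hle (hadj z' hz' _ _ hz4)) ((hr3.mono hle').symm.trans (hc.trans (hr4.mono hle')))
    have := hP y hy (hy0 p q hp hq hne3.symm h4'.symm) (hy0 p' q' hp' hq' h3'.symm hne4.symm) p3 q3 hp3 hq3
    rw [this] at hy1
    exact zero_ne_one hy1
  rw [Prod.mk.injEq] at heq
  obtain ⟨rfl, rfl⟩ := heq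
  exact ⟨p3, q3, hp3, hq3, hne3, h3', h0, hadj z hz _ _ hzpq, hadj z' hz' _ _ hz'pq', hadj z hz _ _ hz3, hr3, hr4⟩
end stp

end part_P4c

section part_P4d
open Module
set_option linter.unusedSectionVars false
set_option linter.unusedVariables false
section stpe
variable {V : Type} [Fintype V]

lemma dg_out {G : SimpleGraph V} (hs : Subcubic G) {Y : Set V} {p : V} (hp : p ∈ Y) (Q : Finset V)
    (hQ : ∀ q ∈ Q, q ∉ Y ∧ G.Adj p q) : dg (G.induce Y) ⟨p, hp⟩ + Q.card ≤ 3 := by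
  classical
  have h1 : dg (G.induce Y) ⟨p, hp⟩ = (Subtype.val '' ((G.induce Y).neighborSet ⟨p, hp⟩)).ncard := by
    rw [Set.ncard_image_of_injective _ Subtype.val_injective]; rfl
  rw [h1, ← Set.ncard_coe_finset Q, ← Set.ncard_union_eq]
  · refine le_trans (Set.ncard_le_ncard ?_ (Set.toFinite _)) (hs p)
    rintro x (⟨y, hy, rfl⟩ | hx)
    · exact hy
    · exact (hQ x hx).2
  · rw [Set.disjoint_left]
    rintro x ⟨y, hy, rfl⟩ hx
    exact (hQ _ hx).1 y.2

lemma finrank_two {S : Submodule ℂ (V → V → ℂ)} {y1 y2 : V → V → ℂ} (h1 : y1 ∈ S) (h2 : y2 ∈ S) {a b c d : V}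
    (e1 : y1 a b ≠ 0) (e2 : y2 a b = 0) (e3 : y2 c d ≠ 0) : 2 ≤ finrank ℂ S := by
  have f1 := finrank_ker (S := S) (cf a b) ⟨y1, h1, e1⟩
  have f2 := finrank_ker (S := S ⊓ LinearMap.ker (cf a b)) (cf c d) ⟨y2, ⟨h2, e2⟩, e3⟩
  omega

lemma crit_step {G : SimpleGraph V} {n : Fin 3 → V → V} (hs : Subcubic G) (hn : Nb G n) {C : Set V} (hC : Closed G C) {j : ℕ}
    (h : Crit G n C j) {X : Set V} (hX : Cᶜ ⊆ X) (hg : Good (fa (n 0) X) (fa (n 1) X) (Zr G X))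
    {i m : ℕ} (hF : MemF i m (G.induce (X ∩ C)))
    {p0 q0 : V} (hp0 : p0 ∈ X) (hpC0 : p0 ∈ C) (hq0 : q0 ∉ X) (hpq0 : G.Adj p0 q0) :
    ∃ X' : Set V, X ⊂ X' ∧ (∃ i, MemF i (m + 1) (G.induce (X' ∩ C))) ∧
      finrank ℂ (Zr G X') + 2 = finrank ℂ (Zr G X) ∧ Good (fa (n 0) X') (fa (n 1) X') (Zr G X') := by
  classical
  obtain ⟨U1, U2, p1, q1, p2, q2, hB⟩ := step_b hn hg (step_a hC h hX hg hp0 hpC0 hq0 hpq0)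
  obtain ⟨p3, q3, hp3, hq3, h31, h32, h12, a1, a2, a3, r1, r2⟩ := step_d hB
  obtain ⟨hp1, hp2, hq1, hq2, -, -, hf2, hUc, -, -, -⟩ := hB
  let U : Finset V := (U1 ∪ U2).filter (fun x => x ∉ X)
  have hUset : (U : Set V) = ((U1 : Set V) ∪ U2) \ X := by ext x; simp [U]
  have hUcard : U.card ≤ U1.card + U2.card := (Finset.card_filter_le _ _).trans (Finset.card_union_le _ _)
  rw [← hUset] at hf2 a1 a2 a3 r1 r2
  have b1 := delV_adj.1 a1
  have b2 := delV_adj.1 a2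
  have b3 := delV_adj.1 a3
  set M := delV (delV G U) X with hM
  obtain ⟨w, R1, R2, R3, hR1, hR2, hR3, hR12, hR13, hR23⟩ := tripod r1 r2
  have hMG : M ≤ G := delV_le.trans delV_le
  -- feet
  have hfeet : ∀ p q, p ∈ X → q ∉ X → G.Adj p q → p ∈ C ∧ q ∈ C := by
    intro p q hp hq hpq
    have hqC : q ∈ C := by by_contra hcon; exact hq (hX hcon)
    exact ⟨hC _ _ hpq.symm hqC, hqC⟩
  have c1 := hfeet _ _ hp1 hq1 b1.1
  have c2 := hfeet _ _ hp2 hq2 b2.1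
  have c3 := hfeet _ _ hp3 hq3 b3.1
  have hdg : ∀ p q (hp : p ∈ X ∩ C), q ∉ X → G.Adj p q → dg (G.induce (X ∩ C)) ⟨p, hp⟩ = 2 := by
    intro p q hp hq hpq
    have := dg_out hs hp {q} (by intro x hx; rw [Finset.mem_singleton] at hx; subst hx; exact ⟨fun h => hq h.1, hpq⟩)
    rw [Finset.card_singleton] at this
    rcases hF.deg23 ⟨p, hp⟩ with h | h <;> omega
  have hdist : ∀ p q p' q', p ∈ X → q ∉ X → q' ∉ X → G.Adj p q → G.Adj p' q' → (p, q) ≠ (p', q') → p ≠ p' := by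
    rintro p q p' q' hp hq hq' hpq hpq' hne rfl
    have hqq : q ≠ q' := fun h => hne (by rw [h])
    have hpXC : p ∈ X ∩ C := ⟨hp, (hfeet _ _ hp hq hpq).1⟩
    have := dg_out hs hpXC {q, q'} (by
      intro x hx; rw [Finset.mem_insert, Finset.mem_singleton] at hx
      rcases hx with rfl | rfl
      · exact ⟨fun h => hq h.1, hpq⟩
      · exact ⟨fun h => hq' h.1, hpq'⟩)
    rw [Finset.card_pair hqq] at this
    rcases hF.deg23 ⟨p, hpXC⟩ with h | h <;> omega
  -- supports
  have hsX : ∀ q, q ∉ X → ∀ (R : M.Walk w q), ∀ x ∈ R.support, x ∉ X := by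
    intro q hq R x hx
    exact reach_notMem (R.dropUntil x hx).reachable.symm hq
  have hsU : ∀ q, q ∉ (U : Set V) → ∀ (R : M.Walk w q), ∀ x ∈ R.support, x ∉ (U : Set V) := by
    intro q hq R x hx
    exact reach_notMem ((R.dropUntil x hx).reachable.symm.mono delV_le) hq
  let T : SimpleGraph V := fromEdgeSet {e | e ∈ R1.edges ∨ e ∈ R2.edges ∨ e ∈ R3.edges ∨ e = s(q1, p1) ∨ e = s(q2, p2) ∨ e = s(q3, p3)}
  have hTK0 : ∀ a b, (s(a, b) ∈ R1.edges ∨ s(a, b) ∈ R2.edges ∨ s(a, b) ∈ R3.edges ∨ s(a, b) = s(q1, p1) ∨ s(a, b) = s(q2, p2) ∨ s(a, b) = s(q3, p3))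
      → (delV G U).Adj a b := by
    rintro a b (h | h | h | h | h | h)
    · exact delV_le (R1.adj_of_mem_edges h)
    · exact delV_le (R2.adj_of_mem_edges h)
    · exact delV_le (R3.adj_of_mem_edges h)
    · rcases Sym2.eq_iff.1 h with ⟨rfl, rfl⟩ | ⟨rfl, rfl⟩; exacts [a1.symm, a1]
    · rcases Sym2.eq_iff.1 h with ⟨rfl, rfl⟩ | ⟨rfl, rfl⟩; exacts [a2.symm, a2]
    · rcases Sym2.eq_iff.1 h with ⟨rfl, rfl⟩ | ⟨rfl, rfl⟩; exacts [a3.symm, a3]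
  have hTadj : ∀ a b, T.Adj a b ↔ (s(a, b) ∈ R1.edges ∨ s(a, b) ∈ R2.edges ∨ s(a, b) ∈ R3.edges ∨ s(a, b) = s(q1, p1) ∨ s(a, b) = s(q2, p2) ∨ s(a, b) = s(q3, p3)) := by
    intro a b
    simp only [T, fromEdgeSet_adj, Set.mem_ofPred_eq]
    exact ⟨fun h => h.1, fun h => ⟨h, (hTK0 a b h).ne⟩⟩
  have hTK : T ≤ delV G U := fun a b hab => hTK0 a b ((hTadj a b).1 hab)
  have t1 : T.Adj p1 q1 := (hTadj _ _).2 (by rw [Sym2.eq_swap]; tauto)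
  have t2 : T.Adj p2 q2 := (hTadj _ _).2 (by rw [Sym2.eq_swap (a := p2)]; tauto)
  have t3 : T.Adj p3 q3 := (hTadj _ _).2 (by rw [Sym2.eq_swap (a := p3)]; tauto)
  have hRT : ∀ q (R : M.Walk w q), (∀ e ∈ R.edges, e ∈ R1.edges ∨ e ∈ R2.edges ∨ e ∈ R3.edges) →
      ∀ x ∈ R.support, (delV T X).Reachable x q := by
    intro q R hR x hx
    refine ((R.dropUntil x hx).transfer (delV T X) ?_).reachable
    intro e he
    have he' := R.edges_dropUntil_subset_edges hx he
    induction e with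
    | _ a b =>
      have h1 := delV_adj.1 (R.adj_of_mem_edges he')
      refine delV_adj.2 ⟨(hTadj a b).2 ?_, h1.2⟩
      have := hR _ he'
      tauto
  have hRT1 := hRT q1 R1 (fun e he => Or.inl he)
  have hRT2 := hRT q2 R2 (fun e he => Or.inr (Or.inl he))
  have hRT3 := hRT q3 R3 (fun e he => Or.inr (Or.inr he))
  have hw1 := hRT1 w R1.start_mem_support
  have hw2 := hRT2 w R2.start_mem_support
  have hw3 := hRT3 w R3.start_mem_support
  obtain ⟨y1, hy1, e1, e1'⟩ := path_flow (H := T) (X := X) hp1 hq1 hp3 hq3 h31.symm t1 t3 (hw1.symm.trans hw3)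
  obtain ⟨y2, hy2, e2, e2'⟩ := path_flow (H := T) (X := X) hp2 hq2 hp3 hq3 h32.symm t2 t3 (hw2.symm.trans hw3)
  have hTd : 2 ≤ finrank ℂ (Zr T X) := finrank_two hy1 hy2 (a := p1) (b := q1) (c := p2) (d := q2)
    (by rw [e1]; exact one_ne_zero) (e2' p1 q1 hp1 hq1 h12 h31.symm) (by rw [e2]; exact one_ne_zero)
  let X' : Set V := X ∪ {x | x ∈ R1.support ∨ x ∈ R2.support ∨ x ∈ R3.support}
  obtain ⟨g1, g2, g3⟩ := ext_lemma (T := T) (X := X) (X' := X') hn U (d := 2) hTK Set.subset_union_left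
    (by
      intro a b hab
      rcases (hTadj a b).1 hab with h | h | h | h | h | h
      · exact Or.inr (Or.inl (R1.fst_mem_support_of_mem_edges h))
      · exact Or.inr (Or.inr (Or.inl (R2.fst_mem_support_of_mem_edges h)))
      · exact Or.inr (Or.inr (Or.inr (R3.fst_mem_support_of_mem_edges h)))
      · rcases Sym2.eq_iff.1 h with ⟨rfl, rfl⟩ | ⟨rfl, rfl⟩
        exacts [Or.inr (Or.inl R1.end_mem_support), Or.inl hp1]
      · rcases Sym2.eq_iff.1 h with ⟨rfl, rfl⟩ | ⟨rfl, rfl⟩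
        exacts [Or.inr (Or.inr (Or.inl R2.end_mem_support)), Or.inl hp2]
      · rcases Sym2.eq_iff.1 h with ⟨rfl, rfl⟩ | ⟨rfl, rfl⟩
        exacts [Or.inr (Or.inr (Or.inr R3.end_mem_support)), Or.inl hp3])
    (by
      rintro x (hx | hx | hx | hx)
      · exact ⟨x, hx, Reachable.refl _⟩
      · exact ⟨p1, hp1, ((hRT1 x hx).mono delV_le).trans t1.symm.reachable⟩
      · exact ⟨p2, hp2, ((hRT2 x hx).mono delV_le).trans t2.symm.reachable⟩
      · exact ⟨p3, hp3, ((hRT3 x hx).mono delV_le).trans t3.symm.reachable⟩)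
    (by
      rintro x hx (hx' | hx' | hx' | hx')
      · have : x ∈ (U : Set V) := hx
        rw [hUset] at this
        exact this.2 hx'
      · exact hsU _ b1.2.2 R1 x hx' hx
      · exact hsU _ b2.2.2 R2 x hx' hx
      · exact hsU _ b3.2.2 R3 x hx' hx)
    hf2 hTd (by omega)
  refine ⟨X', ⟨Set.subset_union_left, fun hsub => hq1 (hsub (Or.inr (Or.inl R1.end_mem_support)))⟩, ?_, g2, g1⟩
  refine tripod_memF (G := G) (M := M) (E' := G) (Y0 := X ∩ C) (Y' := X' ∩ C) hF (p1 := p1) (p2 := p2) (p3 := p3)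
    ⟨hp1, c1.1⟩ ⟨hp2, c2.1⟩ ⟨hp3, c3.1⟩ (hdist _ _ _ _ hp1 hq1 hq2 b1.1 b2.1 h12)
    (hdist _ _ _ _ hp1 hq1 hq3 b1.1 b3.1 h31.symm) (hdist _ _ _ _ hp2 hq2 hq3 b2.1 b3.1 h32.symm)
    (hdg _ _ _ hq1 b1.1) (hdg _ _ _ hq2 b2.1) (hdg _ _ _ hq3 b3.1) R1 R2 R3 hR1 hR2 hR3
    (fun x hx h => hsX _ hq1 R1 x hx h.1) (fun x hx h => hsX _ hq2 R2 x hx h.1) (fun x hx h => hsX _ hq3 R3 x hx h.1)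
    hR12 hR13 hR23 ?_ ?_
  · intro x
    have hxC : x ∉ X → x ∈ C := by intro hx; by_contra hcon; exact hx (hX hcon)
    constructor
    · rintro ⟨hx | hx, hc⟩
      · exact Or.inl ⟨hx, hc⟩
      · exact Or.inr hx
    · rintro (hx | hx)
      · exact ⟨Or.inl hx.1, hx.2⟩
      · refine ⟨Or.inr hx, hxC ?_⟩
        rcases hx with hx | hx | hx
        exacts [hsX _ hq1 R1 x hx, hsX _ hq2 R2 x hx, hsX _ hq3 R3 x hx]
  · intro u hu v hv
    constructor
    · intro huv
      rcases g3 u v hu.1 hv.1 huv with h | h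
      · exact Or.inl ⟨huv, ⟨h.1, hu.2⟩, ⟨h.2, hv.2⟩⟩
      · exact Or.inr ((hTadj u v).1 h)
    · rintro (h | h)
      · exact h.1
      · exact delV_le (hTK0 u v h)

lemma MemF.nonempty' {V : Type} {G : SimpleGraph V} {i j : ℕ} (h : MemF i j G) : Nonempty V := by
  induction h with
  | cycle hi h => obtain ⟨e⟩ := h; exact ⟨e.symm 0⟩
  | k4 h => obtain ⟨e⟩ := h; exact ⟨e.symm 0⟩
  | circ hj hH hxy he1 he2 hG ih =>
    rcases hG with ⟨_, _, _, _, _, _, _, ⟨e⟩⟩ | ⟨_, _, _, _, ⟨e⟩⟩ <;> exact ⟨e.symm none⟩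
  | subd hj hH hxy hG ih => obtain ⟨e⟩ := hG; exact ⟨e.symm none⟩

lemma crit_end {G : SimpleGraph V} {n : Fin 3 → V → V} (hs : Subcubic G) (hn : Nb G n) (c : G.ConnectedComponent) {j : ℕ}
    (h : Crit G n c.supp j) : ∃ i, MemF i j (G.induce c.supp) := by
  classical
  have hC := closed_supp c
  have key : ∀ k : ℕ, ∀ X : Set V, c.suppᶜ ⊆ X → Xᶜ.ncard ≤ k → ∀ i m, MemF i m (G.induce (X ∩ c.supp)) →
      finrank ℂ (Zr G X) + 2 * m = 2 * j → Good (fa (n 0) X) (fa (n 1) X) (Zr G X) → ∃ i, MemF i j (G.induce c.supp) := by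
    intro k
    induction k with
    | zero =>
      intro X hX hk i m hF hf hg
      have hXu : X = Set.univ := by
        have : Xᶜ = ∅ := (Set.ncard_eq_zero (Set.toFinite _)).1 (by omega)
        rw [← compl_compl X, this, Set.compl_empty]
      subst hXu
      have hz : Zr G Set.univ = ⊥ := by
        rw [eq_bot_iff]
        intro z hz
        have := (mem_Zr.1 hz).2.2.1
        rw [Submodule.mem_bot]
        ext a b
        exact this a trivial b trivial
      rw [hz, finrank_bot] at hf
      have : m = j := by omega
      subst this
      rw [Set.univ_inter] at hF
      exact ⟨i, hF⟩
    | succ k ih =>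
      intro X hX hk i m hF hf hg
      by_cases hk' : Xᶜ.ncard ≤ k
      · exact ih X hX hk' i m hF hf hg
      have hne : Xᶜ.Nonempty := by
        rw [← Set.ncard_pos (Set.toFinite _)]; omega
      obtain ⟨b, hb⟩ := hne
      obtain ⟨a, ha⟩ := hF.nonempty'
      have hbc : b ∈ c.supp := by by_contra hcon; exact hb (hX hcon)
      have hr : G.Reachable a b := by
        rw [← ConnectedComponent.eq]
        rw [ConnectedComponent.mem_supp_iff] at hbc
        have := ha.2
        rw [ConnectedComponent.mem_supp_iff] at this
        rw [this, hbc]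
      obtain ⟨W⟩ := hr
      obtain ⟨d, hd, hd1, hd2⟩ := W.exists_boundary_dart X ha.1 hb
      have hd2C : d.snd ∈ c.supp := by by_contra hcon; exact hd2 (hX hcon)
      have hd1C : d.fst ∈ c.supp := hC _ _ d.adj.symm hd2C
      obtain ⟨X', hXX, ⟨i', hF'⟩, hf', hg'⟩ := crit_step hs hn hC h hX hg hF hd1 hd1C hd2 d.adj
      refine ih X' (hX.trans hXX.1) ?_ i' (m + 1) hF' (by omega) hg'
      have : X'ᶜ.ncard < Xᶜ.ncard := Set.ncard_lt_ncard (compl_lt_compl_iff_lt.2 hXX) (Set.toFinite _)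
      omega
  obtain ⟨X, hX, ⟨i, hF⟩, hf, hg⟩ := crit_init hn hC h
  exact key _ X hX le_rfl i 0 hF (by omega) hg

lemma subcubic_mono {G H : SimpleGraph V} (h : H ≤ G) (hs : Subcubic G) : Subcubic H := by
  intro v
  exact (Set.ncard_le_ncard (fun x hx => h hx) (Set.toFinite _)).trans (hs v)

theorem theoremM {G : SimpleGraph V} (hs : Subcubic G) :
    ∃ G' ≤ G, ∃ m : G'.ConnectedComponent → ℕ, fvs G ≤ ∑ᶠ c, m c ∧
      ∀ c, m c = 0 ∨ ∃ i j, m c = j + 1 ∧ MemF i j (G'.induce c.supp) := by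
  obtain ⟨n, hn⟩ := exists_Nb hs
  obtain ⟨G', hG', m, hm, hc⟩ := crit_decomp hn
  refine ⟨G', hG', m, hm, fun c => ?_⟩
  rcases hc c with h | ⟨j, hj, hcr⟩
  · exact Or.inl h
  · obtain ⟨i, hi⟩ := crit_end (subcubic_mono hG' hs) (Nb_mono hG' hn) c hcr
    exact Or.inr ⟨i, j, hj, hi⟩

end stpe

end part_P4d

section part_P5a
set_option linter.unusedSectionVars false
set_option linter.unusedVariables false

/-! ### Feedback vertex sets of members of the families -/

section fvsF

lemma delV_adj' {V : Type} {G : SimpleGraph V} {U : Set V} {u v : V} :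
    (delV G U).Adj u v ↔ G.Adj u v ∧ u ∉ U ∧ v ∉ U := Iff.rfl

/-- combinatorial form of acyclicity -/
def Ac {V : Type} (K : SimpleGraph V) : Prop :=
  ∀ X : Set V, X.Nonempty → ∃ w ∈ X, ∀ a ∈ X, ∀ b ∈ X, K.Adj w a → K.Adj w b → a = b

lemma Ac.isAcyclic {V : Type} {K : SimpleGraph V} (h : Ac K) : K.IsAcyclic := by
  classical
  intro v c hc
  obtain ⟨w, hw, hw2⟩ := h {x | x ∈ c.support} ⟨v, c.start_mem_support⟩
  have hw' : w ∈ c.support := hw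
  set d := c.rotate w hw' with hd
  have hdc : d.IsCycle := hc.rotate hw'
  have hsup : ∀ x, x ∈ d.support → x ∈ c.support := by
    intro x hx
    rw [← Walk.mem_support_rotate_iff c w hw']
    exact hx
  have hne : ¬ d.Nil := hdc.not_nil
  have h1 : K.Adj w d.snd := d.adj_snd hne
  have h2 : K.Adj w d.penultimate := (d.adj_penultimate hne).symm
  have := hw2 d.snd (hsup _ (d.getVert_mem_support 1)) d.penultimate
    (hsup _ (d.getVert_mem_support _)) h1 h2
  exact hdc.snd_ne_penultimate this

lemma Ac.mono {V : Type} {K K' : SimpleGraph V} (h : Ac K) (hle : K' ≤ K) : Ac K' := by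
  intro X hX
  obtain ⟨w, hw, h2⟩ := h X hX
  exact ⟨w, hw, fun a ha b hb h3 h4 => h2 a ha b hb (hle h3) (hle h4)⟩

/-- every edge-deleted subgraph has a feedback vertex set of size at most `k` -/
def TT {V : Type} (G : SimpleGraph V) (k : ℕ) : Prop :=
  ∀ u v, G.Adj u v → ∃ S : Set V, S.Finite ∧ S.ncard ≤ k ∧ Ac (delV (G.deleteEdges {s(u, v)}) S)

lemma TT.iso {V W : Type} {G : SimpleGraph V} {H : SimpleGraph W} {k : ℕ} (h : TT G k) (e : H ≃g G) : TT H k := by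
  intro u v huv
  obtain ⟨S, hS, hk, hA⟩ := h (e u) (e v) (e.map_adj_iff.2 huv)
  refine ⟨e.symm '' S, hS.image _, (Set.ncard_image_le hS).trans hk, ?_⟩
  intro X hX
  obtain ⟨w, ⟨w', hw', rfl⟩, hw2⟩ := hA (e '' X) (hX.image _)
  refine ⟨w', hw', fun a ha b hb h3 h4 => ?_⟩
  apply e.injective
  have key : ∀ a, (delV (H.deleteEdges {s(u, v)}) (e.symm '' S)).Adj w' a →
      (delV (G.deleteEdges {s(e u, e v)}) S).Adj (e w') (e a) := by
    intro a h
    rw [delV_adj', deleteEdges_adj] at h ⊢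
    refine ⟨⟨e.map_adj_iff.2 h.1.1, ?_⟩, ?_, ?_⟩
    · have := h.1.2
      simpa [Sym2.eq_iff] using this
    · intro hh; exact h.2.1 ⟨_, hh, e.symm_apply_apply _⟩
    · intro hh; exact h.2.2 ⟨_, hh, e.symm_apply_apply _⟩
  exact hw2 _ ⟨a, ha, rfl⟩ _ ⟨b, hb, rfl⟩ (key a h3) (key b h4)

lemma TT.subd {V : Type} {H : SimpleGraph V} {k : ℕ} (h : TT H k) {x y : V} (hxy : H.Adj x y) :
    TT (subdivide H x y) k := by
  have half : ∀ u, u = x ∨ u = y → ∃ S : Set (Option V), S.Finite ∧ S.ncard ≤ k ∧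
      Ac (delV ((subdivide H x y).deleteEdges {s(none, some u)}) S) := by
    intro u hu
    obtain ⟨S, hS, hk, hA⟩ := h x y hxy
    refine ⟨some '' S, hS.image _, (Set.ncard_image_le hS).trans hk, ?_⟩
    intro X hX
    by_cases hn : none ∈ X
    · refine ⟨none, hn, ?_⟩
      rintro (_ | a) ha (_ | b) hb h3 h4
      · rfl
      · simp [delV_adj'] at h3
      · simp [delV_adj'] at h4
      · simp only [delV_adj', deleteEdges_adj, subd_ns, Set.mem_singleton_iff, Sym2.congr_right,
          Option.some.injEq] at h3 h4
        grind
    · have hX' : (some ⁻¹' X).Nonempty := by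
        obtain ⟨p, hp⟩ := hX
        rcases p with _ | p
        · exact absurd hp hn
        · exact ⟨p, hp⟩
      obtain ⟨w, hw, hw2⟩ := hA _ hX'
      refine ⟨some w, hw, ?_⟩
      rintro (_ | a) ha (_ | b) hb h3 h4
      · rfl
      · exact absurd ha hn
      · exact absurd hb hn
      · congr 1
        simp only [delV_adj', deleteEdges_adj, subd_ss, Set.mem_singleton_iff, Set.mem_image,
          Option.some.injEq, exists_eq_right] at h3 h4
        refine hw2 a ha b hb ?_ ?_
        · simp only [delV_adj', deleteEdges_adj, Set.mem_singleton_iff]; tauto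
        · simp only [delV_adj', deleteEdges_adj, Set.mem_singleton_iff]; tauto
  rintro (_ | u) (_ | v) huv
  · simp at huv
  · exact half v (by simpa using huv)
  · rw [Sym2.eq_swap]; exact half u (by simpa using huv)
  · rw [subd_ss] at huv
    obtain ⟨S, hS, hk, hA⟩ := h u v huv.1
    refine ⟨some '' S, hS.image _, (Set.ncard_image_le hS).trans hk, ?_⟩
    intro X hX
    by_cases hXS : ∃ p ∈ X, p ∈ some '' S
    · obtain ⟨p, hp, hp2⟩ := hXS
      exact ⟨p, hp, fun a _ b _ h3 _ => absurd hp2 h3.2.1⟩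
    push Not at hXS
    by_cases hn : none ∈ X ∧ ¬ (some x ∈ X ∧ some y ∈ X)
    · refine ⟨none, hn.1, ?_⟩
      rintro (_ | a) ha (_ | b) hb h3 h4
      · rfl
      · simp [delV_adj'] at h3
      · simp [delV_adj'] at h4
      · simp only [delV_adj', deleteEdges_adj, subd_ns] at h3 h4
        grind
    · have hn' : none ∈ X → some x ∈ X ∧ some y ∈ X := by tauto
      have hX' : (some ⁻¹' X).Nonempty := by
        obtain ⟨p, hp⟩ := hX
        rcases p with _ | p
        · exact ⟨x, (hn' hp).1⟩
        · exact ⟨p, hp⟩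
      obtain ⟨w, hw, hw2⟩ := hA _ hX'
      refine ⟨some w, hw, ?_⟩
      have hnS : ∀ z, some z ∈ X → z ∉ S := fun z hz hz2 => hXS _ hz ⟨z, hz2, rfl⟩
      have hwS := hnS w hw
      have hsn : none ∈ X → (w = x ∨ w = y) → ∃ a, some a ∈ X ∧ s(w, a) = s(x, y) ∧
          (delV (H.deleteEdges {s(u, v)}) S).Adj w a := by
        intro h5 h6
        obtain ⟨h7, h8⟩ := hn' h5
        rcases h6 with rfl | rfl
        · refine ⟨y, h8, rfl, ?_⟩
          simp only [delV_adj', deleteEdges_adj, Set.mem_singleton_iff]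
          exact ⟨⟨hxy, fun h => huv.2 h.symm⟩, hwS, hnS _ h8⟩
        · refine ⟨x, h7, Sym2.eq_swap, ?_⟩
          simp only [delV_adj', deleteEdges_adj, Set.mem_singleton_iff]
          exact ⟨⟨hxy.symm, fun h => huv.2 (h.symm.trans Sym2.eq_swap)⟩, hwS, hnS _ h7⟩
      have hss : ∀ a, (delV ((subdivide H x y).deleteEdges {s(some u, some v)}) (some '' S)).Adj (some w) (some a) →
          (delV (H.deleteEdges {s(u, v)}) S).Adj w a ∧ s(w, a) ≠ s(x, y) := by
        intro a h
        simp only [delV_adj', deleteEdges_adj, subd_ss, Set.mem_singleton_iff, Set.mem_image,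
          Option.some.injEq, exists_eq_right] at h ⊢
        refine ⟨⟨⟨h.1.1.1, ?_⟩, h.2⟩, h.1.1.2⟩
        have := h.1.2
        simpa [Sym2.eq_iff] using this
      rintro (_ | a) ha (_ | b) hb h3 h4
      · rfl
      · exfalso
        have h5 : w = x ∨ w = y := by simpa [delV_adj'] using (deleteEdges_adj.1 h3.1).1
        obtain ⟨a, ha', h6, h7⟩ := hsn ha h5
        obtain ⟨h8, h9⟩ := hss b h4
        have := hw2 a ha' b hb h7 h8
        subst this
        exact h9 h6
      · exfalso
        have h5 : w = x ∨ w = y := by simpa [delV_adj'] using (deleteEdges_adj.1 h4.1).1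
        obtain ⟨b, hb', h6, h7⟩ := hsn hb h5
        obtain ⟨h8, h9⟩ := hss a h3
        have := hw2 a ha b hb' h8 h7
        subst this
        exact h9 h6
      · congr 1
        exact hw2 a ha b hb (hss a h3).1 (hss b h4).1

lemma TT.apex {V : Type} {K : SimpleGraph V} {k : ℕ} (h : TT K k) {A : Set V} (hA3 : A.ncard = 3)
    (hdeg : ∀ a ∈ A, ∃ z, K.Adj a z) : TT (addApex K A) (k + 1) := by
  classical
  have half : ∀ u, u ∈ A → ∃ S : Set (Option V), S.Finite ∧ S.ncard ≤ k + 1 ∧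
      Ac (delV ((addApex K A).deleteEdges {s(none, some u)}) S) := by
    intro u hu
    obtain ⟨a, b, c, hab, hac, hbc, rfl⟩ := Set.ncard_eq_three.1 hA3
    obtain ⟨b0, hb0, hbu, hcov⟩ : ∃ b0 ∈ ({a, b, c} : Set V), b0 ≠ u ∧ ∀ p ∈ ({a, b, c} : Set V), ∀ q ∈ ({a, b, c} : Set V),
        p ≠ u → q ≠ u → p ≠ b0 → q ≠ b0 → p = q := by
      simp only [Set.mem_insert_iff, Set.mem_singleton_iff] at hu ⊢
      rcases hu with rfl | rfl | rfl
      · exact ⟨b, by simp, hab.symm, by grind⟩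
      · exact ⟨a, by simp, hab, by grind⟩
      · exact ⟨a, by simp, hac, by grind⟩
    obtain ⟨z, hz⟩ := hdeg b0 hb0
    obtain ⟨S, hS, hk, hA⟩ := h b0 z hz
    refine ⟨some '' (insert b0 S), (hS.insert _).image _, (Set.ncard_image_le (hS.insert _)).trans
      ((Set.ncard_insert_le _ _).trans (by omega)), ?_⟩
    intro X hX
    by_cases hn : none ∈ X
    · refine ⟨none, hn, ?_⟩
      rintro (_ | p) ha (_ | q) hb h3 h4
      · rfl
      · simp [delV_adj'] at h3
      · simp [delV_adj'] at h4
      · simp only [delV_adj', deleteEdges_adj, apex_ns, Set.mem_singleton_iff, Sym2.congr_right,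
          Option.some.injEq, Set.mem_image, exists_eq_right, Set.mem_insert_iff (x := p) (a := b0),
          Set.mem_insert_iff (x := q) (a := b0)] at h3 h4
        congr 1
        exact hcov p h3.1.1 q h4.1.1 h3.1.2 h4.1.2 (fun h => h3.2.2 (Or.inl h)) (fun h => h4.2.2 (Or.inl h))
    · have hX' : (some ⁻¹' X).Nonempty := by
        obtain ⟨p, hp⟩ := hX
        rcases p with _ | p
        · exact absurd hp hn
        · exact ⟨p, hp⟩
      obtain ⟨w, hw, hw2⟩ := hA _ hX'
      refine ⟨some w, hw, ?_⟩
      rintro (_ | a) ha (_ | b) hb h3 h4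
      · rfl
      · exact absurd ha hn
      · exact absurd hb hn
      · congr 1
        simp only [delV_adj', deleteEdges_adj, apex_ss, Set.mem_singleton_iff, Set.mem_image,
          Option.some.injEq, exists_eq_right, Set.mem_insert_iff, not_or] at h3 h4
        refine hw2 a ha b hb ?_ ?_
        · simp only [delV_adj', deleteEdges_adj, Set.mem_singleton_iff, Sym2.eq_iff]; tauto
        · simp only [delV_adj', deleteEdges_adj, Set.mem_singleton_iff, Sym2.eq_iff]; tauto
  rintro (_ | u) (_ | v) huv
  · simp at huv
  · exact half v (by simpa using huv)
  · rw [Sym2.eq_swap]; exact half u (by simpa using huv)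
  · rw [apex_ss] at huv
    obtain ⟨S, hS, hk, hA⟩ := h u v huv
    refine ⟨insert none (some '' S), (hS.image _).insert _, (Set.ncard_insert_le _ _).trans
      (by have := Set.ncard_image_le (f := some) hS; omega), ?_⟩
    intro X hX
    by_cases hn : none ∈ X
    · exact ⟨none, hn, fun a _ b _ h3 _ => absurd (Set.mem_insert _ _) h3.2.1⟩
    have hX' : (some ⁻¹' X).Nonempty := by
      obtain ⟨p, hp⟩ := hX
      rcases p with _ | p
      · exact absurd hp hn
      · exact ⟨p, hp⟩
    obtain ⟨w, hw, hw2⟩ := hA _ hX'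
    refine ⟨some w, hw, ?_⟩
    rintro (_ | a) ha (_ | b) hb h3 h4
    · rfl
    · exact absurd ha hn
    · exact absurd hb hn
    · congr 1
      simp only [delV_adj', deleteEdges_adj, apex_ss, Set.mem_singleton_iff, Set.mem_image,
          Option.some.injEq, exists_eq_right, Set.mem_insert_iff, not_or, Sym2.eq_iff] at h3 h4
      refine hw2 a ha b hb ?_ ?_
      · simp only [delV_adj', deleteEdges_adj, Set.mem_singleton_iff, Sym2.eq_iff]; tauto
      · simp only [delV_adj', deleteEdges_adj, Set.mem_singleton_iff, Sym2.eq_iff]; tauto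

lemma TT_cycF (m : ℕ) : TT (cycF (m + 2)) 0 := by
  induction m with
  | zero =>
    intro u v huv
    refine ⟨∅, Set.finite_empty, by simp, ?_⟩
    have huv := huv.ne
    intro X hX
    by_cases hu : u ∈ X
    · refine ⟨u, hu, fun a _ b _ h3 h4 => ?_⟩
      have h1 := h3.1.ne
      have h2 := h4.1.ne
      have h5 : a ≠ v := by rintro rfl; exact (deleteEdges_adj.1 h3.1).2 rfl
      have h6 : b ≠ v := by rintro rfl; exact (deleteEdges_adj.1 h4.1).2 rfl
      omega
    by_cases hv : v ∈ X
    · refine ⟨v, hv, fun a _ b _ h3 h4 => ?_⟩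
      have h1 := h3.1.ne
      have h2 := h4.1.ne
      have h5 : a ≠ u := by rintro rfl; exact (deleteEdges_adj.1 h3.1).2 Sym2.eq_swap
      have h6 : b ≠ u := by rintro rfl; exact (deleteEdges_adj.1 h4.1).2 Sym2.eq_swap
      omega
    obtain ⟨w, hw⟩ := hX
    refine ⟨w, hw, fun a ha b hb h3 h4 => ?_⟩
    have : a ≠ u := by rintro rfl; exact hu ha
    have : a ≠ v := by rintro rfl; exact hv ha
    have : b ≠ u := by rintro rfl; exact hu hb
    have : b ≠ v := by rintro rfl; exact hv hb
    omega
  | succ m ih =>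
    refine TT.iso (TT.subd ih ?_) (cycSubd (by omega))
    rw [cycF_adj (by omega)]
    simp [Fin.ext_iff]

lemma TT_K4 : TT (⊤ : SimpleGraph (Fin 4)) 1 := by
  intro u v huv
  have huv := huv.ne
  obtain ⟨w, hwu, hwv⟩ : ∃ w, w ≠ u ∧ w ≠ v := by
    revert u v; decide
  refine ⟨{w}, Set.finite_singleton _, by simp, ?_⟩
  intro X hX
  by_cases hu : u ∈ X
  · refine ⟨u, hu, fun a _ b _ h3 h4 => ?_⟩
    have h1 := h3.1.ne
    have h2 := h4.1.ne
    have h5 : a ≠ v := by rintro rfl; exact (deleteEdges_adj.1 h3.1).2 rfl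
    have h6 : b ≠ v := by rintro rfl; exact (deleteEdges_adj.1 h4.1).2 rfl
    have h7 : a ≠ w := h3.2.2
    have h8 : b ≠ w := h4.2.2
    omega
  by_cases hv : v ∈ X
  · refine ⟨v, hv, fun a _ b _ h3 h4 => ?_⟩
    have h1 := h3.1.ne
    have h2 := h4.1.ne
    have h5 : a ≠ u := by rintro rfl; exact (deleteEdges_adj.1 h3.1).2 Sym2.eq_swap
    have h6 : b ≠ u := by rintro rfl; exact (deleteEdges_adj.1 h4.1).2 Sym2.eq_swap
    have h7 : a ≠ w := h3.2.2
    have h8 : b ≠ w := h4.2.2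
    omega
  obtain ⟨x, hx⟩ := hX
  refine ⟨x, hx, fun a ha b hb h3 h4 => ?_⟩
  have : a ≠ u := by rintro rfl; exact hu ha
  have : a ≠ v := by rintro rfl; exact hv ha
  have : b ≠ u := by rintro rfl; exact hu hb
  have : b ≠ v := by rintro rfl; exact hv hb
  have h1 : a ≠ w := h3.2.2
  have h2 : b ≠ w := h4.2.2
  omega

lemma exists_adj_of_dg {V : Type} {G : SimpleGraph V} {v : V} (h : dg G v ≠ 0) : ∃ z, G.Adj v z := by
  obtain ⟨z, hz⟩ := Set.nonempty_of_ncard_ne_zero h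
  exact ⟨z, hz⟩

lemma TT_circ {V W : Type} [Finite V] {H : SimpleGraph V} (hH : ∀ v, dg H v = 3) {k : ℕ} (hT : TT H k) {x y : V} (hxy : H.Adj x y)
    {e1 e2 : Sym2 (Option V)} (he1 : e1 ∈ (subdivide H x y).edgeSet)
    (he2 : e2 ∈ (subdivide H x y).edgeSet) {G : SimpleGraph W}
    (hG : IsCircOp (subdivide H x y) e1 e2 none G) : TT G (k + 1) := by
  have h3 : ∀ {V : Type} (v : V), ({some (some v), some none, none} : Set (Option (Option V))).ncard = 3 := by
    intro V v
    exact Set.ncard_eq_three.2 ⟨_, _, _, by simp, by simp, by simp, rfl⟩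
  have hd1 : ∀ v, dg (subdivide H x y) v ≠ 0 := by
    rintro (_ | v)
    · rw [dg_subd_none hxy]; simp
    · rw [dg_subd_some hxy, hH]; simp
  have hstep : ∀ {V : Type} [Finite V] {H : SimpleGraph V} {x y : V}, H.Adj x y → (∀ v, dg H v ≠ 0) → ∀ v, dg (subdivide H x y) v ≠ 0 := by
    intro V _ H x y hxy h
    rintro (_ | v)
    · rw [dg_subd_none hxy]; simp
    · rw [dg_subd_some hxy]; exact h v
  rcases hG with ⟨hne, x1, y1, x2, y2, rfl, rfl, ⟨e⟩⟩ | ⟨rfl, x1, y1, rfl, ⟨e⟩⟩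
  · rw [mem_edgeSet] at he1 he2
    have ha2 : (subdivide (subdivide H x y) x1 y1).Adj (some x2) (some y2) := by
      rw [subd_ss]; exact ⟨he2, hne.symm⟩
    refine TT.iso (TT.apex (TT.subd (TT.subd (TT.subd hT hxy) he1) ha2) (h3 _) ?_) e
    intro a _
    exact exists_adj_of_dg (hstep ha2 (hstep he1 hd1) a)
  · rw [mem_edgeSet] at he1
    have ha2 : (subdivide (subdivide H x y) x1 y1).Adj none (some y1) := by simp
    refine TT.iso (TT.apex (TT.subd (TT.subd (TT.subd hT hxy) he1) ha2) (h3 _) ?_) e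
    intro a _
    exact exists_adj_of_dg (hstep ha2 (hstep he1 hd1) a)

lemma MemF.TT {i j : ℕ} {V : Type} {G : SimpleGraph V} (h : MemF i j G) : TT G j := by
  induction h with
  | @cycle i hi V G h =>
    obtain ⟨e⟩ := h
    obtain ⟨m, rfl⟩ : ∃ m, i = m + 2 + 1 := ⟨i - 3, by omega⟩
    exact (TT_cycF m).iso (e.trans (cycFIso _))
  | k4 h => obtain ⟨e⟩ := h; exact TT_K4.iso e
  | @circ j hj V H hH x y hxy e1 e2 he1 he2 W G hG ih =>
    haveI := hH.finite
    have := TT_circ (hH.cubic rfl) ih hxy he1 he2 hG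
    rwa [Nat.sub_add_cancel (by omega)] at this
  | subd hj hH hxy hG ih => obtain ⟨e⟩ := hG; exact (ih.subd hxy).iso e

lemma MemF.vfvs {i j : ℕ} {V : Type} {G : SimpleGraph V} (h : MemF i j G) (v : V) :
    ∃ S : Set V, v ∈ S ∧ S.ncard ≤ j + 1 ∧ Ac (delV G S) := by
  have hd : dg G v ≠ 0 := by rcases h.deg23 v with h | h <;> omega
  obtain ⟨u, hu⟩ := exists_adj_of_dg hd
  obtain ⟨S, hS, hk, hA⟩ := h.TT v u hu
  refine ⟨insert v S, Set.mem_insert _ _, (Set.ncard_insert_le _ _).trans (by omega), hA.mono ?_⟩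
  intro a b hab
  simp only [delV_adj', deleteEdges_adj, Set.mem_singleton_iff, Sym2.eq_iff, Set.mem_insert_iff, not_or] at hab ⊢
  tauto

end fvsF

end part_P5a

section part_P5b
set_option linter.unusedSectionVars false
set_option linter.unusedVariables false

section counts

lemma dg_eq_degree {V : Type} [Fintype V] (G : SimpleGraph V) [DecidableRel G.Adj] (v : V) : dg G v = G.degree v := by
  rw [dg, ← card_neighborSet_eq_degree, ← Nat.card_eq_fintype_card]; rfl

lemma sum_dg {V : Type} [Fintype V] (G : SimpleGraph V) : ∑ v, dg G v = 2 * G.edgeSet.ncard := by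
  classical
  have := G.sum_degrees_eq_twice_card_edges
  rw [Set.ncard_eq_toFinset_card', ← edgeFinset, ← this]
  exact Finset.sum_congr rfl fun v _ => dg_eq_degree G v

lemma sum_dg_iso {V W : Type} [Fintype V] [Fintype W] {G : SimpleGraph V} {H : SimpleGraph W} (e : G ≃g H) :
    ∑ v, dg G v = ∑ v, dg H v :=
  Fintype.sum_equiv e.toEquiv _ _ fun v => (dg_iso e v).symm

lemma edges_iso {V W : Type} [Finite V] [Finite W] {G : SimpleGraph V} {H : SimpleGraph W} (e : G ≃g H) :
    G.edgeSet.ncard = H.edgeSet.ncard := by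
  haveI := Fintype.ofFinite V
  haveI := Fintype.ofFinite W
  have := sum_dg_iso e
  rw [sum_dg, sum_dg] at this
  omega

lemma MemF.card {i j : ℕ} {V : Type} {G : SimpleGraph V} (h : MemF i j G) : Nat.card V = 3 * j + i := by
  induction h with
  | @cycle i hi V G h =>
    obtain ⟨e⟩ := h
    rw [Nat.card_congr e.toEquiv, Nat.card_zmod]; omega
  | k4 h => obtain ⟨e⟩ := h; rw [Nat.card_congr e.toEquiv]; simp
  | @circ j hj V H hH x y hxy e1 e2 he1 he2 W G hG ih =>
    haveI := hH.finite
    rcases hG with ⟨hne, x1, y1, x2, y2, rfl, rfl, ⟨e⟩⟩ | ⟨rfl, x1, y1, rfl, ⟨e⟩⟩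
    · rw [Nat.card_congr e.toEquiv]; simp only [Finite.card_option]; omega
    · rw [Nat.card_congr e.toEquiv]; simp only [Finite.card_option]; omega
  | @subd i j hj V H hH x y hxy W G hG ih =>
    haveI := hH.finite
    obtain ⟨e⟩ := hG; rw [Nat.card_congr e.toEquiv]; simp only [Finite.card_option]; omega

lemma MemF.sum {i j : ℕ} {V : Type} [Fintype V] {G : SimpleGraph V} (h : MemF i j G) :
    ∑ v, dg G v = 10 * j + 2 * i := by
  have key : ∀ {i j : ℕ} {V : Type} {G : SimpleGraph V}, MemF i j G → ∀ [Fintype V], ∑ v, dg G v = 10 * j + 2 * i := by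
    intro i j V G h
    induction h with
    | @cycle i hi V G h =>
      intro _
      have hc := (MemF.cycle hi h).card
      obtain ⟨e⟩ := h
      have : ∀ v, dg G v = 2 := fun v => by rw [← dg_iso e, dg_cyc hi]
      simp only [this, Finset.sum_const, Finset.card_univ, smul_eq_mul, ← Nat.card_eq_fintype_card, hc]
      omega
    | k4 h =>
      intro _
      have h1 := (MemF.k4 h).card
      have h2 := (MemF.k4 h).cubic rfl
      simp only [h2, Finset.sum_const, Finset.card_univ, smul_eq_mul, ← Nat.card_eq_fintype_card, h1]
    | @circ j hj V H hH x y hxy e1 e2 he1 he2 W G hG ih =>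
      intro _
      have h1 := (MemF.circ hj hH hxy he1 he2 hG).card
      have h2 := (MemF.circ hj hH hxy he1 he2 hG).cubic rfl
      simp only [h2, Finset.sum_const, Finset.card_univ, smul_eq_mul, ← Nat.card_eq_fintype_card, h1]
      omega
    | @subd i j hj V H hH x y hxy W G hG ih =>
      intro _
      haveI := hH.finite
      haveI := Fintype.ofFinite V
      obtain ⟨e⟩ := hG
      rw [sum_dg_iso e, Fintype.sum_option, dg_subd_none hxy]
      simp only [dg_subd_some hxy, ih]
      omega
  exact key h

lemma MemF.edges {i j : ℕ} {V : Type} {G : SimpleGraph V} (h : MemF i j G) :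
    G.edgeSet.ncard = 5 * j + i := by
  haveI := h.finite
  haveI := Fintype.ofFinite V
  have := h.sum
  rw [sum_dg] at this
  omega

lemma MemF_L : MemF 3 1 Lgraph := by
  refine MemF.subd le_rfl (MemF.subd le_rfl (MemF.k4 ⟨RelIso.refl _⟩) (x := 0) (y := 1) (by simp) ⟨RelIso.refl _⟩) (x := some 2) (y := some 3) ?_
    ⟨RelIso.refl _⟩
  simp

/-- boolean adjacency of `R` -/
def Rb (u v : Fin 5 × Fin 2) : Bool :=
  ((u.2 == 0 && v.2 == 0 && (v.1 == u.1 + 1 || u.1 == v.1 + 1)) ||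
  (u.2 == 1 && v.2 == 1 && (v.1 == u.1 + 2 || u.1 == v.1 + 2)) ||
  (!(u.2 == v.2) && u.1 == v.1)) && !(u == (0, 0) && v == (1, 0)) && !(v == (0, 0) && u == (1, 0))

/-- `R` on `Fin 5 × Fin 2` -/
def RF : SimpleGraph (Fin 5 × Fin 2) where
  Adj u v := Rb u v = true
  symm := ⟨by decide⟩
  loopless := ⟨by decide⟩

lemma R_adj (u v : ZMod 5 × Fin 2) : Rgraph.Adj u v ↔ Rb u v = true := by
  have h : ∀ u v : Fin 5 × Fin 2, ((u ≠ v ∧ (((u.2 = 0 ∧ v.2 = 0 ∧ v.1 = u.1 + 1) ∨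
    (u.2 = 1 ∧ v.2 = 1 ∧ v.1 = u.1 + 2) ∨
    (u.2 = 0 ∧ v.2 = 1 ∧ u.1 = v.1)) ∨ ((v.2 = 0 ∧ u.2 = 0 ∧ u.1 = v.1 + 1) ∨
    (v.2 = 1 ∧ u.2 = 1 ∧ u.1 = v.1 + 2) ∨
    (v.2 = 0 ∧ u.2 = 1 ∧ v.1 = u.1)))) ∧ ¬ (u = (0, 0) ∧ v = (1, 0) ∨ u = (1, 0) ∧ v = (0, 0))) ↔ Rb u v = true := by
    decide
  rw [Rgraph, deleteEdges_adj, Set.mem_singleton_iff, Sym2.eq_iff, petersen, fromRel_adj]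
  exact h u v

def RIso : Rgraph ≃g RF where
  toFun u := u
  invFun u := u
  left_inv _ := rfl
  right_inv _ := rfl
  map_rel_iff' := by
    intro a b
    exact (R_adj a b).symm

/-- computable certificate check -/
lemma Ac_of_order {V : Type} [Finite V] {K : SimpleGraph V} (f : V → ℕ)
    (h : ∀ w a b, K.Adj w a → K.Adj w b → f w ≤ f a → f w ≤ f b → a = b) : Ac K := by
  intro X hX
  obtain ⟨w, hw, hmin⟩ := Set.exists_min_image X f X.toFinite hX
  exact ⟨w, hw, fun a ha b hb h3 h4 => h w a b h3 h4 (hmin a ha) (hmin b hb)⟩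

lemma R_edges : Rgraph.edgeSet.ncard = 14 := by
  rw [edges_iso RIso]
  have h : ∑ v, dg RF v = 28 := by
    have h2 : ∀ v, dg RF v = (Finset.univ.filter fun u => Rb v u = true).card := by
      intro v
      rw [dg, ← Set.ncard_coe_finset]
      congr 1
      ext u
      simp [RF]
    simp only [h2]
    decide
  rw [sum_dg] at h
  omega

/-- certificate checker -/
def Rchk (S : List (Fin 5 × Fin 2)) (f : Fin 5 → Fin 2 → ℕ) (w a : Fin 5 × Fin 2) : Bool :=
  !(S.contains w) && !(S.contains a) && Rb w a && Nat.ble (f w.1 w.2) (f a.1 a.2)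

lemma R_cert (S : List (Fin 5 × Fin 2)) (f : Fin 5 → Fin 2 → ℕ)
    (h : ∀ w a : Fin 5 × Fin 2, Rchk S f w a = true → ∀ b, Rchk S f w b = true → a = b) :
    Ac (delV RF {v | v ∈ S}) := by
  refine Ac_of_order (fun v => f v.1 v.2) ?_
  intro w a b h1 h2 h3 h4
  have h5 := delV_adj'.1 h1
  have h6 := delV_adj'.1 h2
  simp only [Set.mem_ofPred_eq] at h5 h6
  refine h w a ?_ b ?_
  · simp only [Rchk, Bool.and_eq_true, Bool.not_eq_true', List.contains_eq_mem, decide_eq_false_iff_not, Nat.ble_eq]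
    exact ⟨⟨h5.2, h5.1⟩, h3⟩
  · simp only [Rchk, Bool.and_eq_true, Bool.not_eq_true', List.contains_eq_mem, decide_eq_false_iff_not, Nat.ble_eq]
    exact ⟨⟨h6.2, h6.1⟩, h4⟩

lemma R_vfvs (v : Fin 5 × Fin 2) : ∃ S : Set (Fin 5 × Fin 2), v ∈ S ∧ S.ncard ≤ 3 ∧ Ac (delV RF S) := by
  have key : ∀ (S : List (Fin 5 × Fin 2)), v ∈ S → S.length ≤ 3 → Ac (delV RF {v | v ∈ S}) →
      ∃ S : Set (Fin 5 × Fin 2), v ∈ S ∧ S.ncard ≤ 3 ∧ Ac (delV RF S) := by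
    intro S h1 h2 h3
    refine ⟨_, h1, ?_, h3⟩
    have : {v | v ∈ S} = (S.toFinset : Set (Fin 5 × Fin 2)) := by ext; simp
    rw [this, Set.ncard_coe_finset]
    exact (List.toFinset_card_le S).trans h2
  have h1 := R_cert [(0, 0), (1, 1), (2, 1)] ![![0, 0], ![1, 0], ![2, 0], ![4, 3], ![5, 6]] (by decide)
  have h2 := R_cert [(0, 0), (1, 1), (3, 0)] ![![0, 3], ![0, 0], ![1, 4], ![0, 2], ![5, 6]] (by decide)
  have h3 := R_cert [(0, 1), (1, 0), (4, 1)] ![![0, 0], ![0, 1], ![3, 2], ![5, 4], ![6, 0]] (by decide)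
  have h4 := R_cert [(2, 0), (3, 1), (4, 0)] ![![0, 1], ![2, 3], ![0, 4], ![5, 0], ![0, 6]] (by decide)
  have hcov : ∀ v : Fin 5 × Fin 2, v ∈ [((0 : Fin 5), (0 : Fin 2)), (1, 1), (2, 1)] ∨
      v ∈ [((0 : Fin 5), (0 : Fin 2)), (1, 1), (3, 0)] ∨ v ∈ [((0 : Fin 5), (1 : Fin 2)), (1, 0), (4, 1)] ∨
      v ∈ [((2 : Fin 5), (0 : Fin 2)), (3, 1), (4, 0)] := by decide
  rcases hcov v with h | h | h | h
  · exact key _ h (by decide) h1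
  · exact key _ h (by decide) h2
  · exact key _ h (by decide) h3
  · exact key _ h (by decide) h4

lemma vfvs_iso {V W : Type} {G : SimpleGraph V} {H : SimpleGraph W} {k : ℕ} (e : G ≃g H)
    (h : ∀ v, ∃ S : Set W, v ∈ S ∧ S.ncard ≤ k ∧ Ac (delV H S)) (v : V) :
    ∃ S : Set V, v ∈ S ∧ S.ncard ≤ k ∧ Ac (delV G S) := by
  obtain ⟨S, hv, hk, hA⟩ := h (e v)
  refine ⟨e ⁻¹' S, hv, ?_, ?_⟩
  · rwa [Set.ncard_preimage_of_injective_subset_range e.injective]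
    rw [e.surjective.range_eq]; exact Set.subset_univ _
  · intro X hX
    obtain ⟨w, ⟨w', hw', rfl⟩, hw2⟩ := hA (e '' X) (hX.image _)
    refine ⟨w', hw', fun a ha b hb h3 h4 => e.injective ?_⟩
    exact hw2 _ ⟨a, ha, rfl⟩ _ ⟨b, hb, rfl⟩ ⟨e.map_adj_iff.2 h3.1, h3.2⟩ ⟨e.map_adj_iff.2 h4.1, h4.2⟩

end counts

end part_P5b

section part_P5c
set_option linter.unusedSectionVars false
set_option linter.unusedVariables false

section fg

lemma TwoConnected.finite {V : Type} {G : SimpleGraph V} (h : TwoConnected G) : Finite V :=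
  Nat.finite_of_card_ne_zero (by have := h.1; omega)

lemma reach_of_induce {V : Type} {G K : SimpleGraph V} {C : Set V} {x y : V} (hx : x ∈ C) (hy : y ∈ C)
    (hK : ∀ u v, u ∈ C → v ∈ C → G.Adj u v → K.Adj u v)
    (h : (G.induce C).Reachable ⟨x, hx⟩ ⟨y, hy⟩) : K.Reachable x y := by
  have f : G.induce C →g K := ⟨fun z => z.1, fun {a b} hab => hK _ _ a.2 b.2 hab⟩
  have := h.map (⟨fun z => z.1, fun {a b} hab => hK _ _ a.2 b.2 hab⟩ : G.induce C →g K)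
  exact this

lemma TwoConnected.reach_del {V : Type} {G K : SimpleGraph V} (h : TwoConnected G) {w x y : V}
    (hx : x ≠ w) (hy : y ≠ w) (hK : ∀ u v, u ≠ w → v ≠ w → G.Adj u v → K.Adj u v) : K.Reachable x y := by
  have h1 := h.2 {w} (by simp)
  exact reach_of_induce (C := {w}ᶜ) (by simpa using hx) (by simpa using hy)
    (fun u v hu hv => hK u v (by simpa using hu) (by simpa using hv)) (h1.preconnected _ _)

lemma TwoConnected.exists_third {V : Type} {G : SimpleGraph V} (h : TwoConnected G) (u v : V) :
    ∃ w, w ≠ u ∧ w ≠ v := by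
  haveI := h.finite
  by_contra hc
  push Not at hc
  have h1 : (Set.univ : Set V) ⊆ {u, v} := by
    intro w _
    by_cases hw : w = u
    · simp [hw]
    · simp [hc w hw]
  have h2 := Set.ncard_le_ncard h1 (Set.toFinite _)
  rw [Set.ncard_univ] at h2
  have h3 := Set.ncard_insert_le u {v}
  rw [Set.ncard_singleton] at h3
  have := h.1
  omega

lemma TwoConnected.del_edge {V : Type} {G : SimpleGraph V} (h : TwoConnected G) (e : Sym2 V) :
    (G.deleteEdges {e}).Connected := by
  obtain ⟨u, v⟩ := e
  have hV : Nonempty V := ⟨u⟩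
  have key1 : ∀ x y, x ≠ u → y ≠ u → (G.deleteEdges {s(u, v)}).Reachable x y := fun x y hx hy =>
    h.reach_del hx hy fun a b ha hb hab => by
      rw [deleteEdges_adj, Set.mem_singleton_iff, Sym2.eq_iff]; grind
  have key2 : ∀ x y, x ≠ v → y ≠ v → (G.deleteEdges {s(u, v)}).Reachable x y := fun x y hx hy =>
    h.reach_del hx hy fun a b ha hb hab => by
      rw [deleteEdges_adj, Set.mem_singleton_iff, Sym2.eq_iff]; grind
  obtain ⟨w, hwu, hwv⟩ := h.exists_third u v
  have hall : ∀ x, (G.deleteEdges {s(u, v)}).Reachable x w := by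
    intro x
    by_cases hx : x = u
    · by_cases hxv : x = v
      · by_cases hG : G.Adj u v
        · exact absurd (hx.symm.trans hxv) hG.ne
        · have h0 := h.2 ∅ (by simp)
          have : (G.induce (∅ : Set V)ᶜ).Reachable ⟨x, by simp⟩ ⟨w, by simp⟩ := h0.preconnected _ _
          refine reach_of_induce (by simp) (by simp) ?_ this
          intro a b _ _ hab
          rw [deleteEdges_adj, Set.mem_singleton_iff, Sym2.eq_iff]
          refine ⟨hab, ?_⟩
          rintro (⟨rfl, rfl⟩ | ⟨rfl, rfl⟩)
          · exact hG hab
          · exact hG hab.symm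
      · exact key2 x w hxv hwv
    · exact key1 x w hx hwu
  exact ⟨fun x y => (hall x).trans (hall y).symm⟩

lemma TwoConnected.connected {V : Type} {G : SimpleGraph V} (h : TwoConnected G) : G.Connected := by
  haveI : Nonempty V := (Nat.card_pos_iff.1 (by have := h.1; omega)).1
  obtain ⟨v⟩ := this
  exact (h.del_edge s(v, v)).mono (deleteEdges_le _)

/-- contracting the parts of a connected graph -/
lemma cross_edges {V : Type} [Finite V] {K H : SimpleGraph V} {k : ℕ} (hK : K.Connected) (P : V → Fin (k + 1))
    (hP : Function.Surjective P) (hH : ∀ u v, H.Adj u v → P u = P v) :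
    k ≤ (K.edgeSet \ H.edgeSet).ncard := by
  let Q : SimpleGraph (Fin (k + 1)) := SimpleGraph.fromRel fun a b => ∃ u v, K.Adj u v ∧ P u = a ∧ P v = b
  have hQ : Q.Connected := by
    haveI : Nonempty (Fin (k + 1)) := ⟨0⟩
    refine ⟨fun a b => ?_⟩
    obtain ⟨u, rfl⟩ := hP a
    obtain ⟨v, rfl⟩ := hP b
    obtain ⟨p⟩ := hK.preconnected u v
    induction p with
    | nil => rfl
    | @cons u v w huv p ih =>
      refine Reachable.trans ?_ ih
      by_cases h : P u = P v
      · rw [h]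
      · apply Adj.reachable
        rw [fromRel_adj]
        exact ⟨h, Or.inl ⟨u, v, huv, rfl, rfl⟩⟩
  have h1 := hQ.card_vert_le_card_edgeSet_add_one
  rw [Nat.card_fin] at h1
  have h2 : Q.edgeSet ⊆ Sym2.map P '' (K.edgeSet \ H.edgeSet) := by
    rintro ⟨a, b⟩ hab
    have hab : Q.Adj a b := hab
    rw [fromRel_adj] at hab
    obtain ⟨hne, ⟨u, v, huv, rfl, rfl⟩ | ⟨u, v, huv, rfl, rfl⟩⟩ := hab
    · exact ⟨s(u, v), ⟨huv, fun h => hne (hH u v h)⟩, rfl⟩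
    · exact ⟨s(u, v), ⟨huv, fun h => hne (hH u v h).symm⟩, Sym2.eq_swap⟩
  have h3 := Set.ncard_le_ncard h2 (Set.toFinite _)
  have h4 := Set.ncard_image_le (f := Sym2.map P) (Set.toFinite (K.edgeSet \ H.edgeSet))
  have h5 : Nat.card Q.edgeSet = Q.edgeSet.ncard := rfl
  omega

lemma fg_core {V : Type} [Fintype V] {G H : SimpleGraph V} {k : ℕ} (hG : TwoConnected G) (P : V → Fin (k + 1))
    (hP : Function.Surjective P) (hle : H ≤ G) (hH : ∀ u v, H.Adj u v → P u = P v)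
    (hA : (G.edgeSet \ H.edgeSet).ncard = k + 1) (N : Fin (k + 1) → ℕ)
    (hN : ∀ l, ∀ v : P ⁻¹' {l}, ∃ S : Set (P ⁻¹' {l}), v ∈ S ∧ S.ncard ≤ N l ∧ Ac (delV (H.induce (P ⁻¹' {l})) S)) :
    fvs G ≤ ∑ l, N l := by
  classical
  obtain ⟨e, he⟩ : (G.edgeSet \ H.edgeSet).Nonempty := Set.nonempty_of_ncard_ne_zero (by omega)
  obtain ⟨a, b⟩ := e
  change s(a, b) ∈ _ at he
  have hN' : ∀ l, ∃ S : Set (P ⁻¹' {l}), (∀ h : P a = l, ⟨a, h⟩ ∈ S) ∧ S.ncard ≤ N l ∧ Ac (delV (H.induce (P ⁻¹' {l})) S) := by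
    intro l
    by_cases h : P a = l
    · obtain ⟨S, h1, h2⟩ := hN l ⟨a, h⟩
      exact ⟨S, fun _ => h1, h2⟩
    · obtain ⟨u, hu⟩ := hP l
      obtain ⟨S, h1, h2⟩ := hN l ⟨u, hu⟩
      exact ⟨S, fun h' => absurd h' h, h2⟩
  choose S hSa hSN hSA using hN'
  let T : Set V := ⋃ l, Subtype.val '' S l
  have hT : ∀ l (v : P ⁻¹' {l}), v ∈ S l → v.1 ∈ T := fun l v hv => Set.mem_iUnion.2 ⟨l, v, hv, rfl⟩
  have haT : a ∈ T := hT (P a) ⟨a, rfl⟩ (hSa _ rfl)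
  have hTc : T.ncard ≤ ∑ l, N l := by
    refine (Set.ncard_iUnion_le_of_fintype _).trans (Finset.sum_le_sum fun l _ => ?_)
    exact (Set.ncard_image_le (Set.toFinite _)).trans (hSN l)
  refine le_trans (fvs_le_of_delV ?_) hTc
  have hHT : Ac (delV H T) := by
    intro X ⟨x, hx⟩
    obtain ⟨w, hw, hw2⟩ := hSA (P x) (Subtype.val ⁻¹' X) ⟨⟨x, rfl⟩, hx⟩
    have key : ∀ p, (delV H T).Adj w.1 p → ∃ hp : p ∈ P ⁻¹' {P x}, (delV (H.induce (P ⁻¹' {P x})) (S (P x))).Adj w ⟨p, hp⟩ := by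
      intro p hp
      have hp' := delV_adj'.1 hp
      have h1 : p ∈ P ⁻¹' {P x} := by
        have := hH _ _ hp'.1
        have h2 : P w.1 = P x := w.2
        simp only [Set.mem_preimage, Set.mem_singleton_iff, ← this, h2]
      exact ⟨h1, hp'.1, fun h => hp'.2.1 (hT _ _ h), fun h => hp'.2.2 (hT _ _ h)⟩
    refine ⟨w.1, hw, fun p hp q hq h3 h4 => ?_⟩
    obtain ⟨h5, h6⟩ := key p h3
    obtain ⟨h7, h8⟩ := key q h4
    exact congrArg Subtype.val (hw2 ⟨p, h5⟩ hp ⟨q, h7⟩ hq h6 h8)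
  have hconn : (G.deleteEdges {s(a, b)}).Connected := hG.del_edge _
  have hle2 : delV G T ≤ G.deleteEdges {s(a, b)} := by
    intro x y hxy
    have := delV_adj'.1 hxy
    rw [deleteEdges_adj, Set.mem_singleton_iff, Sym2.eq_iff]
    refine ⟨this.1, ?_⟩
    rintro (⟨rfl, rfl⟩ | ⟨rfl, rfl⟩)
    · exact this.2.1 haT
    · exact this.2.2 haT
  have hbr : ∀ f ∈ (G.edgeSet \ H.edgeSet) \ {s(a, b)}, (G.deleteEdges {s(a, b)}).IsBridge f := by
    intro f hf
    induction f with | _ fa fb =>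
    by_contra hnb
    have h1 := hconn.connected_delete_edge_of_not_isBridge hnb
    have h2 := cross_edges (H := H) h1 P hP hH
    have h3 : (((G.deleteEdges {s(a, b)}).deleteEdges {s(fa, fb)}).edgeSet \ H.edgeSet) ⊆ ((G.edgeSet \ H.edgeSet) \ {s(a, b)}) \ {s(fa, fb)} := by
      rintro z ⟨hz, hz2⟩
      rw [edgeSet_deleteEdges, edgeSet_deleteEdges] at hz
      exact ⟨⟨⟨hz.1.1, hz2⟩, hz.1.2⟩, hz.2⟩
    have h4 := Set.ncard_le_ncard h3 (Set.toFinite _)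
    have h5 := Set.ncard_diff_singleton_of_mem he
    have h6 := Set.ncard_diff_singleton_of_mem hf
    have h7 : 0 < ((G.edgeSet \ H.edgeSet) \ {s(a, b)}).ncard := (Set.ncard_pos (Set.toFinite _)).2 ⟨_, hf⟩
    omega
  intro v c hc
  have hcT : ∀ f ∈ c.edges, f ∈ (delV H T).edgeSet := by
    intro f hf
    have h1 : f ∈ (delV G T).edgeSet := c.edges_subset_edgeSet hf
    have h2 : f ∈ H.edgeSet := by
      by_contra hfH
      have h3 : f ∈ (G.deleteEdges {s(a, b)}).edgeSet := edgeSet_mono hle2 h1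
      rw [edgeSet_deleteEdges] at h3
      have h4 := hbr f ⟨⟨h3.1, hfH⟩, h3.2⟩
      refine h4.notMem_edges_of_isCycle (p := c.mapLe hle2) (hc.mapLe hle2) ?_
      rw [Walk.edges_mapLe_eq_edges]
      exact hf
    revert h1 h2
    induction f with
    | _ x y => exact fun h1 h2 => ⟨h2, (delV_adj'.1 h1).2⟩
  exact hHT.isAcyclic (c.transfer _ hcT) (hc.transfer hcT)

lemma dg_induce {V : Type} {H : SimpleGraph V} {C : Set V} (hC : ∀ u v, H.Adj u v → u ∈ C → v ∈ C) (v : C) :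
    dg (H.induce C) v = dg H v.1 := by
  have : H.neighborSet v.1 = Subtype.val '' ((H.induce C).neighborSet v) := by
    ext u
    simp only [mem_neighborSet, Set.mem_image, comap_adj, Function.Embedding.subtype_apply, Subtype.exists, exists_and_right, exists_eq_right]
    exact ⟨fun h => ⟨hC _ _ h v.2, h⟩, fun ⟨_, h⟩ => h⟩
  rw [dg, dg, this, Set.ncard_image_of_injective _ Subtype.val_injective]

lemma sum_fib {V ι : Type} [Fintype V] [Fintype ι] (P : V → ι) (f : V → ℕ) (D : ι → ℕ)
    (h : ∀ l, ∀ [Fintype (P ⁻¹' {l})], ∑ v : P ⁻¹' {l}, f v.1 = D l) : ∑ v, f v = ∑ l, D l := by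
  classical
  rw [← Finset.sum_fiberwise Finset.univ P f]
  refine Finset.sum_congr rfl fun l _ => ?_
  rw [← h l]
  exact Finset.sum_subtype _ (by simp) _

lemma MemFG.bounds {g i j k : ℕ} {V : Type} [Fintype V] {G : SimpleGraph V} (h : MemFG g i j k G) :
    (g = 4 ∧ fvs G ≤ j + 1 + 2 * k ∧ G.edgeSet.ncard = 5 * j + i + 9 * k + 1) ∨
    (g = 5 ∧ fvs G ≤ j + 1 + 3 * k ∧ G.edgeSet.ncard = 5 * j + i + 15 * k + 1) := by
  classical
  obtain ⟨h2, hs, P, H, hle, hP, h0, hg, hA, -⟩ := h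
  have hsurj0 : ∃ a, P a = 0 := by obtain ⟨a⟩ := h0.nonempty'; exact ⟨a.1, a.2⟩
  have hcl : ∀ l, ∀ u v, H.Adj u v → u ∈ P ⁻¹' {l} → v ∈ P ⁻¹' {l} := by
    intro l u v huv hu
    have : P u = l := hu
    rw [Set.mem_preimage, ← hP u v huv]; exact hu
  have hE : G.edgeSet.ncard = H.edgeSet.ncard + (k + 1) := by
    have := Set.ncard_sdiff_add_ncard_of_subset (edgeSet_mono hle) (Set.toFinite _)
    omega
  have hsum : ∀ D : Fin (k + 1) → ℕ, (∀ l, ∀ [Fintype (P ⁻¹' {l})], ∑ v, dg (H.induce (P ⁻¹' {l})) v = D l) → 2 * H.edgeSet.ncard = ∑ l, D l := by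
    intro D hD
    rw [← sum_dg]
    refine sum_fib P _ D fun l _ => ?_
    rw [← hD l]
    exact Finset.sum_congr rfl fun v _ => (dg_induce (hcl l) v).symm
  have hfin : ∀ c d : ℕ, ∑ l : Fin (k + 1), (if l = 0 then c else d) = c + k * d := by
    intro c d
    rw [Fin.sum_univ_succ]
    simp [Fin.succ_ne_zero]
  rcases hg with ⟨rfl, hL⟩ | ⟨rfl, hR⟩
  · left
    have hL' : ∀ l, l ≠ 0 → MemF 3 1 (H.induce (P ⁻¹' {l})) := fun l hl => by
      obtain ⟨e⟩ := hL l hl; exact MemF_L.iso e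
    have hsurj : Function.Surjective P := by
      intro l
      by_cases hl : l = 0
      · rw [hl]; exact hsurj0
      · obtain ⟨a⟩ := (hL' l hl).nonempty'; exact ⟨a.1, a.2⟩
    refine ⟨rfl, ?_, ?_⟩
    · have := fg_core h2 P hsurj hle hP hA (fun l => if l = 0 then j + 1 else 2) (by
        intro l v
        by_cases hl : l = 0
        · subst hl; simpa using h0.vfvs v
        · simpa [hl] using (hL' l hl).vfvs v)
      rw [hfin] at this; omega
    · have := hsum (fun l => if l = 0 then 10 * j + 2 * i else 16) (by
        intro l _
        by_cases hl : l = 0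
        · subst hl; simpa using h0.sum
        · simpa [hl] using (hL' l hl).sum)
      rw [hfin] at this; omega
  · right
    have hsurj : Function.Surjective P := by
      intro l
      by_cases hl : l = 0
      · rw [hl]; exact hsurj0
      · obtain ⟨e⟩ := hR l hl; exact ⟨(e.symm (0, 0)).1, (e.symm (0, 0)).2⟩
    refine ⟨rfl, ?_, ?_⟩
    · have := fg_core h2 P hsurj hle hP hA (fun l => if l = 0 then j + 1 else 3) (by
        intro l v
        by_cases hl : l = 0
        · subst hl; simpa using h0.vfvs v
        · obtain ⟨e⟩ := hR l hl
          simpa [hl] using vfvs_iso (e.trans RIso) R_vfvs v)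
      rw [hfin] at this; omega
    · have := hsum (fun l => if l = 0 then 10 * j + 2 * i else 28) (by
        intro l _
        by_cases hl : l = 0
        · subst hl; simpa using h0.sum
        · obtain ⟨e⟩ := hR l hl
          simp only [hl, if_false]
          rw [sum_dg, edges_iso e, R_edges])
      rw [hfin] at this; omega

lemma tg_pos {g : ℕ} : 0 ≤ tg g := by unfold tg; split_ifs <;> norm_num

/-- The bound for a graph that belongs to one of the families. -/
lemma eps_bound {g : ℕ} (hg : g = 4 ∨ g = 5) {V : Type} [Fintype V] {G : SimpleGraph V}
    (h : (∃ i j, MemF i j G) ∨ ∃ i j k, 1 ≤ i ∧ j ≤ i ∧ MemFG g i j k G) :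
    (fvs G : ℝ) ≤ tg g * G.edgeSet.ncard + eps g G := by
  classical
  unfold eps
  split_ifs with h1 h2 h3
  · obtain ⟨-, -, hF⟩ := h1.choose_spec
    set i := h1.choose.1
    set j := h1.choose.2
    have hE := hF.edges
    have hf : fvs G ≤ j + 1 := by
      obtain ⟨v⟩ := hF.nonempty'
      obtain ⟨S, -, hS, hA⟩ := hF.vfvs v
      exact (fvs_le_of_delV hA.isAcyclic).trans hS
    have hf' : (fvs G : ℝ) ≤ j + 1 := by exact_mod_cast hf
    rw [hE]
    have := le_max_left (1 - (j : ℝ) * (5 * tg g - 1) - (i : ℝ) * tg g) 0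
    push_cast
    nlinarith
  · obtain ⟨-, -, hF⟩ := h2.choose_spec
    set i := h2.choose.1
    set j := h2.choose.2.1
    set k := h2.choose.2.2
    have := le_max_left (1 - tg g - (j : ℝ) * (5 * tg g - 1) - (i : ℝ) * tg g) 0
    rcases hF.bounds with ⟨rfl, hf, hE⟩ | ⟨rfl, hf, hE⟩
    · have hf' : (fvs G : ℝ) ≤ j + 1 + 2 * k := by exact_mod_cast hf
      rw [hE]
      have ht : tg 4 = 2 / 9 := by simp [tg]
      rw [ht] at this ⊢
      push_cast
      linarith
    · have hf' : (fvs G : ℝ) ≤ j + 1 + 3 * k := by exact_mod_cast hf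
      rw [hE]
      have ht : tg 5 = 1 / 5 := by simp [tg]
      rw [ht] at this ⊢
      push_cast
      linarith
  · exfalso
    rcases h with ⟨i, j, h⟩ | ⟨i, j, k, h3, h4, h⟩
    · exact h1 ⟨(i, j), h.le.2, h.le.1, h⟩
    · exact h2 ⟨(i, j, k), h3, h4, h⟩
  · exfalso
    rcases h with ⟨i, j, h⟩ | ⟨i, j, k, h3, h4, h⟩
    · exact h1 ⟨(i, j), h.le.2, h.le.1, h⟩
    · exact h2 ⟨(i, j, k), h3, h4, h⟩
end fg

end part_P5c

section part_P6a
set_option linter.unusedSectionVars false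
set_option linter.unusedVariables false

/-! ### Identification of `L` and `R` among graphs without short cycles -/

section ident

def No3 {V : Type} (K : SimpleGraph V) : Prop := ∀ a b c, K.Adj a b → K.Adj b c → K.Adj c a → False

def No4 {V : Type} (K : SimpleGraph V) : Prop :=
  ∀ a b c d, K.Adj a b → K.Adj b c → K.Adj c d → K.Adj d a → a ≠ c → b ≠ d → False

lemma moore1 {V : Type} [Fintype V] {K : SimpleGraph V} (h3 : No3 K) (h4 : No4 K) (v : V) [DecidableRel K.Adj] :
    1 + ∑ u ∈ Finset.univ.filter (K.Adj v), dg K u ≤ Fintype.card V ∧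
    (Fintype.card V ≤ 1 + ∑ u ∈ Finset.univ.filter (K.Adj v), dg K u →
      ∀ w, w ≠ v → K.Adj v w ∨ ∃ u, K.Adj v u ∧ K.Adj u w) := by
  classical
  have hdg : ∀ u, dg K u = (Finset.univ.filter (K.Adj u)).card := by
    intro u
    rw [dg, ← Set.ncard_coe_finset]
    congr 1
    ext; simp
  simp only [hdg]
  rw [← Finset.card_sigma]
  have hv : (Finset.univ.erase v).card + 1 = Fintype.card V := by
    rw [Finset.card_erase_add_one (Finset.mem_univ v), Finset.card_univ]
  have hmaps : Set.MapsTo (fun p : (_ : V) × V => if p.2 = v then p.1 else p.2)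
      ((Finset.univ.filter (K.Adj v)).sigma fun u => Finset.univ.filter (K.Adj u)) (Finset.univ.erase v) := by
    rintro ⟨u, w⟩ hp
    simp only [Finset.coe_sigma, Set.mem_sigma_iff, Finset.mem_coe, Finset.mem_filter, Finset.mem_univ, true_and] at hp
    simp only [Finset.coe_erase, Finset.coe_univ, Set.mem_sdiff, Set.mem_univ, Set.mem_singleton_iff, true_and]
    split_ifs with h
    · exact hp.1.ne'
    · exact h
  have hinj : Set.InjOn (fun p : (_ : V) × V => if p.2 = v then p.1 else p.2)
      ((Finset.univ.filter (K.Adj v)).sigma fun u => Finset.univ.filter (K.Adj u)) := by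
    rintro ⟨u, w⟩ hp ⟨u', w'⟩ hp' heq
    simp only [Finset.coe_sigma, Set.mem_sigma_iff, Finset.mem_coe, Finset.mem_filter, Finset.mem_univ, true_and] at hp hp'
    dsimp only at heq
    split_ifs at heq with h h' h'
    · subst h heq h'; rfl
    · subst heq h
      exact (h3 _ _ _ hp.1 hp'.2.symm hp'.1.symm).elim
    · subst heq h'
      exact (h3 _ _ _ hp'.1 hp.2.symm hp.1.symm).elim
    · subst heq
      by_cases huu : u = u'
      · subst huu; rfl
      · exact (h4 v u w u' hp.1 hp.2 hp'.2.symm hp'.1.symm (Ne.symm h) huu).elim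
  have := Finset.card_le_card_of_injOn _ hmaps hinj
  refine ⟨by omega, fun hle w hw => ?_⟩
  have hsurj := Finset.surjOn_of_injOn_of_card_le _ hmaps hinj (by omega)
  obtain ⟨⟨u, x⟩, hp, heq⟩ := hsurj (show w ∈ (↑(Finset.univ.erase v) : Set V) by simp [hw])
  simp only [Finset.coe_sigma, Set.mem_sigma_iff, Finset.mem_coe, Finset.mem_filter, Finset.mem_univ, true_and] at hp
  dsimp only at heq
  split_ifs at heq with h
  · exact Or.inl (heq ▸ hp.1)
  · exact Or.inr ⟨u, hp.1, heq ▸ hp.2⟩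

lemma moore {V : Type} [Fintype V] {K : SimpleGraph V} (h3 : No3 K) (h4 : No4 K) :
    Fintype.card V + ∑ u, dg K u * dg K u ≤ Fintype.card V * Fintype.card V := by
  classical
  have hdg : ∀ u, dg K u = (Finset.univ.filter (K.Adj u)).card := by
    intro u
    rw [dg, ← Set.ncard_coe_finset]
    congr 1
    ext; simp
  have h2 : ∑ v, ∑ u ∈ Finset.univ.filter (K.Adj v), dg K u = ∑ u, dg K u * dg K u := by
    simp only [Finset.sum_filter]
    rw [Finset.sum_comm]
    refine Finset.sum_congr rfl fun u _ => ?_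
    rw [← Finset.sum_filter, Finset.sum_const, smul_eq_mul, hdg]
    congr 2
    ext w; simp [K.adj_comm]
  rw [← h2]
  calc Fintype.card V + ∑ v, ∑ u ∈ Finset.univ.filter (K.Adj v), dg K u
      = ∑ v, (1 + ∑ u ∈ Finset.univ.filter (K.Adj v), dg K u) := by
        rw [Finset.sum_add_distrib]; simp
    _ ≤ ∑ v : V, Fintype.card V := Finset.sum_le_sum fun v _ => (moore1 h3 h4 v).1
    _ = _ := by simp

lemma MemF.moore {i j : ℕ} {V : Type} {K : SimpleGraph V} (h : MemF i j K) (h3 : No3 K) (h4 : No4 K) :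
    35 * j + 5 * i ≤ (3 * j + i) * (3 * j + i) := by
  haveI := h.finite
  haveI := Fintype.ofFinite V
  have h1 := InducedForest.moore h3 h4
  have h2 := h.card
  rw [Nat.card_eq_fintype_card] at h2
  have h5 := h.sum
  have h6 : ∑ u, dg K u * dg K u + 6 * Fintype.card V = 5 * ∑ u, dg K u := by
    rw [Finset.mul_sum, show 6 * Fintype.card V = ∑ v : V, 6 by simp [mul_comm], ← Finset.sum_add_distrib]
    refine Finset.sum_congr rfl fun v _ => ?_
    rcases h.deg23 v with h | h <;> simp [h]
  rw [h2] at h1 h6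
  rw [h5] at h6
  omega

lemma iso_of_bij {V W : Type} [Finite V] [Finite W] {G : SimpleGraph V} {H : SimpleGraph W} (f : V → W)
    (hf : Function.Bijective f) (hom : ∀ u v, G.Adj u v → H.Adj (f u) (f v))
    (hc : H.edgeSet.ncard ≤ G.edgeSet.ncard) : Nonempty (G ≃g H) := by
  have h1 : Sym2.map f '' G.edgeSet ⊆ H.edgeSet := by
    rintro _ ⟨e, he, rfl⟩
    induction e with | _ a b => exact hom a b he
  have h2 : (Sym2.map f '' G.edgeSet).ncard = G.edgeSet.ncard :=
    Set.ncard_image_of_injective _ (Sym2.map.injective hf.1)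
  have h3 := Set.eq_of_subset_of_ncard_le h1 (by omega) (Set.toFinite _)
  refine ⟨⟨Equiv.ofBijective f hf, ?_⟩⟩
  intro a b
  constructor
  · intro h
    have : s(f a, f b) ∈ H.edgeSet := h
    rw [← h3] at this
    obtain ⟨e, he, h4⟩ := this
    have h5 : Sym2.map f s(a, b) = s(f a, f b) := rfl
    rw [← h5] at h4
    rw [Sym2.map.injective hf.1 h4] at he
    exact he
  · exact hom a b

lemma exists_third_nbr {V : Type} [Finite V] {K : SimpleGraph V} {v : V} (h : dg K v = 3) (a b : V) :
    ∃ c, K.Adj v c ∧ c ≠ a ∧ c ≠ b := by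
  by_contra hc
  push Not at hc
  have h1 : K.neighborSet v ⊆ {a, b} := by
    intro w hw
    by_cases h2 : w = a
    · simp [h2]
    · simp [hc w hw h2]
  have h2 := Set.ncard_le_ncard h1 (Set.toFinite _)
  have h3 := Set.ncard_insert_le a {b}
  rw [Set.ncard_singleton] at h3
  unfold dg at h
  omega

lemma nbr_three {V : Type} [Finite V] {K : SimpleGraph V} {v : V} (h : dg K v = 3) {a b c : V} (ha : K.Adj v a)
    (hb : K.Adj v b) (hc : K.Adj v c) (hab : a ≠ b) (hac : a ≠ c) (hbc : b ≠ c) (w : V) (hw : K.Adj v w) :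
    w = a ∨ w = b ∨ w = c := by
  have h1 : ({a, b, c} : Set V) ⊆ K.neighborSet v := by
    rintro x (rfl | rfl | rfl) <;> assumption
  have h2 : ({a, b, c} : Set V).ncard = 3 := Set.ncard_eq_three.2 ⟨a, b, c, hab, hac, hbc, rfl⟩
  have h3 := Set.eq_of_subset_of_ncard_le h1 (by unfold dg at h; omega) (Set.toFinite _)
  have : w ∈ ({a, b, c} : Set V) := by rw [h3]; exact hw
  simpa using this

lemma nbr_two {V : Type} [Finite V] {K : SimpleGraph V} {v : V} (h : dg K v = 2) {a : V} (ha : K.Adj v a) :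
    ∃ b, b ≠ a ∧ K.Adj v b ∧ ∀ w, K.Adj v w → w = a ∨ w = b := by
  obtain ⟨x, y, hxy, hN⟩ := Set.ncard_eq_two.1 h
  have hm : ∀ w, K.Adj v w ↔ w = x ∨ w = y := by
    intro w
    have : w ∈ K.neighborSet v ↔ w ∈ ({x, y} : Set V) := by rw [hN]
    simpa using this
  rcases (hm a).1 ha with rfl | rfl
  · exact ⟨y, hxy.symm, (hm y).2 (Or.inr rfl), fun w hw => (hm w).1 hw⟩
  · exact ⟨x, hxy, (hm x).2 (Or.inl rfl), fun w hw => ((hm w).1 hw).symm⟩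

end ident

end part_P6a

section part_P6b
set_option linter.unusedSectionVars false
set_option linter.unusedVariables false

section identR

lemma two_defects {V : Type} [Fintype V] {d : V → ℕ} (h23 : ∀ v, d v = 2 ∨ d v = 3)
    (hs : ∑ v, d v + 2 = 3 * Fintype.card V) :
    ∃ p q, d p = 2 ∧ d q = 2 ∧ p ≠ q ∧ ∀ w, d w = 2 → w = p ∨ w = q := by
  classical
  have h1 : (Finset.univ.filter fun v => d v = 2).card = 2 := by
    have h2 : ∑ v, (d v + if d v = 2 then 1 else 0) = 3 * Fintype.card V := by
      rw [show 3 * Fintype.card V = ∑ v : V, 3 by simp [mul_comm]]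
      refine Finset.sum_congr rfl fun v _ => ?_
      rcases h23 v with h | h <;> simp [h]
    rw [Finset.sum_add_distrib, ← Finset.card_filter] at h2
    omega
  obtain ⟨p, q, hpq, he⟩ := Finset.card_eq_two.1 h1
  have hm : ∀ w, d w = 2 ↔ w = p ∨ w = q := by
    intro w
    have : w ∈ (Finset.univ.filter fun v => d v = 2) ↔ w ∈ ({p, q} : Finset V) := by rw [he]
    simpa using this
  exact ⟨p, q, (hm p).2 (Or.inl rfl), (hm q).2 (Or.inr rfl), hpq, fun w => (hm w).1⟩

lemma leafL {V : Type} [Finite V] {K : SimpleGraph V} (h3 : No3 K) (h4 : No4 K) {v : V} (hv : dg K v = 3)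
    (hcov : ∀ w, w ≠ v → K.Adj v w ∨ ∃ u, K.Adj v u ∧ K.Adj u w) {x u1 u2 : V} (hx : dg K x = 3)
    (hxv : x ≠ v) (h1 : K.Adj v u1) (h1x : K.Adj u1 x) (h2 : K.Adj v u2) (h12 : u1 ≠ u2) :
    ∃ y, K.Adj x y ∧ K.Adj u2 y ∧ y ≠ v := by
  have key : ∀ s, K.Adj x s → s ≠ u1 → s ≠ v ∧ ∃ u, K.Adj v u ∧ K.Adj u s ∧ u ≠ u1 := by
    intro s hs hsu
    have hsv : s ≠ v := by
      rintro rfl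
      exact h3 _ _ _ h1 h1x hs
    refine ⟨hsv, ?_⟩
    rcases hcov s hsv with h | ⟨u, hu, hus⟩
    · exact (h4 x s v u1 hs h.symm h1 h1x hxv hsu).elim
    · refine ⟨u, hu, hus, ?_⟩
      rintro rfl
      exact h3 _ _ _ hs hus.symm h1x
  obtain ⟨s, hs, hs1, -⟩ := exists_third_nbr hx u1 u1
  obtain ⟨t, ht, ht1, hts⟩ := exists_third_nbr hx u1 s
  obtain ⟨hsv, u, hu, hus, hu1⟩ := key s hs hs1
  obtain ⟨htv, u', hu', hus', hu1'⟩ := key t ht ht1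
  have huu : u ≠ u' := by
    rintro rfl
    have hxu : x ≠ u := by
      rintro rfl
      exact h3 _ _ _ h1 h1x hu.symm
    exact h4 x s u t hs hus.symm hus' ht.symm hxu (Ne.symm hts)
  rcases nbr_three hv h1 hu hu' hu1.symm hu1'.symm huu u2 h2 with rfl | rfl | rfl
  · exact (h12 rfl).elim
  · exact ⟨s, hs, hus, hsv⟩
  · exact ⟨t, ht, hus', htv⟩

lemma identR {V : Type} {K : SimpleGraph V} (h : MemF 4 2 K) (h3 : No3 K) (h4 : No4 K) :
    Nonempty (K ≃g Rgraph) := by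
  classical
  haveI := h.finite
  haveI := Fintype.ofFinite V
  have hcard : Fintype.card V = 10 := by
    have := h.card
    rw [Nat.card_eq_fintype_card] at this; omega
  have hsum := h.sum
  obtain ⟨p, q, hp, hq, hpq, hpq'⟩ := two_defects (d := dg K) h.deg23 (by omega)
  have hd3 : ∀ w, w ≠ p → w ≠ q → dg K w = 3 := by
    intro w h1 h2
    rcases h.deg23 w with h | h
    · rcases hpq' w h with h | h <;> contradiction
    · exact h
  -- choose `v`
  obtain ⟨v, hv⟩ : ∃ v, v ∉ ({p, q} ∪ K.neighborSet p ∪ K.neighborSet q : Set V) := by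
    by_contra hcon
    push Not at hcon
    have h1 : (Set.univ : Set V) ⊆ ({p, q} ∪ K.neighborSet p ∪ K.neighborSet q : Set V) := fun v _ => hcon v
    have h2 := Set.ncard_le_ncard h1 (Set.toFinite _)
    have h5 := Set.ncard_union_le ({p, q} ∪ K.neighborSet p) (K.neighborSet q)
    have h6 := Set.ncard_union_le ({p, q}) (K.neighborSet p)
    have h7 := Set.ncard_insert_le p {q}
    rw [Set.ncard_singleton] at h7
    rw [Set.ncard_univ, Nat.card_eq_fintype_card] at h2
    unfold dg at hp hq
    omega
  simp only [Set.mem_union, Set.mem_insert_iff, Set.mem_singleton_iff, mem_neighborSet, not_or] at hv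
  obtain ⟨⟨⟨hvp, hvq⟩, hpv⟩, hqv⟩ := hv
  have hdv : dg K v = 3 := hd3 v hvp hvq
  have hdN : ∀ u, K.Adj v u → dg K u = 3 := by
    intro u hu
    refine hd3 u ?_ ?_
    · rintro rfl; exact hpv hu.symm
    · rintro rfl; exact hqv hu.symm
  have hcov : ∀ w, w ≠ v → K.Adj v w ∨ ∃ u, K.Adj v u ∧ K.Adj u w := by
    refine (moore1 h3 h4 v).2 ?_
    have h1 : ∑ u ∈ Finset.univ.filter (K.Adj v), dg K u = ∑ u ∈ Finset.univ.filter (K.Adj v), 3 := by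
      refine Finset.sum_congr rfl fun u hu => hdN u (by simpa using hu)
    have h2 : (Finset.univ.filter (K.Adj v)).card = 3 := by
      rw [← hdv, dg, ← Set.ncard_coe_finset]
      congr 1
      ext; simp
    rw [h1, Finset.sum_const, h2, hcard]
    norm_num
  -- neighbours of `v` are pairwise non-adjacent
  obtain ⟨uA, hvA, hAp⟩ : ∃ u, K.Adj v u ∧ K.Adj u p := by
    rcases hcov p (Ne.symm hvp) with h | h
    · exact (hpv h.symm).elim
    · exact h
  obtain ⟨c', hc'A, hpc', hpN⟩ := nbr_two hp hAp.symm
  have hc'v : c' ≠ v := by rintro rfl; exact hpv hpc'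
  obtain ⟨uC, hvC, hCc'⟩ : ∃ u, K.Adj v u ∧ K.Adj u c' := by
    rcases hcov c' hc'v with h | h
    · exact (h4 p c' v uA hpc' h.symm hvA hAp (Ne.symm hvp) hc'A).elim
    · exact h
  have hAC : uA ≠ uC := by
    rintro rfl
    exact h3 _ _ _ hAp hpc' hCc'.symm
  obtain ⟨uB, hvB, hBA, hBC⟩ := exists_third_nbr hdv uA uC
  obtain ⟨a, hAa, hav, hap⟩ := exists_third_nbr (hdN _ hvA) v p
  obtain ⟨c, hCc, hcv, hcc'⟩ := exists_third_nbr (hdN _ hvC) v c'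
  have hNv := nbr_three hdv hvA hvB hvC hBA.symm hAC hBC
  have hNA := nbr_three (hdN _ hvA) hvA.symm hAp hAa hvp hav.symm hap.symm
  have hNC := nbr_three (hdN _ hvC) hvC.symm hCc' hCc hc'v.symm hcv.symm hcc'.symm
  -- leaves of different branches are different
  have hleaf : ∀ {u u' x}, K.Adj v u → K.Adj v u' → u ≠ u' → K.Adj u x → x ≠ v → ¬ K.Adj u' x :=
    fun hu hu' hne hux hxv hux' => h4 v _ _ _ hu hux hux'.symm hu'.symm hxv.symm hne
  -- a degree three leaf at `uB` is adjacent to `a`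
  have hBleaf : ∀ x, K.Adj uB x → x ≠ v → dg K x = 3 → K.Adj x a := by
    intro x hx hxv hdx
    obtain ⟨y, hxy, hAy, hyv⟩ := leafL h3 h4 hdv hcov hdx hxv hvB hx hvA hBA
    rcases hNA y hAy with rfl | rfl | rfl
    · exact (hyv rfl).elim
    · rcases hpN x hxy.symm with rfl | rfl
      · exact (h3 _ _ _ hvB hx hvA.symm).elim
      · exact (hleaf hvC hvB hBC.symm hCc' hxv hx).elim
    · exact hxy
  have haB : a ≠ uB := by
    rintro rfl
    exact h3 _ _ _ hvA hAa hvB.symm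
  obtain ⟨b, b', hBb, hBb', hbv, hbv', hbb, hdb, hdb'⟩ : ∃ b b', K.Adj uB b ∧ K.Adj uB b' ∧ b ≠ v ∧ b' ≠ v ∧ b ≠ b' ∧
      dg K b = 2 ∧ dg K b' = 3 := by
    obtain ⟨b1, hB1, h1v, -⟩ := exists_third_nbr (hdN _ hvB) v v
    obtain ⟨b2, hB2, h2v, h21⟩ := exists_third_nbr (hdN _ hvB) v b1
    have hpB : ∀ x, K.Adj uB x → x ≠ p := by
      rintro x hx rfl
      exact hleaf hvA hvB hBA.symm hAp (Ne.symm hvp) hx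
    rcases h.deg23 b1 with hd1 | hd1 <;> rcases h.deg23 b2 with hd2 | hd2
    · rcases hpq' b1 hd1 with h | h
      · exact (hpB _ hB1 h).elim
      · rcases hpq' b2 hd2 with h' | h'
        · exact (hpB _ hB2 h').elim
        · exact (h21 (h'.trans h.symm)).elim
    · exact ⟨b1, b2, hB1, hB2, h1v, h2v, h21.symm, hd1, hd2⟩
    · exact ⟨b2, b1, hB2, hB1, h2v, h1v, h21, hd2, hd1⟩
    · exact (h4 b1 a b2 uB (hBleaf b1 hB1 h1v hd1) (hBleaf b2 hB2 h2v hd2).symm hB2.symm hB1 h21.symm haB).elim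
  have hNB := nbr_three (hdN _ hvB) hvB.symm hBb hBb' hbv.symm hbv'.symm hbb
  have hbq : b = q := by
    rcases hpq' b hdb with h | h
    · rw [h] at hBb
      exact (hleaf hvA hvB hBA.symm hAp (Ne.symm hvp) hBb).elim
    · exact h
  have hb'a : K.Adj b' a := hBleaf b' hBb' hbv' hdb'
  have hda : dg K a = 3 := by
    refine hd3 a hap ?_
    rw [← hbq]; rintro rfl
    exact hleaf hvA hvB hBA.symm hAa hav hBb
  have hdc : dg K c = 3 := by
    refine hd3 c ?_ ?_
    · rintro rfl
      exact hleaf hvA hvC hAC hAp hcv hCc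
    · rw [← hbq]; rintro rfl
      exact hleaf hvB hvC hBC hBb hcv hCc
  have hac : K.Adj a c := by
    obtain ⟨y, hay, hCy, hyv⟩ := leafL h3 h4 hdv hcov hda hav hvA hAa hvC hAC
    rcases hNC y hCy with rfl | rfl | rfl
    · exact (hyv rfl).elim
    · exact (h4 p y a uA hpc' hay.symm hAa.symm hAp hap.symm hc'A).elim
    · exact hay
  have hbbcc : K.Adj b' c' := by
    obtain ⟨y, hay, hCy, hyv⟩ := leafL h3 h4 hdv hcov hdb' hbv' hvB hBb' hvC hBC
    rcases hNC y hCy with rfl | rfl | rfl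
    · exact (hyv rfl).elim
    · exact hay
    · exact (h3 _ _ _ hb'a hac hay.symm).elim
  have hbc : K.Adj b c := by
    obtain ⟨y, hay, hCy, hyv⟩ := leafL h3 h4 hdv hcov hdc hcv hvC hCc hvB hBC.symm
    rcases hNB y hCy with rfl | rfl | rfl
    · exact (hyv rfl).elim
    · exact hay.symm
    · exact (h3 _ _ _ hb'a hac hay).elim
  let f : Fin 5 × Fin 2 → V := fun z => if z.2 = 0 then ![p, b, uB, v, uA] z.1 else ![c', c, b', uC, a] z.1
  have hsurj : Function.Surjective f := by
    have hp' : f (0, 0) = p := rfl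
    have hb' : f (1, 0) = b := rfl
    have hB' : f (2, 0) = uB := rfl
    have hv' : f (3, 0) = v := rfl
    have hA' : f (4, 0) = uA := rfl
    have e0 : f (0, 1) = c' := rfl
    have e1 : f (1, 1) = c := rfl
    have e2 : f (2, 1) = b' := rfl
    have e3 : f (3, 1) = uC := rfl
    have e4 : f (4, 1) = a := rfl
    intro w
    by_cases hw : w = v
    · exact ⟨_, hv'.trans hw.symm⟩
    · rcases hcov w hw with h | ⟨u, hu, huw⟩
      · rcases hNv w h with rfl | rfl | rfl
        exacts [⟨_, hA'⟩, ⟨_, hB'⟩, ⟨_, e3⟩]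
      · rcases hNv u hu with rfl | rfl | rfl
        · rcases hNA w huw with rfl | rfl | rfl
          exacts [⟨_, hv'⟩, ⟨_, hp'⟩, ⟨_, e4⟩]
        · rcases hNB w huw with rfl | rfl | rfl
          exacts [⟨_, hv'⟩, ⟨_, hb'⟩, ⟨_, e2⟩]
        · rcases hNC w huw with rfl | rfl | rfl
          exacts [⟨_, hv'⟩, ⟨_, e0⟩, ⟨_, e1⟩]
  have hbij : Function.Bijective f := hsurj.bijective_of_nat_card_le (by
    rw [Nat.card_eq_fintype_card, Nat.card_eq_fintype_card, hcard]; simp)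
  have hhom : ∀ x y, RF.Adj x y → K.Adj (f x) (f y) := by
    have hsym : ∀ x y, K.Adj (f x) (f y) → K.Adj (f y) (f x) := fun x y h => h.symm
    have hlist : ∀ x y : Fin 5 × Fin 2, Rb x y = true →
        (x, y) ∈ [((0,0),(4,0)),((4,0),(3,0)),((3,0),(2,0)),((2,0),(1,0)),((0,1),(2,1)),((1,1),(3,1)),((2,1),(4,1)),
          ((3,1),(0,1)),((4,1),(1,1)),((0,0),(0,1)),((1,0),(1,1)),((2,0),(2,1)),((3,0),(3,1)),((4,0),(4,1))] ∨
        (y, x) ∈ ([((0,0),(4,0)),((4,0),(3,0)),((3,0),(2,0)),((2,0),(1,0)),((0,1),(2,1)),((1,1),(3,1)),((2,1),(4,1)),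
          ((3,1),(0,1)),((4,1),(1,1)),((0,0),(0,1)),((1,0),(1,1)),((2,0),(2,1)),((3,0),(3,1)),((4,0),(4,1))] :
            List ((Fin 5 × Fin 2) × (Fin 5 × Fin 2))) := by
      decide
    have hall : ∀ z ∈ ([((0,0),(4,0)),((4,0),(3,0)),((3,0),(2,0)),((2,0),(1,0)),((0,1),(2,1)),((1,1),(3,1)),((2,1),(4,1)),
          ((3,1),(0,1)),((4,1),(1,1)),((0,0),(0,1)),((1,0),(1,1)),((2,0),(2,1)),((3,0),(3,1)),((4,0),(4,1))] :
            List ((Fin 5 × Fin 2) × (Fin 5 × Fin 2))), K.Adj (f z.1) (f z.2) := by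
      simp only [List.forall_mem_cons]
      exact ⟨hAp.symm, hvA.symm, hvB, hBb, hbbcc.symm, hCc.symm, hb'a, hCc', hac, hpc', hbc, hBb', hvC, hAa, by simp⟩
    intro x y hxy
    rcases hlist x y hxy with h | h
    · exact hall _ h
    · exact (hall _ h).symm
  obtain ⟨e⟩ := iso_of_bij f hbij hhom (by rw [h.edges, ← edges_iso RIso, R_edges])
  exact ⟨e.symm.trans RIso.symm⟩

end identR

end part_P6b

section part_P6c
set_option linter.unusedSectionVars false
set_option linter.unusedVariables false

section identL

lemma identL_fin {V : Type} {K : SimpleGraph V} (h : MemF 3 1 K) {v s t x y z : V}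
    (hcov : ∀ w, w = v ∨ w = s ∨ w = t ∨ w = x ∨ w = y ∨ w = z)
    (hvx : K.Adj v x) (hvy : K.Adj v y) (hvz : K.Adj v z) (hsx : K.Adj s x) (hsy : K.Adj s y) (hsz : K.Adj s z)
    (hty : K.Adj t y) (htz : K.Adj t z) : Nonempty (K ≃g Lgraph) := by
  haveI := h.finite
  let f : Option (Option (Fin 4)) → V := fun o =>
    match o with
    | none => t
    | some none => x
    | some (some k) => ![v, s, y, z] k
  have hsurj : Function.Surjective f := by
    intro w
    rcases hcov w with rfl | rfl | rfl | rfl | rfl | rfl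
    exacts [⟨some (some 0), rfl⟩, ⟨some (some 1), rfl⟩, ⟨none, rfl⟩, ⟨some none, rfl⟩, ⟨some (some 2), rfl⟩, ⟨some (some 3), rfl⟩]
  have hbij : Function.Bijective f := hsurj.bijective_of_nat_card_le (by
    rw [h.card, MemF_L.card])
  have hhom : ∀ a b, Lgraph.Adj a b → K.Adj (f a) (f b) := by
    rintro (_ | _ | a) (_ | _ | b) hab
    · simp at hab
    · simp [Lgraph] at hab
    · rcases (by simpa [Lgraph] using hab : b = 2 ∨ b = 3) with rfl | rfl
      exacts [hty, htz]
    · simp [Lgraph] at hab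
    · simp at hab
    · rcases (by simpa [Lgraph] using hab : b = 0 ∨ b = 1) with rfl | rfl
      exacts [hvx.symm, hsx.symm]
    · rcases (by simpa [Lgraph] using hab : a = 2 ∨ a = 3) with rfl | rfl
      exacts [hty.symm, htz.symm]
    · rcases (by simpa [Lgraph] using hab : a = 0 ∨ a = 1) with rfl | rfl
      exacts [hvx, hsx]
    · fin_cases a <;> fin_cases b <;> first
        | exact hvy
        | exact hvz
        | exact hsy
        | exact hsz
        | exact hvy.symm
        | exact hvz.symm
        | exact hsy.symm
        | exact hsz.symm
        | exact absurd hab (by simp [Lgraph])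
  obtain ⟨e⟩ := iso_of_bij f hbij hhom (by rw [h.edges, MemF_L.edges])
  exact ⟨e.symm⟩

lemma adj_of_three {V : Type} [Finite V] {K : SimpleGraph V} {s a b c : V} (h : dg K s = 3)
    (hN : ∀ w, K.Adj s w → w = a ∨ w = b ∨ w = c) : K.Adj s a ∧ K.Adj s b ∧ K.Adj s c := by
  refine ⟨?_, ?_, ?_⟩
  · obtain ⟨w, hw, h1, h2⟩ := exists_third_nbr h b c
    rcases hN w hw with rfl | rfl | rfl <;> first | exact hw | contradiction
  · obtain ⟨w, hw, h1, h2⟩ := exists_third_nbr h a c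
    rcases hN w hw with rfl | rfl | rfl <;> first | exact hw | contradiction
  · obtain ⟨w, hw, h1, h2⟩ := exists_third_nbr h a b
    rcases hN w hw with rfl | rfl | rfl <;> first | exact hw | contradiction

lemma three_of_adj {V : Type} [Finite V] {K : SimpleGraph V} {s a b c : V} (h : dg K s = 2)
    (ha : K.Adj s a) (hb : K.Adj s b) (hc : K.Adj s c) (hab : a ≠ b) (hac : a ≠ c) (hbc : b ≠ c) : False := by
  obtain ⟨d, hd, -, hN⟩ := nbr_two h ha
  rcases hN b hb with h | h
  · exact hab h.symm
  · rcases hN c hc with h' | h'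
    · exact hac h'.symm
    · exact hbc (h.trans h'.symm)

lemma identL {V : Type} {K : SimpleGraph V} (h : MemF 3 1 K) (h3 : No3 K) : Nonempty (K ≃g Lgraph) := by
  classical
  haveI := h.finite
  haveI := Fintype.ofFinite V
  have hcard : Fintype.card V = 6 := by
    have := h.card
    rw [Nat.card_eq_fintype_card] at this; omega
  have hsum := h.sum
  obtain ⟨p, q, hp, hq, hpq, hpq'⟩ := two_defects (d := dg K) h.deg23 (by omega)
  obtain ⟨v, hdv⟩ : ∃ v, dg K v = 3 := by
    by_contra hcon
    push Not at hcon
    have h1 : (Finset.univ : Finset V) ⊆ {p, q} := by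
      intro w _
      rcases hpq' w ((h.deg23 w).resolve_right (hcon w)) with h | h <;> simp [h]
    have := Finset.card_le_card h1
    have h2 := Finset.card_le_two (a := p) (b := q)
    rw [Finset.card_univ] at this
    omega
  obtain ⟨x, y, z, hxy, hxz, hyz, hN⟩ := Set.ncard_eq_three.1 hdv
  have hNv : ∀ w, K.Adj v w ↔ w = x ∨ w = y ∨ w = z := by
    intro w
    have : w ∈ K.neighborSet v ↔ w ∈ ({x, y, z} : Set V) := by rw [hN]
    simpa using this
  have hvx : K.Adj v x := (hNv x).2 (by simp)
  have hvy : K.Adj v y := (hNv y).2 (by simp)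
  have hvz : K.Adj v z := (hNv z).2 (by simp)
  obtain ⟨s, t, hst, hco⟩ : ∃ s t, s ≠ t ∧ ({v, x, y, z} : Finset V)ᶜ = {s, t} := by
    refine Finset.card_eq_two.1 ?_
    rw [Finset.card_compl, hcard, Finset.card_insert_of_notMem, Finset.card_insert_of_notMem, Finset.card_insert_of_notMem,
      Finset.card_singleton]
    · simp [hyz]
    · simp [hxy, hxz]
    · simp [hvx.ne, hvy.ne, hvz.ne]
  have hst' : ∀ w, (w ≠ v ∧ w ≠ x ∧ w ≠ y ∧ w ≠ z) ↔ w = s ∨ w = t := by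
    intro w
    have : w ∈ ({v, x, y, z} : Finset V)ᶜ ↔ w ∈ ({s, t} : Finset V) := by rw [hco]
    simpa using this
  have hs := (hst' s).2 (Or.inl rfl)
  have ht := (hst' t).2 (Or.inr rfl)
  have hcov : ∀ w, w = v ∨ w = s ∨ w = t ∨ w = x ∨ w = y ∨ w = z := by
    intro w
    have := hst' w
    tauto
  have hNu : ∀ u, K.Adj v u → ∀ w, K.Adj u w → w = v ∨ w = s ∨ w = t := by
    intro u hu w hw
    have h1 : ¬ K.Adj v w := fun hvw => h3 _ _ _ hu hw hvw.symm
    rw [hNv] at h1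
    have := hcov w
    tauto
  have h3x : ∀ u, K.Adj v u → dg K u = 3 → K.Adj s u ∧ K.Adj t u := by
    intro u hu hd
    obtain ⟨-, h1, h2⟩ := adj_of_three hd (hNu u hu)
    exact ⟨h1.symm, h2.symm⟩
  have hnst : ¬ K.Adj s t := by
    intro hadj
    have h2 : ∀ u, K.Adj v u → dg K u = 2 := by
      intro u hu
      rcases h.deg23 u with h | h
      · exact h
      · obtain ⟨h1, h2⟩ := h3x u hu h
        exact (h3 _ _ _ hadj h2 h1.symm).elim
    have e1 := hpq' x (h2 x hvx)
    have e2 := hpq' y (h2 y hvy)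
    have e3 := hpq' z (h2 z hvz)
    grind
  have hNs : ∀ w, K.Adj s w → w = x ∨ w = y ∨ w = z := by
    intro w hw
    rcases hcov w with rfl | rfl | rfl | h
    · have := (hNv s).1 hw.symm
      tauto
    · exact (hw.ne rfl).elim
    · exact (hnst hw).elim
    · exact h
  have hNt : ∀ w, K.Adj t w → w = x ∨ w = y ∨ w = z := by
    intro w hw
    rcases hcov w with rfl | rfl | rfl | h
    · have := (hNv t).1 hw.symm
      tauto
    · exact (hnst hw.symm).elim
    · exact (hw.ne rfl).elim
    · exact h
  have main : ∀ s t, (∀ w, w = v ∨ w = s ∨ w = t ∨ w = x ∨ w = y ∨ w = z) → dg K s = 3 → dg K t = 2 →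
      (∀ w, K.Adj s w → w = x ∨ w = y ∨ w = z) → (∀ w, K.Adj t w → w = x ∨ w = y ∨ w = z) →
      Nonempty (K ≃g Lgraph) := by
    intro s t hcov hds hdt hNs hNt
    obtain ⟨hsx, hsy, hsz⟩ := adj_of_three hds hNs
    obtain ⟨a, b, hab, hN⟩ := Set.ncard_eq_two.1 hdt
    have ha : K.Adj t a := by
      have : a ∈ K.neighborSet t := by rw [hN]; simp
      exact this
    have hb : K.Adj t b := by
      have : b ∈ K.neighborSet t := by rw [hN]; simp
      exact this
    rcases hNt a ha with rfl | rfl | rfl <;> rcases hNt b hb with rfl | rfl | rfl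
    · exact (hab rfl).elim
    · exact identL_fin h (x := z) (by intro w; rcases hcov w with h | h | h | h | h | h <;> simp [h]) hvz hvx hvy hsz hsx hsy ha hb
    · exact identL_fin h (x := y) (by intro w; rcases hcov w with h | h | h | h | h | h <;> simp [h]) hvy hvx hvz hsy hsx hsz ha hb
    · exact identL_fin h (x := z) (by intro w; rcases hcov w with h | h | h | h | h | h <;> simp [h]) hvz hvx hvy hsz hsx hsy hb ha
    · exact (hab rfl).elim
    · exact identL_fin h (x := x) (by intro w; rcases hcov w with h | h | h | h | h | h <;> simp [h]) hvx hvy hvz hsx hsy hsz ha hb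
    · exact identL_fin h (x := y) (by intro w; rcases hcov w with h | h | h | h | h | h <;> simp [h]) hvy hvx hvz hsy hsx hsz hb ha
    · exact identL_fin h (x := x) (by intro w; rcases hcov w with h | h | h | h | h | h <;> simp [h]) hvx hvy hvz hsx hsy hsz hb ha
    · exact (hab rfl).elim
  rcases h.deg23 s with hds | hds <;> rcases h.deg23 t with hdt | hdt
  · exfalso
    have h1 : ∀ u, K.Adj v u → dg K u = 3 := by
      intro u hu
      refine (h.deg23 u).resolve_left fun hd => ?_
      have e1 := hpq' s hds
      have e2 := hpq' t hdt
      have e3 := hpq' u hd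
      have e4 := (hNv u).1 hu
      grind
    exact three_of_adj hds (h3x x hvx (h1 x hvx)).1 (h3x y hvy (h1 y hvy)).1 (h3x z hvz (h1 z hvz)).1 hxy hxz hyz
  · exact main t s (by intro w; rcases hcov w with h | h | h | h | h | h <;> simp [h]) hdt hds hNt hNs
  · exact main s t hcov hds hdt hNs hNt
  · exfalso
    obtain ⟨hsx, hsy, hsz⟩ := adj_of_three hds hNs
    obtain ⟨htx, hty, htz⟩ := adj_of_three hdt hNt
    rcases hcov p with rfl | rfl | rfl | rfl | rfl | rfl
    · omega
    · omega
    · omega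
    · exact three_of_adj hp hvx.symm hsx.symm htx.symm hs.1.symm ht.1.symm hst
    · exact three_of_adj hp hvy.symm hsy.symm hty.symm hs.1.symm ht.1.symm hst
    · exact three_of_adj hp hvz.symm hsz.symm htz.symm hs.1.symm ht.1.symm hst

end identL

section short

/-- a cycle of length less than `g` inside `C` -/
def HasShort {V : Type} (g : ℕ) (G : SimpleGraph V) (C : Set V) : Prop :=
  ∃ (v : V) (c : G.Walk v v), c.IsCycle ∧ c.length < g ∧ ∀ x ∈ c.support, x ∈ C

lemma not_short_both {V : Type} {g : ℕ} {G : SimpleGraph V} (h : ¬ TwoDisjointCyclesLt G g) {C D : Set V}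
    (hC : HasShort g G C) (hD : HasShort g G D) (hdis : ∀ x, x ∈ C → x ∉ D) : False := by
  obtain ⟨u, c, h1, h2, h3⟩ := hC
  obtain ⟨v, d, h4, h5, h6⟩ := hD
  exact h ⟨u, v, c, d, h1, h4, h2, h5, fun x hx hx' => hdis x (h3 x hx) (h6 x hx')⟩

lemma short3 {V : Type} {g : ℕ} (hg : 4 ≤ g) {G : SimpleGraph V} {C : Set V} {a b c : V} (hab : G.Adj a b)
    (hbc : G.Adj b c) (hca : G.Adj c a) (ha : a ∈ C) (hb : b ∈ C) (hc : c ∈ C) : HasShort g G C := by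
  refine ⟨a, Walk.cons hab (Walk.cons hbc (Walk.cons hca Walk.nil)), ?_, ?_, ?_⟩
  · rw [Walk.cons_isCycle_iff]
    have h1 := hab.ne
    have h2 := hbc.ne
    have h3 := hca.ne
    constructor
    · simp [Walk.cons_isPath_iff, h2, h1.symm, h3]
    · simp [h1, h2, h3, h1.symm, h2.symm, h3.symm]
  · simp; omega
  · simp [ha, hb, hc]

lemma short4 {V : Type} {g : ℕ} (hg : 5 ≤ g) {G : SimpleGraph V} {C : Set V} {a b c d : V} (hab : G.Adj a b)
    (hbc : G.Adj b c) (hcd : G.Adj c d) (hda : G.Adj d a) (hac : a ≠ c) (hbd : b ≠ d)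
    (ha : a ∈ C) (hb : b ∈ C) (hc : c ∈ C) (hd : d ∈ C) : HasShort g G C := by
  refine ⟨a, Walk.cons hab (Walk.cons hbc (Walk.cons hcd (Walk.cons hda Walk.nil))), ?_, ?_, ?_⟩
  · rw [Walk.cons_isCycle_iff]
    have h1 := hab.ne
    have h2 := hbc.ne
    have h3 := hcd.ne
    have h4 := hda.ne
    constructor
    · simp [Walk.cons_isPath_iff, h2, h1.symm, h3, h4, hbd, hac.symm]
    · simp [h1, h2, h3, h1.symm, h2.symm, h3.symm, h4, h4.symm, hbd, hac, hac.symm, hbd.symm]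
  · simp; omega
  · simp [ha, hb, hc, hd]

lemma no3_of {V : Type} {g : ℕ} (hg : 4 ≤ g) {G G' : SimpleGraph V} (hle : G' ≤ G) {C : Set V} (h : ¬ HasShort g G C) :
    No3 (G'.induce C) := by
  intro a b c h1 h2 h3
  exact h (short3 hg (hle h1) (hle h2) (hle h3) a.2 b.2 c.2)

lemma no4_of {V : Type} {g : ℕ} (hg : 5 ≤ g) {G G' : SimpleGraph V} (hle : G' ≤ G) {C : Set V} (h : ¬ HasShort g G C) :
    No4 (G'.induce C) := by
  intro a b c d h1 h2 h3 h4 h5 h6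
  exact h (short4 hg (hle h1) (hle h2) (hle h3) (hle h4) (fun h => h5 (Subtype.ext h)) (fun h => h6 (Subtype.ext h))
    a.2 b.2 c.2 d.2)

lemma MemF30_not_no3 {V : Type} {G : SimpleGraph V} (h : MemF 3 0 G) (h3 : No3 G) : False := by
  cases h with
  | cycle hi h =>
    obtain ⟨e⟩ := h
    have h1 : ∀ u v : ZMod 3, u ≠ v → (cyc 3).Adj u v := by
      intro u v huv
      simp only [cyc, fromRel_adj]
      revert u v
      decide
    have h2 : ∀ u v : ZMod 3, u ≠ v → G.Adj (e.symm u) (e.symm v) := fun u v huv => e.symm.map_adj_iff.2 (h1 u v huv)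
    exact h3 _ _ _ (h2 0 1 (by decide)) (h2 1 2 (by decide)) (h2 2 0 (by decide))
  | subd hj _ _ _ => omega

end short

end part_P6c

section part_P6d
set_option linter.unusedSectionVars false
set_option linter.unusedVariables false

section blk

open Classical in
/-- sum of `f` over a fibre of `P` -/
noncomputable def fsum {V κ : Type} [Fintype V] (P : V → κ) (f : V → ℕ) (c : κ) : ℕ :=
  ∑ v ∈ Finset.univ.filter (fun v => P v = c), f v

lemma fsum_total {V κ : Type} [Fintype V] [Fintype κ] (P : V → κ) (f : V → ℕ) : ∑ c, fsum P f c = ∑ v, f v := by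
  classical
  unfold fsum
  rw [← Finset.sum_fiberwise Finset.univ P f]

lemma fsum_add {V κ : Type} [Fintype V] (P : V → κ) (f f' : V → ℕ) (c : κ) :
    fsum P (fun v => f v + f' v) c = fsum P f c + fsum P f' c := by
  classical
  unfold fsum
  rw [Finset.sum_add_distrib]

lemma fsum_mono {V κ : Type} [Fintype V] (P : V → κ) {f f' : V → ℕ} (h : ∀ v, f v ≤ f' v) (c : κ) :
    fsum P f c ≤ fsum P f' c := by
  classical
  unfold fsum
  exact Finset.sum_le_sum fun v _ => h v

lemma fsum_low {V κ : Type} [Fintype V] (P : V → κ) (A : SimpleGraph V) (c : κ) (F : Finset (V × V))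
    (hF : ∀ p ∈ F, A.Adj p.1 p.2 ∧ P p.1 = c) : F.card ≤ fsum P (dg A) c := by
  classical
  have hdg : ∀ u, dg A u = (Finset.univ.filter (A.Adj u)).card := by
    intro u
    rw [dg, ← Set.ncard_coe_finset]
    congr 1
    ext; simp
  unfold fsum
  simp only [hdg]
  rw [← Finset.card_sigma]
  refine Finset.card_le_card_of_injOn (fun p => ⟨p.1, p.2⟩) ?_ ?_
  · intro p hp
    have := hF p hp
    simp [this]
  · rintro ⟨a, b⟩ _ ⟨a', b'⟩ _ h
    simp at h
    simp [h]

lemma fsum_supp {V : Type} [Fintype V] {G' : SimpleGraph V} (c : G'.ConnectedComponent) [Fintype c.supp] (f : V → ℕ) :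
    fsum G'.connectedComponentMk f c = ∑ v : c.supp, f v.1 := by
  classical
  unfold fsum
  exact Finset.sum_subtype _ (fun x => by simp) f

lemma fsum_MemF {V : Type} [Fintype V] {G' : SimpleGraph V} {c : G'.ConnectedComponent} {i j : ℕ}
    (h : MemF i j (G'.induce c.supp)) : fsum G'.connectedComponentMk (dg G') c = 10 * j + 2 * i ∧
    fsum G'.connectedComponentMk (fun _ => 3) c = 3 * (3 * j + i) := by
  classical
  haveI : Fintype c.supp := Fintype.ofFinite _
  rw [fsum_supp, fsum_supp, ← h.sum, ← h.card, Nat.card_eq_fintype_card]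
  constructor
  · refine Finset.sum_congr rfl fun v _ => ?_
    rw [dg_induce]
    intro x y hxy hx
    exact (ConnectedComponent.connectedComponentMk_eq_of_adj hxy).symm.trans hx
  · simp [mul_comm]

lemma dg_sdiff {V : Type} [Finite V] {G G' : SimpleGraph V} (hle : G' ≤ G) (v : V) :
    dg G' v + dg (G \ G') v = dg G v := by
  unfold dg
  rw [← Set.ncard_union_eq]
  · congr 1
    ext w
    simp only [Set.mem_union, mem_neighborSet, sdiff_adj]
    constructor
    · rintro (h | h)
      exacts [hle h, h.1]
    · intro h
      by_cases h' : G'.Adj v w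
      exacts [Or.inl h', Or.inr ⟨h, h'⟩]
  · rw [Set.disjoint_left]
    intro w h1 h2
    exact h2.2 h1

lemma cross_one {V : Type} {K : SimpleGraph V} (hK : K.Connected) {C : Set V} {a b : V} (ha : a ∈ C) (hb : b ∉ C) :
    ∃ u v, K.Adj u v ∧ u ∈ C ∧ v ∉ C := by
  obtain ⟨w⟩ := hK.preconnected a b
  obtain ⟨d, hd, h1, h2⟩ := w.exists_boundary_dart C ha hb
  exact ⟨d.fst, d.snd, d.adj, h1, h2⟩

lemma cross_A {V : Type} [Fintype V] {G G' : SimpleGraph V} (h2 : TwoConnected G) (hle : G' ≤ G)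
    (c : G'.ConnectedComponent) {b : V} (hb : G'.connectedComponentMk b ≠ c) :
    ∃ u v u' v', (u, v) ≠ (u', v') ∧ (G \ G').Adj u v ∧ (G \ G').Adj u' v' ∧
      G'.connectedComponentMk u = c ∧ G'.connectedComponentMk u' = c ∧
      G'.connectedComponentMk v ≠ c ∧ G'.connectedComponentMk v' ≠ c := by
  obtain ⟨a, ha⟩ := c.exists_rep
  obtain ⟨u, v, huv, hu, hv⟩ := cross_one h2.connected (C := c.supp) (show a ∈ c.supp from ha) (show b ∉ c.supp from hb)
  obtain ⟨u', v', huv', hu', hv'⟩ := cross_one (h2.del_edge s(u, v)) (C := c.supp) (show a ∈ c.supp from ha) (show b ∉ c.supp from hb)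
  have key : ∀ u v, u ∈ c.supp → v ∉ c.supp → ¬ G'.Adj u v := by
    intro u v hu hv h
    exact hv ((ConnectedComponent.connectedComponentMk_eq_of_adj h).symm.trans hu)
  rw [deleteEdges_adj] at huv'
  refine ⟨u, v, u', v', ?_, ⟨huv, key _ _ hu hv⟩, ⟨huv'.1, key _ _ hu' hv'⟩, hu, hu', hv, hv'⟩
  intro h
  rw [Prod.mk.injEq] at h
  obtain ⟨rfl, rfl⟩ := h
  exact huv'.2 rfl

lemma H_ge {V : Type} [Fintype V] {G G' : SimpleGraph V} (h2 : TwoConnected G) (hle : G' ≤ G) {a b : V}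
    (hab : (G \ G').Adj a b) (c : G'.ConnectedComponent) : 2 ≤ fsum G'.connectedComponentMk (dg (G \ G')) c := by
  classical
  by_cases h : ∃ b, G'.connectedComponentMk b ≠ c
  · obtain ⟨b, hb⟩ := h
    obtain ⟨u, v, u', v', hne, h1, h2, h3, h4, -, -⟩ := cross_A h2 hle c hb
    rw [← Finset.card_pair hne]
    refine fsum_low _ _ _ _ ?_
    intro p hp
    simp only [Finset.mem_insert, Finset.mem_singleton] at hp
    rcases hp with rfl | rfl
    exacts [⟨h1, h3⟩, ⟨h2, h4⟩]
  · push Not at h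
    have hne : (a, b) ≠ (b, a) := by
      intro h; rw [Prod.mk.injEq] at h; exact hab.ne h.1
    rw [← Finset.card_pair hne]
    refine fsum_low _ _ _ _ ?_
    intro p hp
    simp only [Finset.mem_insert, Finset.mem_singleton] at hp
    rcases hp with rfl | rfl
    exacts [⟨hab, h _⟩, ⟨hab.symm, h _⟩]

lemma build_FG {V : Type} [Fintype V] {G G' : SimpleGraph V} {g i j : ℕ} (h2 : TwoConnected G) (hs : Subcubic G) (hle : G' ≤ G)
    (c0 : G'.ConnectedComponent) (h0 : MemF i j (G'.induce c0.supp))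
    (hH : ∀ c, fsum G'.connectedComponentMk (dg (G \ G')) c = 2)
    (hc : (g = 4 ∧ ∀ c, c ≠ c0 → Nonempty ((G'.induce c.supp) ≃g Lgraph)) ∨
      (g = 5 ∧ ∀ c, c ≠ c0 → Nonempty ((G'.induce c.supp) ≃g Rgraph))) : ∃ k, MemFG g i j k G := by
  classical
  haveI : Fintype G'.ConnectedComponent := Fintype.ofFinite _
  obtain ⟨k, hk⟩ : ∃ k, Fintype.card G'.ConnectedComponent = k + 1 :=
    ⟨_, (Nat.succ_pred_eq_of_pos (Fintype.card_pos_iff.2 ⟨c0⟩)).symm⟩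
  let e' := Fintype.equivFinOfCardEq hk
  let e : G'.ConnectedComponent ≃ Fin (k + 1) := e'.trans (Equiv.swap (e' c0) 0)
  have he0 : e c0 = 0 := by simp [e]
  let P : V → Fin (k + 1) := fun v => e (G'.connectedComponentMk v)
  have hP : ∀ l, P ⁻¹' {l} = (e.symm l).supp := by
    intro l
    ext v
    simp only [Set.mem_preimage, Set.mem_singleton_iff, ConnectedComponent.mem_supp_iff, P]
    exact (Equiv.eq_symm_apply e).symm
  have he0' : e.symm 0 = c0 := by rw [← he0, Equiv.symm_apply_apply]
  have hne : ∀ l, l ≠ 0 → e.symm l ≠ c0 := by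
    intro l hl h
    apply hl
    rw [← h, Equiv.apply_symm_apply] at he0
    exact he0
  refine ⟨k, h2, hs, P, G', hle, ?_, ?_, ?_, ?_, ?_⟩
  · intro u v huv
    simp only [P]
    rw [ConnectedComponent.connectedComponentMk_eq_of_adj huv]
  · rw [hP, he0']; exact h0
  · rcases hc with ⟨hg, hc⟩ | ⟨hg, hc⟩
    · exact Or.inl ⟨hg, fun l hl => by rw [hP]; exact hc _ (hne l hl)⟩
    · exact Or.inr ⟨hg, fun l hl => by rw [hP]; exact hc _ (hne l hl)⟩
  · rw [← edgeSet_sdiff]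
    have h3 := sum_dg (G := G \ G')
    rw [← fsum_total G'.connectedComponentMk, Finset.sum_congr rfl fun c _ => hH c] at h3
    rw [Finset.sum_const, Finset.card_univ, hk, smul_eq_mul] at h3
    omega
  · intro hk1 u v huv huv' hPP
    have hmk : G'.connectedComponentMk u = G'.connectedComponentMk v := e.injective hPP
    obtain ⟨d, hd⟩ := Fintype.exists_ne_of_one_lt_card (by omega) (G'.connectedComponentMk u)
    obtain ⟨b, hb⟩ := d.exists_rep
    obtain ⟨x, y, -, -, -, h4, -, h5, -, h6, -⟩ := cross_A h2 hle (G'.connectedComponentMk u) (b := b)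
      (by rw [← hb] at hd; exact hd)
    have hcard : ({(u, v), (v, u), (x, y)} : Finset (V × V)).card = 3 := by
      rw [Finset.card_eq_three]
      refine ⟨_, _, _, ?_, ?_, ?_, rfl⟩
      · intro h; rw [Prod.mk.injEq] at h; exact huv.ne h.1
      · intro h; rw [Prod.mk.injEq] at h; exact h6 (by rw [← h.2]; exact hmk.symm)
      · intro h; rw [Prod.mk.injEq] at h; exact h6 (by rw [← h.2])
    have := fsum_low G'.connectedComponentMk (G \ G') (G'.connectedComponentMk u) {(u, v), (v, u), (x, y)} (by
      intro p hp
      simp only [Finset.mem_insert, Finset.mem_singleton] at hp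
      rcases hp with rfl | rfl | rfl
      exacts [⟨⟨huv, huv'⟩, rfl⟩, ⟨⟨huv.symm, fun h => huv' h.symm⟩, hmk.symm⟩, ⟨h4, h5⟩])
    rw [hcard, hH] at this
    omega

lemma neg_sum {κ : Type} [Fintype κ] (δ : κ → ℤ) (N : ℤ) (hN : 0 < N) (hs : ∑ c, δ c ≤ -N) (hl : ∀ c, -N ≤ δ c)
    (hu : ∀ c c', δ c < 0 → δ c' < 0 → c = c') : ∃ c0, δ c0 = -N ∧ ∀ c, c ≠ c0 → δ c = 0 := by
  classical
  obtain ⟨c0, h0⟩ : ∃ c, δ c < 0 := by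
    by_contra h
    push Not at h
    have := Finset.sum_nonneg (s := Finset.univ) fun c _ => h c
    omega
  have hnn : ∀ c, c ≠ c0 → 0 ≤ δ c := by
    intro c hc
    by_contra h
    exact hc (hu c c0 (by omega) h0)
  have h1 := Finset.sum_erase_add Finset.univ δ (Finset.mem_univ c0)
  have h2 : 0 ≤ ∑ c ∈ Finset.univ.erase c0, δ c :=
    Finset.sum_nonneg fun c hc => hnn c (Finset.ne_of_mem_erase hc)
  have h3 := hl c0
  refine ⟨c0, by omega, fun c hc => ?_⟩
  have h4 : ∑ c ∈ Finset.univ.erase c0, δ c = 0 := by omega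
  exact (Finset.sum_eq_zero_iff_of_nonneg fun c hc => hnn c (Finset.ne_of_mem_erase hc)).1 h4 c (by simp [hc])

lemma MemF.three {i : ℕ} {V : Type} {G : SimpleGraph V} (h : MemF i 0 G) : 3 ≤ i := by
  cases h with
  | cycle hi h => exact hi
  | circ hj _ _ _ _ _ => omega
  | subd hj _ _ _ => omega

theorem block_main {V : Type} [Fintype V] {G : SimpleGraph V} {g : ℕ} (hg : g = 4 ∨ g = 5) (h2 : TwoConnected G)
    (hs : Subcubic G) (hcyc : ¬ TwoDisjointCyclesLt G g) :
    ((∃ i j, MemF i j G) ∨ (∃ i j k, 1 ≤ i ∧ j ≤ i ∧ MemFG g i j k G)) ∨ (fvs G : ℝ) ≤ tg g * G.edgeSet.ncard := by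
  classical
  obtain ⟨G', hle, m, hm, hmc⟩ := theoremM hs
  haveI : Fintype G'.ConnectedComponent := Fintype.ofFinite _
  rw [finsum_eq_sum_of_fintype] at hm
  by_cases hGG : G' = G
  · subst hGG
    obtain ⟨v⟩ := h2.connected.nonempty
    have hall : ∀ c : G'.ConnectedComponent, c = G'.connectedComponentMk v := by
      intro c
      obtain ⟨w, rfl⟩ := c.exists_rep
      exact ConnectedComponent.sound (h2.connected.preconnected w v)
    rcases hmc (G'.connectedComponentMk v) with h | ⟨i, j, -, h⟩
    · right
      have h0 : ∑ c, m c = 0 := Finset.sum_eq_zero fun c _ => by rw [hall c]; exact h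
      have : fvs G' = 0 := by omega
      rw [this]
      have := tg_pos (g := g)
      push_cast
      positivity
    · left; left
      refine ⟨i, j, ?_⟩
      have hu : (G'.connectedComponentMk v).supp = Set.univ := by
        ext w
        simpa using hall (G'.connectedComponentMk w)
      rw [hu] at h
      exact h.iso (induceUnivIso G').symm
  obtain ⟨a, b, hab⟩ : ∃ a b, (G \ G').Adj a b := by
    by_contra h
    push Not at h
    apply hGG
    refine le_antisymm hle ?_
    intro a b hab
    by_contra h'
    exact h a b ⟨hab, h'⟩
  set P := G'.connectedComponentMk with hP
  set D := fsum P (dg G') with hD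
  set H := fsum P (dg (G \ G')) with hH
  have hH2 : ∀ c, 2 ≤ H c := H_ge h2 hle hab
  have hE : ∑ c, (D c + H c) = 2 * G.edgeSet.ncard := by
    rw [← sum_dg, Finset.sum_add_distrib, fsum_total, fsum_total, ← Finset.sum_add_distrib]
    exact Finset.sum_congr rfl fun v _ => dg_sdiff hle v
  have hF : ∀ c i j, MemF i j (G'.induce c.supp) → D c = 10 * j + 2 * i ∧ H c + j ≤ i ∧ 3 ≤ i := by
    intro c i j h
    obtain ⟨h1, h3⟩ := fsum_MemF h
    have h4 : D c + H c ≤ fsum P (fun _ => 3) c := by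
      rw [hD, hH, ← fsum_add]
      refine fsum_mono _ (fun v => ?_) c
      rw [dg_sdiff hle v]
      exact hs v
    have h5 : H c + j ≤ i := by
      have h6 : D c = 10 * j + 2 * i := h1
      have h7 : fsum P (fun _ => 3) c = 3 * (3 * j + i) := h3
      omega
    refine ⟨h1, h5, ?_⟩
    have := hH2 c
    rcases Nat.eq_zero_or_pos j with rfl | hj
    · exact h.three
    · omega
  have hdisj : ∀ c c' : G'.ConnectedComponent, c ≠ c' → ∀ x, x ∈ c.supp → x ∉ c'.supp := by
    intro c c' hne x hx hx'
    exact hne (hx.symm.trans hx')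
  rcases hg with rfl | rfl
  · -- g = 4
    by_cases hbig : 9 * ∑ c, m c ≤ 2 * G.edgeSet.ncard
    · right
      have : 9 * fvs G ≤ 2 * G.edgeSet.ncard := by omega
      have h' : (9 : ℝ) * fvs G ≤ 2 * G.edgeSet.ncard := by exact_mod_cast this
      simp only [tg, if_true]
      linarith
    left; right
    let δ : G'.ConnectedComponent → ℤ := fun c => (D c : ℤ) + H c - 9 * m c
    have hδ : ∑ c, δ c = 2 * G.edgeSet.ncard - 9 * ∑ c, m c := by
      have : ((∑ c, (D c + H c) : ℕ) : ℤ) = (2 * G.edgeSet.ncard : ℕ) := by rw [hE]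
      push_cast at this
      simp only [δ]
      rw [Finset.sum_sub_distrib, ← Finset.mul_sum, this]
      push_cast
      rfl
    have hneg : ∀ c, δ c < 0 → δ c = -1 ∧ H c = 2 ∧ MemF 3 0 (G'.induce c.supp) := by
      intro c hc
      have h1 := hH2 c
      simp only [δ] at hc ⊢
      rcases hmc c with h | ⟨i, j, h, hM⟩
      · omega
      · obtain ⟨h3, h4, h5⟩ := hF c i j hM
        have : i = 3 ∧ j = 0 ∧ H c = 2 := by omega
        obtain ⟨rfl, rfl, h6⟩ := this
        refine ⟨by omega, h6, hM⟩
    have hsh : ∀ c, δ c < 0 → HasShort 4 G c.supp := by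
      intro c hc
      by_contra h
      exact MemF30_not_no3 (hneg c hc).2.2 (no3_of le_rfl hle h)
    obtain ⟨c0, h0, h0'⟩ := neg_sum δ 1 (by norm_num) (by rw [hδ]; push_cast; push Not at hbig; zify at hbig; linarith)
      (by
        intro c
        by_cases hc : δ c < 0
        · rw [(hneg c hc).1]
        · omega)
      (by
        intro c c' hc hc'
        by_contra hne
        exact not_short_both hcyc (hsh c hc) (hsh c' hc') (hdisj c c' hne))
    have hc0 : δ c0 < 0 := by omega
    have hoth : ∀ c, c ≠ c0 → H c = 2 ∧ Nonempty ((G'.induce c.supp) ≃g Lgraph) := by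
      intro c hc
      have h1 := hH2 c
      have h6 := h0' c hc
      simp only [δ] at h6
      have hns : ¬ HasShort 4 G c.supp := fun h => not_short_both hcyc h (hsh c0 hc0) (hdisj c c0 hc)
      rcases hmc c with h | ⟨i, j, h, hM⟩
      · omega
      · obtain ⟨h3, h4, h5⟩ := hF c i j hM
        have : (i = 3 ∧ j = 0) ∨ (i = 3 ∧ j = 1 ∧ H c = 2) := by omega
        rcases this with ⟨rfl, rfl⟩ | ⟨rfl, rfl, h7⟩
        · exact (MemF30_not_no3 hM (no3_of le_rfl hle hns)).elim
        · exact ⟨h7, identL hM (no3_of le_rfl hle hns)⟩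
    obtain ⟨k, hk⟩ := build_FG (g := 4) h2 hs hle c0 (hneg c0 hc0).2.2 (by
      intro c
      by_cases hc : c = c0
      · rw [hc]; exact (hneg c0 hc0).2.1
      · exact (hoth c hc).1) (Or.inl ⟨rfl, fun c hc => (hoth c hc).2⟩)
    exact ⟨3, 0, k, by norm_num, by norm_num, hk⟩
  · -- g = 5
    by_cases hbig : 10 * ∑ c, m c ≤ 2 * G.edgeSet.ncard
    · right
      have : 5 * fvs G ≤ G.edgeSet.ncard := by omega
      have h' : (5 : ℝ) * fvs G ≤ G.edgeSet.ncard := by exact_mod_cast this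
      simp only [tg]
      norm_num
      linarith
    left; right
    let δ : G'.ConnectedComponent → ℤ := fun c => (D c : ℤ) + H c - 10 * m c
    have hδ : ∑ c, δ c = 2 * G.edgeSet.ncard - 10 * ∑ c, m c := by
      have : ((∑ c, (D c + H c) : ℕ) : ℤ) = (2 * G.edgeSet.ncard : ℕ) := by rw [hE]
      push_cast at this
      simp only [δ]
      rw [Finset.sum_sub_distrib, ← Finset.mul_sum, this]
      push_cast
      rfl
    have hneg : ∀ c, δ c < 0 → -2 ≤ δ c ∧ (δ c = -2 → H c = 2) ∧ ∃ j, j ≤ 1 ∧ MemF 3 j (G'.induce c.supp) := by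
      intro c hc
      have h1 := hH2 c
      simp only [δ] at hc ⊢
      rcases hmc c with h | ⟨i, j, h, hM⟩
      · omega
      · obtain ⟨h3, h4, h5⟩ := hF c i j hM
        have : i = 3 ∧ j ≤ 1 := by omega
        obtain ⟨rfl, h6⟩ := this
        refine ⟨by omega, by omega, j, h6, hM⟩
    have hsh : ∀ c, δ c < 0 → HasShort 5 G c.supp := by
      intro c hc
      by_contra h
      obtain ⟨-, -, j, hj, hM⟩ := hneg c hc
      have := hM.moore (no3_of (by norm_num) hle h) (no4_of le_rfl hle h)
      interval_cases j <;> omega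
    obtain ⟨c0, h0, h0'⟩ := neg_sum δ 2 (by norm_num) (by
        push Not at hbig
        zify at hbig
        have h7 : ∑ c, δ c < 0 := by rw [hδ]; push_cast; linarith
        have h8 : ∃ z : ℤ, ∑ c, δ c = 2 * z := ⟨G.edgeSet.ncard - 5 * ∑ c, m c, by rw [hδ]; push_cast; ring⟩
        obtain ⟨z, hz⟩ := h8
        omega)
      (by
        intro c
        by_cases hc : δ c < 0
        · exact (hneg c hc).1
        · omega)
      (by
        intro c c' hc hc'
        by_contra hne
        exact not_short_both hcyc (hsh c hc) (hsh c' hc') (hdisj c c' hne))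
    have hc0 : δ c0 < 0 := by omega
    have hoth : ∀ c, c ≠ c0 → H c = 2 ∧ Nonempty ((G'.induce c.supp) ≃g Rgraph) := by
      intro c hc
      have h1 := hH2 c
      have h6 := h0' c hc
      simp only [δ] at h6
      have hns : ¬ HasShort 5 G c.supp := fun h => not_short_both hcyc h (hsh c0 hc0) (hdisj c c0 hc)
      rcases hmc c with h | ⟨i, j, h, hM⟩
      · omega
      · obtain ⟨h3, h4, h5⟩ := hF c i j hM
        have : i = 4 ∧ j ≤ 2 ∧ H c = 2 := by omega
        obtain ⟨rfl, hj, h7⟩ := this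
        have n3 := no3_of (g := 5) (by norm_num) hle hns
        have n4 := no4_of le_rfl hle hns
        have := hM.moore n3 n4
        interval_cases j
        · omega
        · omega
        · exact ⟨h7, identR hM n3 n4⟩
    obtain ⟨-, h9, j, hj, hM⟩ := hneg c0 hc0
    obtain ⟨k, hk⟩ := build_FG (g := 5) h2 hs hle c0 hM (by
      intro c
      by_cases hc : c = c0
      · rw [hc]; exact h9 h0
      · exact (hoth c hc).1) (Or.inr ⟨rfl, fun c hc => (hoth c hc).2⟩)
    exact ⟨3, j, k, by norm_num, by omega, hk⟩

end blk

end part_P6d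

section part_P7a
set_option linter.unusedSectionVars false
set_option linter.unusedVariables false

section red
variable {V : Type}

/-- the graph without its bridges -/
def nbr (G : SimpleGraph V) : SimpleGraph V := G.deleteEdges {e | G.IsBridge e}

lemma nbr_adj {G : SimpleGraph V} {u v : V} : (nbr G).Adj u v ↔ G.Adj u v ∧ ¬ G.IsBridge s(u, v) := by
  unfold nbr
  rw [deleteEdges_adj]
  rfl

lemma nbr_le {G : SimpleGraph V} : nbr G ≤ G := fun _ _ h => (nbr_adj.1 h).1

lemma nbr_le_del {G : SimpleGraph V} {u v : V} (h : G.IsBridge s(u, v)) : nbr G ≤ G.deleteEdges {s(u, v)} := by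
  intro a b hab
  rw [deleteEdges_adj]
  refine ⟨nbr_le hab, fun hc => (nbr_adj.1 hab).2 ?_⟩
  rw [Set.mem_singleton_iff] at hc
  rwa [hc]

lemma nbr_not_reach {G : SimpleGraph V} {u v : V} (h : G.IsBridge s(u, v)) : ¬ (nbr G).Reachable u v :=
  fun hr => isBridge_iff.1 h (hr.mono (nbr_le_del h))

lemma cycle_nbr {G : SimpleGraph V} {u : V} {c : G.Walk u u} (hc : c.IsCycle) : ∀ e ∈ c.edges, e ∈ (nbr G).edgeSet := by
  intro e he
  have h1 := c.edges_subset_edgeSet he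
  induction e with
  | h a b => exact nbr_adj.2 ⟨h1, fun hb => hb.notMem_edges_of_isCycle hc he⟩

lemma nbr_nonbridge {G : SimpleGraph V} {u v : V} (h : (nbr G).Adj u v) :
    ((nbr G).deleteEdges {s(u, v)}).Reachable u v := by
  by_contra hc
  have hb : (nbr G).IsBridge s(u, v) := isBridge_iff.2 hc
  have h1 := (nbr_adj.1 h)
  apply h1.2
  rw [isBridge_iff_forall_cycle_notMem (by exact h1.1)]
  intro w p hp he
  have := hp.transfer (cycle_nbr hp)
  exact hb.notMem_edges_of_isCycle this (by rw [Walk.edges_transfer]; exact he)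

lemma reach_of_adj {K M : SimpleGraph V} (h : ∀ u v, K.Adj u v → M.Reachable u v) {x y : V} (hr : K.Reachable x y) :
    M.Reachable x y := by
  obtain ⟨p⟩ := hr
  induction p with
  | nil => exact Reachable.refl _
  | cons h' p ih => exact (h _ _ h').trans ih

lemma nbr_reach_del {G : SimpleGraph V} {z w x y : V} (h : (nbr G).Adj z w) (hr : (nbr G).Reachable x y) :
    ((nbr G).deleteEdges {s(z, w)}).Reachable x y := by
  refine reach_of_adj (fun u v huv => ?_) hr
  by_cases he : s(u, v) = s(z, w)
  · rw [← he]; exact nbr_nonbridge huv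
  · exact Adj.reachable (by rw [deleteEdges_adj]; exact ⟨huv, he⟩)

lemma cross_reach {K : SimpleGraph V} {C : Set V} {a b : V} (hK : K.Reachable a b) (ha : a ∈ C) (hb : b ∉ C) :
    ∃ u v, K.Adj u v ∧ u ∈ C ∧ v ∉ C := by
  obtain ⟨w⟩ := hK
  obtain ⟨d, hd, h1, h2⟩ := w.exists_boundary_dart C ha hb
  exact ⟨d.fst, d.snd, d.adj, h1, h2⟩

lemma reach_lift {W : Type} {K : SimpleGraph V} {M : SimpleGraph W} (φ : W → V)
    (hl : ∀ p v, K.Adj (φ p) v → ∃ q, φ q = v ∧ M.Adj p q) {x y : V} (h : K.Reachable x y) :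
    ∀ p, φ p = x → ∃ q, φ q = y ∧ M.Reachable p q := by
  obtain ⟨w⟩ := h
  induction w with
  | nil => exact fun p hp => ⟨p, hp, Reachable.refl _⟩
  | cons h' w ih =>
    intro p hp
    subst hp
    obtain ⟨q, hq, hpq⟩ := hl _ _ h'
    obtain ⟨r, hr, hqr⟩ := ih q hq
    exact ⟨r, hr, hpq.reachable.trans hqr⟩

lemma reach_notMem' {H : SimpleGraph V} {A : Set V} {q x : V} (h : (delV H A).Reachable q x) (hq : q ∉ A) : x ∉ A := by
  obtain ⟨p⟩ := h
  induction p with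
  | nil => exact hq
  | cons h p ih => exact ih (delV_adj'.1 h).2.2

lemma two_nbrs {G : SimpleGraph V} {w x : V} (hx : x ≠ w) (h : (nbr G).Reachable x w) :
    ∃ z z', z ≠ z' ∧ (nbr G).Adj w z ∧ (nbr G).Adj w z' ∧
      (delV (nbr G) {w}).Reachable x z ∧ (delV (nbr G) {w}).Reachable x z' := by
  have hw : w ∉ {z | (delV (nbr G) {w}).Reachable x z} := fun hc => reach_notMem' hc (by simpa using hx) rfl
  have key : ∀ z v, (nbr G).Adj z v → (delV (nbr G) {w}).Reachable x z → ¬ (delV (nbr G) {w}).Reachable x v → v = w := by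
    intro z v hzv hz hv
    by_contra hvw
    have hzw := reach_notMem' hz (by simpa using hx)
    exact hv (hz.trans (Adj.reachable (delV_adj'.2 ⟨hzv, hzw, by simpa using hvw⟩)))
  obtain ⟨z, v, hzv, hz, hv⟩ := cross_reach h (C := {z | (delV (nbr G) {w}).Reachable x z}) (Reachable.refl _) hw
  obtain rfl := key z v hzv hz hv
  obtain ⟨z', v', hzv', hz', hv'⟩ := cross_reach (nbr_reach_del hzv h) (C := {z | (delV (nbr G) {v}).Reachable x z})
    (Reachable.refl _) hw
  rw [deleteEdges_adj] at hzv'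
  obtain rfl := key z' v' hzv'.1 hz' hv'
  exact ⟨z, z', fun hc => hzv'.2 (by rw [hc]; rfl), hzv.symm, hzv'.1.symm, hz, hz'⟩

lemma nbr_del_reach [Finite V] {G : SimpleGraph V} (hs : Subcubic G) {w x y : V} (hx : x ≠ w) (hy : y ≠ w)
    (h : (nbr G).Reachable x w) (h' : (nbr G).Reachable y w) : (delV (nbr G) {w}).Reachable x y := by
  classical
  by_contra hc
  obtain ⟨a, a', h1, h2, h3, h4, h5⟩ := two_nbrs hx h
  obtain ⟨b, b', k1, k2, k3, k4, k5⟩ := two_nbrs hy h'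
  have ne : ∀ {p q}, (delV (nbr G) {w}).Reachable x p → (delV (nbr G) {w}).Reachable y q → p ≠ q := by
    rintro p q hp hq rfl
    exact hc (hp.trans hq.symm)
  have hsub : (↑({a, a', b, b'} : Finset V) : Set V) ⊆ G.neighborSet w := by
    intro z hz
    simp only [Finset.coe_insert, Finset.coe_singleton, Set.mem_insert_iff, Set.mem_singleton_iff] at hz
    rcases hz with rfl | rfl | rfl | rfl <;> exact nbr_le (by assumption)
  have := Set.ncard_le_ncard hsub (Set.toFinite _)
  rw [Set.ncard_coe_finset] at this
  have h6 : ({a, a', b, b'} : Finset V).card = 4 := by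
    rw [Finset.card_insert_of_notMem, Finset.card_insert_of_notMem, Finset.card_pair k1]
    · simp [ne h5 k4, ne h5 k5]
    · simp [h1, ne h4 k4, ne h4 k5]
  have := hs w
  omega

lemma supp_closed {K : SimpleGraph V} (c : K.ConnectedComponent) {u v : V} (h : K.Adj u v) (hu : u ∈ c.supp) : v ∈ c.supp := by
  rw [ConnectedComponent.mem_supp_iff] at hu ⊢
  rw [← hu]
  exact (ConnectedComponent.connectedComponentMk_eq_of_adj h).symm

lemma supp_reach {K : SimpleGraph V} (c : K.ConnectedComponent) {u v : V} (hu : u ∈ c.supp) (hv : v ∈ c.supp) : K.Reachable u v := by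
  rw [ConnectedComponent.mem_supp_iff] at hu hv
  exact ConnectedComponent.exact (hu.trans hv.symm)

lemma nbr_induce {G : SimpleGraph V} (c : (nbr G).ConnectedComponent) : G.induce c.supp = (nbr G).induce c.supp := by
  ext u v
  simp only [comap_adj]
  refine ⟨fun h => nbr_adj.2 ⟨h, fun hb => nbr_not_reach hb (supp_reach c u.2 v.2)⟩, fun h => nbr_le h⟩

lemma comp_reach {G : SimpleGraph V} (c : (nbr G).ConnectedComponent) (s : Set c.supp) (p q : (sᶜ : Set c.supp))
    (h : (delV (nbr G) (Subtype.val '' s)).Reachable p.1.1 q.1.1) : ((G.induce c.supp).induce sᶜ).Reachable p q := by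
  obtain ⟨q', hq', hr⟩ := reach_lift (M := (G.induce c.supp).induce sᶜ) (fun z => z.1.1) (fun p v hpv => by
    have hv := supp_closed c hpv.1 p.1.2
    refine ⟨⟨⟨v, hv⟩, fun hc => hpv.2.2 ⟨_, hc, rfl⟩⟩, rfl, (nbr_adj.1 hpv.1).1⟩) h p rfl
  have : q' = q := Subtype.ext (Subtype.ext hq')
  rwa [← this]

lemma comp_card [Finite V] {G : SimpleGraph V} (c : (nbr G).ConnectedComponent) (hn : c.supp.Nontrivial) :
    3 ≤ Nat.card c.supp := by
  classical
  obtain ⟨a, ha, b, hb, hab⟩ := hn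
  obtain ⟨u, v, huv, hu, hv⟩ := cross_reach (supp_reach c ha hb) (C := {a}) rfl (by simpa using hab.symm)
  obtain rfl : u = a := hu
  obtain ⟨u', v', huv', hu', hv'⟩ := cross_reach (nbr_reach_del huv (supp_reach c ha hb)) (C := {u}) rfl (by simpa using hab.symm)
  obtain rfl : u' = u := hu'
  rw [deleteEdges_adj] at huv'
  have hne : v ≠ v' := by
    rintro rfl
    exact huv'.2 rfl
  have hsub : (↑({u', v, v'} : Finset V) : Set V) ⊆ c.supp := by
    intro z hz
    simp only [Finset.coe_insert, Finset.coe_singleton, Set.mem_insert_iff, Set.mem_singleton_iff] at hz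
    rcases hz with rfl | rfl | rfl
    · exact ha
    · exact supp_closed c huv ha
    · exact supp_closed c huv'.1 ha
  have := Set.ncard_le_ncard hsub (Set.toFinite _)
  rw [Set.ncard_coe_finset, Finset.card_insert_of_notMem (by simp [huv.ne, huv'.1.ne]), Finset.card_pair hne] at this
  exact this

lemma comp_two [Finite V] {G : SimpleGraph V} (hs : Subcubic G) (c : (nbr G).ConnectedComponent) (hn : c.supp.Nontrivial) :
    TwoConnected (G.induce c.supp) := by
  have h3 := comp_card c hn
  refine ⟨h3, fun s hs2 => ?_⟩
  have hne : (sᶜ : Set c.supp).Nonempty := by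
    rw [Set.nonempty_compl]
    rintro rfl
    rw [Set.ncard_univ] at hs2
    omega
  haveI : Nonempty (sᶜ : Set c.supp) := hne.to_subtype
  refine ⟨fun p q => comp_reach c s p q ?_⟩
  have hcase : s = ∅ ∨ ∃ w, s = {w} := by
    rcases Nat.lt_succ_iff_lt_or_eq.1 hs2 with h | h
    · exact Or.inl ((Set.ncard_eq_zero (Set.toFinite _)).1 (by omega))
    · exact Or.inr (Set.ncard_eq_one.1 h)
  rcases hcase with rfl | ⟨w, rfl⟩
  · exact (supp_reach c p.1.2 q.1.2).mono fun a b hab => delV_adj'.2 ⟨hab, by simp, by simp⟩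
  · rw [Set.image_singleton]
    refine nbr_del_reach hs ?_ ?_ (supp_reach c p.1.2 w.2) (supp_reach c q.1.2 w.2)
    · exact fun hc => p.2 (Subtype.ext hc)
    · exact fun hc => q.2 (Subtype.ext hc)

end red

end part_P7a

section part_P7b
set_option linter.unusedSectionVars false
set_option linter.unusedVariables false

section blocks
variable {V : Type}

lemma precon_of_card [Finite V] {K : SimpleGraph V} (h : Nat.card K.ConnectedComponent ≤ 1) : K.Preconnected := by
  have : Subsingleton K.ConnectedComponent := Finite.card_le_one_iff_subsingleton.1 h
  exact fun u v => ConnectedComponent.exact (Subsingleton.elim _ _)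

lemma card_cc_one [Finite V] {K : SimpleGraph V} (h : K.Connected) : Nat.card K.ConnectedComponent = 1 := by
  have h1 := h.preconnected.subsingleton_connectedComponent
  obtain ⟨v⟩ := h.nonempty
  rw [Nat.card_eq_one_iff_unique]
  exact ⟨h1, ⟨K.connectedComponentMk v⟩⟩

lemma notCut_precon [Finite V] {K : SimpleGraph V} (h : K.Connected) {v : V} (hv : ¬ IsCutVertex K v) :
    (K.induce {u | u ≠ v}).Preconnected := by
  unfold IsCutVertex at hv
  rw [card_cc_one h] at hv
  exact precon_of_card (by omega)

lemma two_notCut [Finite V] {K : SimpleGraph V} (h : TwoConnected K) (v : V) : ¬ IsCutVertex K v := by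
  unfold IsCutVertex
  have h1 : (K.induce ({v} : Set V)ᶜ).Connected := h.2 {v} (by simp)
  have h2 : ({v} : Set V)ᶜ = {u | u ≠ v} := by ext; simp
  rw [h2] at h1
  rw [card_cc_one h.connected, card_cc_one h1]
  omega

lemma comp_block [Finite V] {G : SimpleGraph V} (hs : Subcubic G) (c : (nbr G).ConnectedComponent) (hn : c.supp.Nontrivial) :
    IsBlock G c.supp := by
  have h2 := comp_two hs c hn
  refine ⟨⟨h2.connected, two_notCut h2⟩, fun B' hB ⟨hcon, hcut⟩ => ?_⟩
  by_contra hne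
  obtain ⟨b, hb, hbc⟩ : ∃ b, b ∈ B' ∧ b ∉ c.supp := by
    by_contra hc
    push Not at hc
    exact hne (Set.Subset.antisymm hc hB)
  obtain ⟨a, ha⟩ := hn.nonempty
  obtain ⟨u, v, huv, hu, hv⟩ := cross_reach (hcon.preconnected ⟨a, hB ha⟩ ⟨b, hb⟩) (C := {z : B' | z.1 ∈ c.supp}) ha hbc
  have huv' : G.Adj u.1 v.1 := huv
  have hbr : G.IsBridge s(u.1, v.1) := by
    by_contra hc
    exact hv (supp_closed c (nbr_adj.2 ⟨huv', hc⟩) hu)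
  obtain ⟨u', hu', hne'⟩ := hn.exists_ne u.1
  have h3 := notCut_precon hcon (hcut u) ⟨v, fun h => huv'.ne (by rw [h])⟩
    ⟨⟨u', hB hu'⟩, fun h => hne' (congrArg Subtype.val h)⟩
  have h4 : (G.deleteEdges {s(u.1, v.1)}).Reachable v.1 u' := by
    let f : ((G.induce B').induce {z | z ≠ u}) →g G.deleteEdges {s(u.1, v.1)} :=
      ⟨fun z => z.1.1, fun {p q} hpq => by
        rw [deleteEdges_adj]
        refine ⟨hpq, fun hc => ?_⟩
        rw [Set.mem_singleton_iff, Sym2.eq_iff] at hc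
        rcases hc with hc | hc
        · exact p.2 (Subtype.ext hc.1)
        · exact q.2 (Subtype.ext hc.2)⟩
    exact h3.map f
  have h5 : (G.deleteEdges {s(u.1, v.1)}).Reachable u' u.1 := (supp_reach c hu' hu).mono (nbr_le_del hbr)
  exact isBridge_iff.1 hbr (h4.trans h5).symm

lemma K2_block [Finite V] {G : SimpleGraph V} (hs : Subcubic G) {B : Set V} (hB : IsBlock G B)
    (hK : Nonempty (G.induce B ≃g (⊤ : SimpleGraph (Fin 2)))) :
    ∃ e ∈ {e | e ∈ G.edgeSet ∧ G.IsBridge e}, B = {x | x ∈ e} := by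
  obtain ⟨f⟩ := hK
  have hcard : Nat.card B = 2 := by
    rw [Nat.card_congr f.toEquiv, Nat.card_fin]
  have hadj : G.Adj (f.symm 0).1 (f.symm 1).1 := by
    have : (G.induce B).Adj (f.symm 0) (f.symm 1) := by
      rw [f.symm.map_adj_iff]
      simp
    exact this
  have hBe : B = {x | x ∈ s((f.symm 0).1, (f.symm 1).1)} := by
    ext x
    rw [Set.mem_ofPred_eq, Sym2.mem_iff]
    constructor
    · intro hx
      have h1 : ∀ i : Fin 2, i = 0 ∨ i = 1 := by decide
      rcases h1 (f ⟨x, hx⟩) with h | h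
      · left; rw [← h]; simp
      · right; rw [← h]; simp
    · rintro (rfl | rfl) <;> exact Subtype.property _
  refine ⟨s((f.symm 0).1, (f.symm 1).1), ⟨hadj, ?_⟩, hBe⟩
  by_contra hc
  have h1 := nbr_adj.2 ⟨hadj, hc⟩
  set c := (nbr G).connectedComponentMk (f.symm 0).1
  have hu : (f.symm 0).1 ∈ c.supp := rfl
  have hv := supp_closed c h1 hu
  have hn : c.supp.Nontrivial := ⟨_, hu, _, hv, hadj.ne⟩
  have h2 := comp_two hs c hn
  have h3 := hB.2 c.supp (by
    rw [hBe]
    intro x hx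
    rw [Set.mem_ofPred_eq, Sym2.mem_iff] at hx
    rcases hx with rfl | rfl
    · exact hu
    · exact hv) ⟨h2.connected, two_notCut h2⟩
  have h4 := comp_card c hn
  rw [h3] at h4
  omega

lemma eps_lower {g : ℕ} {G : SimpleGraph V} : -tg g ≤ eps g G := by
  have := tg_pos (g := g)
  unfold eps
  split_ifs
  · exact le_trans (by linarith) (le_max_right _ _)
  · exact le_trans (by linarith) (le_max_right _ _)
  · rfl
  · linarith

lemma eps_nonneg {g : ℕ} {G : SimpleGraph V} (h : ¬ Nonempty (G ≃g (⊤ : SimpleGraph (Fin 2)))) : 0 ≤ eps g G := by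
  unfold eps
  split_ifs
  · exact le_max_right _ _
  · exact le_max_right _ _
  · rfl

lemma rg_lower [Fintype V] {g : ℕ} {G : SimpleGraph V} (hs : Subcubic G) (T : Finset (nbr G).ConnectedComponent)
    (hT : ∀ c ∈ T, c.supp.Nontrivial) :
    ∑ c ∈ T, eps g (G.induce c.supp) - tg g * ({e | e ∈ G.edgeSet ∧ G.IsBridge e} : Set (Sym2 V)).ncard ≤ rg g G := by
  classical
  have ht := tg_pos (g := g)
  have hfin : ({B : Set V | IsBlock G B}).Finite := Set.toFinite _
  unfold rg
  rw [finsum_mem_eq_finite_toFinset_sum _ hfin]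
  set I := T.image (fun c => c.supp)
  have hI : I ⊆ hfin.toFinset := by
    intro B hB
    obtain ⟨c, hc, rfl⟩ := Finset.mem_image.1 hB
    exact hfin.mem_toFinset.2 (comp_block hs c (hT c hc))
  rw [← Finset.sum_sdiff hI]
  have h1 : ∑ B ∈ I, eps g (G.induce B) = ∑ c ∈ T, eps g (G.induce c.supp) :=
    Finset.sum_image fun a _ b _ h => ConnectedComponent.supp_injective h
  have hbf : ({e | e ∈ G.edgeSet ∧ G.IsBridge e} : Set (Sym2 V)).Finite := Set.toFinite _
  set D := hfin.toFinset \ I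
  set D2 := D.filter fun B => Nonempty (G.induce B ≃g (⊤ : SimpleGraph (Fin 2)))
  have h2 : D2.card ≤ ({e | e ∈ G.edgeSet ∧ G.IsBridge e} : Set (Sym2 V)).ncard := by
    rw [Set.ncard_eq_toFinset_card _ hbf]
    refine le_trans (Finset.card_le_card (t := hbf.toFinset.image fun e => {x | x ∈ e}) ?_) Finset.card_image_le
    intro B hB
    obtain ⟨h3, h4⟩ := Finset.mem_filter.1 hB
    obtain ⟨e, he, hBe⟩ := K2_block hs (hfin.mem_toFinset.1 (Finset.mem_sdiff.1 h3).1) h4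
    exact Finset.mem_image.2 ⟨e, hbf.mem_toFinset.2 he, hBe.symm⟩
  have h3 : - tg g * D2.card ≤ ∑ B ∈ D, eps g (G.induce B) := by
    have h4 : ∑ B ∈ D2, (- tg g) ≤ ∑ B ∈ D2, eps g (G.induce B) := Finset.sum_le_sum fun B _ => eps_lower
    have h5 : 0 ≤ ∑ B ∈ D.filter (fun B => ¬ Nonempty (G.induce B ≃g (⊤ : SimpleGraph (Fin 2)))), eps g (G.induce B) :=
      Finset.sum_nonneg fun B hB => eps_nonneg (Finset.mem_filter.1 hB).2
    have h6 := Finset.sum_filter_add_sum_filter_not D (fun B => Nonempty (G.induce B ≃g (⊤ : SimpleGraph (Fin 2)))) fun B => eps g (G.induce B)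
    rw [Finset.sum_const, nsmul_eq_mul] at h4
    linarith
  have h7 : tg g * D2.card ≤ tg g * ({e | e ∈ G.edgeSet ∧ G.IsBridge e} : Set (Sym2 V)).ncard :=
    mul_le_mul_of_nonneg_left (by exact_mod_cast h2) ht
  linarith

lemma fvs_spec [Finite V] (G : SimpleGraph V) : ∃ S : Set V, IsFVS G S ∧ S.ncard = fvs G := by
  have h : {n : ℕ | ∃ S : Set V, IsFVS G S ∧ S.ncard = n}.Nonempty := by
    refine ⟨_, Set.univ, ?_, rfl⟩
    intro v
    exact absurd (Set.mem_univ v.1) v.2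
  exact Nat.sInf_mem h

lemma fvs_le_comps [Fintype V] (G : SimpleGraph V) [Fintype (nbr G).ConnectedComponent] :
    fvs G ≤ ∑ c : (nbr G).ConnectedComponent, fvs (G.induce c.supp) := by
  classical
  choose S hS hc using fun c : (nbr G).ConnectedComponent => fvs_spec (G.induce c.supp)
  have h1 : fvs G ≤ (⋃ c, (Subtype.val '' (S c) : Set V)).ncard := by
    refine Nat.sInf_le ⟨_, ?_, rfl⟩
    intro v p hp
    let e : G.induce (⋃ c, (Subtype.val '' (S c) : Set V))ᶜ →g G := (Embedding.induce _).toHom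
    have he : Function.Injective e := (Embedding.induce (G := G) _).injective
    have hq : (p.map e).IsCycle := (Walk.isCycle_map_iff_of_injective he).2 hp
    have hout : ∀ x ∈ (p.map e).support, x ∉ (⋃ c, (Subtype.val '' (S c) : Set V)) := by
      intro x hx
      rw [Walk.support_map, List.mem_map] at hx
      obtain ⟨y, _, rfl⟩ := hx
      exact y.2
    generalize p.map e = q at hq hout
    set c := (nbr G).connectedComponentMk (e v)
    have hin : ∀ x ∈ q.support, x ∈ c.supp := by
      intro x hx
      rw [ConnectedComponent.mem_supp_iff]
      refine ConnectedComponent.sound ?_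
      rw [← Walk.support_transfer q (cycle_nbr hq)] at hx
      exact ((q.transfer _ (cycle_nbr hq)).takeUntil x hx).reachable.symm
    have h2 : (q.induce c.supp hin).IsCycle := by
      rw [← Walk.isCycle_map_iff_of_injective (f := (Embedding.induce (G := G) c.supp).toHom) (Embedding.induce (G := G) c.supp).injective,
        Walk.map_induce]
      exact hq
    have hout2 : ∀ x ∈ (q.induce c.supp hin).support, x ∈ (S c)ᶜ := by
      intro x hx hxS
      rw [Walk.support_induce, List.mem_attachWith] at hx
      exact hout x.1 hx (Set.mem_iUnion.2 ⟨c, x, hxS, rfl⟩)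
    have h3 : ((q.induce c.supp hin).induce _ hout2).IsCycle := by
      rw [← Walk.isCycle_map_iff_of_injective (f := (Embedding.induce (G := G.induce c.supp) (S c)ᶜ).toHom) (Embedding.induce (G := G.induce c.supp) (S c)ᶜ).injective,
        Walk.map_induce]
      exact h2
    exact hS c _ h3
  refine h1.trans ((Set.ncard_iUnion_le_of_fintype _).trans (Finset.sum_le_sum fun c _ => ?_))
  rw [← hc c]
  exact Set.ncard_image_le (Set.toFinite _)

lemma edges_comps [Fintype V] (G : SimpleGraph V) [Fintype (nbr G).ConnectedComponent] :
    ∑ c : (nbr G).ConnectedComponent, (G.induce c.supp).edgeSet.ncard +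
      ({e | e ∈ G.edgeSet ∧ G.IsBridge e} : Set (Sym2 V)).ncard = G.edgeSet.ncard := by
  classical
  have h1 : (nbr G).edgeSet.ncard + ({e | e ∈ G.edgeSet ∧ G.IsBridge e} : Set (Sym2 V)).ncard = G.edgeSet.ncard := by
    have : (nbr G).edgeSet = G.edgeSet \ {e | e ∈ G.edgeSet ∧ G.IsBridge e} := by
      unfold nbr
      rw [edgeSet_deleteEdges]
      ext e
      simp only [Set.mem_sdiff, Set.mem_ofPred_eq]
      tauto
    rw [this]
    exact Set.ncard_sdiff_add_ncard_of_subset (fun e he => he.1) (Set.toFinite _)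
  have h2 : ∑ c : (nbr G).ConnectedComponent, 2 * (G.induce c.supp).edgeSet.ncard = 2 * (nbr G).edgeSet.ncard := by
    rw [← sum_dg, ← fsum_total (nbr G).connectedComponentMk]
    refine Finset.sum_congr rfl fun c _ => ?_
    rw [fsum_supp, ← sum_dg, nbr_induce]
    exact Finset.sum_congr rfl fun v _ => dg_induce (fun a b hab ha => supp_closed c hab ha) v
  rw [← Finset.mul_sum] at h2
  omega

lemma subcubic_induce [Finite V] {G : SimpleGraph V} (hs : Subcubic G) (C : Set V) : Subcubic (G.induce C) := by
  intro v
  refine le_trans ?_ (hs v.1)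
  rw [← Set.ncard_image_of_injective _ Subtype.val_injective]
  refine Set.ncard_le_ncard ?_ (Set.toFinite _)
  rintro _ ⟨x, hx, rfl⟩
  exact hx

lemma twoDisj_induce {G : SimpleGraph V} {g : ℕ} (C : Set V) (h : TwoDisjointCyclesLt (G.induce C) g) :
    TwoDisjointCyclesLt G g := by
  obtain ⟨u, v, c1, c2, h1, h2, l1, l2, hd⟩ := h
  have hi : Function.Injective (Embedding.induce (G := G) C).toHom := (Embedding.induce (G := G) C).injective
  refine ⟨_, _, c1.map (Embedding.induce C).toHom, c2.map (Embedding.induce C).toHom, h1.map hi, h2.map hi, ?_, ?_, ?_⟩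
  · rwa [Walk.length_map]
  · rwa [Walk.length_map]
  · intro x hx hx'
    rw [Walk.support_map, List.mem_map] at hx hx'
    obtain ⟨y, hy, rfl⟩ := hx
    obtain ⟨z, hz, hzy⟩ := hx'
    obtain rfl := hi hzy
    exact hd _ hy hz

theorem main_red {g : ℕ} (hg : g = 4 ∨ g = 5) [Fintype V]
    (G : SimpleGraph V) (hsub : Subcubic G) (hcyc : ¬ TwoDisjointCyclesLt G g) :
    (fvs G : ℝ) ≤ tg g * G.edgeSet.ncard + rg g G := by
  classical
  have ht := tg_pos (g := g)
  set T : Finset (nbr G).ConnectedComponent := Finset.univ.filter fun c => c.supp.Nontrivial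
  have h1 := rg_lower (g := g) hsub T fun c hc => (Finset.mem_filter.1 hc).2
  have h2 := fvs_le_comps G
  have h3 := edges_comps G
  have h4 : ∀ c : (nbr G).ConnectedComponent, (fvs (G.induce c.supp) : ℝ) ≤
      tg g * (G.induce c.supp).edgeSet.ncard + if c.supp.Nontrivial then eps g (G.induce c.supp) else 0 := by
    intro c
    split_ifs with hn
    · rcases block_main hg (comp_two hsub c hn) (subcubic_induce hsub _) (fun h => hcyc (twoDisj_induce _ h)) with h | h
      · exact eps_bound hg h
      · refine h.trans (le_add_of_nonneg_right (eps_nonneg ?_))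
        rintro ⟨f⟩
        have := comp_card c hn
        rw [Nat.card_congr f.toEquiv, Nat.card_fin] at this
        omega
    · have h5 : fvs (G.induce c.supp) ≤ (∅ : Set c.supp).ncard := by
        refine Nat.sInf_le ⟨∅, ?_, rfl⟩
        intro v p hp
        apply hn
        have := hp.three_le_length
        cases p with
        | nil => simp at this
        | cons h p => exact ⟨_, v.1.2, _, Subtype.property _, fun hc => h.ne (Subtype.ext (Subtype.ext hc))⟩
      rw [Set.ncard_empty] at h5
      have h6 : fvs (G.induce c.supp) = 0 := by omega
      rw [h6]
      simp only [Nat.cast_zero, add_zero]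
      exact mul_nonneg ht (Nat.cast_nonneg _)
  have h5 : (fvs G : ℝ) ≤ ∑ c : (nbr G).ConnectedComponent, (fvs (G.induce c.supp) : ℝ) := by exact_mod_cast h2
  have h6 := Finset.sum_le_sum fun c (_ : c ∈ (Finset.univ : Finset (nbr G).ConnectedComponent)) => h4 c
  rw [Finset.sum_add_distrib, ← Finset.mul_sum, ← Finset.sum_filter] at h6
  have h7 : (∑ c : (nbr G).ConnectedComponent, ((G.induce c.supp).edgeSet.ncard : ℝ)) +
      (({e | e ∈ G.edgeSet ∧ G.IsBridge e} : Set (Sym2 V)).ncard : ℝ) = G.edgeSet.ncard := by exact_mod_cast h3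
  rw [← h7, mul_add]
  linarith

end blocks

end part_P7b

/-- the main theorem, `φ(G) ≤ t_g |E(G)| + r_g(G)`. -/
theorem statement4 (g : ℕ) (hg : g = 4 ∨ g = 5) {V : Type} [Fintype V]
    (G : SimpleGraph V) (hsub : Subcubic G) (hcyc : ¬ TwoDisjointCyclesLt G g) :
    (fvs G : ℝ) ≤ tg g * G.edgeSet.ncard + rg g G := by
  exact main_red hg G hsub hcyc

end InducedForest
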